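/- H₃(SL₂(ℚ), ℤ[1/2]) is isomorphic as an abelian group to ℤ/3 ⊕ (⊕_{p prime} ℤ/(p+1)′), the direct sum ranging over all prime numbers p. -/

import Mathlib

open scoped Classical

noncomputable section

/-- `SL₂(ℚ)` -/
abbrev SL2Q : Type := Matrix.SpecialLinearGroup (Fin 2) ℚ

/-- The ring `ℤ[1/2]`. -/
def ZHalf : Type := Localization.Away (2 : ℤ)

instance : CommRing ZHalf := by unfold ZHalf; infer_instance

/-- The group of inhomogeneous `n`-chains of `SL₂(ℚ)` with (trivial) coefficients in
`ℤ[1/2]`: the free `ℤ[1/2]`-module on `n`-tuples of group elements. -/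
abbrev Chains (n : ℕ) : Type := (Fin n → SL2Q) →₀ ZHalf

/-- The differential of the standard (inhomogeneous, bar) complex computing group
homology with trivial coefficients:
`d(g₁,…,g_{n+1}) = (g₂,…,g_{n+1}) + ∑_{j=1}^{n} (-1)^j (g₁,…,g_j g_{j+1},…,g_{n+1})
 + (-1)^{n+1} (g₁,…,g_n)`. -/
def bdry (n : ℕ) : Chains (n + 1) →ₗ[ZHalf] Chains n :=
  Finsupp.lsum ZHalf fun g =>
    (Finsupp.lsingle (Fin.tail g)
      + ∑ j : Fin n,
          ((-1 : ZHalf) ^ ((j : ℕ) + 1)) •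
            Finsupp.lsingle (Fin.contractNth j.castSucc (· * ·) g)
      + ((-1 : ZHalf) ^ (n + 1)) • Finsupp.lsingle (Fin.init g))

/-- The 3-cycles. -/
def Z3 : Submodule ZHalf (Chains 3) := LinearMap.ker (bdry 2)

/-- The 3-boundaries. -/
def B3 : Submodule ZHalf (Chains 3) := LinearMap.range (bdry 3)

/-- the odd part `m′ = 2^{-v₂(m)}·m` of a natural number `m` -/
def oddPart (m : ℕ) : ℕ := m / 2 ^ (m.factorization 2)

open QuotientGroup (induction_on mk_out_eq_mul)
open Submodule.Quotient (mk_eq_zero)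
open Submodule (span span_le mem_sup subset_span mkQ_apply mem_bot mem_sup_left mem_sup_right smul_of_tower_mem mem_inf mem_span_singleton mem_iInf span_mono mem_comap)
open Finsupp (single mapDomain mapDomain_add single_apply lsingle_apply)
open LinearMap (comp_apply ker mem_ker id_apply mem_eqLocus eqLocus ext_ring)
open Units (mk0 val_pow_eq_pow_val val_inj)
open ZMod (natCast_zmod_val val_pos natCast_self intCast_zmod_eq_zero_iff_dvd val_one natCast_eq_zero_iff)
open Finset (sum_congr sum_add_distrib mem_image univ sum_sub_distrib sum_eq_zero smul_sum mem_univ mem_insert mem_Ico mem_insert_self mem_sdiff mem_insert_of_mem mem_filter)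
open MulAction (orbitRel)
open MulAction.Quotient (smul_coe)
open Fin (partialProd snoc lt_def val_castSucc)
open LinearEquiv (apply_symm_apply)
open Fintype (sum_equiv)
open Function (surjInv)
open SetLike (mem_coe)
open Int (cast_natCast cast_mul)
open FiniteField (pow_card)
open Equiv (addRight prodCongr)
open Submonoid (powers)
open Additive (ofMul)

section ZHalfBasics

/-- `ZHalf` is the localization of `ℤ` away from `2`, as a ring. -/
def zhalfEquiv : ZHalf ≃+* Localization.Away (2 : ℤ) where
  toFun x := x
  invFun x := x
  left_inv _ := rfl
  right_inv _ := rfl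
  map_mul' _ _ := rfl
  map_add' _ _ := rfl

instance : IsDomain ZHalf :=
  haveI : IsDomain (Localization.Away (2 : ℤ)) :=
    IsLocalization.isDomain_localization (powers_le_nonZeroDivisors_of_noZeroDivisors two_ne_zero)
  zhalfEquiv.toMulEquiv.isDomain _

instance : CharZero ZHalf := by
  have : CharZero (Localization.Away (2 : ℤ)) := by
    refine charZero_of_injective_algebraMap (R := ℤ)
      (IsLocalization.injective (M := powers (2 : ℤ)) _
        (powers_le_nonZeroDivisors_of_noZeroDivisors two_ne_zero))
  exact charZero_of_injective_ringHom (f := zhalfEquiv.symm.toRingHom) zhalfEquiv.symm.injective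

lemma zhalf_isUnit_two : IsUnit (2 : ZHalf) := by
  have h : IsUnit (algebraMap ℤ (Localization.Away (2 : ℤ)) 2) :=
    IsLocalization.Away.algebraMap_isUnit _
  have h2 := h.map zhalfEquiv.symm
  rwa [show zhalfEquiv.symm (algebraMap ℤ (Localization.Away (2 : ℤ)) 2) = 2 by
    rw [map_ofNat, map_ofNat]] at h2

/-- Every element of `ZHalf` is an integer divided by a power of two. -/
lemma zhalf_exists_pow_mul (x : ZHalf) : ∃ (n : ℕ) (a : ℤ), 2^n*x = a := by
  obtain ⟨⟨a, s⟩, h⟩ := IsLocalization.surj (powers (2 : ℤ)) (zhalfEquiv x); obtain ⟨n, hn⟩ := s.2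
  refine ⟨n, a, zhalfEquiv.injective ?_⟩
  have h' : zhalfEquiv x*algebraMap ℤ (Localization.Away (2 : ℤ)) (2^n) = algebraMap ℤ _ a := by
    grind
  rw [map_mul, mul_comm, map_pow, map_ofNat, map_intCast]; rw [map_pow, map_ofNat, eq_intCast] at h'
  exact h'

def half : ZHalf := ((zhalf_isUnit_two.unit⁻¹ : ZHalfˣ) : ZHalf)

lemma two_mul_half : (2 : ZHalf)*half = 1 := by simp [half]

variable {W : Type*} [AddCommGroup W] [Module ZHalf W]

lemma add_self_cancel {w : W} (h : w + w = 0) : w = 0 := by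
  have h1 : half • ((2 : ZHalf) • w) = 0 := by rw [two_smul, h, smul_zero]
  rwa [smul_smul, mul_comm half 2, two_mul_half, one_smul] at h1

end ZHalfBasics

section Character

variable (χ : ℚ →*₀ ℤ)

lemma chi_sq {x : ℚ} (hx : x ≠ 0) : χ x*χ x = 1 := by
  have h : χ x*χ x⁻¹ = 1 := by rw [← map_mul, mul_inv_cancel₀ hx, map_one]
  rcases Int.eq_one_or_neg_one_of_mul_eq_one h with h1 | h1 <;> rw [h1] <;> norm_num

lemma chi_cases {x : ℚ} (hx : x ≠ 0) : χ x = 1 ∨ χ x = -1 := by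
  have h := chi_sq χ hx; exact Int.eq_one_or_neg_one_of_mul_eq_one h

lemma chi_inv (x : ℚ) : χ x⁻¹ = χ x := by
  by_cases hx : x = 0
  · simp [hx]
  have h : χ x*χ x⁻¹ = 1 := by rw [← map_mul, mul_inv_cancel₀ hx, map_one]
  have h2 := chi_sq χ hx; grind

lemma chi_div (x y : ℚ) : χ (x/y) = χ x*χ y := by rw [div_eq_mul_inv, map_mul, chi_inv]

lemma chi_neg (h : χ (-1) = 1) (x : ℚ) : χ (-x) = χ x := by
  rw [neg_eq_neg_one_mul, map_mul, h, one_mul]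

end Character

/-- A function satisfying the `χ`-twisted five-term relation of the dilogarithm. -/
structure IsBloch {W : Type*} [AddCommGroup W] (χ : ℚ →*₀ ℤ) (b : ℚ → W) : Prop where
  zero : b 0 = 0
  one : b 1 = 0
  five : ∀ x y : ℚ, x ≠ 0 → x ≠ 1 → y ≠ 0 → y ≠ 1 → x ≠ y →
    b x - b y + χ x • b (y/x) - χ (x⁻¹ - 1) • b ((1 - x⁻¹)/(1 - y⁻¹))
      + χ (1-x) • b ((1-x)/(1-y)) = 0

namespace IsBloch

variable {W : Type*} [AddCommGroup W] {χ : ℚ →*₀ ℤ} {b : ℚ → W}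

/-- A function satisfying a twisted additivity off `1` is determined by its sign. -/
lemma cocycle_symm {Ψ : ℚ → W} (h : ∀ r t, r ≠ 0 → t ≠ 0 → r ≠ 1 → t ≠ 1 → r*t ≠ 1 →
    Ψ (r*t) = Ψ r + χ r • Ψ t) {r t : ℚ} (hr : r ≠ 0) (ht : t ≠ 0) (hr1 : r ≠ 1) (ht1 : t ≠ 1)
    (hrt : r*t ≠ 1) : (1 - χ t) • Ψ r = (1 - χ r) • Ψ t := by
  have h1 := h r t hr ht hr1 ht1 hrt; have h2 := h t r ht hr ht1 hr1 (by rwa [mul_comm])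
  rw [mul_comm t r, h1] at h2; simp only [sub_smul, one_smul]; grind

lemma inv_cocycle (hb : IsBloch χ b) {x y : ℚ} (hx : x ≠ 0) (hx1 : x ≠ 1) (hy : y ≠ 0)
    (hy1 : y ≠ 1) (hxy : x*y ≠ 1) :
    b (x*y) + χ (-1) • b (x*y)⁻¹ = b x + χ (-1) • b x⁻¹ + χ x • (b y + χ (-1) • b y⁻¹) := by
  have hne : x ≠ x*y := fun h => hy1 (by
    grind)
  have e1 := hb.five x (x*y) hx hx1 (mul_ne_zero hx hy) hxy hne
  have e2 := hb.five x⁻¹ (x*y)⁻¹ (inv_ne_zero hx) (by simpa using hx1)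
    (inv_ne_zero (mul_ne_zero hx hy)) (by rw [ne_eq, inv_eq_one]; exact hxy)
    (fun h => hne (inv_injective h))
  rw [inv_inv, inv_inv, chi_inv] at e2; have q1 : x*y/x = y := by field_simp
  have q2 : (x*y)⁻¹/x⁻¹ = y⁻¹ := by field_simp
  rw [q1] at e1; rw [q2] at e2
  have s1 : χ (x⁻¹ - 1) = χ (-1)*χ (1 - x⁻¹) := by rw [← map_mul]; congr 1; ring
  have s2 : χ (x-1) = χ (-1)*χ (1-x) := by rw [← map_mul]; congr 1; ring
  have s3 := chi_sq χ (show (-1 : ℚ) ≠ 0 by norm_num); rw [s1] at e1; rw [s2] at e2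
  generalize b (x*y) = A at *; generalize b (x*y)⁻¹ = A' at *
  generalize b ((1 - x⁻¹)/(1 - (x*y)⁻¹)) = B1 at *
  generalize b ((1-x)/(1 - x*y)) = B2 at *
  rcases Int.eq_one_or_neg_one_of_mul_eq_one s3 with h | h <;> rw [h] at e1 e2 ⊢
  · have : b x - A + χ x • b y - (1*χ (1 - x⁻¹)) • B1 + χ (1-x) • B2
      + (b x⁻¹ - A' + χ x • b y⁻¹ - (1*χ (1-x)) • B2 + χ (1 - x⁻¹) • B1) = 0 := by
      rw [e1, e2, add_zero]
    simp only [one_mul, one_smul, smul_add] at this ⊢; grind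
  · have : b x - A + χ x • b y - (-1*χ (1 - x⁻¹)) • B1 + χ (1-x) • B2
      - (b x⁻¹ - A' + χ x • b y⁻¹ - (-1*χ (1-x)) • B2 + χ (1 - x⁻¹) • B1) = 0 := by
      rw [e1, e2, sub_zero]
    simp only [neg_mul, one_mul, neg_smul, one_smul, smul_add, smul_neg] at this ⊢; grind

/-- Inversion antisymmetry when `χ(-1) = 1`, provided it holds at one point with `χ = -1`
(or `χ` is trivial). -/
lemma inv_of [Module ZHalf W] (hb : IsBloch χ b) (he : χ (-1) = 1)
    (h : (∀ x, x ≠ 0 → χ x = 1) ∨ ∃ t, χ t = -1 ∧ b t + b t⁻¹ = 0) (x : ℚ) : b x⁻¹ = -b x := by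
  suffices H : ∀ x, x ≠ 0 → x ≠ 1 → b x + b x⁻¹ = 0 by
    by_cases h0 : x = 0
    · simp [h0, hb.zero]
    by_cases h1 : x = 1
    · simp [h1, hb.one]
    grind
  have co : ∀ r t, r ≠ 0 → t ≠ 0 → r ≠ 1 → t ≠ 1 → r*t ≠ 1 →
      (b (r*t) + b (r*t)⁻¹) = (b r + b r⁻¹) + χ r • (b t + b t⁻¹) := by
    intro r t hr ht hr1 ht1 hrt; have := hb.inv_cocycle hr hr1 ht ht1 hrt; simp_all
  intro x hx hx1; rcases h with h | ⟨t, ht, htb⟩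
  · have key : ∀ x z : ℚ, x ≠ 0 → z ≠ 0 → x ≠ 1 → z ≠ 1 → x ≠ z → b (x/z) + b (x/z)⁻¹ = 0 := by
      intro x z hx hz hx1 hz1 hxz
      have n1 : z/x ≠ 1 := by rw [ne_eq, div_eq_one_iff_eq hx]; exact hxz.symm
      have n2 : x/z ≠ 1 := by rw [ne_eq, div_eq_one_iff_eq hz]; exact hxz
      have e1 := co x (z/x) hx (div_ne_zero hz hx) hx1 n1 (by rwa [mul_div_cancel₀ _ hx])
      have e2 := co z (x/z) hz (div_ne_zero hx hz) hz1 n2 (by rwa [mul_div_cancel₀ _ hz])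
      rw [mul_div_cancel₀ _ hx, h x hx, one_smul] at e1
      rw [mul_div_cancel₀ _ hz, h z hz, one_smul, e1, ← inv_div x z, inv_inv] at e2
      apply add_self_cancel; grind
    obtain ⟨z, hz0, hz1, hz2⟩ : ∃ z : ℚ, z ≠ 0 ∧ z ≠ 1 ∧ x*z ≠ 1 := by
      by_cases h2 : x*2 = 1
      · exact ⟨3, by norm_num, by norm_num, fun h3 => by linarith⟩
      · grind
    have := key (x*z) z (mul_ne_zero hx hz0) hz0 hz2 hz1 (fun h' => hx1 (by
      grind))
    grind
  · have ht0 : t ≠ 0 := by rintro rfl; simp at ht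
    have ht1 : t ≠ 1 := by rintro rfl; simp at ht
    by_cases hxt : x*t = 1
    · grind
    · have := cocycle_symm (Ψ := fun x => b x + b x⁻¹) co hx ht0 hx1 ht1 hxt
      simp only [htb, smul_zero, ht] at this; apply add_self_cancel; grind

end IsBloch

/-- A twisted dilogarithm function with the standard symmetries under the anharmonic group. -/
structure IsBlochAlt {W : Type*} [AddCommGroup W] (χ : ℚ →*₀ ℤ) (b : ℚ → W) (C : W) : Prop
    extends IsBloch χ b where
  chi_neg_one : χ (-1) = 1
  inv : ∀ x, b x⁻¹ = -b x
  one_sub : ∀ x, x ≠ 0 → x ≠ 1 → b (1-x) = C - b x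
  three : C + C + C = 0

lemma IsBloch.alt {W : Type*} [AddCommGroup W] [Module ZHalf W] {χ : ℚ →*₀ ℤ} {b : ℚ → W}
    (hb : IsBloch χ b) (he : χ (-1) = 1)
    (h : (∀ x, x ≠ 0 → χ x = 1) ∨ ∃ t, χ t = -1 ∧ b t + b t⁻¹ = 0) :
    IsBlochAlt χ b (b 2) := by
  have inv := hb.inv_of he h
  have key : ∀ x y, x ≠ 0 → x ≠ 1 → y ≠ 0 → y ≠ 1 → b x + b (1-x) = b y + b (1-y) := by
    intro x y hx hx1 hy hy1; by_cases hxy : x = y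
    · rw [hxy]
    have hx' := sub_ne_zero.2 hx1.symm; have hy' := sub_ne_zero.2 hy1.symm
    have e1 := hb.five x y hx hx1 hy hy1 hxy
    have e2 := hb.five (1-x) (1-y) hx' (by simpa using hx) hy' (by simpa using hy)
      (by simpa using hxy)
    rw [sub_sub_cancel, sub_sub_cancel] at e2
    have q1 : (1-y)/(1-x) = ((1-x)/(1-y))⁻¹ := by rw [inv_div]
    have q2 : (1 - (1-x)⁻¹)/(1 - (1-y)⁻¹) = ((1 - x⁻¹)/(1 - y⁻¹))⁻¹ := by grind
    have q3 : x/y = (y/x)⁻¹ := by rw [inv_div]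
    have s1 : χ ((1-x)⁻¹ - 1) = χ (x⁻¹ - 1) := by
      have a1 : (1-x)⁻¹ - 1 = x/(1-x) := by field_simp; ring
      have a2 : x⁻¹ - 1 = (1-x)/x := by field_simp
      rw [a1, a2, chi_div, chi_div, mul_comm]
    rw [q1, q2, q3, s1, inv, inv, inv] at e2
    have : b x - b y + (b (1-x) - b (1-y)) = 0 := by
      rw [← add_zero (0 : W)]; nth_rewrite 2 [← e1]; rw [← e2]; simp only [smul_neg]; abel
    grind
  have hm1 : b (-1) = 0 := by
    apply add_self_cancel; grind
  have one_sub : ∀ x, x ≠ 0 → x ≠ 1 → b (1-x) = b 2 - b x := by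
    intro x hx hx1; have := key x 2 hx hx1 (by norm_num) (by norm_num); grind
  refine ⟨hb, he, inv, one_sub, ?_⟩; grind

section Approximation

lemma exists_int_approx {p : ℤ} (hp : 0 < p) (c : ℤ) {n : ℕ} (hn : 0 < n) :
    ∃ β α ω : ℤ, 0 < β ∧ β ≤ n ∧ β*c = α + p*ω ∧ (n+1) * |α| ≤ p := by
  obtain ⟨k, hk0, hkn, hk⟩ := Real.exists_nat_abs_mul_sub_round_le ((c : ℝ)/p) hn
  set ω := round ((k : ℝ)*(c/p))
  refine ⟨k, k*c - p*ω, ω, mod_cast hk0, mod_cast hkn, by ring, ?_⟩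
  have hp' : (0 : ℝ) < p := mod_cast hp
  have h1 : ((n : ℝ) + 1) * |(k*c - p*ω : ℝ)| ≤ p := by
    rw [show (k*c - p*ω : ℝ) = p*(k*(c/p) - ω) by field_simp, abs_mul, abs_of_pos hp']
    rw [le_div_iff₀ (by positivity)] at hk; nlinarith
  exact_mod_cast h1

lemma prime_sqrt_bounds {ℓ : ℕ} (hℓ : ℓ.Prime) :
    0 < ℓ.sqrt ∧ 2*ℓ.sqrt ≤ ℓ ∧ ℓ.sqrt*ℓ.sqrt < ℓ := by
  have h1 : 0 < ℓ.sqrt := Nat.sqrt_pos.2 hℓ.pos; have h2 := Nat.sqrt_le ℓ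
  have h3 : ℓ.sqrt*ℓ.sqrt ≠ ℓ := fun h => by
    rcases Nat.prime_mul_iff.1 (h ▸ hℓ) with ⟨a, b⟩ | ⟨a, b⟩ <;> rw [b] at a <;>
      exact Nat.not_prime_one a
  refine ⟨h1, ?_, lt_of_le_of_ne h2 h3⟩; have := hℓ.two_le; rcases Nat.lt_or_ge ℓ.sqrt 2 with h | h
  · omega
  · nlinarith

/-- Thue's lemma: a residue class modulo `ℓ` is a quotient of two small integers. -/
lemma thue {ℓ : ℕ} (hℓ : ℓ.Prime) {a b : ℤ} (ha : ¬ (ℓ : ℤ) ∣ a) (hb : ¬ (ℓ : ℤ) ∣ b) :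
    ∃ α β : ℤ, α ≠ 0 ∧ β ≠ 0 ∧ |α| ≤ ℓ.sqrt ∧ |β| ≤ ℓ.sqrt ∧ (ℓ : ℤ) ∣ b*α - a*β := by
  have hp : Prime (ℓ : ℤ) := Nat.prime_iff_prime_int.1 hℓ
  obtain ⟨h1, h2, h3⟩ := prime_sqrt_bounds hℓ; obtain ⟨i, j, hij⟩ := (hp.coprime_iff_not_dvd.2 hb)
  obtain ⟨β, α, ω, hβ0, hβ, e, hα⟩ := exists_int_approx (Int.natCast_pos.2 hℓ.pos) (j*a) h1
  have hs := Nat.lt_succ_sqrt ℓ; zify at h1 h2 hs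
  refine ⟨α, β, ?_, hβ0.ne', by nlinarith, by rwa [abs_of_pos hβ0],
    ⟨-(i*a*β) - b*ω, by linear_combination -b*e + a*β*hij⟩⟩
  rintro rfl; rcases hp.dvd_or_dvd (⟨ω, by rw [e]; ring⟩ : (ℓ : ℤ) ∣ β*(j*a)) with h | h
  · have := Int.le_of_dvd hβ0 h; linarith
  · rcases hp.dvd_or_dvd h with h | h
    · exact hp.not_isUnit (isUnit_of_dvd_one (hij ▸ dvd_add (Dvd.intro_left i rfl) (h.mul_right b)))
    · exact ha h

end Approximation

namespace IsBlochAlt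

variable {W : Type*} [AddCommGroup W] {χ : ℚ →*₀ ℤ} {b : ℚ → W}

lemma one_sub' (hb : IsBlochAlt χ b 0) (x : ℚ) : b (1-x) = -b x := by
  by_cases h0 : x = 0
  · simp [h0, hb.one, hb.zero]
  by_cases h1 : x = 1
  · simp [h1, hb.one, hb.zero]
  rw [hb.one_sub x h0 h1, zero_sub]

lemma div_sub (hb : IsBlochAlt χ b 0) {x : ℚ} (hx : x ≠ 0) (y : ℚ) :
    b (x/(x-y)) = -b (x/y) := by
  rw [← inv_div, ← one_sub_div hx, hb.inv, hb.one_sub', ← inv_div x, hb.inv, neg_neg]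

lemma mul_eq (hb : IsBlochAlt χ b 0) {u v w r s : ℚ} (hu : u ≠ 0) (hv : v ≠ 0) (hw : u*v = w)
    (hc : w = 1 → χ u • b u = b u)
    (h : w ≠ 1 → r*(1-w) = 1 - u ∧ b r = 0 ∧ s*(1-w) = v*(1-u) ∧ b s = 0) :
    b w = b u + χ u • b v := by
  subst hw; by_cases huv : u*v = 1
  · rw [huv, hb.one, eq_inv_of_mul_eq_one_right huv, hb.inv, smul_neg, hc huv, add_neg_cancel]
  by_cases hu1 : u = 1
  · simp [hu1, hb.one]
  by_cases hv1 : v = 1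
  · simp [hv1, hb.one]
  obtain ⟨e1, h1, e2, h2⟩ := h huv; have n := sub_ne_zero.2 (Ne.symm huv)
  have h := hb.five u (u*v) hu hu1 (mul_ne_zero hu hv) huv (by grind)
  rw [show (1 - u⁻¹)/(1 - (u*v)⁻¹) = s by rw [div_eq_iff (by grind)]; grind,
    ← eq_div_of_mul_eq n e1, h1, h2, mul_div_cancel_left₀ _ hu, smul_zero, smul_zero, sub_zero, add_zero] at h
  rw [← sub_eq_zero, ← neg_eq_zero, ← h]; abel

end IsBlochAlt

/-- `x` is a product of two integers of absolute value at most `m`. -/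
def Sm (m x : ℤ) : Prop := ∃ y z : ℤ, |y| ≤ m ∧ |z| ≤ m ∧ y*z = x

/-- `b` vanishes at all `A/C`, where `A`, `C - A` and `C` are products of two integers of absolute
value at most `m`. -/
def Van {W : Type*} [AddCommGroup W] (b : ℚ → W) (m : ℤ) : Prop :=
  ∀ A C : ℤ, C ≠ 0 → Sm m A → Sm m (C-A) → Sm m C → b ((A : ℚ)/C) = 0

lemma Van.frac {W : Type*} [AddCommGroup W] {b : ℚ → W} {m : ℤ} (hv : Van b m)
    (α β γ δ η θ : ℤ) (e : α*β + γ*δ = η*θ) (hη : η ≠ 0 := by grind) (hθ : θ ≠ 0 := by grind)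
    (h1 : |α| ≤ m := by first | omega | grind) (h2 : |β| ≤ m := by first | omega | grind) (h3 : |γ| ≤ m := by first | omega | grind)
    (h4 : |δ| ≤ m := by first | omega | grind) (h5 : |η| ≤ m := by first | omega | grind) (h6 : |θ| ≤ m := by first | omega | grind) :
    b ((α*β : ℚ)/(η*θ)) = 0 := by
  exact_mod_cast hv (α*β) (η*θ) (mul_ne_zero hη hθ) ⟨α, β, h1, h2, rfl⟩
    ⟨γ, δ, h3, h4, by rw [← e]; ring⟩ ⟨η, θ, h5, h6, rfl⟩

/-- `x` is a product of two integers smaller than `m`, or `m` times an integer of absolute value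
at most `t`. -/
def SmUpTo (m t x : ℤ) : Prop := Sm (m-1) x ∨ ∃ θ, |θ| ≤ t ∧ x = m*θ

namespace IsBlochAlt

variable {W : Type*} [AddCommGroup W] {χ : ℚ →*₀ ℤ} {b : ℚ → W}

/-- Reduction of triples with a factor `±m` to those which are prime to `ℓ ∣ m` outside of one
product. -/
lemma vanish_of_core (hb : IsBlochAlt χ b 0) {m t k : ℤ} {ℓ : ℕ} (hℓ : ℓ.Prime) (hk : 0 < k)
    (hm : ℓ*k = m) (ht : m - 1 ≤ t) (htm : t ≤ m) (hv : Van b (m-1))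
    (core : ∀ A C θ : ℤ, Sm (m-1) A → Sm (m-1) C → ¬ (ℓ : ℤ) ∣ A → ¬ (ℓ : ℤ) ∣ C → θ ≠ 0 →
      |θ| ≤ t → A - C = m*θ → b ((A : ℚ)/C) = 0) (A C : ℤ) (hC : C ≠ 0) (hA : SmUpTo m t A)
    (hB : SmUpTo m t (C-A)) (hCC : SmUpTo m t C) : b ((A : ℚ)/C) = 0 := by
  have hp : Prime (ℓ : ℤ) := Nat.prime_iff_prime_int.1 hℓ
  have hℓ2 : (2 : ℤ) ≤ ℓ := mod_cast hℓ.two_le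
  have le : ∀ y : ℤ, |y| ≤ |(ℓ : ℤ)*y| := fun y => by
    rw [abs_mul, Nat.abs_cast]; nlinarith [abs_nonneg y]
  have red : ∀ x, SmUpTo m t (ℓ*x) → SmUpTo m t x := by
    rintro x (⟨y, z, hy, hz, e⟩ | ⟨θ, h, e⟩)
    · rcases hp.dvd_or_dvd (e ▸ dvd_mul_right _ x) with ⟨y, rfl⟩ | ⟨z, rfl⟩
      · exact .inl ⟨y, z, (le y).trans hy, hz, mul_left_cancel₀ hp.ne_zero (by rw [← e]; ring)⟩
      · exact .inl ⟨y, z, hy, (le z).trans hz, mul_left_cancel₀ hp.ne_zero (by rw [← e]; ring)⟩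
    · have hx : k*θ = x := mul_left_cancel₀ hp.ne_zero (by rw [e, ← hm]; ring)
      have hkm : k ≤ m - 1 := by nlinarith
      by_cases hθ : |θ| ≤ m - 1
      · exact .inl ⟨k, θ, by rwa [abs_of_pos hk], hθ, hx⟩
      · rcases abs_choice θ with h' | h'
        · exact .inr ⟨k, by grind, by grind⟩
        · exact .inr ⟨-k, by grind, by grind⟩
  have dm : ∀ θ, (ℓ : ℤ) ∣ m*θ := fun θ => hm ▸ (dvd_mul_right _ _).mul_right θ
  have sm : ∀ x, SmUpTo m t x → ¬ (ℓ : ℤ) ∣ x → Sm (m-1) x := by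
    rintro x (h | ⟨θ, -, rfl⟩) hd
    · exact h
    · exact absurd (dm θ) hd
  induction hn : A.natAbs using Nat.strong_induction_on generalizing A C with
  | _ n ih =>
  by_cases A0 : A = 0
  · simp [A0, hb.zero]
  by_cases AC : A = C
  · rw [AC, div_self (mod_cast hC), hb.one]
  have dB : (ℓ : ℤ) ∣ C - A → ((ℓ : ℤ) ∣ A ↔ (ℓ : ℤ) ∣ C) := fun h => (dvd_iff_dvd_of_dvd_sub h).symm
  have dA : (ℓ : ℤ) ∣ A → ((ℓ : ℤ) ∣ C - A ↔ (ℓ : ℤ) ∣ C) := fun h => dvd_sub_left h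
  have dC : (ℓ : ℤ) ∣ C → ((ℓ : ℤ) ∣ C - A ↔ (ℓ : ℤ) ∣ A) := fun h => dvd_sub_right h
  by_cases hdA : (ℓ : ℤ) ∣ A
  · by_cases hdC : (ℓ : ℤ) ∣ C
    · obtain ⟨A, rfl⟩ := hdA; obtain ⟨C, rfl⟩ := hdC; have a0 := right_ne_zero_of_mul A0
      have := ih A.natAbs (by rw [← hn, Int.natAbs_mul, Int.natAbs_natCast]; nlinarith [hℓ.two_le, Int.natAbs_pos.2 a0])
        A C (right_ne_zero_of_mul hC) (red _ hA) (red _ (by rwa [mul_sub])) (red _ hCC) rfl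
      push_cast; rwa [mul_div_mul_left _ _ (mod_cast hp.ne_zero)]
    · have sB := sm _ hB (by grind); rcases hA with h | ⟨θ, h, rfl⟩
      · exact hv A C hC h sB (sm _ hCC hdC)
      · have := core C (C - m*θ) θ (sm _ hCC hdC) sB hdC (by grind) (right_ne_zero_of_mul A0) h (by ring)
        push_cast at this ⊢; rwa [hb.div_sub (mod_cast hC), ← hb.inv, inv_div] at this
  have sA := sm _ hA hdA; by_cases hdC : (ℓ : ℤ) ∣ C
  · have sB := sm _ hB (by grind); rcases hCC with h | ⟨θ, h, rfl⟩
    · exact hv A C hC sA sB h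
    · obtain ⟨y, z, hy, hz, e⟩ := sB
      have := core A (A - m*θ) θ sA ⟨-y, z, by rwa [abs_neg], hz, by linear_combination -e⟩ hdA
        (by rw [← neg_sub, dvd_neg]; grind) (right_ne_zero_of_mul hC) h (by ring)
      push_cast at this ⊢; rwa [hb.div_sub (mod_cast A0), neg_eq_zero] at this
  rcases hB with h | ⟨θ, h, e⟩
  · exact hv A C hC sA h (sm _ hCC hdC)
  · exact core A C (-θ) sA (sm _ hCC hdC) hdA hdC (by grind) (by rwa [abs_neg]) (by linear_combination -e)

/-- To pass from `m - 1` to a multiple `m` of `ℓ` it suffices to treat fractions which are close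
to a small fraction modulo `ℓ`. -/
lemma van_of_split (hb : IsBlochAlt χ b 0) {ℓ k : ℕ} (hℓ : ℓ.Prime) (hk : k ≠ 0)
    (hv : Van b (ℓ*k - 1))
    (hsmall : ∀ x y x₀ y₀ s : ℤ, |x| ≤ ℓ*k - 1 → |y| ≤ ℓ*k - 1 → ¬ (ℓ : ℤ) ∣ x →
      ¬ (ℓ : ℤ) ∣ y → x₀ ≠ 0 → y₀ ≠ 0 → |x₀| ≤ ℓ.sqrt → |y₀| ≤ ℓ.sqrt → |s| ≤ ℓ*k - 1 →
      y*x₀ - x*y₀ = ℓ*s → b ((x*y₀ : ℚ)/(y*x₀)) = 0) : Van b (ℓ*k) := by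
  have hp : Prime (ℓ : ℤ) := Nat.prime_iff_prime_int.1 hℓ
  have hℓpos : (0 : ℤ) < ℓ := mod_cast hℓ.pos
  have hkpos : (1 : ℤ) ≤ k := mod_cast Nat.one_le_iff_ne_zero.2 hk
  obtain ⟨q1, q2, q3⟩ := prime_sqrt_bounds hℓ; zify at q1 q2 q3; set m : ℤ := ℓ*k with hm
  have bound : ∀ x y z w s : ℤ, |x| ≤ m - 1 → |y| ≤ ℓ.sqrt → |z| ≤ m - 1 →
      |w| ≤ ℓ.sqrt → x*y - z*w = ℓ*s → |s| ≤ m - 1 := by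
    intro x y z w s h1 h2 h3 h4 h; have a4 := (abs_nonneg _).trans h1
    refine le_of_mul_le_mul_left (a := (ℓ : ℤ)) ?_ hℓpos
    rw [← abs_of_pos hℓpos, ← abs_mul, ← h, abs_of_pos hℓpos]; have a1 := abs_sub (x*y) (z*w)
    rw [abs_mul, abs_mul] at a1; have a2 := mul_le_mul h1 h2 (abs_nonneg _) a4
    have a3 := mul_le_mul h3 h4 (abs_nonneg _) a4; nlinarith
  have split : ∀ A C θ : ℤ, Sm (m-1) A → Sm (m-1) C → ¬ (ℓ : ℤ) ∣ A → ¬ (ℓ : ℤ) ∣ C → θ ≠ 0 →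
      (∀ A C η : ℤ, Sm (m-1) A → Sm (m-1) (C-A) → |η| ≤ m - 1 → C ≠ 0 → C = η*θ →
        b ((A : ℚ)/C) = 0) → A - C = m*θ → b ((A : ℚ)/C) = 0 := by
    rintro _ _ θ ⟨α, δ, hα, hδ, rfl⟩ ⟨β, γ, hβ, hγ, rfl⟩ dA dC hθ hc e
    have dα := fun h => dA (Dvd.dvd.mul_right h δ)
    have dβ := fun h => dC (Dvd.dvd.mul_right h γ)
    have dγ := fun h => dC (Dvd.dvd.mul_left h β)
    have dδ := fun h => dA (Dvd.dvd.mul_left h α)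
    obtain ⟨α₀, β₀, hα₀, hβ₀, lα, lβ, s₁, e₁⟩ := thue hℓ dα dβ
    obtain ⟨s₂, e₂⟩ : (ℓ : ℤ) ∣ β₀*γ - α₀*δ :=
      (hp.dvd_or_dvd (⟨-(k*θ*β₀) - s₁*δ, by linear_combination -β₀*e - δ*e₁⟩ :
        (ℓ : ℤ) ∣ β*(β₀*γ - α₀*δ))).resolve_left dβ
    have bs₁ := bound β α₀ α β₀ s₁ hβ lα hα lβ e₁
    have bs₂ := bound γ β₀ δ α₀ s₂ hγ lβ hδ lα (by rw [← e₂]; ring)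
    have ksm : ∀ x : ℤ, |x| ≤ ℓ.sqrt → |-(k*x)| ≤ m - 1 := by
      intro x hx; rw [abs_neg, abs_mul, Nat.abs_cast]
      have : (k : ℤ) * |x| ≤ k*ℓ.sqrt := by gcongr
      nlinarith
    have c1 : s₁*γ + s₂*α = -(k*α₀)*θ := by
      apply mul_left_cancel₀ hp.ne_zero; linear_combination -γ*e₁ - α*e₂ - α₀*e
    have c2 : s₁*δ + s₂*β = -(k*β₀)*θ := by
      apply mul_left_cancel₀ hp.ne_zero; linear_combination -δ*e₁ - β*e₂ - β₀*e
    have f1 := hc (s₁*γ) _ _ ⟨_, _, bs₁, hγ, rfl⟩ ⟨s₂, α, bs₂, hα, by rw [← c1]; ring⟩ (ksm _ lα)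
      (by simp [hα₀, hk, hθ]) rfl
    have f2 := hc (s₁*δ) _ _ ⟨_, _, bs₁, hδ, rfl⟩ ⟨s₂, β, bs₂, hβ, by rw [← c2]; ring⟩ (ksm _ lβ)
      (by simp [hβ₀, hk, hθ]) rfl
    have nz : ∀ {x : ℤ}, ¬ (ℓ : ℤ) ∣ x → x ≠ 0 := by rintro _ h rfl; exact h (dvd_zero _)
    have nα := nz dα; have nβ := nz dβ; have nγ := nz dγ; have nδ := nz dδ
    have h1 := hsmall α β α₀ β₀ s₁ hα hβ dα dβ hα₀ hβ₀ lα lβ bs₁ e₁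
    have h2 := hsmall δ γ β₀ α₀ s₂ hδ hγ dδ dγ hβ₀ hα₀ lβ lα bs₂ (by rw [← e₂]; ring)
    push_cast at f1 f2 ⊢
    rw [hb.mul_eq (u := (α*β₀)/(β*α₀)) (v := (δ*α₀)/(γ*β₀)) (by positivity)
      (by positivity) (by field_simp) (by simp [h1]) fun _ => ⟨?_, f1, ?_, f2⟩, h1, h2]
    · simp
    · field_simp; norm_cast; grind
    · field_simp; norm_cast; grind
  have s1 := hb.vanish_of_core hℓ (by omega) hm.symm le_rfl (by omega) hv
    fun A C θ hA hC dA dC h0 h => split A C θ hA hC dA dC h0 fun A C η hA hB hη hC e =>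
      hv A C hC hA hB ⟨η, θ, hη, h, e.symm⟩
  have s2 := hb.vanish_of_core hℓ (by omega) hm.symm (by omega) le_rfl hv
    fun A C θ hA hC dA dC h0 h => split A C θ hA hC dA dC h0 fun A C η hA hB hη hC e =>
      s1 A C hC (.inl hA) (.inl hB) (by
        by_cases h' : |θ| ≤ m - 1
        · exact .inl ⟨η, θ, hη, h', e.symm⟩
        · rcases abs_choice θ with h'' | h''
          · exact .inr ⟨η, hη, by grind⟩
          · exact .inr ⟨-η, by rwa [abs_neg], by grind⟩)
  have up : ∀ x, Sm m x → SmUpTo m m x := by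
    rintro _ ⟨y, z, hy, hz, rfl⟩; by_cases h : |y| ≤ m - 1
    · by_cases h' : |z| ≤ m - 1
      · exact .inl ⟨y, z, h, h', rfl⟩
      · rcases abs_choice z with h'' | h''
        · exact .inr ⟨y, hy, by grind⟩
        · exact .inr ⟨-y, by rwa [abs_neg], by grind⟩
    · rcases abs_choice y with h'' | h''
      · exact .inr ⟨z, hz, by grind⟩
      · exact .inr ⟨-z, by rwa [abs_neg], by grind⟩
  exact fun A C hC h1 h2 h3 => s2 A C hC (up _ h1) (up _ h2) (up _ h3)

lemma van_composite (hb : IsBlochAlt χ b 0) {ℓ k : ℕ} (hℓ : ℓ.Prime) (hk : 2 ≤ k)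
    (hv : Van b (ℓ*k - 1)) : Van b (ℓ*k) := by
  refine hb.van_of_split hℓ (by omega) hv ?_; intro x y x₀ y₀ s hx hy dx dy hx₀ hy₀ lx ly hs e
  have hℓ2 := hℓ.two_le; have q2 := (prime_sqrt_bounds hℓ).2.1; zify at hℓ2 hk q2
  have : 2*(ℓ : ℤ) ≤ ℓ*k := by nlinarith
  exact hv.frac x y₀ ℓ s y x₀ (by linarith) (by rintro rfl; exact dy (dvd_zero _))

set_option maxHeartbeats 800000 in
/-- At a prime `p` it suffices that `b` vanishes at the fractions `j/p`. -/
lemma van_prime (hb : IsBlochAlt χ b 0) {p : ℕ} (hp : p.Prime) (hv : Van b (p-1))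
    (hj : ∀ j : ℤ, 0 < j → j < p → b ((j : ℚ)/p) = 0) : Van b p := by
  have hp' : Prime (p : ℤ) := Nat.prime_iff_prime_int.1 hp
  have hpos : (0 : ℤ) < p := mod_cast hp.pos
  have quot : ∀ x y z w n : ℤ, |x| ≤ n → |y| < p → |z| < p → x*y = z + p*w → |w| ≤ n := by
    intro x y z w n hx hy hz h; have h1 := abs_sub (x*y) z
    rw [h, add_sub_cancel_left, abs_mul, abs_of_pos hpos, ← h, abs_mul] at h1
    have h2 : |x| * |y| ≤ n*(p-1) := mul_le_mul hx (by omega) (abs_nonneg _) (by grind)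
    by_contra hc
    nlinarith [mul_le_mul_of_nonneg_left (by omega : n + 1 ≤ |w|) hpos.le, (abs_nonneg x).trans hx]
  have ndvd : ∀ x : ℤ, x ≠ 0 → |x| < p → ¬ (p : ℤ) ∣ x := fun x h0 h hd =>
    h0 (Int.eq_zero_of_abs_lt_dvd hd h)
  have K : ∀ a c r : ℤ, |a| < p → |c| < p → |r| < p → a ≠ 0 → c ≠ 0 → r ≠ 0 →
      (p : ℤ) ∣ a*c - r → b ((a*c : ℚ)/r) = 0 := by
    intro a
    induction hn : a.natAbs using Nat.strong_induction_on generalizing a with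
    | _ n ih =>
    rintro c r ha hc hr ha0 hc0 hr0 ⟨θ, hθ⟩; have an : |a| = n := by rw [← hn, Int.natCast_natAbs]
    rcases Nat.lt_or_ge 1 n with h1 | h1
    · obtain ⟨β, α, ω, hβ0, hβ, e, hα⟩ := exists_int_approx hpos c (n := n - 1) (by omega)
      rw [show ((n - 1 : ℕ) : ℤ) = |a| - 1 by omega] at hβ hα; rw [sub_add_cancel, ← abs_mul] at hα
      have dc := ndvd c hc0 hc; have βa := abs_of_pos hβ0
      have dβ : ¬ (p : ℤ) ∣ β := ndvd β hβ0.ne' (by omega)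
      have dα : ¬ (p : ℤ) ∣ α := fun h =>
        (hp'.dvd_or_dvd (e ▸ dvd_add h (dvd_mul_right _ _) : (p : ℤ) ∣ β*c)).elim dβ dc
      have hα0 : α ≠ 0 := by rintro rfl; simp at dα
      have hα' : |a*α| < p := lt_of_le_of_ne hα fun h =>
        (hp'.dvd_or_dvd ((dvd_abs _ _).1 (dvd_of_eq h.symm))).elim (ndvd a ha0 ha) dα
      have hαp : |α| < p := by rw [abs_mul] at hα'; nlinarith [abs_nonneg α]
      obtain ⟨φ, hφ⟩ : ∃ φ, β*r = a*α + p*φ :=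
        ⟨a*ω - β*θ, by linear_combination a*e - β*hθ⟩
      have b1 := ih β.natAbs (by omega) β rfl c α (by omega) hc hαp hβ0.ne' hc0 hα0
        ⟨ω, by rw [e]; ring⟩
      have b2 := ih β.natAbs (by omega) β rfl r (a*α) (by omega) hr hα' hβ0.ne' hr0
        (mul_ne_zero ha0 hα0) ⟨φ, by rw [hφ]; ring⟩
      have bω := quot β c α ω β βa.le hc hαp e; have bφ := quot β r _ φ β βa.le hr hα' hφ
      have bθ := quot a c r θ |a| le_rfl hc hr (by linarith); have := abs_neg φ
      have := abs_one (α := ℤ)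
      have t1 : ω*r + -φ*c = θ*α := by
        apply mul_left_cancel₀ hpos.ne'; linear_combination c*hφ - r*e + α*hθ
      have t2 : a*ω + -φ*1 = β*θ := by
        apply mul_left_cancel₀ hpos.ne'; linear_combination hφ - a*e + β*hθ
      have θ0 : (a*c : ℚ)/r ≠ 1 → θ ≠ 0 := by
        rintro h rfl
        exact h (by rw [div_eq_one_iff_eq (mod_cast hr0)]; exact_mod_cast (by linarith : a*c = r))
      rw [hb.mul_eq (u := (β*c : ℚ)/α) (v := (a*α)/(β*r)) (by positivity) (by positivity)
        (by field_simp) (by simp [b1]) fun h => ⟨?_, hv.frac ω r (-φ) c θ α t1 (θ0 h), ?_,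
          hv.frac a ω (-φ) 1 β θ t2 hβ0.ne' (θ0 h)⟩, b1, ← inv_div (β*r : ℚ), hb.inv]
      · push_cast at b2; simp [b2]
      all_goals have := θ0 h; field_simp; norm_cast; grind
    · have jp : ∀ j : ℤ, 0 < j → j < p → b ((j : ℚ)/(j-p)) = 0 := fun j h0 h1 => by
        rw [hb.div_sub (mod_cast h0.ne'), hj j h0 h1, neg_zero]
      obtain ⟨d, hd, hd0⟩ : ∃ d, a*c = d ∧ d ≠ 0 := ⟨_, rfl, mul_ne_zero ha0 hc0⟩
      have hdp : |d| < p := by rw [← hd, abs_mul]; grind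
      have := quot 1 d r θ 1 (by simp) hdp hr (by linarith)
      rw [show (a*c : ℚ) = d by exact_mod_cast hd]
      rcases (by grind : θ = 0 ∨ θ = 1 ∨ θ = -1) with rfl | rfl | rfl
      · rw [show d = r by linarith, div_self (mod_cast hr0), hb.one]
      · rw [show r = d - p by linarith]; exact_mod_cast jp d (by grind) (by grind)
      · rw [show r = d + p by linarith, ← neg_div_neg_eq, ← jp (-d) (by grind) (by grind)]
        congr 1; push_cast; ring
  have := hb.van_of_split hp one_ne_zero (by simpa using hv) ?_
  · simpa using this
  rw [Nat.cast_one, mul_one]; intro x y x₀ y₀ s hx hy dx dy hx₀ hy₀ lx ly hs e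
  obtain ⟨q1, q2, q3⟩ := prime_sqrt_bounds hp; zify at q1 q2 q3
  obtain ⟨r, θ₁, e1, r0, rp⟩ : ∃ r θ : ℤ, x*y₀ = r + p*θ ∧ 0 ≤ r ∧ r < p :=
    ⟨_, _, (Int.emod_add_mul_ediv _ _).symm, Int.emod_nonneg _ hpos.ne', Int.emod_lt_of_pos _ hpos⟩
  have := abs_of_nonneg r0; have := abs_one (α := ℤ)
  have hx0 : x ≠ 0 := by rintro rfl; exact dx (dvd_zero _)
  have hy0 : y ≠ 0 := by rintro rfl; exact dy (dvd_zero _)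
  have rne : r ≠ 0 := by
    rintro rfl
    exact (hp'.dvd_or_dvd ⟨θ₁, by rw [e1, zero_add]⟩).elim dx (ndvd y₀ hy₀ (by linarith))
  obtain ⟨θ₂, e2⟩ : ∃ θ₂, y*x₀ = r + p*θ₂ := ⟨θ₁ + s, by linear_combination e + e1⟩
  have es : s = θ₂ - θ₁ := by apply mul_left_cancel₀ hpos.ne'; linear_combination -e + e2 - e1
  have bθ₁ := quot y₀ x r θ₁ _ ly (by omega) (by omega) (by rw [← e1, mul_comm])
  have bθ₂ := quot x₀ y r θ₂ _ lx (by omega) (by omega) (by rw [← e2, mul_comm])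
  have b1 := K x y₀ r (by omega) (by omega) (by omega) hx0 hy₀ rne ⟨θ₁, by rw [e1]; ring⟩
  have b2 := K y x₀ r (by omega) (by omega) (by omega) hy0 hx₀ rne ⟨θ₂, by rw [e2]; ring⟩
  have s0 : (x*y₀ : ℚ)/(y*x₀) ≠ 1 → s ≠ 0 := by
    rintro h rfl
    exact h (by rw [div_eq_one_iff_eq (by positivity)]; exact_mod_cast (by linarith : x*y₀ = y*x₀))
  have prodb : ∀ z w : ℤ, |z| ≤ p.sqrt → |w| ≤ p.sqrt → |z*w| ≤ p - 1 := by
    intro z w hz hw; rw [abs_mul]; linarith [mul_le_mul hz hw (abs_nonneg _) (by linarith)]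
  have p1 := prodb _ _ bθ₁ lx; have p2 := prodb _ _ bθ₂ ly; have := abs_neg θ₁
  have := abs_neg (θ₁*x₀)
  rw [hb.mul_eq (u := (x*y₀ : ℚ)/r) (v := r/(y*x₀)) (by positivity) (by positivity)
    (by field_simp) (by simp [b1]) fun h => ⟨?_, hv.frac (-(θ₁*x₀)) y (θ₂*y₀) x s r
      (by rw [es]; linear_combination θ₂*e1 - θ₁*e2) (s0 h) rne, ?_,
      hv.frac (-θ₁) 1 θ₂ 1 s 1 (by rw [es]; ring) (s0 h)⟩, b1, ← inv_div (y*x₀ : ℚ), hb.inv, b2]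
  · simp
  all_goals have := s0 h; push_cast; field_simp; norm_cast; grind

end IsBlochAlt

attribute [local irreducible] instCommRingZHalf
set_option linter.unusedSectionVars false

/-- A normalized symmetric 2-cocycle on a commutative group. -/
structure SymCocycle (V A : Type*) [AddCommGroup V] [CommGroup A] where
  toFun : A → A → V
  symm : ∀ a c, toFun a c = toFun c a
  one_left : ∀ a, toFun 1 a = 0
  cocycle : ∀ a c d, toFun a c + toFun (a*c) d = toFun c d + toFun a (c*d)

namespace SymCocycle

variable {V A : Type*} [AddCommGroup V] [CommGroup A] (k : SymCocycle V A)

def Ext (_ : SymCocycle V A) : Type _ := V × A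

instance : CommGroup k.Ext :=
  letI : Mul k.Ext := ⟨fun x y => (x.1 + y.1 + k.toFun x.2 y.2, x.2*y.2)⟩
  letI : One k.Ext := ⟨((0 : V), (1 : A))⟩
  letI : Inv k.Ext := ⟨fun x => (-x.1 - k.toFun x.2 x.2⁻¹, x.2⁻¹)⟩
  { Group.ofLeftAxioms (G := k.Ext)
      (by
        rintro ⟨u, a⟩ ⟨v, c⟩ ⟨w, d⟩; refine Prod.ext ?_ (mul_assoc a c d)
        change u + v + k.toFun a c + w + k.toFun (a*c) d
          = u + (v + w + k.toFun c d) + k.toFun a (c*d)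
        have h : u + v + w + (k.toFun a c + k.toFun (a*c) d)
          = u + v + w + (k.toFun c d + k.toFun a (c*d)) := by rw [k.cocycle]
        rw [← sub_eq_zero] at h ⊢; rw [← h]; abel) (by
        rintro ⟨u, a⟩; refine Prod.ext ?_ (one_mul a); change 0 + u + k.toFun 1 a = u
        rw [k.one_left, zero_add, add_zero]) (by
        rintro ⟨u, a⟩; refine Prod.ext ?_ (inv_mul_cancel a)
        change -u - k.toFun a a⁻¹ + u + k.toFun a⁻¹ a = 0
        rw [k.symm a⁻¹ a]; abel) with
    mul_comm := by
      rintro ⟨u, a⟩ ⟨v, c⟩; refine Prod.ext ?_ (mul_comm a c)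
      change u + v + k.toFun a c = v + u + k.toFun c a
      rw [k.symm, add_comm u v] }

def elt (v : V) (a : A) : Additive k.Ext := ofMul ((v, a) : V × A)

lemma elt_add_elt (u v : V) (a c : A) : k.elt u a + k.elt v c = k.elt (u + v + k.toFun a c) (a*c) :=
  rfl

lemma elt_injective {u v : V} {a c : A} (h : k.elt u a = k.elt v c) : u = v :=
  congrArg Prod.fst (ofMul.injective h)

def incl : V →+ Additive k.Ext where
  toFun v := k.elt v 1
  map_zero' := rfl
  map_add' u v := by rw [elt_add_elt, k.one_left, add_zero, one_mul]

lemma incl_add_elt (u v : V) (a : A) : k.incl u + k.elt v a = k.elt (u+v) a := by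
  change k.elt u 1 + _ = _; rw [elt_add_elt, k.one_left, add_zero, one_mul]

end SymCocycle

lemma cochain_shift {V A : Type*} [AddCommGroup V] [CommGroup A] (κ : A → A → V)
    (symm : ∀ a c, κ a c = κ c a) {β : A}
    (hβ : ∀ x y, κ β x + κ (β*x) y = κ x y + κ β (x*y)) {q c d : A}
    (h : κ q (β*c) + κ (q*(β*c)) d = κ (β*c) d + κ q (β*c*d)) :
    κ q c + κ (q*c) d = κ c d + κ q (c*d) := by
  have e2 := hβ (q*c) d; have e4 := hβ c d; have e5 := hβ c q; have e6 := hβ (c*d) q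
  simp only [mul_comm, mul_left_comm, mul_assoc, symm] at *; grind

/-- The representative in `[1, p - 1]` of a unit modulo `p`. -/
def res {p : ℕ} (a : (ZMod p)ˣ) : ℤ := (a : ZMod p).val

section Residues

variable {p : ℕ} [Fact p.Prime]

lemma res_pos (a : (ZMod p)ˣ) : 0 < res a :=
  Int.natCast_pos.2 (Nat.pos_of_ne_zero ((ZMod.val_ne_zero _).2 a.ne_zero))

lemma res_lt (a : (ZMod p)ˣ) : res a < p := Int.ofNat_lt.2 (ZMod.val_lt _)

@[simp] lemma res_cast (a : (ZMod p)ˣ) : ((res a : ℤ) : ZMod p) = a := by simp [res]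

lemma dvd_res_mul_sub (a c : (ZMod p)ˣ) : (p : ℤ) ∣ res a*res c - res (a*c) := by
  rw [← intCast_zmod_eq_zero_iff_dvd]; simp

lemma res_eq {a : (ZMod p)ˣ} {n : ℤ} (h0 : 0 ≤ n) (h : n < p) (e : (a : ZMod p) = n) :
    res a = n := by
  rw [res, e, ZMod.val_intCast, Int.emod_eq_of_lt h0 h]

lemma res_neg (a : (ZMod p)ˣ) : res (-a) = p - res a :=
  res_eq (by linarith [res_lt a]) (by linarith [res_pos a]) (by simp)

lemma res_one : res (1 : (ZMod p)ˣ) = 1 :=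
  res_eq one_pos.le (mod_cast (Fact.out : p.Prime).one_lt) (by simp)

end Residues

namespace IsBlochAlt

variable {W : Type*} [AddCommGroup W] {χ : ℚ →*₀ ℤ} {b : ℚ → W}

section PrimeLevel

variable {p : ℕ}

/-- The value `b (a c / r)` with `r` the residue of `a c` modulo `p`. -/
def kap {W : Type*} (b : ℚ → W) (a c : (ZMod p)ˣ) : W := b ((res a*res c : ℚ)/res (a*c))

lemma kap_symm {W : Type*} {b : ℚ → W} (a c : (ZMod p)ˣ) : kap b a c = kap b c a := by
  unfold kap; rw [mul_comm a c, mul_comm (res a : ℚ)]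

lemma res_mul_of_lt [Fact p.Prime] {a c : (ZMod p)ˣ} (h : res a*res c < p) :
    res (a*c) = res a*res c := res_eq (mul_pos (res_pos a) (res_pos c)).le h (by simp)

lemma kap_eq_zero_of_lt (hb : IsBlochAlt χ b 0) [Fact p.Prime] {a c : (ZMod p)ˣ}
    (h : res a*res c < p) : kap b a c = 0 := by
  have h1 := res_pos a; have h2 := res_pos c
  rw [kap, res_mul_of_lt h, cast_mul, div_self (by positivity), hb.one]

variable (hb : IsBlochAlt χ b 0) (hχ : ∀ x, x ≠ 0 → χ x = 1) (hp : p.Prime) (hv : Van b (p-1))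

include hb hχ hv hp

lemma star {a c d s t : ℤ} (ha : 0 < a) (hc : 0 < c) (hac : a*c < p) (hd : 0 < d) (hd' : d < p)
    (hs : 0 < s) (hs' : s < p) (ht : 0 < t) (ht' : t < p) (h1 : (p : ℤ) ∣ c*d - s)
    (h2 : (p : ℤ) ∣ a*s - t) :
    b ((a*c*d : ℚ)/t) = b ((c*d : ℚ)/s) + b ((a*s : ℚ)/t) := by
  obtain ⟨θ₁, e1⟩ := h1; obtain ⟨θ₂, e2⟩ := h2; have hpos : (0 : ℤ) < p := mod_cast hp.pos
  have p1 : 0 ≤ θ₁ := by by_contra! h; nlinarith [mul_pos hc hd]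
  have p2 : 0 ≤ θ₂ := by by_contra! h; nlinarith [mul_pos ha hs]
  have q1 : θ₁ < c := by by_contra! h; nlinarith
  have q2 : θ₂ < a := by by_contra! h; nlinarith
  have h0 : (a*c*d : ℚ)/t ≠ 1 → a*θ₁ + θ₂ ≠ 0 := fun h h' => h (by
    rw [div_eq_one_iff_eq (by positivity)]
    exact_mod_cast (by linear_combination a*e1 + e2 + p*h' : a*c*d = t))
  have := mul_nonneg ha.le p1; have := mul_nonneg hc.le p2
  have : a*θ₁ + θ₂ < a*c := by nlinarith
  have : c ≤ a*c := by nlinarith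
  have : a ≤ a*c := by nlinarith
  have : c*θ₂ < a*c := by nlinarith
  have t1 : θ₁*t + c*θ₂*d = (a*θ₁ + θ₂)*s := by
    apply mul_left_cancel₀ hpos.ne'; linear_combination (a*s - t)*e1 + (s - c*d)*e2
  rw [hb.mul_eq (u := (c*d : ℚ)/s) (v := (a*s)/t) (by positivity) (by positivity)
    (by field_simp) (fun _ => by rw [hχ _ (by positivity), one_smul])
    fun h => ⟨?_, hv.frac θ₁ t (c*θ₂) d _ s t1 (h0 h), ?_,
      hv.frac a θ₁ θ₂ 1 _ 1 (by ring) (h0 h)⟩, hχ _ (by positivity), one_smul]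
  all_goals have := h0 h; field_simp; norm_cast; grind

lemma neg_one_left {j : ℤ} (hj : 0 < j) (hj' : j < p) :
    b ((j*(p-1) : ℚ)/(p-j)) = b (1-p) + b ((j : ℚ)/(j-p)) := by
  have n1 : (j : ℚ) - p ≠ 0 := sub_ne_zero.2 (mod_cast hj'.ne)
  have n2 : (p : ℚ) - j ≠ 0 := sub_ne_zero.2 (mod_cast hj'.ne')
  have n3 : (1 : ℚ) - p ≠ 0 := sub_ne_zero.2 (mod_cast hp.one_lt.ne)
  have h0 : (j*(p-1) : ℚ)/(p-j) ≠ 1 → 1 - j ≠ 0 := by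
    rintro h h'; obtain rfl : j = 1 := by omega
    exact h (by rw [div_eq_one_iff_eq n2]; push_cast; ring)
  rw [hb.mul_eq (u := 1 - p) (v := j/(j-p)) n3 (by positivity) (by field_simp; ring)
    (fun _ => by rw [hχ _ n3, one_smul]) fun h => ⟨?_, hv.frac (p-j) 1 (1-p) 1 _ 1 (by ring) (h0 h),
      ?_, hv.frac (-j) 1 1 1 _ 1 (by ring) (h0 h)⟩, hχ _ n3, one_smul]
  all_goals
    have : (1 : ℚ) - j ≠ 0 := mod_cast h0 h; push_cast; field_simp; ring

lemma neg_both {a c r : ℤ} (ha : 0 < a) (ha' : a < p) (hc : 0 < c) (hc' : c < p)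
    (hr : 0 < r) (hr' : r < p) (h : (p : ℤ) ∣ a*c - r) :
    b (((p-a)*c : ℚ)/(p-r)) + b ((a : ℚ)/(a-p))
      = b ((a*c : ℚ)/r) + b ((r : ℚ)/(r-p)) := by
  obtain ⟨θ, e⟩ := h; have n1 : (a : ℚ) - p ≠ 0 := sub_ne_zero.2 (mod_cast ha'.ne)
  have n2 : (r : ℚ) - p ≠ 0 := sub_ne_zero.2 (mod_cast hr'.ne)
  have n3 : (p : ℚ) - r ≠ 0 := sub_ne_zero.2 (mod_cast hr'.ne')
  have e' : (a : ℚ)*c - r = p*θ := mod_cast e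
  have p1 : 0 ≤ θ := by by_contra! h; nlinarith [mul_pos ha hc]
  have q1 : θ < c := by by_contra! h; nlinarith
  have q2 : θ < a := by by_contra! h; nlinarith
  have n4 : (θ : ℚ) + 1 ≠ 0 := by positivity
  have h1 := hb.mul_eq (w := (a*c : ℚ)/(r-p)) (u := (a*c)/r) (v := r/(r-p))
    (by positivity) (by positivity) (by field_simp)
    (fun _ => by rw [hχ _ (by positivity), one_smul]) fun _ => ⟨?_, hv.frac θ (r-p) a c (θ+1) r
      (by linear_combination e), ?_, hv.frac θ 1 1 1 (θ+1) 1 (by ring)⟩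
  have h2 := hb.mul_eq (w := (a*c : ℚ)/(r-p)) (u := a/(a-p))
    (v := ((p-a)*c)/(p-r)) (by positivity) (div_ne_zero (mul_ne_zero (by grind) (by positivity)) n3)
    (by field_simp; ring) (fun _ => by rw [hχ _ (by positivity), one_smul])
    fun _ => ⟨?_, hv.frac 1 (r-p) a (θ + 1 - c) (θ+1) (a-p) (by linear_combination -e), ?_,
      hv.frac c 1 (θ + 1 - c) 1 (θ+1) 1 (by ring)⟩
  · rw [hχ _ (by positivity), one_smul] at h1 h2; rw [← h1, h2, add_comm]
  all_goals push_cast; field_simp; grind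

lemma kap_star [Fact p.Prime] {a c : (ZMod p)ˣ} (h : res a*res c < p) (d : (ZMod p)ˣ) :
    kap b a c + kap b (a*c) d = kap b c d + kap b a (c*d) := by
  have := hb.star hχ hp hv (res_pos a) (res_pos c) h (res_pos d) (res_lt d) (res_pos _) (res_lt _)
    (res_pos _) (res_lt _) (dvd_res_mul_sub c d) (dvd_res_mul_sub a (c*d))
  rw [kap_eq_zero_of_lt hb h, zero_add, kap, kap, kap, res_mul_of_lt h, mul_assoc a c d, cast_mul,
    this]

lemma kap_neg_one [Fact p.Prime] (a : (ZMod p)ˣ) :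
    kap b a (-1) = b (1-p) + b ((res a : ℚ)/(res a - p)) := by
  rw [← hb.neg_one_left hχ hp hv (res_pos a) (res_lt a), kap, mul_neg_one, res_neg, res_neg, res_one]
  push_cast; rfl

lemma kap_neg_one_mem [Fact p.Prime] (x y : (ZMod p)ˣ) :
    kap b (-1) x + kap b (-1*x) y = kap b x y + kap b (-1) (x*y) := by
  have := hb.neg_both hχ hp hv (res_pos x) (res_lt x) (res_pos y) (res_lt y) (res_pos _) (res_lt _)
    (dvd_res_mul_sub x y)
  have e : kap b (-1*x) y = b (((p - res x)*res y : ℚ)/(p - res (x*y))) := by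
    rw [kap, neg_one_mul, neg_mul, res_neg, res_neg]; push_cast; rfl
  rw [kap_symm (-1), kap_symm (-1) (x*y), kap_neg_one hb hχ hp hv, kap_neg_one hb hχ hp hv, e,
    add_assoc, add_comm (b _) (b ((_*_)/_)), this, kap]
  abel

lemma kap_cocycle [Fact p.Prime] (a x y : (ZMod p)ˣ) :
    kap b a x + kap b (a*x) y = kap b x y + kap b a (x*y) := by
  have hpos : (0 : ℤ) < p := mod_cast hp.pos
  induction hn : (res a).toNat using Nat.strong_induction_on generalizing a x y with
  | _ n ih =>
  have ha := res_pos a; have ha' := res_lt a; rcases Nat.lt_or_ge 1 n with h1 | h1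
  · obtain ⟨β, α, ω, hβ0, hβ, e, hα⟩ := exists_int_approx hpos (res x) (n := n - 1) (by omega)
    rw [show ((n - 1 : ℕ) : ℤ) = res a - 1 by omega] at hβ hα; rw [sub_add_cancel] at hα
    have nb : (β : ZMod p) ≠ 0 := by
      rw [ne_eq, intCast_zmod_eq_zero_iff_dvd]; intro h; have := Int.le_of_dvd hβ0 h; linarith
    have ez : (β : ZMod p)*(x : ZMod p) = (α : ZMod p) := by
      simpa using congrArg (Int.cast : ℤ → ZMod p) e
    have nα : (α : ZMod p) ≠ 0 := by rw [← ez]; exact mul_ne_zero nb x.ne_zero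
    have hα' : res a * |α| < p := by
      refine lt_of_le_of_ne hα fun h => mul_ne_zero a.ne_zero nα ?_
      rw [← res_cast a, ← cast_mul, intCast_zmod_eq_zero_iff_dvd, ← dvd_abs, abs_mul,
        abs_of_pos ha, h]
    have hα0 : 0 < |α| := abs_pos.2 (by rintro rfl; simp at nα); have hαlt : |α| < p := by nlinarith
    let B : (ZMod p)ˣ := mk0 (β : ZMod p) nb
    have hB : res B = β := res_eq hβ0.le (by omega) rfl
    have key : ∀ z : (ZMod p)ˣ, (z : ZMod p) = (|α| : ℤ) →
        kap b a z + kap b (a*z) y = kap b z y + kap b a (z*y) := fun z hz =>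
      hb.kap_star hχ hp hv (by rwa [res_eq hα0.le hαlt hz]) y
    apply cochain_shift (kap b) kap_symm fun x y => ih _ (by omega) B x y rfl
    rcases abs_choice α with h | h
    · exact key _ (by rw [h, ← ez]; rfl)
    · exact cochain_shift (kap b) kap_symm (hb.kap_neg_one_mem hχ hp hv)
        (key _ (by rw [h]; push_cast; rw [← ez, neg_one_mul]; rfl))
  · exact hb.kap_star hχ hp hv (by rw [show res a = 1 by omega, one_mul]; exact res_lt x) y

def kapCocycle [Fact p.Prime] : SymCocycle W (ZMod p)ˣ where
  toFun := kap b
  symm := kap_symm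
  one_left a := kap_eq_zero_of_lt hb (by rw [res_one, one_mul]; exact res_lt a)
  cocycle := hb.kap_cocycle hχ hp hv

/-- Integral relations between the fractions `j/(p - j)` give relations between the `b (j/p)`. -/
lemma sum_eq_zero_of_factorization [Module ZHalf W] (n : ℕ → ℤ)
    (hn : ∀ ℓ : ℕ, ∑ j ∈ Finset.Ico 1 p, n j*((j.factorization ℓ : ℤ) - ((p-j).factorization ℓ : ℤ))
      = 0) : ∑ j ∈ Finset.Ico 1 p, n j • b ((j : ℚ)/p) = 0 := by
  have : Fact p.Prime := ⟨hp⟩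
  let k := kapCocycle hb hχ hp hv
  have unit : ∀ j : ℕ, 0 < j → j < p → ∃ u : (ZMod p)ˣ, (u : ZMod p) = j ∧ res u = j := fun j h0 h1 => by
    have h : (j : ZMod p) ≠ 0 := fun h =>
      absurd (Nat.le_of_dvd h0 ((natCast_eq_zero_iff _ _).1 h)) (by omega)
    exact ⟨mk0 _ h, rfl, res_eq (by omega) (by omega) (by simp)⟩
  let e : ℕ → Additive k.Ext := fun j =>
    if h : (j : ZMod p) ≠ 0 then k.elt 0 (mk0 (j : ZMod p) h) else 0
  have e_def : ∀ (j : ℕ) (u : (ZMod p)ˣ), (u : ZMod p) = j → e j = k.elt 0 u := fun j u h => by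
    have h' : (j : ZMod p) ≠ 0 := h ▸ u.ne_zero
    exact (dif_pos h').trans (congrArg _ (Units.ext h.symm))
  have e_mul : ∀ i j : ℕ, 0 < i → 0 < j → i*j < p → e (i*j) = e i + e j := by
    intro i j hi hj hij
    obtain ⟨u, hu, ru⟩ := unit i hi (lt_of_le_of_lt (Nat.le_mul_of_pos_right i hj) hij)
    obtain ⟨v, hv, rv⟩ := unit j hj (lt_of_le_of_lt (Nat.le_mul_of_pos_left j hi) hij)
    rw [e_def i u hu, e_def j v hv, e_def _ (u*v) (by simp [hu, hv]), k.elt_add_elt, zero_add,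
      zero_add]
    exact congrArg (k.elt · _) (kap_eq_zero_of_lt hb (by rw [ru, rv]; exact_mod_cast hij)).symm
  let T : (ℕ →₀ ℤ) →+ Additive k.Ext := Finsupp.liftAddHom fun q => (zmultiplesHom _ (e q))
  let F : ℕ → (ℕ →₀ ℤ) := fun j => j.factorization.mapRange (Nat.cast : ℕ → ℤ) rfl
  have hT : ∀ j : ℕ, 0 < j → j < p → T (F j) = e j := by
    intro j
    induction j using Nat.recOnMul with
    | zero => intro h; omega
    | one =>
      intro _ h; rw [show F 1 = 0 by ext; simp [F], map_zero, e_def 1 1 (by simp)]; rfl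
    | prime q hq =>
      intro _ h
      have : F q = single q 1 := by
        simp only [F, hq.factorization]; rw [Finsupp.mapRange_single]; simp
      rw [this]; simp [T]
    | mul i j hi hj =>
      intro h0 h; have i0 : 0 < i := Nat.pos_of_mul_pos_right h0
      have j0 : 0 < j := Nat.pos_of_mul_pos_left h0
      have : F (i*j) = F i + F j := by ext q; simp [F, Nat.factorization_mul i0.ne' j0.ne']
      rw [this, map_add, hi i0 (lt_of_le_of_lt (Nat.le_mul_of_pos_right i j0) h),
        hj j0 (lt_of_le_of_lt (Nat.le_mul_of_pos_left j i0) h), e_mul i j i0 j0 h]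
  have hsum : ∑ j ∈ Finset.Ico 1 p, n j • (F j - F (p-j)) = 0 := by ext q; simpa [F] using hn q
  let ε : Additive k.Ext := k.elt 0 (-1)
  have step : ∀ j ∈ Finset.Ico 1 p,
      (2 : ℤ) • (e j - e (p-j)) = k.incl (-((2 : ℤ) • b ((j : ℚ)/p))) := by
    intro j hj; rw [mem_Ico] at hj; obtain ⟨u, hu, ru⟩ := unit j (by omega) hj.2
    have a1 : e j + ε = k.incl (b (1-p) + b ((j : ℚ)/(j-p))) + e (p-j) := by
      have := kap_neg_one hb hχ hp hv u; rw [ru] at this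
      rw [e_def j u hu, e_def _ (-u) (by push_cast [Nat.cast_sub hj.2.le]; simp [hu]), k.elt_add_elt,
        k.incl_add_elt, mul_neg_one, zero_add, zero_add, add_zero]
      exact congrArg (k.elt · _) this
    have a2 : ε + ε = k.incl (b (1-p) + b (1-p)) := by
      have := kap_neg_one hb hχ hp hv (-1 : (ZMod p)ˣ)
      rw [res_neg, res_one, show (((p - 1 : ℤ) : ℚ)/((p - 1 : ℤ) - p)) = 1 - p by
        push_cast; rw [sub_sub_cancel_left]; ring] at this
      change k.elt 0 (-1) + k.elt 0 (-1) = k.elt _ 1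
      rw [k.elt_add_elt, neg_mul_neg, one_mul, zero_add, zero_add]; exact congrArg (k.elt · _) this
    rw [sub_eq_sub_iff_add_eq_add.2 a1, two_smul, sub_add_sub_comm, a2, ← map_add, ← map_sub, hb.div_sub (mod_cast (by omega : j ≠ 0))]
    congr 1; rw [two_smul]; abel
  have fin : k.incl (-((2 : ℤ) • ∑ j ∈ Finset.Ico 1 p, n j • b ((j : ℚ)/p))) = 0 := by
    have := congrArg (fun x => (2 : ℤ) • T x) hsum
    simp only [map_zero, smul_zero, map_sum, map_zsmul, map_sub, smul_sum] at this
    rw [← this, smul_sum, ← Finset.sum_neg_distrib, map_sum]; refine sum_congr rfl fun j hj => ?_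
    have hj' := mem_Ico.1 hj
    rw [hT j (by omega) hj'.2, hT (p-j) (by omega) (by omega), smul_comm (2 : ℤ) (n j) (e j - e (p-j)),
      step j hj, ← map_zsmul, smul_neg, smul_comm (n j) (2 : ℤ)]
  have z := k.elt_injective (v := 0) (a := 1) (c := 1) fin; rw [neg_eq_zero, two_smul] at z
  exact add_self_cancel z

end PrimeLevel

lemma map {W' : Type*} [AddCommGroup W'] {C : W} (hb : IsBlochAlt χ b C) (f : W →+ W') :
    IsBlochAlt χ (fun x => f (b x)) (f C) where
  zero := by rw [hb.zero, map_zero]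
  one := by rw [hb.one, map_zero]
  five x y h1 h2 h3 h4 h5 := by
    have := congrArg f (hb.five x y h1 h2 h3 h4 h5)
    simpa only [map_add, map_sub, map_zsmul, map_zero] using this
  chi_neg_one := hb.chi_neg_one
  inv x := by rw [hb.inv, map_neg]
  one_sub x h0 h1 := by rw [hb.one_sub x h0 h1, map_sub]
  three := by rw [← map_add, ← map_add, hb.three, map_zero]

lemma mkQ [Module ZHalf W] {C : W} (hb : IsBlochAlt χ b C) {S : Submodule ZHalf W}
    (hC : C ∈ S) : IsBlochAlt χ (fun x => S.mkQ (b x)) 0 := by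
  have := hb.map S.mkQ.toAddMonoidHom; have h0 : S.mkQ.toAddMonoidHom C = 0 := (mk_eq_zero S).2 hC
  rw [h0] at this; exact this

lemma van_succ (hb : IsBlochAlt χ b 0) {m : ℕ} (hv : Van b m)
    (hj : (m+1).Prime → ∀ j : ℤ, 0 < j → j < (m + 1 : ℕ) → b ((j : ℚ)/(m + 1 : ℕ)) = 0) :
    Van b (m + 1 : ℕ) := by
  by_cases hm : m = 0
  · subst hm; rintro _ _ hC ⟨a, a', h1, h2, rfl⟩ ⟨c, c', h3, h4, h5⟩ ⟨d, d', h6, h7, rfl⟩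
    simp only [zero_add, Nat.cast_one, Int.abs_le_one_iff] at *
    have : a*a' = 0 ∨ a*a' = d*d' := by
      rcases h1 with rfl | rfl | rfl <;> rcases h2 with rfl | rfl | rfl <;>
        rcases h6 with rfl | rfl | rfl <;> rcases h7 with rfl | rfl | rfl <;> simp at hC ⊢ <;>
        rcases h3 with rfl | rfl | rfl <;> rcases h4 with rfl | rfl | rfl <;> simp at h5
    rcases this with h | h <;> rw [h]
    · simp [hb.zero]
    · rw [div_self (mod_cast hC), hb.one]
  by_cases hp : (m+1).Prime
  · exact hb.van_prime hp (by simpa using hv) (hj hp)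
  · obtain ⟨k, hk⟩ := Nat.minFac_dvd (m+1)
    have hmf : (m+1).minFac.Prime := Nat.minFac_prime (by omega)
    have hk' : ((m + 1 : ℕ) : ℤ) = ((m+1).minFac : ℤ)*k := mod_cast hk; rw [hk']
    refine hb.van_composite hmf ?_ (by rw [← hk']; simpa using hv); by_contra! h; interval_cases k
    · omega
    · rw [mul_one] at hk; rw [hk] at hp; exact hp hmf

end IsBlochAlt

lemma Sm.mono {m n x : ℤ} (h : m ≤ n) : Sm m x → Sm n x := fun ⟨y, z, hy, hz, e⟩ =>
  ⟨y, z, hy.trans h, hz.trans h, e⟩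

lemma Sm.self (x : ℤ) : Sm (|x| + 1) x := ⟨x, 1, by simp, by simp, mul_one x⟩

lemma exists_sm (x : ℚ) : ∃ m : ℕ, Sm m x.num ∧ Sm m (x.den - x.num) ∧ Sm m x.den := by
  refine ⟨x.num.natAbs + x.den + 1, (Sm.self _).mono ?_, (Sm.self _).mono ?_, (Sm.self _).mono ?_⟩ <;>
    push_cast <;> grind

lemma van_zero {W : Type*} [AddCommGroup W] {b : ℚ → W} : Van b (0 : ℕ) := by
  rintro _ _ hC _ _ ⟨y, z, hy, -, rfl⟩; simp [abs_nonpos_iff.1 hy] at hC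

lemma eq_zero_of_van {W : Type*} [AddCommGroup W] {b : ℚ → W} (hv : ∀ m : ℕ, Van b m) (x : ℚ) :
    b x = 0 := by
  obtain ⟨m, h1, h2, h3⟩ := exists_sm x
  simpa [x.num_div_den] using hv m x.num x.den (mod_cast x.den_ne_zero) h1 h2 h3

/-- The submodule spanned by `C` and the values of `b` at triples of size at most `m`. -/
def fullSpan {W : Type*} [AddCommGroup W] [Module ZHalf W] (b : ℚ → W) (C : W) (m : ℤ) :
    Submodule ZHalf W := span ZHalf ({C} ∪ {w | ∃ x y : ℤ, y ≠ 0 ∧ Sm m x ∧ Sm m (y-x) ∧ Sm m y ∧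
    b ((x : ℚ)/y) = w})

section Injectivity

variable {W : Type*} [AddCommGroup W] [Module ZHalf W] {χ : ℚ →*₀ ℤ} {b : ℚ → W} {C : W}

lemma mem_fullSpan_C (m : ℤ) : C ∈ fullSpan b C m := subset_span (Or.inl rfl)

lemma van_of_fullSpan_le {S : Submodule ZHalf W} {m : ℤ} (h : fullSpan b C m ≤ S) :
    Van (fun x => S.mkQ (b x)) m := fun x y hy h1 h2 h3 =>
  (mk_eq_zero _).2 (h (subset_span (.inr ⟨x, y, hy, h1, h2, h3, rfl⟩)))

lemma fullSpan_le_of_van {S : Submodule ZHalf W} (hC : C ∈ S) {m : ℤ}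
    (hv : Van (fun x => S.mkQ (b x)) m) : fullSpan b C m ≤ S := by
  refine span_le.2 ?_; rintro w (rfl | ⟨x, y, hy, h1, h2, h3, rfl⟩)
  · exact hC
  · exact (mk_eq_zero S).1 (hv x y hy h1 h2 h3)

lemma fullSpan_mono {m n : ℤ} (h : m ≤ n) : fullSpan b C m ≤ fullSpan b C n := by
  refine span_mono (Set.union_subset_union_right _ ?_); rintro w ⟨x, y, hy, h1, h2, h3, e⟩
  exact ⟨x, y, hy, h1.mono h, h2.mono h, h3.mono h, e⟩

lemma Sm.padicValRat_eq_zero {p : ℕ} [Fact p.Prime] {x : ℤ} (hx : x ≠ 0) (h : Sm (p-1) x) :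
    padicValRat p x = 0 := by
  obtain ⟨y, z, hy, hz, rfl⟩ := h; rw [padicValRat.of_int, Nat.cast_eq_zero]
  refine padicValInt.eq_zero_of_not_dvd fun hd => hx ?_
  rcases (Nat.prime_iff_prime_int.1 Fact.out).dvd_or_dvd hd with h | h
  · rw [Int.eq_zero_of_abs_lt_dvd h (by omega), zero_mul]
  · rw [Int.eq_zero_of_abs_lt_dvd h (by omega), mul_zero]

/-- The symbol `v_ℓ(x) v_p(y) - v_p(x) v_ℓ(y)`. -/
def omegaVal (p ℓ : ℕ) (x y : ℚ) : ℤ :=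
  padicValRat ℓ x*padicValRat p y - padicValRat p x*padicValRat ℓ y

/-- For the untwisted relation, an element killed by all symbols is a multiple of `C`. -/
lemma mem_span_of_symbols (hb : IsBlochAlt χ b C) (hχ : ∀ x, x ≠ 0 → χ x = 1)
    (lam : ℕ → ℕ → W →ₗ[ZHalf] ZHalf) (hlam : ∀ p ℓ : ℕ, p.Prime → ℓ.Prime → ∀ x, x ≠ 0 → x ≠ 1 →
      lam p ℓ (b x) = (omegaVal p ℓ x (1-x) : ZHalf)) {w : W} (hw : w ∈ span ZHalf (Set.range b))
    (h0 : ∀ p ℓ : ℕ, p.Prime → ℓ.Prime → lam p ℓ w = 0) : w ∈ span ZHalf {C} := by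
  have lamC : ∀ p ℓ, lam p ℓ C = 0 := by
    intro p ℓ; have := congrArg (lam p ℓ) hb.three; rw [map_add, map_add, map_zero] at this
    have h3 : (3 : ZHalf)*lam p ℓ C = 0 := by rw [← this]; ring
    exact (mul_eq_zero.1 h3).resolve_left (by norm_num)
  have key : ∀ m : ℕ, ∀ w ∈ fullSpan b C m,
      (∀ p ℓ : ℕ, p.Prime → ℓ.Prime → lam p ℓ w = 0) → w ∈ span ZHalf {C} := by
    intro m
    induction m with
    | zero =>
      exact fun w hw _ => fullSpan_le_of_van (Submodule.mem_span_singleton_self C) van_zero hw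
    | succ m ih =>
      intro w hw hl; have hv := van_of_fullSpan_le (le_refl (fullSpan b C m))
      have hq := hb.mkQ (mem_fullSpan_C (b := b) (C := C) (m : ℤ)); by_cases hp : (m+1).Prime
      swap
      · exact ih w (fullSpan_le_of_van (mem_fullSpan_C _) (hq.van_succ hv fun h => absurd h hp) hw) hl
      set p := m + 1 with hpm; have hpm' : (p : ℤ) - 1 = m := by rw [hpm]; push_cast; ring
      have : Fact p.Prime := ⟨hp⟩
      let S : Submodule ZHalf W := fullSpan b C m ⊔
        span ZHalf ((fun j : ℕ => b ((j : ℚ)/p)) '' Finset.Ico 1 p)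
      have hwS : w ∈ S := by
        have hCS : C ∈ S := mem_sup_left (mem_fullSpan_C _)
        refine fullSpan_le_of_van hCS ((hb.mkQ hCS).van_succ (van_of_fullSpan_le le_sup_left) ?_) hw
        intro _ j hj0 hjp; lift j to ℕ using hj0.le
        refine (mk_eq_zero S).2 (mem_sup_right (subset_span ⟨j, ?_, by simp [hpm]⟩)); simp; omega
      obtain ⟨s, hs, t, ht, rfl⟩ := mem_sup.1 hwS
      obtain ⟨c, hc⟩ : ∃ c : ℕ → ZHalf, ∑ j ∈ Finset.Ico 1 p, c j • b ((j : ℚ)/p) = t := by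
        obtain ⟨c, hc⟩ := (Submodule.mem_span_image_finset_iff_exists_fun _).1 ht
        refine ⟨fun j => if h : j ∈ Finset.Ico 1 p then c ⟨j, h⟩ else 0, ?_⟩
        rw [← hc, ← Finset.sum_coe_sort]; simp
      have lams : ∀ ℓ : ℕ, ℓ.Prime → lam p ℓ s = 0 := by
        intro ℓ hℓ
        suffices fullSpan b C m ≤ ker (lam p ℓ) from this hs
        refine span_le.2 ?_; rintro w (rfl | ⟨x, y, hy, h1, h2, h3, rfl⟩)
        · exact lamC p ℓ
        rw [mem_coe, mem_ker]; by_cases x0 : x = 0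
        · rw [x0, Int.cast_zero, zero_div, hb.zero, map_zero]
        by_cases x1 : x = y
        · rw [x1, div_self (mod_cast hy), hb.one, map_zero]
        rw [← hpm'] at h1 h2 h3; have yx := sub_ne_zero.2 (Ne.symm x1)
        have e : 1 - (x : ℚ)/y = (y - x : ℤ)/y := by push_cast; field_simp
        rw [hlam p ℓ hp hℓ _ (by positivity) (by
          rw [ne_eq, div_eq_one_iff_eq (mod_cast hy)]; exact_mod_cast x1), e, omegaVal,
          padicValRat.div (p := p) (mod_cast yx) (mod_cast hy),
          padicValRat.div (p := p) (mod_cast x0) (mod_cast hy), h1.padicValRat_eq_zero x0,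
          h2.padicValRat_eq_zero yx, h3.padicValRat_eq_zero hy]
        simp
      have lamt : ∀ ℓ : ℕ, ∑ j ∈ Finset.Ico 1 p,
          c j*(((j.factorization ℓ : ℤ) - ((p-j).factorization ℓ : ℤ) : ℤ) : ZHalf) = 0 := by
        intro ℓ; by_cases hℓ : ℓ.Prime; swap
        · simp [Nat.factorization_eq_zero_of_not_prime _ hℓ]
        by_cases hℓp : ℓ = p
        · refine sum_eq_zero fun j hj => ?_
          rw [mem_Ico] at hj
          rw [hℓp, Nat.factorization_eq_zero_of_lt hj.2,
            Nat.factorization_eq_zero_of_lt (by omega : p - j < p)]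
          simp
        have h1 := hl p ℓ hp hℓ; rw [map_add, lams ℓ hℓ, zero_add, ← hc, map_sum] at h1
        rw [← neg_eq_zero, ← h1, ← Finset.sum_neg_distrib]; refine sum_congr rfl fun j hj => ?_
        rw [mem_Ico] at hj; have : Fact ℓ.Prime := ⟨hℓ⟩
        have nj : (j : ℚ) ≠ 0 := mod_cast (by omega : j ≠ 0)
        have np : (p : ℚ) ≠ 0 := mod_cast hp.ne_zero
        have npj : ((p - j : ℕ) : ℚ) ≠ 0 := mod_cast (by omega : p - j ≠ 0)
        have e1 : 1 - (j : ℚ)/p = ((p - j : ℕ) : ℚ)/p := by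
          rw [Nat.cast_sub hj.2.le]; field_simp
        have z : ∀ i : ℕ, 0 < i → i < p → padicValNat p i = 0 := fun i hi hip =>
          padicValNat.eq_zero_of_not_dvd fun hd => absurd (Nat.le_of_dvd hi hd) (by omega)
        rw [map_smul, hlam p ℓ hp hℓ _ (div_ne_zero nj np) (by
          rw [ne_eq, div_eq_one_iff_eq np]; exact_mod_cast hj.2.ne), e1, omegaVal]
        simp only [padicValRat.div nj np, padicValRat.div npj np, padicValRat.of_nat,
          z j (by omega) hj.2, z (p-j) (by omega) (by omega), padicValNat_self,
          padicValNat_primes hℓp, Nat.factorization_def _ hℓ, smul_eq_mul]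
        push_cast; ring
      obtain ⟨N, n, hNn⟩ : ∃ (N : ℕ) (n : ℕ → ℤ), ∀ j ∈ Finset.Ico 1 p, 2^N*c j = n j := by
        choose N' n' hn' using fun j => zhalf_exists_pow_mul (c j)
        refine ⟨∑ j ∈ Finset.Ico 1 p, N' j,
          fun j => 2^(∑ i ∈ Finset.Ico 1 p, N' i - N' j)*n' j, fun j hj => ?_⟩
        push_cast
        rw [← hn', ← mul_assoc, ← pow_add, Nat.sub_add_cancel
          (Finset.single_le_sum (f := N') (fun _ _ => Nat.zero_le _) hj)]
      have hsum := hq.sum_eq_zero_of_factorization hχ hp (by rwa [hpm']) n (by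
        intro ℓ; have := congrArg (fun x => (2 : ZHalf)^N*x) (lamt ℓ)
        simp only [mul_zero, Finset.mul_sum, ← mul_assoc] at this
        rw [sum_congr rfl fun j hj => by rw [hNn j hj]] at this
        exact_mod_cast this)
      have ht' : (2 : ZHalf)^N • t ∈ fullSpan b C m := by
        rw [← mk_eq_zero, ← hsum, ← hc, smul_sum]; change (fullSpan b C m).mkQ _ = _; rw [map_sum]
        refine sum_congr rfl fun j hj => ?_
        rw [smul_smul, hNn j hj, map_smul, Int.cast_smul_eq_zsmul]
      obtain ⟨u, hu⟩ := zhalf_isUnit_two.pow N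
      have ht2 := (fullSpan b C m).smul_mem ((u⁻¹ : ZHalfˣ) : ZHalf) ht'
      rw [← hu, smul_smul, Units.inv_mul, one_smul] at ht2
      exact ih _ (Submodule.add_mem _ hs ht2) hl
  obtain ⟨m, hm⟩ : ∃ m : ℕ, w ∈ fullSpan b C m := by
    refine Submodule.span_induction (p := fun w _ => ∃ m : ℕ, w ∈ fullSpan b C m) ?_ ?_ ?_ ?_ hw
    · rintro _ ⟨x, rfl⟩; obtain ⟨m, h1, h2, h3⟩ := exists_sm x
      exact ⟨m, subset_span (.inr ⟨_, _, mod_cast x.den_ne_zero, h1, h2, h3, by simp [x.num_div_den]⟩)⟩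
    · exact ⟨0, Submodule.zero_mem _⟩
    · rintro x y _ _ ⟨m, hm⟩ ⟨n, hn⟩
      exact ⟨m + n, Submodule.add_mem _ (fullSpan_mono (by simp) hm) (fullSpan_mono (by simp) hn)⟩
    · rintro a x _ ⟨m, hm⟩; exact ⟨m, Submodule.smul_mem _ _ hm⟩
  exact key m w hm h0

end Injectivity

lemma one_sub_inv_div {F : Type*} [Field F] {x y : F} (hx : x ≠ 0) (hy : y ≠ 0) (hy1 : y ≠ 1) :
    (1 - x⁻¹)/(1 - y⁻¹) = (1-x)*y/(x*(1-y)) := by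
  have h := sub_ne_zero.2 hy1.symm
  have : 1 - y⁻¹ ≠ 0 := fun h => hy1 (by simpa using (sub_eq_zero.1 h).symm)
  rw [div_eq_div_iff this (mul_ne_zero hx h)]; field_simp; ring

section CharacterOnIntegers

variable {χ : ℚ →*₀ ℤ}

lemma chi_nat_eq_one {n : ℕ} (hn : n ≠ 0) (h : ∀ q : ℕ, q.Prime → q ∣ n → χ q = 1) :
    χ (n : ℚ) = 1 := by
  induction n using Nat.recOnMul with
  | zero => exact absurd rfl hn
  | one => simp
  | prime q hq => exact h q hq dvd_rfl
  | mul i j hi hj =>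
    rw [Nat.cast_mul, map_mul, hi (left_ne_zero_of_mul hn) fun q hq hd => h q hq (hd.mul_right _),
      hj (right_ne_zero_of_mul hn) fun q hq hd => h q hq (hd.mul_left _), one_mul]

lemma chi_int_eq_one (he : χ (-1) = 1) {n : ℤ} (hn : n ≠ 0)
    (h : ∀ q : ℕ, q.Prime → (q : ℤ) ∣ n → χ q = 1) : χ (n : ℚ) = 1 := by
  have := chi_nat_eq_one (Int.natAbs_ne_zero.2 hn) fun q hq hd => h q hq (Int.natCast_dvd.2 hd)
  rcases Int.natAbs_eq n with h | h <;> rw [h]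
  · rwa [cast_natCast]
  · rwa [Int.cast_neg, cast_natCast, chi_neg χ he]

lemma chi_eq_one_of_primes (he : χ (-1) = 1) (h : ∀ q : ℕ, q.Prime → χ q = 1) {x : ℚ}
    (hx : x ≠ 0) : χ x = 1 := by
  rw [← x.num_div_den, chi_div, chi_int_eq_one he (Rat.num_ne_zero.2 hx) fun q hq _ => h q hq,
    chi_nat_eq_one x.den_ne_zero fun q hq _ => h q hq, one_mul]

lemma chi_one_sub_inv {x : ℚ} (hx : x ≠ 0) : χ (1 - x⁻¹) = χ (-1)*(χ (1-x)*χ x) := by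
  rw [← chi_div, ← map_mul]; congr 1; grind

lemma ne_of_chi_eq_neg_one {x : ℚ} (h : χ x = -1) : x ≠ 0 ∧ x ≠ 1 :=
  ⟨by rintro rfl; simp at h, by rintro rfl; simp at h⟩

end CharacterOnIntegers

namespace IsBloch

variable {W : Type*} [AddCommGroup W] [Module ZHalf W] {χ : ℚ →*₀ ℤ} {b : ℚ → W}

/-- Adding the five-term relations of `(x, y)` and `(y, x)`: the part of `b` (anti)symmetric under
inversion defines a twisted cocycle. -/
lemma symm_cocycle (hb : IsBloch χ b) {e : ℤ} (hinv : ∀ x, b x⁻¹ = e • b x)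
    {r t : ℚ} (hr : r ≠ 0) (ht : t ≠ 0) (hr1 : r ≠ 1) (ht1 : t ≠ 1) (hrt : r*t ≠ 1) :
    (χ (1 - r*t)*(1 + e*χ (r*t))) • b (r*t)
      = (χ (1-r)*(1 + e*χ r)) • b r + χ r • (χ (1-t)*(1 + e*χ t)) • b t := by
  have n1 : 1 - r ≠ 0 := sub_ne_zero.2 hr1.symm; have n2 : 1 - t ≠ 0 := sub_ne_zero.2 ht1.symm
  have n3 : 1 - r*t ≠ 0 := sub_ne_zero.2 hrt.symm; set X : ℚ := (1-r)/(1 - r*t) with hX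
  have X0 : X ≠ 0 := div_ne_zero n1 n3; have Y0 : t*X ≠ 0 := mul_ne_zero ht X0
  have h1X : 1 - X = r*(1-t)/(1 - r*t) := by grind
  have h1Y : 1 - t*X = (1-t)/(1 - r*t) := by grind
  have X1 : 1 - X ≠ 0 := by rw [h1X]; exact div_ne_zero (mul_ne_zero hr n2) n3
  have Y1 : 1 - t*X ≠ 0 := by rw [h1Y]; exact div_ne_zero n2 n3
  have hXY : X ≠ t*X := by grind
  have e1 := hb.five X (t*X) X0 (by grind) Y0 (by grind) hXY
  have e2 := hb.five (t*X) X Y0 (by grind) X0 (by grind) hXY.symm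
  have q2 : (1-X)/(1 - t*X) = r := by rw [h1X, h1Y]; field_simp
  have q3 : (1 - X⁻¹)/(1 - (t*X)⁻¹) = r*t := by
    rw [one_sub_inv_div X0 Y0 (by grind), ← q2]; field_simp
  have inv1 : ∀ {x : ℚ}, x ≠ 0 → χ (x⁻¹ - 1) = χ (1-x)*χ x := fun hx => by
    rw [← chi_div]; congr 1; field_simp
  rw [mul_div_cancel_right₀ _ X0, q2, q3, inv1 X0, h1X] at e1
  rw [← inv_div, mul_div_cancel_right₀ _ X0, ← inv_div (1-X), q2, ← inv_div (1 - X⁻¹), q3, inv1 Y0,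
    h1Y, hinv, hinv, hinv] at e2
  simp only [chi_div, map_mul, hX] at e1 e2 ⊢; have s1 := chi_sq χ n1; have s2 := chi_sq χ n2
  have s3 := chi_sq χ n3; have s4 := chi_sq χ hr
  linear_combination (norm := match_scalars <;> grind)
    -(χ (1-r)*χ (1-t)*χ (1 - r*t)*χ r) • (e1+e2)

/-- If `χ(-1) = -1` then `b` is constant on the points with both signs negative and zero elsewhere. -/
lemma of_neg_one (hb : IsBloch χ b) (he : χ (-1) = -1) :
    (∀ x, χ x = 1 → b x = 0) ∧ (∀ x, χ (1-x) = 1 → b x = 0) ∧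
      ∀ x y, χ x = -1 → χ (1-x) = -1 → χ y = -1 → χ (1-y) = -1 → b x = b y := by
  have inv : ∀ x, b x⁻¹ = b x := by
    intro x; by_cases h0 : x = 0
    · simp [h0]
    by_cases h1 : x = 1
    · simp [h1]
    by_cases hxm : x = -1
    · simp [hxm]
    have := cocycle_symm (χ := χ) (Ψ := fun x => b x + χ (-1) • b x⁻¹)
      (fun r t hr ht hr1 ht1 hrt => hb.inv_cocycle hr hr1 ht ht1 hrt) h0
      (by norm_num : (-1 : ℚ) ≠ 0) h1 (by norm_num) (by grind)
    norm_num [he] at this; apply eq_of_sub_eq_zero; apply add_self_cancel; grind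
  have h1 : ∀ x, χ x = 1 → b x = 0 := by
    intro x hx; have hx0 : x ≠ 0 := by rintro rfl; simp at hx
    by_cases hx1 : x = 1
    · rw [hx1, hb.one]
    have hxm : x * -1 ≠ 1 := by grind
    have := cocycle_symm (χ := χ) (Ψ := fun t => (χ (1-t)*(1 + 1*χ t)) • b t)
      (fun r t hr ht hr1 ht1 hrt => hb.symm_cocycle (e := 1) (fun x => by rw [inv, one_smul])
        hr ht hr1 ht1 hrt) hx0 (by norm_num : (-1 : ℚ) ≠ 0) hx1 (by norm_num) hxm
    simp only [he, hx] at this; norm_num [smul_smul] at this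
    rcases chi_cases χ (sub_ne_zero.2 (Ne.symm hx1)) with h | h <;> rw [h] at this <;>
      norm_num at this <;> apply add_self_cancel <;> apply add_self_cancel <;> grind
  have sub : ∀ x, x ≠ 0 → x ≠ 1 → b (1-x) = b x := by
    have key : ∀ x y, x ≠ 0 → x ≠ 1 → y ≠ 0 → y ≠ 1 → b x - b (1-x) = b y - b (1-y) := by
      intro x y hx hx1 hy hy1; by_cases hxy : x = y
      · rw [hxy]
      have hx' := sub_ne_zero.2 (Ne.symm hx1); have hy' := sub_ne_zero.2 hy1.symm
      have e1 := hb.five x y hx hx1 hy hy1 hxy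
      have e2 := hb.five (1-x) (1-y) hx' (by simpa using hx) hy' (by simpa using hy)
        (by simpa using hxy)
      rw [sub_sub_cancel, sub_sub_cancel] at e2
      have q1 : (1-y)/(1-x) = ((1-x)/(1-y))⁻¹ := by rw [inv_div]
      have q2 : (1 - (1-x)⁻¹)/(1 - (1-y)⁻¹) = ((1 - x⁻¹)/(1 - y⁻¹))⁻¹ := by
        rw [one_sub_inv_div hx' hy' (by simpa using hy), one_sub_inv_div hx hy hy1,
          sub_sub_cancel, sub_sub_cancel, inv_div]
      have q3 : x/y = (y/x)⁻¹ := by rw [inv_div]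
      have s1 : χ ((1-x)⁻¹ - 1) = χ (x⁻¹ - 1) := by
        have a1 : (1-x)⁻¹ - 1 = x/(1-x) := by field_simp; ring
        have a2 : x⁻¹ - 1 = (1-x)/x := by field_simp
        rw [a1, a2, chi_div, chi_div, mul_comm]
      rw [q1, q2, q3, s1, inv, inv, inv] at e2; grind
    intro x hx hx1; have := key x (1-x) hx hx1 (sub_ne_zero.2 (Ne.symm hx1)) (by simpa using hx)
    rw [sub_sub_cancel] at this; apply eq_of_sub_eq_zero; apply add_self_cancel; grind
  refine ⟨h1, fun x hx => ?_, ?_⟩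
  · by_cases hx0 : x = 0
    · rw [hx0, hb.zero]
    by_cases hx1 : x = 1
    · rw [hx1, hb.one]
    rw [← sub x hx0 hx1, h1 _ hx]
  · intro x y hx hx' hy hy'; obtain ⟨hx0, hx1⟩ := ne_of_chi_eq_neg_one hx
    obtain ⟨hy0, hy1⟩ := ne_of_chi_eq_neg_one hy; by_cases hxy : x = y
    · rw [hxy]
    have e1 := hb.five x y hx0 hx1 hy0 hy1 hxy
    rw [h1 (y/x) (by rw [chi_div, hx, hy]; rfl),
      h1 ((1-x)/(1-y)) (by rw [chi_div, hx', hy']; rfl), h1 ((1 - x⁻¹)/(1 - y⁻¹)) (by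
        rw [chi_div, chi_one_sub_inv hx0, chi_one_sub_inv hy0, hx, hx', hy, hy', he]; rfl)] at e1
    simpa [sub_eq_zero] using e1

end IsBloch

namespace IsBlochAlt

variable {W : Type*} [AddCommGroup W] [Module ZHalf W] {χ : ℚ →*₀ ℤ} {b : ℚ → W} {C : W}

lemma of_chi_neg (hb : IsBlochAlt χ b C) {t : ℚ} (ht : χ t = -1) : b t = χ (1-t) • C := by
  have hinv : ∀ x, b x⁻¹ = (-1 : ℤ) • b x := fun x => by rw [hb.inv, neg_one_smul]
  have co := fun r t hr ht hr1 ht1 hrt =>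
    hb.toIsBloch.symm_cocycle hinv (r := r) (t := t) hr ht hr1 ht1 hrt
  have ne {t : ℚ} (h : χ t = -1) := ne_of_chi_eq_neg_one h
  have const : ∀ r t, χ r = -1 → χ t = -1 → χ (1-r) • b r = χ (1-t) • b t := by
    intro r t hr ht; by_cases hrt : r*t = 1
    · have : r = t⁻¹ := eq_inv_of_mul_eq_one_left hrt; rw [this, hb.inv]
      rw [chi_one_sub_inv (ne ht).1, hb.chi_neg_one, ht]; simp
    have := IsBloch.cocycle_symm (χ := χ) (Ψ := fun t => (χ (1-t)*(1 + -1*χ t)) • b t) co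
      (ne hr).1 (ne ht).1 (ne hr).2 (ne ht).2 hrt
    simp only [hr, ht] at this; norm_num [smul_smul] at this; apply eq_of_sub_eq_zero
    apply add_self_cancel; apply add_self_cancel; rw [← sub_eq_zero] at this; rw [← this]; module
  have main : ∀ t, χ t = -1 → χ (1-t) = 1 → b t = C := by
    intro t ht ht1; have n := ne ht; have hi : χ t⁻¹ = -1 := by rw [chi_inv, ht]
    have hs : χ (1 - t⁻¹) = -1 := by rw [chi_one_sub_inv n.1, hb.chi_neg_one, ht, ht1]; rfl
    have c1 := const t (1 - t⁻¹) ht hs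
    rw [sub_sub_cancel, hi, ht1, one_smul, neg_one_smul,
      hb.one_sub _ (inv_ne_zero n.1) (by simpa using n.2), hb.inv] at c1
    apply eq_of_sub_eq_zero; apply add_self_cancel
    linear_combination (norm := module) c1 - hb.three
  have n := ne ht; rcases chi_cases χ (sub_ne_zero.2 (Ne.symm n.2)) with h | h
  · rw [h, one_smul]; exact main t ht h
  · have hs : χ (1 - t⁻¹) = 1 := by rw [chi_one_sub_inv n.1, hb.chi_neg_one, ht, h]; rfl
    have := main t⁻¹ (by rw [chi_inv, ht]) hs; rw [hb.inv] at this
    rw [h, neg_one_smul, ← this, neg_neg]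

lemma of_chi_one_sub (hb : IsBlochAlt χ b C) {y : ℚ} (hy : χ y = 1) (hy' : χ (1-y) = -1) :
    b y = 0 := by
  have h0 := ne_of_chi_eq_neg_one hy'; have := hb.one_sub (1-y) h0.1 h0.2
  rw [sub_sub_cancel, hb.of_chi_neg hy', sub_sub_cancel, hy, one_smul, sub_self] at this; exact this

lemma two_term (hb : IsBlochAlt χ b C) {a c a' c' : ℤ} (ha : χ a = 1) (hc : χ c = 1)
    (hac : χ ((a - c : ℤ) : ℚ) = 1) (ha' : χ a' = 1) (hc' : χ c' = 1)
    (hac' : χ ((a' - c' : ℤ) : ℚ) = 1) (h : χ ((c*a' - c'*a : ℤ) : ℚ) = -1) :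
    b ((c : ℚ)/a) = b ((c' : ℚ)/a') := by
  have nz : ∀ {x : ℚ}, χ x = 1 → x ≠ 0 := by rintro x h rfl; simp at h
  have na := nz ha; have nc := nz hc; have na' := nz ha'; have nc' := nz hc'; have nac := nz hac
  have nac' := nz hac'; push_cast at nac nac' hac hac' h
  have hD : (c*a' - c'*a : ℚ) ≠ 0 := by intro h0; rw [h0] at h; simp at h
  have five := hb.five (c/a) (c'/a') (div_ne_zero nc na) (by grind) (div_ne_zero nc' na')
    (by grind) (by grind)
  have zero : ∀ {x y d : ℚ}, x/y = 1 - d/y → y ≠ 0 → χ x = 1 → χ y = 1 → χ d = -1 → b (x/y) = 0 :=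
    fun {x y d} e hy0 hx hy hd => hb.of_chi_one_sub (by rw [chi_div, hx, hy]; rfl)
      (by rw [e, sub_sub_cancel, chi_div, hd, hy]; rfl)
  have z1 : b ((c' : ℚ)/a'/(c/a)) = 0 := by
    rw [show (c' : ℚ)/a'/(c/a) = c'*a/(c*a') by field_simp]
    exact zero (d := c*a' - c'*a) (by field_simp; ring) (by positivity) (by simp [*]) (by simp [*]) h
  have z2 : b ((1 - ((c : ℚ)/a)⁻¹)/(1 - ((c' : ℚ)/a')⁻¹)) = 0 := by
    rw [inv_div, inv_div, show (1 - (a : ℚ)/c)/(1 - a'/c') = (a-c)*c'/(c*(a' - c')) by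
      rw [one_sub_div nc, one_sub_div nc', ← neg_sub, ← neg_sub (a' : ℚ)]; field_simp]
    exact zero (d := c*a' - c'*a) (by field_simp; ring) (by positivity) (by simp [*]) (by simp [*]) h
  have z3 : b ((1 - (c : ℚ)/a)/(1 - (c' : ℚ)/a')) = 0 := by
    rw [show (1 - (c : ℚ)/a)/(1 - (c' : ℚ)/a') = (a-c)*a'/(a*(a' - c')) by
      rw [one_sub_div na, one_sub_div na']; field_simp]
    exact zero (d := c*a' - c'*a) (by field_simp; ring) (by positivity) (by simp [*]) (by simp [*]) h
  rw [z1, z2, z3, smul_zero, smul_zero, smul_zero, add_zero, sub_zero, add_zero] at five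
  exact sub_eq_zero.1 five

end IsBlochAlt

namespace IsBlochAlt

variable {W : Type*} [AddCommGroup W] [Module ZHalf W] {χ : ℚ →*₀ ℤ} {b : ℚ → W} {C : W}

lemma chi_small (he : χ (-1) = 1) {P : ℕ} (hmin : ∀ q : ℕ, q.Prime → q < P → χ q = 1)
    {n : ℤ} (hn : n ≠ 0) (h : |n| < P) : χ n = 1 := by
  apply chi_int_eq_one he hn; intro q hq hd; apply hmin q hq
  have := Int.le_of_dvd (abs_pos.2 hn) ((dvd_abs _ _).2 hd); omega

lemma of_chi_ne (hb : IsBlochAlt χ b 0) {t : ℚ} (h : χ t = -1 ∨ χ (1-t) = -1) : b t = 0 := by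
  by_cases ht : t = 0
  · rw [ht, hb.zero]
  rcases chi_cases χ ht with h1 | h1
  · rcases h with h | h
    · rw [h] at h1; norm_num at h1
    · exact hb.of_chi_one_sub h1 h
  · rw [hb.of_chi_neg h1, smul_zero]

/-- Beyond the least prime `P` with `χ P = -1`, prime levels bring no new values. -/
lemma level_of_lt (hb : IsBlochAlt χ b 0) {P p : ℕ} (hP : χ P = -1) (hP1 : P.Prime)
    (hmin : ∀ q : ℕ, q.Prime → q < P → χ q = 1) (hp : p.Prime) (hPp : P < p)
    (hv : Van b (p-1)) {j : ℤ} (hj : 0 < j) (hjp : j < p) : b ((j : ℚ)/p) = 0 := by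
  have he := hb.chi_neg_one; by_contra hne; have hp0 : (p : ℚ) ≠ 0 := mod_cast hp.ne_zero
  have hP0 : (P : ℚ) ≠ 0 := mod_cast hP1.ne_zero; have hj0 : (j : ℚ) ≠ 0 := mod_cast hj.ne'
  have hjp0 : (j - p : ℚ) ≠ 0 := by
    have : (j : ℚ) < p := mod_cast hjp; linarith
  have c1 : χ j*χ p = 1 := by
    rw [← chi_div]
    exact (chi_cases χ (div_ne_zero hj0 hp0)).resolve_right fun h => hne (hb.of_chi_ne (Or.inl h))
  have e1 : 1 - (j : ℚ)/p = -((j-p)/p) := by field_simp; ring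
  have c2 : χ (j-p)*χ p = 1 := by
    have := (chi_cases χ (div_ne_zero hjp0 hp0)).resolve_right fun h =>
      hne (hb.of_chi_ne (Or.inr (by rw [e1, chi_neg χ he]; exact h)))
    rwa [chi_div] at this
  obtain ⟨i, hi0, hiP, hr⟩ : ∃ i : ℤ, 0 < i ∧ i < P ∧ |P*j - i*p| < p := by
    have hdiv := Int.mul_ediv_add_emod (P*j) p
    have hm0 := Int.emod_nonneg (P*j) (mod_cast hp.ne_zero : (p : ℤ) ≠ 0)
    have hm1 := Int.emod_lt_of_pos (P*j) (mod_cast hp.pos : (0 : ℤ) < p)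
    have hP2 : (2 : ℤ) ≤ P := mod_cast hP1.two_le; have hpp : (0 : ℤ) < p := mod_cast hp.pos
    set q := (P*j)/(p : ℤ) with hq; have hq0 : 0 ≤ q := Int.ediv_nonneg (by positivity) hpp.le
    have hqP : q < P := by apply Int.ediv_lt_of_lt_mul hpp; nlinarith
    rcases hq0.lt_or_eq with h | h
    · refine ⟨q, h, hqP, ?_⟩; rw [abs_lt]; constructor <;> nlinarith
    · refine ⟨1, one_pos, by omega, ?_⟩; rw [← h] at hdiv; have : 0 < (P : ℤ)*j := by positivity
      rw [abs_lt]; constructor <;> linarith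
  set r : ℤ := P*j - i*p with hrdef
  have hr0 : r ≠ 0 := by
    intro h; have hd : (p : ℤ) ∣ P*j := ⟨i, by linarith⟩
    rcases (Nat.prime_iff_prime_int.1 hp).dvd_or_dvd hd with h | h
    · have := Nat.le_of_dvd hP1.pos (Int.natCast_dvd_natCast.1 h); omega
    · have := Int.le_of_dvd hj h; omega
  have hrQ : (r : ℚ) = P*j - i*p := by rw [hrdef]; push_cast; ring
  have hr0' : (r : ℚ) ≠ 0 := mod_cast hr0
  have ci : χ i = 1 := chi_small he hmin hi0.ne' (by rw [abs_of_pos hi0]; exact hiP)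
  have cPi : χ (i-P) = 1 := by
    have := chi_small he hmin (n := i - P) (by omega) (by rw [abs_lt]; constructor <;> omega)
    push_cast at this; exact this
  set u : ℚ := P*j/r with hu; set v : ℚ := r/(P*(j-p)) with hv'
  have u0 : u ≠ 0 := by rw [hu]; positivity
  have v0 : v ≠ 0 := div_ne_zero hr0' (mul_ne_zero hP0 hjp0)
  have huv : u*v = j/(j-p) := by rw [hu, hv']; field_simp
  have h1u : 1 - u = -(i*p/r) := by rw [hu]; field_simp; rw [hrQ]; ring
  have h1v : 1 - v = p*(i-P)/(P*(j-p)) := by rw [hv']; field_simp; rw [hrQ]; ring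
  have h1uv : 1 - u*v = -(p/(j-p)) := by rw [huv]; field_simp; ring
  have bu : b u = 0 := by
    apply hb.of_chi_ne; rw [h1u, chi_neg χ he, hu, chi_div, chi_div, map_mul, map_mul, ci, hP]
    rcases chi_cases χ hr0' with h | h <;> rcases chi_cases χ hp0 with h' | h' <;>
      rw [h'] at c1 <;> rw [h, h'] <;> [left; right; right; left] <;> linarith
  have bv : b v = 0 := by
    apply hb.of_chi_ne; right; rw [h1v, chi_div, map_mul, map_mul, cPi, hP]; linarith
  have bx : b (u*v) = 0 := by
    rw [hb.mul_eq u0 v0 rfl (by simp [bu]) fun _ => ⟨?_, hv.frac i (j-p) (P-i) j r 1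
      (by rw [hrdef]; ring), ?_, hv.frac i 1 (P-i) 1 P 1 (by ring) (mod_cast hP1.pos.ne')⟩, bu, bv]
    · simp
    · rw [h1u, h1uv]; push_cast; field_simp
    · rw [h1u, h1uv, hv']; push_cast; field_simp
  rw [huv, hb.div_sub hj0, neg_eq_zero] at bx; exact hne bx

/-- All values of `b` come from the levels below the least prime `P` with `χ P = -1`. -/
lemma mem_of_small (hb : IsBlochAlt χ b C) {P : ℕ} (hP : χ P = -1) (hP1 : P.Prime)
    (hmin : ∀ q : ℕ, q.Prime → q < P → χ q = 1) {S : Submodule ZHalf W} (hC : C ∈ S)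
    (hS : ∀ p : ℕ, p.Prime → p < P → ∀ j : ℤ, 0 < j → j < p → b ((j : ℚ)/p) ∈ S) (x : ℚ) :
    b x ∈ S := by
  have hb' := hb.mkQ hC; have hz : ∀ y, S.mkQ (b y) = 0 ↔ b y ∈ S := fun y => mk_eq_zero S
  rw [← hz]; refine eq_zero_of_van (b := fun y => S.mkQ (b y)) (fun m => ?_) x
  induction m with
  | zero => exact van_zero
  | succ m ih =>
    refine hb'.van_succ ih fun hp j hj hjp => ?_
    rcases lt_trichotomy (m+1) P with h | h | h
    · exact (hz _).2 (hS _ hp h j hj hjp)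
    · apply hb'.of_chi_ne; left
      rw [chi_div, h, hP, chi_small hb.chi_neg_one hmin hj.ne' (by
        rw [abs_of_pos hj, ← h]; exact hjp)]; rfl
    · exact hb'.level_of_lt hP hP1 hmin hp h (by push_cast; simpa using ih) hj hjp

lemma b_neg_one (hb : IsBlochAlt χ b C) : b (-1) = 0 := by
  apply add_self_cancel; have := hb.inv (-1); rw [show (-1 : ℚ)⁻¹ = -1 by norm_num] at this
  nth_rewrite 1 [this]; simp

lemma b_two (hb : IsBlochAlt χ b C) : b 2 = C := by
  have := hb.one_sub 2 (by norm_num) (by norm_num)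
  rw [show (1 : ℚ) - 2 = -1 by norm_num, hb.b_neg_one] at this; exact (sub_eq_zero.1 this.symm).symm

lemma mem_span_of_two (hb : IsBlochAlt χ b C) (h2 : χ 2 = -1) (x : ℚ) : b x ∈ span ZHalf {C} :=
  hb.mem_of_small (P := 2) (mod_cast h2) Nat.prime_two
    (fun q hq h => absurd hq.two_le (by omega)) (Submodule.mem_span_singleton_self C)
    (fun q hq h => absurd hq.two_le (by omega)) x

lemma const_eq_zero_of_three (hb : IsBlochAlt χ b C) (h3 : χ 3 = -1) : C = 0 := by
  have he := hb.chi_neg_one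
  have five := hb.five 2 (-1) (by norm_num) (by norm_num) (by norm_num) (by norm_num) (by norm_num)
  have f1 : (1 - (2 : ℚ)⁻¹)/(1 - (-1)⁻¹) = 1/4 := by norm_num
  have f2 : (1 - (2 : ℚ))/(1 - -1) = -1/2 := by norm_num
  have f3 : (2 : ℚ)⁻¹ - 1 = -(1/2) := by norm_num
  have f4 : (1 : ℚ) - 2 = -1 := by norm_num
  rw [f1, f2, f3, f4, he, hb.b_neg_one, hb.b_two] at five
  have c14 : b (1/4) = 0 := by
    apply hb.of_chi_one_sub
    · rw [show (1/4 : ℚ) = (1/2)*(1/2) by norm_num, map_mul, chi_sq χ (by norm_num)]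
    · rw [show (1 - 1/4 : ℚ) = 3*((1/2)*(1/2)) by norm_num, map_mul, map_mul,
        chi_sq χ (by norm_num), h3]; rfl
  rw [c14] at five; rcases chi_cases χ (by norm_num : (2 : ℚ) ≠ 0) with h | h
  · have : b (-1/2) = 0 := by
      apply hb.of_chi_one_sub
      · rw [chi_div, he, h]; rfl
      · rw [show (1 - -1/2 : ℚ) = 3/2 by norm_num, chi_div, h3, h]; rfl
    rw [this] at five; simpa using five
  · have : b (-1/2) = C := by
      rw [hb.of_chi_neg (by rw [chi_div, he, h]; rfl), show (1 - -1/2 : ℚ) = 3/2 by norm_num,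
        chi_div, h3, h]; norm_num
    rw [this, h] at five; simpa using five

lemma const_eq_zero_of_two (hb : IsBlochAlt χ b C) (h2 : χ 2 = -1) {Q : ℕ} (hQ : Q.Prime)
    (hQ5 : 5 ≤ Q) (hχ : χ Q = -1) (hmin : ∀ q : ℕ, q.Prime → q ≠ 2 → q < Q → χ q = 1) : C = 0 := by
  have he := hb.chi_neg_one; have hodd : Q % 2 = 1 := hQ.eq_two_or_odd.resolve_left (by omega)
  have small : ∀ n : ℤ, n % 2 = 1 → |n| < Q → χ n = 1 := by
    intro n hn h; apply chi_int_eq_one he (by omega); intro q hq hd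
    refine hmin q hq (by rintro rfl; omega) ?_
    have := Int.le_of_dvd (abs_pos.2 (by omega : n ≠ 0)) ((dvd_abs _ _).2 hd); omega
  have c4 : χ 4 = 1 := by rw [show (4 : ℚ) = 2*2 by norm_num, map_mul, h2]; rfl
  obtain ⟨m, hm⟩ : ∃ m : ℤ, m = Q - 4 := ⟨_, rfl⟩
  have cm := small m (by omega) (by rw [abs_lt]; omega)
  have cm2 := small (m-2) (by omega) (by rw [abs_lt]; omega)
  have cm4 := small (m-4) (by omega) (by rw [abs_lt]; omega)
  have cm4' := small (4-m) (by omega) (by rw [abs_lt]; omega)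
  have hs := hb.two_term (a := 4) (c := m) (a' := m) (c' := 4) (mod_cast c4) cm cm4' cm
    (mod_cast c4) cm4 (by
      rw [show m*m - 4*4 = (m-4)*Q by rw [hm]; ring, cast_mul, map_mul, cm4,
        cast_natCast, hχ]; rfl)
  push_cast at hs cm2 cm4 cm4'; have m0 : (m : ℚ) ≠ 0 := by intro h; rw [h] at cm; simp at cm
  have m2 : (m - 2 : ℚ) ≠ 0 := by intro h; rw [h] at cm2; simp at cm2
  have m4 : (m - 4 : ℚ) ≠ 0 := by intro h; rw [h] at cm4; simp at cm4
  have m4' : (4 - m : ℚ) ≠ 0 := by intro h; rw [h] at cm4'; simp at cm4'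
  have b4 : b (4/m) = 0 := by
    apply add_self_cancel; nth_rewrite 1 [← hs]; rw [← inv_div (4 : ℚ) m, hb.inv]; simp
  have five := hb.five (2/m) (4/m) (by positivity)
    (by rw [ne_eq, div_eq_one_iff_eq m0]; exact fun h => m2 (by rw [h]; ring)) (by positivity)
    (by rw [ne_eq, div_eq_one_iff_eq m0]; exact fun h => m4 (by rw [h]; ring))
    (by rw [ne_eq, div_left_inj' m0]; norm_num)
  have g1 : (4 : ℚ)/m/(2/m) = 2 := by field_simp; norm_num
  have g2 : (1 - (2/m : ℚ)⁻¹)/(1 - (4/m : ℚ)⁻¹) = 2*(m-2)/(m-4) := by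
    have : 1 - (4/m : ℚ)⁻¹ ≠ 0 := by
      rw [inv_div, sub_ne_zero, ne_eq, eq_div_iff (by norm_num)]
      exact fun h => m4 (by rw [← h]; ring)
    rw [div_eq_div_iff this m4]; field_simp; ring
  have g3 : (1 - (2/m : ℚ))/(1 - 4/m) = (m-2)/(m-4) := by
    have : 1 - (4/m : ℚ) ≠ 0 := by
      rw [sub_ne_zero, ne_eq, eq_div_iff m0]; exact fun h => m4 (by rw [← h]; ring)
    rw [div_eq_div_iff this m4]; field_simp
  have g4 : (2/m : ℚ)⁻¹ - 1 = (m-2)/2 := by field_simp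
  rw [g1, g2, g3, g4, b4, hb.b_two] at five
  have h1 : b (2/m) = C := by
    rw [hb.of_chi_neg (by rw [chi_div, h2, cm]; rfl),
      show (1 - 2/m : ℚ) = (m-2)/m by field_simp, chi_div, cm2, cm]; norm_num
  have h3 : b (2*(m-2)/(m-4)) = C := by
    rw [hb.of_chi_neg (by rw [chi_div, map_mul, h2, cm2, cm4]; rfl),
      show (1 - 2*(m-2)/(m-4) : ℚ) = m/(4-m) by field_simp; ring, chi_div, cm, cm4']
    norm_num
  have h4 : b ((m-2)/(m-4)) = 0 := by
    apply hb.of_chi_one_sub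
    · rw [chi_div, cm2, cm4]; rfl
    · rw [show (1 - (m-2)/(m-4) : ℚ) = 2/(4-m) by field_simp; ring, chi_div, h2, cm4']
      rfl
  rw [h1, h3, h4, chi_div, chi_div, h2, cm, cm2] at five; simpa using five

lemma eq_zero_of_three (hb : IsBlochAlt χ b C) (h2 : χ 2 = 1) (h3 : χ 3 = -1) (x : ℚ) :
    b x = 0 := by
  have hC := hb.const_eq_zero_of_three h3; subst hC
  have := hb.mem_of_small (P := 3) (mod_cast h3) Nat.prime_three (fun q hq h => by
      have : q = 2 := by have := hq.two_le; omega
      subst this; exact_mod_cast h2) (S := ⊥) (by simp) (fun q hq h j hj hjq => by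
      have : q = 2 := by have := hq.two_le; omega
      subst this; have : j = 1 := by omega
      subst this; rw [mem_bot]; norm_num
      rw [show (1/2 : ℚ) = 2⁻¹ by norm_num, hb.inv, hb.b_two, neg_zero]) x
  simpa using this

section Residues

variable {P : ℕ}

def resVal (b : ℚ → W) (x y : ZMod P) : W := b ((y.val : ℚ)/x.val)

lemma resVal_of_lt [Fact P.Prime] (hb : IsBlochAlt χ b C) (hP : χ P = -1)
    (hmin : ∀ q : ℕ, q.Prime → q < P → χ q = 1) {a c : ℤ} (ha : |a| < P) (hc : |c| < P)
    (hac : |a - c| < P) (ha0 : a ≠ 0) (hc0 : c ≠ 0) (hne : a ≠ c) :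
    b ((c : ℚ)/a) = resVal b (a : ZMod P) (c : ZMod P) := by
  have he := hb.chi_neg_one; have hpos : (0 : ℤ) < P := mod_cast (Fact.out : P.Prime).pos
  have va : (((a : ZMod P).val : ℕ) : ℤ) = a % P := ZMod.val_intCast a
  have vc : (((c : ZMod P).val : ℕ) : ℤ) = c % P := ZMod.val_intCast c
  have cases : ∀ x : ℤ, |x| < P → x ≠ 0 → (0 < x ∧ x % P = x) ∨ (x < 0 ∧ x % P = x + P) := by
    intro x hx hx0; rw [abs_lt] at hx; rcases lt_or_gt_of_ne hx0 with h | h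
    · right; refine ⟨h, ?_⟩; rw [← Int.add_emod_right, Int.emod_eq_of_lt (by omega) (by omega)]
    · left; exact ⟨h, Int.emod_eq_of_lt h.le hx.2⟩
  set a0 : ℤ := (((a : ZMod P).val : ℕ) : ℤ) with ha0'
  set c0 : ℤ := (((c : ZMod P).val : ℕ) : ℤ) with hc0'
  have goal : b ((c : ℚ)/a) = b ((c0 : ℚ)/a0) := by
    have sm := fun n h h' => chi_small he hmin (n := n) h h'
    have tt := fun (h1 : χ a0 = 1) (h2 : χ c0 = 1) (h3 : χ ((a0 - c0 : ℤ) : ℚ) = 1) h =>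
      hb.two_term (a := a) (c := c) (a' := a0) (c' := c0) (sm a ha0 ha) (sm c hc0 hc)
      (sm _ (sub_ne_zero.2 hne) hac) h1 h2 h3 h
    have key : ∀ D : ℤ, D ≠ 0 → |D| < P → c*a0 - c0*a = P*D →
        χ ((c*a0 - c0*a : ℤ) : ℚ) = -1 := by
      intro D h0 h1 h2; rw [h2, cast_mul, map_mul, sm D h0 h1, cast_natCast, hP]; rfl
    rw [abs_lt] at ha hc hac
    rcases cases a (abs_lt.2 ha) ha0 with ⟨h1, h1'⟩ | ⟨h1, h1'⟩ <;>
      rcases cases c (abs_lt.2 hc) hc0 with ⟨h2, h2'⟩ | ⟨h2, h2'⟩ <;> rw [h1'] at va <;>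
      rw [h2'] at vc
    · rw [va, vc]
    · exact tt (sm _ (by omega) (by rw [abs_lt]; omega)) (sm _ (by omega) (by rw [abs_lt]; omega))
        (sm _ (by omega) (by rw [abs_lt]; omega)) (key (-a) (by omega) (by rw [abs_lt]; omega)
          (by rw [va, vc]; ring))
    · exact tt (sm _ (by omega) (by rw [abs_lt]; omega)) (sm _ (by omega) (by rw [abs_lt]; omega))
        (sm _ (by omega) (by rw [abs_lt]; omega)) (key c (by omega) (by rw [abs_lt]; omega)
          (by rw [va, vc]; ring))
    · exact tt (sm _ (by omega) (by rw [abs_lt]; omega)) (sm _ (by omega) (by rw [abs_lt]; omega))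
        (sm _ (by omega) (by rw [abs_lt]; omega)) (key (c-a) (by omega) (by rw [abs_lt]; omega)
          (by rw [va, vc]; ring))
  rw [goal, resVal, hc0', ha0']; push_cast; rfl

end Residues

end IsBlochAlt

/-- An antisymmetric function on pairs of residues which is invariant under a common shift and
satisfies the reflection identity is constant on increasing pairs. -/
lemma shift_invariant_const {W : Type*} [AddCommGroup W] {P : ℕ} (hP : 5 ≤ P)
    {f : ℕ → ℕ → W} {C : W} (h1 : ∀ a c, 0 < a → a < P → 0 < c → c < P → f c a = -f a c)
    (h2 : ∀ a c, 0 < a → a < c → c < P → f (P-a) (c-a) = C - f a c)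
    (h3 : ∀ a c, 0 < a → 0 < c → a ≠ c → a + 1 < P → c + 1 < P → f (a+1) (c+1) = f a c) :
    C = 0 ∧ ∀ a c, 0 < a → a < c → c < P → f a c = f 1 2 := by
  have sh : ∀ i a c, 0 < a → 0 < c → a ≠ c → a + i < P → c + i < P → f (a+i) (c+i) = f a c := by
    intro i
    induction i with
    | zero => intros; rfl
    | succ i ih =>
      intro a c ha hc hac hai hci
      rw [← add_assoc, ← add_assoc, h3 _ _ (by omega) (by omega) (by omega) (by omega) (by omega),
        ih a c ha hc hac (by omega) (by omega)]
  have diag : ∀ a c, 0 < a → a < c → c < P → f a c = f 1 (c - a + 1) := by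
    intro a c ha hac hc
    have := sh (a-1) 1 (c - a + 1) one_pos (by omega) (by omega) (by omega) (by omega)
    rw [← this]; congr 1 <;> omega
  have refl : ∀ a c, 0 < a → a < c → c < P → f 1 (c - a + 1) = C + f 1 (P - c + 1) := by
    intro a c ha hac hc; have e := h2 a c ha hac hc
    rw [h1 (c-a) (P-a) (by omega) (by omega) (by omega) (by omega),
      diag (c-a) (P-a) (by omega) (by omega) (by omega), diag a c ha hac hc,
      show P - a - (c-a) = P - c by omega] at e
    grind
  have const : ∀ d, 0 < d → d < P - 1 → f 1 (d+1) = C + f 1 2 := by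
    intro d hd hdP; have := refl (P - 1 - d) (P-1) (by omega) (by omega) (by omega)
    rwa [show P - 1 - (P - 1 - d) = d by omega, show P - (P-1) + 1 = 2 by omega] at this
  have hC : C = 0 := by simpa using const 1 one_pos (by omega)
  refine ⟨hC, fun a c ha hac hc => ?_⟩
  rw [diag a c ha hac hc, const _ (by omega) (by omega), hC, zero_add]

/-- Functions on a prime field satisfying the (untwisted) five-term relation. -/
structure FinBloch {W : Type*} [AddCommGroup W] (p : ℕ) [Fact p.Prime] (B : ZMod p → W) (C : W) :
    Prop where
  zero : B 0 = 0
  one : B 1 = 0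
  five : ∀ x y : ZMod p, x ≠ 0 → x ≠ 1 → y ≠ 0 → y ≠ 1 → x ≠ y →
    B x - B y + B (y/x) - B ((1 - x⁻¹)/(1 - y⁻¹)) + B ((1-x)/(1-y)) = 0
  inv : ∀ x, B x⁻¹ = -B x
  one_sub : ∀ x, x ≠ 0 → x ≠ 1 → B (1-x) = C - B x
  three : C + C + C = 0

namespace IsBlochAlt

variable {W : Type*} [AddCommGroup W] [Module ZHalf W] {χ : ℚ →*₀ ℤ} {b : ℚ → W} {C : W}

section Residues

variable {P : ℕ} [hPp : Fact P.Prime]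

lemma chi_int_of_residue (he : χ (-1) = 1) {n : ℤ} (hn : (n : ZMod P) ≠ 0)
    (h : ∀ q : ℕ, q.Prime → q ≠ P → (q : ℤ) ≤ |n| → χ q = 1) : χ n = 1 := by
  have hn0 : n ≠ 0 := by rintro rfl; simp at hn
  refine chi_int_eq_one he hn0 fun q hq hd => h q hq ?_ (Int.le_of_dvd (abs_pos.2 hn0) ((dvd_abs _ _).2 hd))
  rintro rfl; exact hn ((intCast_zmod_eq_zero_iff_dvd _ _).2 hd)

lemma resVal_symm (hb : IsBlochAlt χ b C) (x y : ZMod P) : resVal b y x = -resVal b x y := by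
  rw [resVal, resVal, ← hb.inv, inv_div]

lemma resVal_sub (hb : IsBlochAlt χ b C) (hP : χ P = -1)
    (hmin : ∀ q : ℕ, q.Prime → q < P → χ q = 1) {x y : ZMod P} (hx : x ≠ 0) (hy : y ≠ 0)
    (hxy : x ≠ y) : resVal b (-x) (y-x) = C - resVal b x y := by
  have lx := x.val_lt; have ly := y.val_lt; have px := val_pos.2 hx; have py := val_pos.2 hy
  have nxy := (ZMod.val_injective P).ne hxy
  have w := hb.resVal_of_lt hP hmin (a := -(x.val : ℤ)) (c := (y.val : ℤ) - x.val)
    (by rw [abs_lt]; omega) (by rw [abs_lt]; omega) (by rw [abs_lt]; omega) (by omega) (by omega)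
    (by omega)
  push_cast at w; rw [natCast_zmod_val, natCast_zmod_val] at w
  rw [← w, resVal, ← hb.one_sub _ (by positivity) (by
    rw [ne_eq, div_eq_one_iff_eq (by positivity)]; exact mod_cast nxy.symm)]
  congr 1; field_simp; ring

lemma resVal_shift (hb : IsBlochAlt χ b C) (hP : χ P = -1) {Q : ℕ} (hχ : χ Q = -1) (hPQ : P < Q)
    (hmin : ∀ q : ℕ, q.Prime → q ≠ P → q < Q → χ q = 1)
    {x y : ZMod P} (hx : x ≠ 0) (hy : y ≠ 0) (hxy : x ≠ y) (hxQ : x ≠ (Q : ZMod P))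
    (hyQ : y ≠ (Q : ZMod P)) : resVal b (x - (Q : ZMod P)) (y - (Q : ZMod P)) = resVal b x y := by
  have he := hb.chi_neg_one
  have hminP : ∀ q : ℕ, q.Prime → q < P → χ q = 1 := fun q hq h => hmin q hq (by omega) (by omega)
  have small : ∀ n : ℤ, (n : ZMod P) ≠ 0 → |n| < Q → χ n = 1 := fun n hn h =>
    chi_int_of_residue he hn fun q hq h1 h2 => hmin q hq h1 (by omega)
  have lx := x.val_lt; have ly := y.val_lt; have px := val_pos.2 hx; have py := val_pos.2 hy
  have nxy := (ZMod.val_injective P).ne hxy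
  have cxy : χ (((x.val : ℤ) - y.val : ℤ) : ℚ) = 1 :=
    small _ (by simpa [sub_eq_zero] using hxy) (by rw [abs_lt]; omega)
  set s := Q/P; set k := Q % P with hk; have hsk : P*s + k = Q := Nat.div_add_mod Q P
  have kP : k < P := Nat.mod_lt _ (Fact.out : P.Prime).pos
  have skZ : (P : ℤ)*s + k = Q := mod_cast hsk
  have csub : ∀ z : ZMod P, z ≠ 0 → z ≠ (Q : ZMod P) → ∀ i : ℕ, i ≤ s →
      χ (((z.val : ℤ) - Q + P*i : ℤ) : ℚ) = 1 := by
    intro z hz0 hz i hi; have lz := z.val_lt; have pz := val_pos.2 hz0; apply small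
    · simpa [sub_eq_zero] using hz
    · have h1 : (P : ℤ)*i ≤ P*s := mod_cast Nat.mul_le_mul_left P hi; grind
  have cv : ∀ z : ZMod P, z ≠ 0 → χ (((z.val : ℕ) : ℤ) : ℚ) = 1 := fun z hz =>
    small _ (by simpa using hz) (by rw [Nat.abs_cast]; have := z.val_lt; omega)
  have chain : ∀ i : ℕ, i ≤ s → b ((((y.val : ℤ) - Q + P*i : ℤ) : ℚ) /
      (((x.val : ℤ) - Q + P*i : ℤ) : ℚ)) = resVal b x y := by
    intro i
    induction i with
    | zero =>
      intro _; have h1 := csub x hx hxQ 0 (Nat.zero_le _)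
      have h2 := csub y hy hyQ 0 (Nat.zero_le _)
      have := hb.two_term (a := x.val) (c := y.val) (cv x hx) (cv y hy) cxy h1 h2
        (by convert cxy using 3; ring) (by
          rw [show (y.val : ℤ)*((x.val : ℤ) - Q + P*(0 : ℕ)) - ((y.val : ℤ) - Q + P*(0 : ℕ)) *
            x.val = Q*((x.val : ℤ) - y.val) by push_cast; ring, cast_mul, map_mul, cxy,
            cast_natCast, hχ]; rfl)
      rw [← this, resVal]; push_cast; rfl
    | succ i ih =>
      intro hi; rw [← ih (by omega)]
      refine (hb.two_term (csub x hx hxQ i (by omega)) (csub y hy hyQ i (by omega))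
        (by convert cxy using 3; ring) (csub x hx hxQ _ hi) (csub y hy hyQ _ hi)
        (by convert cxy using 3; ring) ?_).symm
      rw [show ((y.val : ℤ) - Q + P*i)*((x.val : ℤ) - Q + P*(i + 1 : ℕ)) -
          ((y.val : ℤ) - Q + P*(i + 1 : ℕ))*((x.val : ℤ) - Q + P*i)
          = -(P*((x.val : ℤ) - y.val)) by push_cast; ring, Int.cast_neg, chi_neg χ he,
        cast_mul, map_mul, cxy, cast_natCast, hP]; rfl
  have nk : ∀ z : ZMod P, z ≠ (Q : ZMod P) → (z.val : ℤ) ≠ k := by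
    intro z hz h
    rw [← natCast_zmod_val z, Nat.cast_inj.1 h, hk, ZMod.natCast_mod] at hz; exact hz rfl
  have kQ : (k : ZMod P) = Q := by rw [hk, ZMod.natCast_mod]
  have fin := chain s le_rfl
  rw [show (x.val : ℤ) - Q + P*s = x.val - k by omega,
    show (y.val : ℤ) - Q + P*s = y.val - k by omega] at fin
  have nx := nk x hxQ; have ny := nk y hyQ
  rw [hb.resVal_of_lt hP hminP (by rw [abs_lt]; omega) (by rw [abs_lt]; omega)
    (by rw [abs_lt]; omega) (by omega) (by omega) (by omega)] at fin
  simpa [kQ] using fin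

/-- If `χ` is nontrivial on two primes, the least being at least five, then `b` vanishes. -/
lemma eq_zero_of_two_primes (hb : IsBlochAlt χ b C) (h5 : 5 ≤ P) (hP : χ P = -1) {Q : ℕ}
    (hQ : Q.Prime) (hχ : χ Q = -1) (hPQ : P < Q)
    (hmin : ∀ q : ℕ, q.Prime → q ≠ P → q < Q → χ q = 1) (t : ℚ) : b t = 0 := by
  have hPp := hPp.out
  have hminP : ∀ q : ℕ, q.Prime → q < P → χ q = 1 := fun q hq h => hmin q hq (by omega) (by omega)
  set K : ZMod P := (Q : ZMod P) with hK
  have K0 : K ≠ 0 := by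
    rw [hK, ne_eq, natCast_eq_zero_iff]; intro hd
    rcases (Nat.dvd_prime hQ).1 hd with h | h <;> omega
  have cast0 : ∀ a : ℕ, 0 < a → a < P → (a : ZMod P) ≠ 0 := by
    intro a h1 h2; rw [ne_eq, natCast_eq_zero_iff]
    exact fun hd => absurd (Nat.le_of_dvd h1 hd) (by omega)
  have castne : ∀ a c : ℕ, a < P → c < P → a ≠ c → (a : ZMod P) ≠ c := by
    intro a c h1 h2 h3 h
    rw [ZMod.natCast_eq_natCast_iff', Nat.mod_eq_of_lt h1, Nat.mod_eq_of_lt h2] at h; exact h3 h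
  set f : ℕ → ℕ → W := fun a c => resVal b (K*(a : ZMod P)) (K*(c : ZMod P)) with hf
  have hsymm : ∀ a c, f c a = -f a c := fun a c => hb.resVal_symm _ _
  obtain ⟨hC, hconst⟩ := shift_invariant_const h5 (f := f) (C := C) (fun a c _ _ _ _ => hsymm a c)
    (fun a c ha hac hc => by
      have := hb.resVal_sub hP hminP (x := K*(a : ZMod P)) (y := K*(c : ZMod P))
        (mul_ne_zero K0 (cast0 a ha (by omega))) (mul_ne_zero K0 (cast0 c (by omega) hc))
        fun h => castne a c (by omega) hc hac.ne (mul_left_cancel₀ K0 h)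
      rw [hf]; simp only; rw [← this, Nat.cast_sub (by omega), Nat.cast_sub hac.le, natCast_self]
      congr 1 <;> ring) (fun a c ha hc hac ha' hc' => by
      have := hb.resVal_shift hP hχ hPQ hmin (x := K*((a + 1 : ℕ) : ZMod P)) (y := K*((c + 1 : ℕ) : ZMod P))
        (mul_ne_zero K0 (cast0 _ (by omega) ha')) (mul_ne_zero K0 (cast0 _ (by omega) hc'))
        (fun h => castne _ _ ha' hc' (by omega) (mul_left_cancel₀ K0 h))
        (fun h => cast0 a ha (by omega) (by grind)) (fun h => cast0 c hc (by omega) (by grind))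
      grind)
  have f12 : f 1 2 = 0 := by
    have w := hb.resVal_of_lt hP hminP (a := 1) (c := -1) (by norm_num; omega) (by norm_num; omega)
      (by norm_num; omega) (by norm_num) (by norm_num) (by norm_num)
    norm_num at w; rw [hb.b_neg_one] at w; have Ki0 : K⁻¹ ≠ 0 := inv_ne_zero K0
    have hne : K⁻¹ ≠ -K⁻¹ := by grind
    have hz : f (K⁻¹).val (-K⁻¹).val = 0 := by rw [hf, w]; simp [mul_inv_cancel₀ K0]
    have := val_pos.2 Ki0; have := val_pos.2 (neg_ne_zero.2 Ki0); have := (K⁻¹).val_lt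
    have := (-K⁻¹).val_lt; rcases lt_trichotomy (K⁻¹).val (-K⁻¹).val with h | h | h
    · grind
    · exact absurd (ZMod.val_injective P h) hne
    · grind
  have hall : ∀ x y : ZMod P, x ≠ 0 → y ≠ 0 → x ≠ y → resVal b x y = 0 := by
    intro x y hx hy hxy
    have hfx : resVal b x y = f (K⁻¹*x).val (K⁻¹*y).val := by
      rw [hf]; simp [mul_inv_cancel_left₀ K0]
    have px := val_pos.2 (mul_ne_zero (inv_ne_zero K0) hx)
    have py := val_pos.2 (mul_ne_zero (inv_ne_zero K0) hy); have := (K⁻¹*x).val_lt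
    have := (K⁻¹*y).val_lt; rw [hfx]
    rcases lt_trichotomy (K⁻¹*x).val (K⁻¹*y).val with h | h | h
    · grind
    · exact absurd (mul_left_cancel₀ (inv_ne_zero K0) (ZMod.val_injective P h)) hxy
    · grind
  subst hC
  have := hb.mem_of_small hP hPp hminP (S := ⊥) (by simp) (fun q hq h j hj hjq => by
      rw [mem_bot]
      have w := hb.resVal_of_lt hP hminP (a := q) (c := j) (by rw [Nat.abs_cast]; omega)
        (by rw [abs_of_pos hj]; omega) (by rw [abs_lt]; omega)
        (mod_cast hq.ne_zero) hj.ne' (by omega)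
      lift j to ℕ using hj.le; simp only [cast_natCast] at w ⊢; rw [w]
      exact hall _ _ (cast0 q hq.pos h) (cast0 j (by omega) (by omega))
        (castne _ _ h (by omega) (by omega))) t
  simpa using this

/-- The value at `c/a` only depends on the residue of `c/a` modulo `P`. -/
lemma eq_of_residue (hb : IsBlochAlt χ b C) (hP : χ P = -1)
    (hχ : ∀ q : ℕ, q.Prime → q ≠ P → χ q = 1) {a c a' c' : ℤ} (ha : (a : ZMod P) ≠ 0)
    (hc : (c : ZMod P) ≠ 0) (hac : (a : ZMod P) ≠ c) (ha' : (a' : ZMod P) ≠ 0)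
    (hc' : (c' : ZMod P) ≠ 0) (h : (c*a' : ZMod P) = c'*a) :
    b ((c : ℚ)/a) = b ((c' : ℚ)/a') := by
  have he := hb.chi_neg_one; have hac' : (a' : ZMod P) ≠ c' := by grind
  have cu : ∀ n : ℤ, (n : ZMod P) ≠ 0 → χ n = 1 := fun n hn =>
    chi_int_of_residue he hn fun q hq h _ => hχ q hq h
  have step : ∀ {a c a' c' e : ℤ}, (a : ZMod P) ≠ 0 → (c : ZMod P) ≠ 0 → (a : ZMod P) ≠ c →
      (a' : ZMod P) ≠ 0 → (c' : ZMod P) ≠ 0 → (a' : ZMod P) ≠ c' → (e : ZMod P) ≠ 0 →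
      c*a' - c'*a = P*e → b ((c : ℚ)/a) = b ((c' : ℚ)/a') := by
    intro a c a' c' e ha hc hac ha' hc' hac' he' hD
    exact hb.two_term (cu a ha) (cu c hc) (cu _ (by simpa [sub_eq_zero])) (cu a' ha') (cu c' hc')
      (cu _ (by simpa [sub_eq_zero])) (by rw [hD, cast_mul, map_mul, cu e he']; simp [hP])
  obtain ⟨e, hD⟩ : (P : ℤ) ∣ c*a' - c'*a := by
    rw [← intCast_zmod_eq_zero_iff_dvd]; push_cast; rw [h, sub_self]
  by_cases he' : (e : ZMod P) = 0
  · have hc'' : ((c + P*a : ℤ) : ZMod P) = c := by simp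
    exact (step (e := -(a*a)) ha hc hac ha (by rwa [hc'']) (by rwa [hc'']) (by simpa) (by ring)).trans
      (step (e := e + a*a') ha (by rwa [hc'']) (by rwa [hc'']) ha' hc' hac' (by simp [*])
        (by linear_combination hD))
  · exact step ha hc hac ha' hc' hac' he' hD

lemma b_div_eq_val (hb : IsBlochAlt χ b C) (hP : χ P = -1)
    (hχ : ∀ q : ℕ, q.Prime → q ≠ P → χ q = 1) {a c : ℤ} (ha : (a : ZMod P) ≠ 0)
    (hc : (c : ZMod P) ≠ 0) (hac : (a : ZMod P) ≠ c) :
    b ((c : ℚ)/a) = b (((c/a : ZMod P).val : ℕ) : ℚ) := by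
  have := hb.eq_of_residue hP hχ (a' := 1) (c' := ((c/a : ZMod P).val : ℕ)) ha hc hac
    (by simp) (by simp [*]) (by simp [*])
  simpa using this

lemma finBloch (hb : IsBlochAlt χ b C) (hP : χ P = -1) (hχ : ∀ q : ℕ, q.Prime → q ≠ P → χ q = 1) :
    FinBloch P (fun z => b ((z.val : ℕ) : ℚ)) C := by
  have he := hb.chi_neg_one
  have hval {a c : ℤ} (ha : (a : ZMod P) ≠ 0) (hc : (c : ZMod P) ≠ 0) (h : (a : ZMod P) ≠ c) :=
    hb.b_div_eq_val hP hχ ha hc h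
  have cu : ∀ n : ℤ, (n : ZMod P) ≠ 0 → χ n = 1 := fun n hn =>
    chi_int_of_residue he hn fun q hq h _ => hχ q hq h
  have cv : ∀ z : ZMod P, (((z.val : ℕ) : ℤ) : ZMod P) = z := fun z => by simp
  have q0 : ∀ n : ℤ, (n : ZMod P) ≠ 0 → (n : ℚ) ≠ 0 := by
    rintro n hn h; rw [Int.cast_eq_zero.1 h] at hn; simp at hn
  refine ⟨by simp [hb.zero], ?_, ?_, ?_, ?_, hb.three⟩
  · simp [val_one, hb.one]
  · intro x y hx hx1 hy hy1 hxy; obtain ⟨X, rfl⟩ : ∃ X : ℤ, (X : ZMod P) = x := ⟨_, cv x⟩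
    obtain ⟨Y, rfl⟩ : ∃ Y : ℤ, (Y : ZMod P) = y := ⟨_, cv y⟩
    have X1 : ((1 - X : ℤ) : ZMod P) ≠ 0 := by simpa [sub_eq_zero] using hx1.symm
    have Y1 : ((1 - Y : ℤ) : ZMod P) ≠ 0 := by simpa [sub_eq_zero] using hy1.symm
    have X0 := q0 X hx; have Y0 := q0 Y hy; have qX1 := q0 _ X1; have qY1 := q0 _ Y1
    have cX := cu X hx; have cX1 := cu _ X1; push_cast at qX1 qY1 X1 Y1 cX1
    have xx1 : (X : ℚ) ≠ 1 := fun h => qX1 (by rw [h, sub_self])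
    have yy1 : (Y : ℚ) ≠ 1 := fun h => qY1 (by rw [h, sub_self])
    have five := hb.five X Y X0 xx1 Y0 yy1 fun h => hxy (by rw [Int.cast_injective h])
    have t1 := hval (a := 1) (c := X) (by simp) hx (by simpa using hx1.symm)
    have t2 := hval (a := 1) (c := Y) (by simp) hy (by simpa using hy1.symm)
    have t3 := hval (a := X) (c := Y) hx hy hxy
    have t4 := hval (a := X*(1-Y)) (c := (1-X)*Y) (by simp [*]) (by simp [*]) (by
      push_cast; grind)
    have t5 := hval (a := 1 - Y) (c := 1 - X) (by simpa) (by simpa) (by push_cast; grind)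
    simp only [cast_mul, Int.cast_sub, Int.cast_one, div_one] at t1 t2 t4 t5
    have c4 : χ ((X : ℚ)⁻¹ - 1) = 1 := by
      rw [show (X : ℚ)⁻¹ - 1 = (1-X)/X by field_simp, chi_div, cX, cX1]; rfl
    rwa [t1, t2, t3, one_sub_inv_div X0 Y0 yy1, t4, t5, cX, cX1, c4, one_smul, one_smul, one_smul,
      ← one_sub_inv_div hx hy hy1] at five
  · intro x; by_cases h0 : x = 0
    · simp [h0, hb.zero]
    by_cases h1 : x = 1
    · simp [h1, val_one, hb.one]
    have := hval (a := (x.val : ℕ)) (c := 1) (by rwa [cv]) (by simp) (by rwa [cv, Int.cast_one])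
    rw [← hb.inv]; simpa [eq_comm] using this
  · intro x h0 h1
    have := hval (a := 1) (c := 1 - (x.val : ℕ)) (by simp) (by simpa [sub_eq_zero] using h1.symm)
      (by push_cast; rw [natCast_zmod_val]; grind)
    simp only [Int.cast_sub, Int.cast_one, cast_natCast, natCast_zmod_val, div_one] at this
    rw [← this, hb.one_sub _ (Nat.cast_ne_zero.2 (by simpa using h0)) fun h => h1 (by
      rw [← natCast_zmod_val x, Nat.cast_eq_one.1 h, Nat.cast_one])]

lemma mem_span_finBloch (hb : IsBlochAlt χ b C) (hP : χ P = -1)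
    (hχ : ∀ q : ℕ, q.Prime → q ≠ P → χ q = 1) {S : Submodule ZHalf W} (hC : C ∈ S)
    (hS : ∀ z : ZMod P, b ((z.val : ℕ) : ℚ) ∈ S) (x : ℚ) : b x ∈ S := by
  refine hb.mem_of_small hP hPp.out (fun q hq h => hχ q hq h.ne) hC (fun q hq h j hj hjq => ?_) x
  have c0 : ∀ n : ℤ, 0 < n → n < P → (n : ZMod P) ≠ 0 := by
    intro n h0 h1; rw [ne_eq, intCast_zmod_eq_zero_iff_dvd]
    exact fun hd => absurd (Int.le_of_dvd h0 hd) (by omega)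
  have := c0 (q-j) (by omega) (by omega)
  have := hb.b_div_eq_val hP hχ (a := q) (c := j) (c0 _ (mod_cast hq.pos) (by omega))
    (c0 _ hj (by omega)) (by grind)
  rw [cast_natCast] at this; rw [this]; exact hS _

end Residues

end IsBlochAlt

section CyclicCocycle

variable {X W : Type*} [AddCommGroup W]

def cobdry (c : X → X → X → X → W) (x0 x1 x2 x3 x4 : X) : W :=
  c x1 x2 x3 x4 - c x0 x2 x3 x4 + c x0 x1 x3 x4 - c x0 x1 x2 x4 + c x0 x1 x2 x3

/-- Extension of a function on quadruples of distinct points to degenerate quadruples. -/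
def quadExt (c : X → X → X → X → W) (C : W) (x0 x1 x2 x3 : X) : W :=
  if x0 = x1 ∨ x1 = x2 ∨ x2 = x3 then 0
  else if x0 = x2 ∧ x1 = x3 then 0
  else if x0 = x2 ∨ x1 = x3 ∨ x0 = x3 then -C
  else c x0 x1 x2 x3

def Distinct4 (x0 x1 x2 x3 : X) : Prop := x0 ≠ x1 ∧ x0 ≠ x2 ∧ x0 ≠ x3 ∧ x1 ≠ x2 ∧ x1 ≠ x3 ∧ x2 ≠ x3

lemma quadExt_of_distinct {c : X → X → X → X → W} {C : W} {x0 x1 x2 x3 : X}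
    (h : Distinct4 x0 x1 x2 x3) : quadExt c C x0 x1 x2 x3 = c x0 x1 x2 x3 := by
  obtain ⟨h1, h2, h3, h4, h5, h6⟩ := h; simp [quadExt, *]

lemma cobdry_quadExt {c : X → X → X → X → W} {C : W} (h3 : C + C + C = 0)
    (s01 : ∀ x0 x1 x2 x3, Distinct4 x0 x1 x2 x3 → c x1 x0 x2 x3 = -c x0 x1 x2 x3)
    (s12 : ∀ x0 x1 x2 x3, Distinct4 x0 x1 x2 x3 → c x0 x2 x1 x3 = C - c x0 x1 x2 x3)
    (s23 : ∀ x0 x1 x2 x3, Distinct4 x0 x1 x2 x3 → c x0 x1 x3 x2 = -c x0 x1 x2 x3)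
    (five : ∀ x0 x1 x2 x3 x4, Distinct4 x0 x1 x2 x3 → x0 ≠ x4 → x1 ≠ x4 → x2 ≠ x4 → x3 ≠ x4 →
      cobdry c x0 x1 x2 x3 x4 = 0) (x0 x1 x2 x3 x4 : X) :
    cobdry (quadExt c C) x0 x1 x2 x3 x4 = 0 := by
  have h3n : -C + -C + -C = 0 := by rw [← neg_eq_zero, ← h3]; abel
  unfold cobdry at *; by_cases h01 : x0 = x1
  · subst h01; simp [quadExt]
  by_cases h12 : x1 = x2
  · subst h12; simp [quadExt]
  by_cases h23 : x2 = x3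
  · subst h23; simp [quadExt]
  by_cases h34 : x3 = x4
  · subst h34; simp [quadExt]
  by_cases h02 : x0 = x2
  · subst h02; by_cases h13 : x1 = x3
    · subst h13; by_cases h04 : x0 = x4
      · subst h04; simp [quadExt, *]
      · simp [quadExt, *]
    · by_cases h04 : x0 = x4
      · subst h04; simp [quadExt, *]
      · by_cases h14 : x1 = x4
        · subst h14; simp [quadExt, *]
        · have e := s01 x0 x1 x3 x4 ⟨h01, h23, h04, h13, h14, h34⟩; simp [quadExt, *]
  by_cases h13 : x1 = x3
  · subst h13; by_cases h04 : x0 = x4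
    · subst h04; simp [quadExt, *]
    · by_cases h24 : x2 = x4
      · subst h24; simp [quadExt, *]
      · have e := s12 x0 x1 x2 x4 ⟨h01, h02, h04, h12, h34, h24⟩; simp [quadExt, *]; grind
  by_cases h24 : x2 = x4
  · subst h24; by_cases h03 : x0 = x3
    · subst h03; simp [quadExt, *]
    · have e := s23 x0 x1 x2 x3 ⟨h01, h02, h03, h12, h13, h23⟩; simp [quadExt, *]
  by_cases h03 : x0 = x3
  · subst h03; by_cases h14 : x1 = x4
    · subst h14; simp [quadExt, *]
    · have e := s12 x1 x0 x2 x4 ⟨Ne.symm h01, h12, h14, h02, h34, h24⟩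
      have e' := s01 x0 x1 x2 x4 ⟨h01, h02, h34, h12, h14, h24⟩; simp [quadExt, *]
  by_cases h14 : x1 = x4
  · subst h14; have e := s12 x0 x1 x2 x3 ⟨h01, h02, h03, h12, h13, h23⟩
    have e' := s23 x0 x2 x1 x3 ⟨h02, h01, h03, Ne.symm h12, h23, h13⟩; simp [quadExt, *]; grind
  by_cases h04 : x0 = x4
  · subst h04; have e1 := s12 x1 x0 x2 x3 ⟨Ne.symm h01, h12, h13, h02, h03, h23⟩
    have e2 := s01 x0 x1 x2 x3 ⟨h01, h02, h03, h12, h13, h23⟩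
    have e3 := s23 x1 x2 x0 x3 ⟨h12, Ne.symm h01, h13, Ne.symm h02, h23, h03⟩; simp [quadExt, *]
  have := five x0 x1 x2 x3 x4 ⟨h01, h02, h03, h12, h13, h23⟩ h04 h14 h24 h34
  rw [quadExt_of_distinct ⟨h12, h13, h14, h23, h24, h34⟩, quadExt_of_distinct ⟨h02, h03, h04, h23, h24, h34⟩,
    quadExt_of_distinct ⟨h01, h03, h04, h13, h14, h34⟩, quadExt_of_distinct ⟨h01, h02, h04, h12, h14, h24⟩,
    quadExt_of_distinct ⟨h01, h02, h03, h12, h13, h23⟩]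
  exact this

variable {n : ℕ} [NeZero n]

/-- The carry of the addition of two residues modulo `n`. -/
def carry (j k : ZMod n) : ℕ := (j.val + k.val)/n

lemma carry_mul_add (j k : ZMod n) : n*carry j k + (j+k).val = j.val + k.val := by
  rw [carry, ZMod.val_add]; exact Nat.div_add_mod _ _

lemma carry_cocycle (j k l : ZMod n) :
    carry k l + carry j (k+l) = carry (j+k) l + carry j k := by
  have h1 := carry_mul_add k l; have h2 := carry_mul_add j (k+l)
  have h3 := carry_mul_add (j+k) l; have h4 := carry_mul_add j k; rw [add_assoc] at h3
  have : n*(carry k l + carry j (k+l)) = n*(carry (j+k) l + carry j k) := by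
    rw [mul_add, mul_add]; omega
  exact Nat.eq_of_mul_eq_mul_left (NeZero.pos n) this

def carryCocycle (x0 x1 x2 x3 : ZMod n) : ZMod n := carry (x1-x0) (x2-x1)*(x3-x2)

lemma cobdry_carryCocycle (x0 x1 x2 x3 x4 : ZMod n) : cobdry carryCocycle x0 x1 x2 x3 x4 = 0 := by
  have h := carry_cocycle (x1-x0) (x2-x1) (x3-x2)
  have e : (carry (x2-x1) (x3-x2) : ZMod n) + carry (x1-x0) (x2 - x1 + (x3-x2))
      = carry (x1 - x0 + (x2-x1)) (x3-x2) + carry (x1-x0) (x2-x1) := by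
    exact_mod_cast congrArg (Nat.cast (R := ZMod n)) h
  rw [show x2 - x1 + (x3-x2) = x3 - x1 by ring, show x1 - x0 + (x2-x1) = x2 - x0 by ring] at e
  unfold cobdry carryCocycle; linear_combination (x4-x3)*e

lemma sum_range_zmod (g : ZMod n → W) : ∑ i ∈ Finset.range n, g i = ∑ i : ZMod n, g i := by
  refine Finset.sum_nbij' (fun i => (i : ZMod n)) ZMod.val (fun _ _ => mem_univ _)
    (fun i _ => Finset.mem_range.2 i.val_lt) (fun i hi => ?_) (fun i _ => ?_) (fun _ _ => rfl)
  · exact ZMod.val_cast_of_lt (Finset.mem_range.1 hi)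
  · exact natCast_zmod_val i

lemma sum_range_val_add (g : ZMod n → W) (j l : ZMod n) :
    ∑ i ∈ Finset.range j.val, g (i+l) + ∑ i ∈ Finset.range l.val, g i
      = carry j l • ∑ i : ZMod n, g i + ∑ i ∈ Finset.range (j+l).val, g i := by
  have h1 : ∑ i ∈ Finset.range (l.val + j.val), g i
      = ∑ i ∈ Finset.range l.val, g i + ∑ i ∈ Finset.range j.val, g (i+l) := by
    rw [Finset.sum_range_add]; congr 1; refine sum_congr rfl fun i _ => ?_
    push_cast; rw [natCast_zmod_val, add_comm]
  have per : ∀ q r : ℕ, ∑ i ∈ Finset.range (n*q + r), g i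
      = q • ∑ i : ZMod n, g i + ∑ i ∈ Finset.range r, g i := by
    intro q r
    induction q with
    | zero => simp
    | succ q ih =>
      rw [show n*(q+1) + r = n + (n*q + r) by ring, Finset.sum_range_add, sum_range_zmod]
      have e : ∀ i : ℕ, g ((n + i : ℕ) : ZMod n) = g i := fun i => by
        rw [Nat.cast_add, natCast_self, zero_add]
      simp only [e]; rw [ih, succ_nsmul', add_assoc]
  rw [add_comm, ← h1, add_comm l.val, ← carry_mul_add, per]

/-- A translation invariant normalized 3-cocycle on `ZMod n` is a multiple of the standard one up to
an invariant coboundary. -/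
lemma exists_cyclic_decomposition {c : ZMod n → ZMod n → ZMod n → ZMod n → W}
    (hc : ∀ x0 x1 x2 x3 x4, cobdry c x0 x1 x2 x3 x4 = 0)
    (ht : ∀ t x0 x1 x2 x3, c (x0+t) (x1+t) (x2+t) (x3+t) = c x0 x1 x2 x3)
    (h0 : ∀ x y z, c x x y z = 0) : ∃ (ζ : W) (b : ZMod n → ZMod n → ZMod n → W), n • ζ = 0 ∧
      (∀ t x0 x1 x2, b (x0+t) (x1+t) (x2+t) = b x0 x1 x2) ∧
      ∀ x0 x1 x2 x3, c x0 x1 x2 x3 = (carry (x1-x0) (x2-x1)*(x3-x2).val) • ζ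
        - (b x1 x2 x3 - b x0 x2 x3 + b x0 x1 x3 - b x0 x1 x2) := by
  set h : ZMod n → ZMod n → ZMod n → W := fun j k l => c 0 j (j+k) (j + k + l) with hh
  have hcoc : ∀ j k l m, h k l m - h (j+k) l m + h j (k+l) m - h j k (l+m) + h j k l = 0 := by
    intro j k l m; have := hc 0 j (j+k) (j + k + l) (j + k + l + m)
    have t := ht j 0 k (k+l) (k + l + m); rw [zero_add] at t; simp only [hh]
    unfold cobdry at this; rw [← this, ← t]; simp only [ add_comm, add_left_comm]
  set ζ : ZMod n → W := fun m => ∑ i : ZMod n, h 1 i m with hζ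
  have hadd : ∀ l m, ζ (l+m) = ζ l + ζ m := by
    intro l m
    have : ∑ i : ZMod n, (h i l m - h (1+i) l m + h 1 (i+l) m - h 1 i (l+m) + h 1 i l) = 0 :=
      sum_eq_zero fun i _ => hcoc 1 i l m
    rw [sum_add_distrib, sum_sub_distrib, sum_add_distrib,
      sum_sub_distrib, sum_equiv (Equiv.addLeft (1 : ZMod n))
        (fun i => h (1+i) l m) (fun i => h i l m) (fun _ => rfl),
      sum_equiv (addRight l) (fun i => h 1 (i+l) m) (fun i => h 1 i m)
        (fun _ => rfl), sub_self, zero_add] at this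
    change ζ m - ζ (l+m) + ζ l = 0 at this; rw [← sub_eq_zero, ← neg_eq_zero, ← this]; abel
  have hnat : ∀ m : ℕ, ζ (m : ZMod n) = m • ζ 1 := by
    intro m
    induction m with
    | zero =>
      have := hadd 0 0; rw [add_zero] at this; simpa using this
    | succ m ih => rw [Nat.cast_succ, hadd, ih, succ_nsmul]
  have hz : n • ζ 1 = 0 := by
    rw [← hnat, natCast_self]; simpa using hnat 0
  have hval : ∀ m : ZMod n, ζ m = m.val • ζ 1 := fun m => by rw [← hnat, natCast_zmod_val]
  have hN : ∀ (N : ℕ) (l m : ZMod n), h N l m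
      = ∑ i ∈ Finset.range N, (h 1 (i+l) m - h 1 i (l+m) + h 1 i l) := by
    intro N l m
    induction N with
    | zero => simp [hh, h0]
    | succ N ih =>
      rw [Finset.sum_range_succ, ← ih, Nat.cast_succ, add_comm]; have := hcoc 1 N l m
      rw [← sub_eq_zero, ← neg_eq_zero, ← this]; abel
  set β : ZMod n → ZMod n → W := fun j m => ∑ i ∈ Finset.range j.val, h 1 i m with hβ
  have key : ∀ j l m, h j l m = (carry j l*m.val) • ζ 1
      - (β l m - β (j+l) m + β j (l+m) - β j l) := by
    intro j l m; have e := sum_range_val_add (fun i => h 1 i m) j l; have e2 := hN j.val l m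
    rw [natCast_zmod_val, sum_add_distrib, sum_sub_distrib] at e2
    change _ + β l m = carry j l • ζ m + β (j+l) m at e
    change h j l m = _ - β j (l+m) + β j l at e2; rw [hval, smul_smul] at e
    rw [e2, eq_sub_of_add_eq e]; abel
  refine ⟨ζ 1, fun x0 x1 x2 => β (x1-x0) (x2-x1), hz, fun t x0 x1 x2 => by simp, ?_⟩
  intro x0 x1 x2 x3; have t := ht (-x0) x0 x1 x2 x3; have k := key (x1-x0) (x2-x1) (x3-x2)
  rw [show x1 - x0 + (x2-x1) = x2 - x0 by ring, show x2 - x1 + (x3-x2) = x3 - x1 by ring] at k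
  rw [← t, ← k, hh]; congr 1 <;> ring

lemma sum_join_eq_zero {c : X → X → X → X → W} (hc : ∀ x0 x1 x2 x3 x4, cobdry c x0 x1 x2 x3 x4 = 0)
    (g : ZMod n → X) : ∑ j : ZMod n, ∑ l : ZMod n, c (g j) (g (j+1)) (g l) (g (l+1)) = 0 := by
  have e : ∀ j l : ZMod n, c (g j) (g (j+1)) (g l) (g (l+1))
      = (c (g 0) (g (j+1)) (g l) (g (l+1)) - c (g 0) (g j) (g l) (g (l+1)))
        + (c (g 0) (g j) (g (j+1)) (g (l+1)) - c (g 0) (g j) (g (j+1)) (g l)) := by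
    intro j l; have := hc (g 0) (g j) (g (j+1)) (g l) (g (l+1)); unfold cobdry at this
    rw [← sub_eq_zero, ← this]; abel
  simp_rw [e, sum_add_distrib, sum_sub_distrib]
  have s1 := sum_equiv (addRight (1 : ZMod n))
    (fun j => ∑ l : ZMod n, c (g 0) (g (j+1)) (g l) (g (l+1)))
    (fun j => ∑ l : ZMod n, c (g 0) (g j) (g l) (g (l+1))) (fun _ => rfl)
  have s2 : ∀ j, _ := fun j => sum_equiv (addRight (1 : ZMod n))
    (fun l => c (g 0) (g j) (g (j+1)) (g (l+1)))
    (fun l => c (g 0) (g j) (g (j+1)) (g l)) (fun _ => rfl)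
  rw [s1, sub_self, zero_add]; simp_rw [s2, sub_self]

end CyclicCocycle

/-- A sum over a finite set with a free action of a finite group vanishes when all orbit sums do. -/
lemma sum_eq_zero_of_free {Γ Y W : Type*} [AddGroup Γ] [Fintype Γ] [AddCommGroup W] (s : Finset Y)
    (act : Γ → Y → Y) (h0 : ∀ y, act 0 y = y) (hadd : ∀ g h y, act (g+h) y = act g (act h y))
    (hs : ∀ g, ∀ y ∈ s, act g y ∈ s) (hfree : ∀ g, ∀ y ∈ s, act g y = y → g = 0) (F : Y → W)
    (hF : ∀ y ∈ s, ∑ g, F (act g y) = 0) : ∑ y ∈ s, F y = 0 := by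
  induction s using Finset.strongInduction with
  | H s ih =>
  rcases s.eq_empty_or_nonempty with rfl | ⟨y, hy⟩
  · simp
  set o : Finset Y := univ.image fun g => act g y with ho
  have hos : o ⊆ s := by
    intro z hz; obtain ⟨g, _, rfl⟩ := mem_image.1 hz; exact hs g y hy
  have inj : ∀ g h, act g y = act h y → g = h := by
    intro g h e; have : act (-h + g) y = y := by rw [hadd, e, ← hadd, neg_add_cancel, h0]
    have := hfree _ y hy this; rwa [neg_add_eq_zero, eq_comm] at this
  have so : ∑ z ∈ o, F z = 0 := by
    rw [ho, Finset.sum_image fun g _ h _ e => inj g h e]; exact hF y hy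
  rw [← Finset.sum_sdiff hos, so, add_zero]; refine ih (s \ o) ?_ ?_ ?_ ?_
  · exact Finset.sdiff_ssubset hos ⟨y, mem_image.2 ⟨0, mem_univ _, h0 y⟩⟩
  · intro g z hz; rw [mem_sdiff] at hz ⊢; refine ⟨hs g z hz.1, fun hgz => hz.2 ?_⟩
    obtain ⟨h, _, e⟩ := mem_image.1 hgz; refine mem_image.2 ⟨-g + h, mem_univ _, ?_⟩
    rw [hadd, e, ← hadd, neg_add_cancel, h0]
  · exact fun g z hz => hfree g z (mem_sdiff.1 hz).1
  · exact fun z hz => hF z (mem_sdiff.1 hz).1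

notation:max "V2" p:max => ZMod p × ZMod p

def det2 {F : Type*} [CommRing F] (v w : F × F) : F := v.1*w.2 - w.1*v.2

def crossRatio {F : Type*} [Field F] (v0 v1 v2 v3 : F × F) : F :=
  det2 v1 v2*det2 v0 v3/(det2 v1 v3*det2 v0 v2)

section CrossRatio

variable {F : Type*} [Field F]

lemma det2_swap (v w : F × F) : det2 w v = -det2 v w := by unfold det2; ring

lemma det2_ne_swap {v w : F × F} (h : det2 v w ≠ 0) : det2 w v ≠ 0 := by
  rw [det2_swap]; exact neg_ne_zero.2 h

lemma det2_self (v : F × F) : det2 v v = 0 := by unfold det2; ring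

lemma plucker (v0 v1 v2 v3 : F × F) :
    det2 v0 v1*det2 v2 v3 - det2 v0 v2*det2 v1 v3 + det2 v0 v3*det2 v1 v2 = 0 := by
  unfold det2; ring

def Indep4 (v0 v1 v2 v3 : F × F) : Prop :=
  det2 v0 v1 ≠ 0 ∧ det2 v0 v2 ≠ 0 ∧ det2 v0 v3 ≠ 0 ∧ det2 v1 v2 ≠ 0 ∧ det2 v1 v3 ≠ 0 ∧ det2 v2 v3 ≠ 0

variable {v0 v1 v2 v3 v4 : F × F}

lemma crossRatio_ne_zero (h : Indep4 v0 v1 v2 v3) : crossRatio v0 v1 v2 v3 ≠ 0 :=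
  div_ne_zero (mul_ne_zero h.2.2.2.1 h.2.2.1) (mul_ne_zero h.2.2.2.2.1 h.2.1)

lemma one_sub_crossRatio (h : Indep4 v0 v1 v2 v3) : 1 - crossRatio v0 v1 v2 v3
    = det2 v0 v1*det2 v2 v3/(det2 v1 v3*det2 v0 v2) := by
  obtain ⟨_, h2, _, _, h5, _⟩ := h; unfold crossRatio
  rw [eq_div_iff (mul_ne_zero h5 h2), sub_mul, div_mul_cancel₀ _ (mul_ne_zero h5 h2)]
  linear_combination -plucker v0 v1 v2 v3

lemma crossRatio_ne_one (h : Indep4 v0 v1 v2 v3) : crossRatio v0 v1 v2 v3 ≠ 1 := by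
  intro e; have := one_sub_crossRatio h; rw [e, sub_self, eq_comm, div_eq_zero_iff] at this
  obtain ⟨h1, h2, h3, h4, h5, h6⟩ := h; grind

lemma crossRatio_swap01 : crossRatio v1 v0 v2 v3 = (crossRatio v0 v1 v2 v3)⁻¹ := by
  unfold crossRatio; rw [inv_div, mul_comm (det2 v0 v2), mul_comm (det2 v0 v3)]

lemma crossRatio_swap23 : crossRatio v0 v1 v3 v2 = (crossRatio v0 v1 v2 v3)⁻¹ := by
  unfold crossRatio; rw [inv_div]

lemma crossRatio_swap12 (h : Indep4 v0 v1 v2 v3) :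
    crossRatio v0 v2 v1 v3 = (1 - (crossRatio v0 v1 v2 v3)⁻¹)⁻¹ := by
  have h' : Indep4 v0 v1 v3 v2 := by
    obtain ⟨h1, h2, h3, h4, h5, h6⟩ := h
    exact ⟨h1, h3, h2, h5, h4, det2_ne_swap h6⟩
  rw [← crossRatio_swap23, one_sub_crossRatio h', inv_div]; unfold crossRatio
  rw [det2_swap v1 v2, det2_swap v2 v3, neg_mul, mul_neg, neg_div, div_neg, mul_comm (det2 v2 v3)]

lemma crossRatio_div (h : Indep4 v0 v1 v2 v3) (h4 : det2 v0 v4 ≠ 0) (h5 : det2 v1 v4 ≠ 0) :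
    crossRatio v0 v1 v2 v4/crossRatio v0 v1 v2 v3 = crossRatio v0 v1 v3 v4 := by
  obtain ⟨h1, h2, h3, h4, h5, h6⟩ := h; unfold crossRatio; field_simp

lemma crossRatio_one_sub_div (h : Indep4 v0 v1 v2 v3) (h' : Indep4 v0 v1 v2 v4) :
    (1 - crossRatio v0 v1 v2 v3)/(1 - crossRatio v0 v1 v2 v4) = crossRatio v1 v2 v3 v4 := by
  rw [one_sub_crossRatio h, one_sub_crossRatio h']; obtain ⟨h1, h2, h3, h4, h5, h6⟩ := h
  obtain ⟨_, _, h3', _, h5', h6'⟩ := h'; unfold crossRatio; field_simp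

lemma indep4_symm01 (h : Indep4 v0 v1 v2 v3) : Indep4 v1 v0 v2 v3 := by
  obtain ⟨h1, h2, h3, h4, h5, h6⟩ := h; exact ⟨det2_ne_swap h1, h4, h5, h2, h3, h6⟩

lemma crossRatio_one_sub_inv_div (h : Indep4 v0 v1 v2 v3) (h' : Indep4 v0 v1 v2 v4) :
    (1 - (crossRatio v0 v1 v2 v3)⁻¹)/(1 - (crossRatio v0 v1 v2 v4)⁻¹)
      = crossRatio v0 v2 v3 v4 := by
  rw [← crossRatio_swap01, ← crossRatio_swap01, crossRatio_one_sub_div (indep4_symm01 h) (indep4_symm01 h')]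

lemma crossRatio_std (x : F) : crossRatio (1, 0) (0, 1) (1, 1) (1, x) = x := by
  simp [crossRatio, det2]

end CrossRatio

section QuadraticField

variable (p : ℕ) [Fact p.Prime]

abbrev QF : Type := GaloisField p 2

instance : Fintype (QF p) := Fintype.ofFinite _

lemma card_QF : Fintype.card (QF p) = p^2 := by
  rw [← Nat.card_eq_fintype_card]; exact GaloisField.card p 2 two_ne_zero

def qfGen : (QF p)ˣ := (IsCyclic.exists_generator (α := (QF p)ˣ)).choose

lemma mem_zpowers_qfGen (x : (QF p)ˣ) : x ∈ Subgroup.zpowers (qfGen p) :=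
  (IsCyclic.exists_generator (α := (QF p)ˣ)).choose_spec x

lemma orderOf_qfGen : orderOf (qfGen p) = (p-1)*(p+1) := by
  rw [orderOf_eq_card_of_forall_mem_zpowers (mem_zpowers_qfGen p),
    Nat.card_units, GaloisField.card p 2 two_ne_zero, mul_comm, ← Nat.sq_sub_sq, one_pow]

lemma exists_qfGen_pow {x : QF p} (hx : x ≠ 0) : ∃ i : ℕ, (qfGen p : QF p)^i = x := by
  obtain ⟨i, hi⟩ := mem_powers_iff_mem_zpowers.2 (mem_zpowers_qfGen p (mk0 x hx))
  exact ⟨i, by simpa using congrArg Units.val hi⟩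

/-- The discrete logarithm modulo `p + 1`. -/
def qfLog (x : QF p) : ZMod (p+1) :=
  if h : ∃ i : ℕ, (qfGen p : QF p)^i = x then (h.choose : ZMod (p+1)) else 0

variable {p}

lemma qfLog_pow (i : ℕ) : qfLog p ((qfGen p : QF p)^i) = i := by
  have h : ∃ j : ℕ, (qfGen p : QF p)^j = (qfGen p : QF p)^i := ⟨i, rfl⟩; rw [qfLog, dif_pos h]
  have e := h.choose_spec; generalize h.choose = j at e
  rw [← val_pow_eq_pow_val, ← val_pow_eq_pow_val, val_inj, pow_eq_pow_iff_modEq, orderOf_qfGen] at e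
  exact (ZMod.natCast_eq_natCast_iff _ _ _).2 (e.of_mul_left _)

lemma qfLog_mul {x y : QF p} (hx : x ≠ 0) (hy : y ≠ 0) :
    qfLog p (x*y) = qfLog p x + qfLog p y := by
  obtain ⟨i, rfl⟩ := exists_qfGen_pow p hx; obtain ⟨j, rfl⟩ := exists_qfGen_pow p hy
  rw [← pow_add, qfLog_pow, qfLog_pow, qfLog_pow, Nat.cast_add]

lemma qfLog_eq_zero_iff {x : QF p} (hx : x ≠ 0) : qfLog p x = 0 ↔ x^p = x := by
  obtain ⟨i, rfl⟩ := exists_qfGen_pow p hx; have hp := (Fact.out : p.Prime).one_lt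
  rw [qfLog_pow, natCast_eq_zero_iff, ← pow_mul, ← val_pow_eq_pow_val,
    ← val_pow_eq_pow_val, val_inj, pow_eq_pow_iff_modEq, orderOf_qfGen,
    Nat.ModEq.comm, Nat.modEq_iff_dvd' (Nat.le_mul_of_pos_right _ (by omega)),
    show i*p - i = (p-1)*i by rw [Nat.sub_mul, one_mul, mul_comm],
    Nat.mul_dvd_mul_iff_left (by omega)]

lemma qf_charP_pow (t : ZMod p) : (algebraMap (ZMod p) (QF p) t)^p = algebraMap _ _ t := by
  rw [← map_pow, ZMod.pow_card]

lemma exists_of_pow_eq {x : QF p} (hx : x^p = x) : ∃ t : ZMod p, algebraMap _ (QF p) t = x := by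
  have := (Subfield.mem_bot_iff_pow_eq_self (QF p) p).2 hx
  rw [← ZMod.fieldRange_castHom_eq_bot p] at this; obtain ⟨t, ht⟩ := this
  exact ⟨t, by rw [← ht]; congr 1; exact Subsingleton.elim _ _⟩

lemma qfLog_algebraMap {t : ZMod p} (ht : t ≠ 0) : qfLog p (algebraMap _ (QF p) t) = 0 :=
  (qfLog_eq_zero_iff (by simpa using ht)).2 (qf_charP_pow t)

def linForm (τ : QF p) (v : V2 p) : QF p := algebraMap _ _ v.1 - algebraMap _ _ v.2*τ

variable (p) in
/-- The elements of the quadratic field not in the prime field. -/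
def nonReal : Finset (QF p) := univ.filter fun τ => τ^p ≠ τ

lemma mem_nonReal {τ : QF p} : τ ∈ nonReal p ↔ τ^p ≠ τ := by simp [nonReal]

lemma card_nonReal : (nonReal p).card = p^2 - p := by
  have h : (univ.filter fun τ : QF p => τ^p = τ) = univ.image (algebraMap (ZMod p) (QF p)) := by
    ext τ; simp only [mem_filter, mem_univ, true_and, mem_image]
    exact ⟨exists_of_pow_eq, by rintro ⟨t, rfl⟩; exact qf_charP_pow t⟩
  have h2 := Finset.card_filter_add_card_filter_not (s := (univ : Finset (QF p)))
    (fun τ => τ^p = τ)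
  rw [h, Finset.card_image_of_injective _ (algebraMap (ZMod p) (QF p)).injective, Finset.card_univ,
    ZMod.card, Finset.card_univ, card_QF] at h2
  unfold nonReal; simp only [ne_eq] at *; omega

lemma linForm_eq_zero {τ : QF p} (hτ : τ ∈ nonReal p) {v : V2 p} (h : linForm τ v = 0) : v = 0 := by
  rw [mem_nonReal] at hτ; unfold linForm at h; by_cases h2 : v.2 = 0
  · rw [h2, map_zero, zero_mul, sub_zero, map_eq_zero] at h; exact Prod.ext h h2
  · exfalso; apply hτ; have h2' : algebraMap (ZMod p) (QF p) v.2 ≠ 0 := by simpa using h2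
    have : τ = algebraMap _ _ (v.1/v.2) := by rw [map_div₀, eq_div_iff h2']; linear_combination -h
    rw [this]; exact qf_charP_pow _

lemma linForm_ne_zero {τ : QF p} (hτ : τ ∈ nonReal p) {v : V2 p} (hv : v ≠ 0) :
    linForm τ v ≠ 0 := fun h => hv (linForm_eq_zero hτ h)

lemma linForm_pow (τ : QF p) (v : V2 p) : linForm τ v^p = linForm (τ^p) v := by
  unfold linForm; rw [sub_pow_char, mul_pow, qf_charP_pow, qf_charP_pow]

lemma linForm_det (τ : QF p) (v w : V2 p) :
    linForm τ v*linForm τ w^p - linForm τ v^p*linForm τ w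
      = algebraMap _ _ (det2 v w)*(τ - τ^p) := by
  rw [linForm_pow, linForm_pow]; unfold linForm det2; grind

lemma linForm_comb (τ : QF p) (s t : ZMod p) (v w : V2 p) : linForm τ (s • v + t • w)
    = algebraMap _ _ s*linForm τ v + algebraMap _ _ t*linForm τ w := by
  unfold linForm; simp; ring

def qfPos (τ : QF p) (v : V2 p) : ZMod (p+1) := qfLog p (linForm τ v)

lemma qfPos_eq_iff {τ : QF p} (hτ : τ ∈ nonReal p) {v w : V2 p} (hv : v ≠ 0)
    (hw : w ≠ 0) : qfPos τ v = qfPos τ w ↔ det2 v w = 0 := by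
  have a := linForm_ne_zero hτ hv; have c := linForm_ne_zero hτ hw; have d := div_ne_zero a c
  have e : qfPos τ v = qfLog p (linForm τ v/linForm τ w) + qfPos τ w := by
    rw [qfPos, qfPos, ← qfLog_mul d c, div_mul_cancel₀ _ c]
  rw [e, add_eq_right, qfLog_eq_zero_iff d, div_pow, div_eq_div_iff (pow_ne_zero _ c) c, eq_comm,
    ← sub_eq_zero, linForm_det, mul_eq_zero, map_eq_zero]
  exact or_iff_left (sub_ne_zero.2 (mem_nonReal.1 hτ).symm)

lemma qfPos_smul {τ : QF p} (hτ : τ ∈ nonReal p) {v : V2 p} (hv : v ≠ 0) {t : ZMod p}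
    (ht : t ≠ 0) : qfPos τ (t • v) = qfPos τ v := by
  have : linForm τ (t • v) = algebraMap _ _ t*linForm τ v := by simpa using linForm_comb τ t 0 v v
  rw [qfPos, this, qfLog_mul (by simpa using ht) (linForm_ne_zero hτ hv), qfLog_algebraMap ht,
    zero_add, qfPos]

/-- Sums over all `τ` of translation invariant functions are invariant under linear changes of
coordinates. -/
lemma sum_nonReal_comp {A : Type*} [AddCommMonoid A] {w0 w1 : V2 p}
    (hw : det2 w0 w1 ≠ 0) (G : (V2 p → ZMod (p+1)) → A)
    (hG : ∀ a c t, (∀ v, v ≠ 0 → a v = c v + t) → G a = G c) :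
    ∑ τ ∈ nonReal p, G (fun v => qfPos τ (v.1 • w0 + v.2 • w1)) = ∑ τ ∈ nonReal p, G (qfPos τ) := by
  have n0 : w0 ≠ 0 := by rintro rfl; simp [det2] at hw
  set σ : QF p → QF p := fun τ => -(linForm τ w1/linForm τ w0) with hσ
  have maps : ∀ τ ∈ nonReal p, σ τ ∈ nonReal p := by
    intro τ hτ; have h0 := linForm_ne_zero hτ n0; rw [mem_nonReal]; intro h
    obtain ⟨t, ht⟩ := exists_of_pow_eq h; have := linForm_comb τ t 1 w0 w1; rw [ht, hσ] at this
    simp only [map_one, one_mul, neg_mul, div_mul_cancel₀ _ h0, neg_add_cancel] at this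
    have z := linForm_eq_zero hτ this; apply hw
    have : det2 w0 (t • w0 + (1 : ZMod p) • w1) = det2 w0 w1 := by simp [det2]; ring
    rw [← this, z]; simp [det2]
  have inj : Set.InjOn σ (nonReal p) := by
    intro τ hτ τ' hτ' h; have h0 := linForm_ne_zero hτ n0; have h0' := linForm_ne_zero hτ' n0
    simp only [hσ, neg_inj] at h; rw [div_eq_div_iff h0 h0'] at h
    have : algebraMap _ (QF p) (det2 w0 w1)*(τ - τ') = 0 := by
      unfold linForm at h; unfold det2; simp only [map_sub, map_mul]; linear_combination -h
    rcases mul_eq_zero.1 this with h | h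
    · simp_all
    · exact sub_eq_zero.1 h
  refine Finset.sum_nbij σ maps inj
    (Finset.surjOn_of_injOn_of_card_le σ maps inj le_rfl) fun τ hτ => ?_
  refine hG _ _ (qfLog p (linForm τ w0)) fun v hv => ?_
  have h0 := linForm_ne_zero hτ n0
  rw [qfPos, linForm_comb, qfPos, ← qfLog_mul (linForm_ne_zero (maps τ hτ) hv) h0]; congr 1
  have e : linForm (σ τ) v = algebraMap _ _ v.1 + algebraMap _ _ v.2*(linForm τ w1/linForm τ w0) := by
    rw [linForm, hσ]; ring
  grind

abbrev Quad (n : ℕ) (A : Type*) : Type _ := ZMod n → ZMod n → ZMod n → ZMod n → A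

def quadSum {A : Type*} [AddCommMonoid A] (F : Quad (p+1) A) (v0 v1 v2 v3 : V2 p) : A :=
  ∑ τ ∈ nonReal p, F (qfPos τ v0) (qfPos τ v1) (qfPos τ v2) (qfPos τ v3)

def Homog {A : Type*} {n : ℕ} (F : Quad n A) : Prop :=
  ∀ t x0 x1 x2 x3, F (x0+t) (x1+t) (x2+t) (x3+t) = F x0 x1 x2 x3

lemma quadSum_comp {A : Type*} [AddCommMonoid A] {F : Quad (p+1) A} (hF : Homog F)
    {w0 w1 : V2 p} (hw : det2 w0 w1 ≠ 0) {v0 v1 v2 v3 : V2 p}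
    (a0 a1 a2 a3 : V2 p) {t0 t1 t2 t3 : ZMod p} (k0 : t0 ≠ 0) (k1 : t1 ≠ 0) (k2 : t2 ≠ 0) (k3 : t3 ≠ 0)
    (e0 : v0 = t0 • (a0.1 • w0 + a0.2 • w1)) (e1 : v1 = t1 • (a1.1 • w0 + a1.2 • w1))
    (e2 : v2 = t2 • (a2.1 • w0 + a2.2 • w1)) (e3 : v3 = t3 • (a3.1 • w0 + a3.2 • w1))
    (h0 : a0 ≠ 0 := by simp) (h1 : a1 ≠ 0 := by simp) (h2 : a2 ≠ 0 := by simp)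
    (h3 : a3 ≠ 0 := by simp) : quadSum F v0 v1 v2 v3 = quadSum F a0 a1 a2 a3 := by
  have nz : ∀ a : V2 p, a ≠ 0 → a.1 • w0 + a.2 • w1 ≠ 0 := by
    intro a ha h; apply ha
    have d0 : det2 (a.1 • w0 + a.2 • w1) w1 = a.1*det2 w0 w1 := by simp [det2]; ring
    have d1 : det2 w0 (a.1 • w0 + a.2 • w1) = a.2*det2 w0 w1 := by simp [det2]; ring
    rw [h] at d0 d1
    exact Prod.ext ((mul_eq_zero.1 (d0.symm.trans (by simp [det2]))).resolve_right hw)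
      ((mul_eq_zero.1 (d1.symm.trans (by simp [det2]))).resolve_right hw)
  have := sum_nonReal_comp hw (fun a => F (a a0) (a a1) (a a2) (a a3)) (fun a c t h => by
    rw [h _ h0, h _ h1, h _ h2, h _ h3, hF])
  unfold quadSum; rw [← this]; refine sum_congr rfl fun τ hτ => ?_
  rw [e0, e1, e2, e3, qfPos_smul hτ (nz _ h0) k0, qfPos_smul hτ (nz _ h1) k1,
    qfPos_smul hτ (nz _ h2) k2, qfPos_smul hτ (nz _ h3) k3]

lemma exists_frame {F : Type*} [Field F] {v0 v1 v2 : F × F} (h01 : det2 v0 v1 ≠ 0)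
    (h02 : det2 v0 v2 ≠ 0) (h12 : det2 v1 v2 ≠ 0) :
    ∃ (w0 w1 : F × F) (s t : F), det2 w0 w1 ≠ 0 ∧ s ≠ 0 ∧ t ≠ 0 ∧ v0 = s • w0 ∧ v1 = t • w1 ∧
      v2 = w0 + w1 ∧ s = -(det2 v0 v1/det2 v1 v2) ∧ t = det2 v0 v1/det2 v0 v2 := by
  have hs : -(det2 v0 v1/det2 v1 v2) ≠ 0 := neg_ne_zero.2 (div_ne_zero h01 h12)
  have ht : det2 v0 v1/det2 v0 v2 ≠ 0 := div_ne_zero h01 h02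
  refine ⟨(-(det2 v0 v1/det2 v1 v2))⁻¹ • v0, (det2 v0 v1/det2 v0 v2)⁻¹ • v1, _, _, ?_, hs, ht,
    ?_, ?_, ?_, rfl, rfl⟩
  · have e : ∀ (s t : F) (v w : F × F), det2 (s • v) (t • w) = s*t*det2 v w := by
      intro s t v w; simp [det2]; ring
    grind
  · rw [smul_smul, mul_inv_cancel₀ hs, one_smul]
  · rw [smul_smul, mul_inv_cancel₀ ht, one_smul]
  · rw [inv_neg, inv_div, inv_div]
    refine Prod.ext ?_ ?_ <;>
      simp only [Prod.fst_add, Prod.smul_fst, Prod.snd_add, Prod.smul_snd, smul_eq_mul] <;>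
      field_simp <;> unfold det2 <;> ring

lemma quadSum_of_indep {A : Type*} [AddCommMonoid A] {F : Quad (p+1) A} (hF : Homog F)
    {v0 v1 v2 v3 : V2 p} (h : Indep4 v0 v1 v2 v3) : quadSum F v0 v1 v2 v3
      = quadSum F (1, 0) (0, 1) (1, 1) (1, crossRatio v0 v1 v2 v3) := by
  obtain ⟨h1, h2, h3, h4, h5, h6⟩ := h
  obtain ⟨w0, w1, s, t, hw, hs, ht, e0, e1, e2, es, et⟩ := exists_frame h1 h2 h4
  refine quadSum_comp hF hw (1, 0) (0, 1) (1, 1) (1, crossRatio v0 v1 v2 v3)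
    (t0 := s) (t1 := t) (t2 := 1) (t3 := det2 v1 v3/det2 v1 v2) hs ht
    one_ne_zero (div_ne_zero h5 h4) (by simpa using e0) (by simpa using e1) (by simpa using e2) ?_
  have e0' : w0 = s⁻¹ • v0 := by rw [e0, smul_smul, inv_mul_cancel₀ hs, one_smul]
  have e1' : w1 = t⁻¹ • v1 := by rw [e1, smul_smul, inv_mul_cancel₀ ht, one_smul]
  rw [e0', e1', es, et]; unfold crossRatio; rw [inv_neg, inv_div, inv_div]
  refine Prod.ext ?_ ?_ <;>
    simp only [Prod.fst_add, Prod.smul_fst, Prod.snd_add, Prod.smul_snd, smul_eq_mul] <;>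
    field_simp <;> unfold det2 <;> ring

end QuadraticField

namespace FinBloch

variable {W : Type*} [AddCommGroup W] [Module ZHalf W] {p : ℕ} [Fact p.Prime] {B : ZMod p → W} {C : W}

lemma card_smul (hB : FinBloch p B C) (x : ZMod p) : (p+1) • B x = 0 := by
  by_cases h0 : x = 0
  · rw [h0, hB.zero, smul_zero]
  by_cases h1 : x = 1
  · rw [h1, hB.one, smul_zero]
  have T : ∑ y, B y = 0 := by
    apply add_self_cancel
    have : ∑ y, B y = ∑ y, B y⁻¹ := sum_equiv (Equiv.inv _) _ _ (fun y => by simp)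
    nth_rewrite 1 [this]; rw [← sum_add_distrib]
    exact sum_eq_zero fun y _ => by rw [hB.inv, neg_add_cancel]
  have perm : ∀ e : ZMod p ≃ ZMod p, ∑ y, B (e y) = 0 := fun e => by rw [Equiv.sum_comp e B, T]
  have hx1 : 1 - x ≠ 0 := sub_ne_zero.2 (Ne.symm h1)
  have hx1' : 1 - x⁻¹ ≠ 0 := sub_ne_zero.2 fun h => h1 (inv_eq_one.1 h.symm)
  have p1 : ∑ y, B (y/x) = 0 := perm (Equiv.divRight₀ x h0)
  have p2 : ∑ y, B ((1-x)/(1-y)) = 0 := by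
    simp only [div_eq_mul_inv]
    exact perm (((Equiv.subLeft (1 : ZMod p)).trans (Equiv.inv _)).trans (Equiv.mulLeft₀ _ hx1))
  have p3 : ∑ y, B ((1 - x⁻¹)/(1 - y⁻¹)) = 0 := by
    simp only [div_eq_mul_inv]
    exact perm ((((Equiv.inv (ZMod p)).trans (Equiv.subLeft (1 : ZMod p))).trans
      (Equiv.inv _)).trans (Equiv.mulLeft₀ _ hx1'))
  set E : ZMod p → W := fun y => B x - B y + B (y/x) - B ((1 - x⁻¹)/(1 - y⁻¹))
    + B ((1-x)/(1-y)) with hE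
  have s1 : ∑ y, E y = p • B x := by
    rw [hE]; simp only [sum_add_distrib, sum_sub_distrib]; simp_all
  have s2 : ∑ y, E y = -B x := by
    have : ∑ y, E y = ∑ y ∈ ({0, 1, x} : Finset (ZMod p)), E y := by
      refine (Finset.sum_subset (Finset.subset_univ _) fun y _ hy => ?_).symm
      simp only [mem_insert, Finset.mem_singleton, not_or] at hy
      exact hB.five x y h0 h1 hy.1 hy.2.1 (Ne.symm hy.2.2)
    rw [this, Finset.sum_insert (by simp [Ne.symm h0]), Finset.sum_insert (by simp [Ne.symm h1]),
      Finset.sum_singleton, hE]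
    simp only [zero_div, inv_zero, sub_zero, div_one, inv_one, sub_self, div_zero, hB.zero, hB.one,
      div_self h0, div_self hx1, div_self hx1', one_div, hB.inv, hB.one_sub x h0 h1,
      hB.one_sub x⁻¹ (inv_ne_zero h0) (fun h => h1 (inv_eq_one.1 h))]
    abel
  rw [add_smul, one_smul, ← s1, s2, neg_add_cancel]

/-- The number of carries attached to the cross ratio `x`. -/
def carryCount (x : ZMod p) : ℕ :=
  quadSum (fun x0 x1 x2 x3 => carry (x1-x0) (x2-x1)*(x3-x2).val) (1, 0) (0, 1) (1, 1) (1, x)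

lemma exists_point (τ : QF p) (hτ : τ ∈ nonReal p) (m : ZMod (p+1)) :
    ∃ v : V2 p, v ≠ 0 ∧ linForm τ v = (qfGen p : QF p)^m.val := by
  have inj : Function.Injective (linForm τ) := by
    intro v w h; have := linForm_comb τ 1 (-1) v w
    simp only [one_smul, neg_smul, ← sub_eq_add_neg, h] at this
    exact sub_eq_zero.1 (linForm_eq_zero hτ (this.trans (by simp)))
  have bij := (Fintype.bijective_iff_injective_and_card (linForm τ)).2 ⟨inj, by
    rw [card_QF, Fintype.card_prod, ZMod.card, sq]⟩
  obtain ⟨v, hv⟩ := bij.2 ((qfGen p : QF p)^m.val); refine ⟨v, ?_, hv⟩; rintro rfl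
  simpa [linForm] using hv.symm

end FinBloch

lemma quadExt_comp {X W : Type*} [AddCommGroup W] {c : X → X → X → X → W} {C : W} {f : X → X}
    (hf : Function.Injective f)
    (hc : ∀ x0 x1 x2 x3, c (f x0) (f x1) (f x2) (f x3) = c x0 x1 x2 x3) (x0 x1 x2 x3 : X) :
    quadExt c C (f x0) (f x1) (f x2) (f x3) = quadExt c C x0 x1 x2 x3 := by
  simp only [quadExt, hf.eq_iff, hc]

section QuadraticField

variable {p : ℕ} [Fact p.Prime]

/-- The cross ratio of four lines in the quadratic field. -/
def qfCross (x0 x1 x2 x3 : QF p) : QF p :=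
  (x1*x2^p - x1^p*x2)*(x0*x3^p - x0^p*x3) /
    ((x1*x3^p - x1^p*x3)*(x0*x2^p - x0^p*x2))

lemma algebraMap_crossRatio {τ : QF p} (hτ : τ ∈ nonReal p) (v0 v1 v2 v3 : V2 p) :
    algebraMap _ (QF p) (crossRatio v0 v1 v2 v3)
      = qfCross (linForm τ v0) (linForm τ v1) (linForm τ v2) (linForm τ v3) := by
  have h : τ - τ^p ≠ 0 := sub_ne_zero.2 (mem_nonReal.1 hτ).symm; unfold qfCross crossRatio
  rw [linForm_det, linForm_det, linForm_det, linForm_det, map_div₀, map_mul, map_mul,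
    mul_mul_mul_comm, mul_mul_mul_comm (algebraMap _ (QF p) (det2 v1 v3)),
    mul_div_mul_right _ _ (mul_ne_zero h h)]

lemma exists_scalar {x y : QF p} (hx : x ≠ 0) (hy : y ≠ 0) (h : qfLog p x = qfLog p y) :
    ∃ t : ZMod p, t ≠ 0 ∧ x = algebraMap _ _ t*y := by
  have hd := div_ne_zero hx hy
  have : qfLog p (x/y) = 0 := by
    have := qfLog_mul hd hy; rw [div_mul_cancel₀ _ hy, h] at this
    exact left_eq_add.1 (this.trans (add_comm _ _))
  obtain ⟨t, ht⟩ := exists_of_pow_eq ((qfLog_eq_zero_iff hd).1 this)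
  refine ⟨t, ?_, by rw [ht, div_mul_cancel₀ _ hy]⟩; rintro rfl; rw [map_zero] at ht
  exact hd ht.symm

lemma qfCross_congr {x0 x1 x2 x3 y0 y1 y2 y3 u : QF p} (hu : u ≠ 0) (hx0 : x0 ≠ 0)
    (hx1 : x1 ≠ 0) (hx2 : x2 ≠ 0) (hx3 : x3 ≠ 0) (hy0 : y0 ≠ 0)
    (hy1 : y1 ≠ 0) (hy2 : y2 ≠ 0) (hy3 : y3 ≠ 0) (h0 : qfLog p x0 = qfLog p (u*y0))
    (h1 : qfLog p x1 = qfLog p (u*y1)) (h2 : qfLog p x2 = qfLog p (u*y2))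
    (h3 : qfLog p x3 = qfLog p (u*y3)) : qfCross x0 x1 x2 x3 = qfCross y0 y1 y2 y3 := by
  obtain ⟨t0, k0, e0⟩ := exists_scalar hx0 (mul_ne_zero hu hy0) h0
  obtain ⟨t1, k1, e1⟩ := exists_scalar hx1 (mul_ne_zero hu hy1) h1
  obtain ⟨t2, k2, e2⟩ := exists_scalar hx2 (mul_ne_zero hu hy2) h2
  obtain ⟨t3, k3, e3⟩ := exists_scalar hx3 (mul_ne_zero hu hy3) h3
  have E : ∀ (s t : ZMod p) (x y : QF p), (algebraMap _ _ s*(u*x))*(algebraMap _ _ t*(u*y))^p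
      - (algebraMap _ _ s*(u*x))^p*(algebraMap _ _ t*(u*y))
      = algebraMap _ _ s*algebraMap _ _ t*(u*u^p)*(x*y^p - x^p*y) := by
    intro s t x y; rw [mul_pow, mul_pow, mul_pow, mul_pow, qf_charP_pow, qf_charP_pow]; ring
  have nz : ∀ {t : ZMod p}, t ≠ 0 → algebraMap _ (QF p) t ≠ 0 := fun h => by simpa using h
  have hK : algebraMap _ (QF p) t0*algebraMap _ (QF p) t1*algebraMap _ (QF p) t2
      * algebraMap _ (QF p) t3*(u*u^p)*(u*u^p) ≠ 0 :=
    mul_ne_zero (mul_ne_zero (mul_ne_zero (mul_ne_zero (mul_ne_zero (nz k0) (nz k1)) (nz k2)) (nz k3))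
      (mul_ne_zero hu (pow_ne_zero _ hu))) (mul_ne_zero hu (pow_ne_zero _ hu))
  unfold qfCross; rw [e0, e1, e2, e3, E, E, E, E, eq_comm, ← mul_div_mul_left _ _ hK]
  congr 1 <;> ring

lemma qfPos_zero_ne {τ : QF p} (hτ : τ ∈ nonReal p) {v w : V2 p} (h : det2 v w ≠ 0) :
    qfPos τ v ≠ qfPos τ w := by
  have hv : v ≠ 0 := by rintro rfl; simp [det2] at h
  have hw : w ≠ 0 := by rintro rfl; simp [det2] at h
  rwa [ne_eq, qfPos_eq_iff hτ hv hw]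

lemma nonReal_nonempty : (nonReal p).Nonempty := by
  rw [← Finset.card_pos, card_nonReal]; have := (Fact.out : p.Prime).two_le; rw [sq]
  exact Nat.sub_pos_of_lt (by nlinarith)

lemma quadSum_triple {A : Type*} [AddCommMonoid A] {F : Quad (p+1) A} (hF : Homog F)
    {v0 v1 v2 : V2 p} (h01 : det2 v0 v1 ≠ 0) (h02 : det2 v0 v2 ≠ 0) (h12 : det2 v1 v2 ≠ 0) :
    quadSum F v0 v1 v2 v0 = quadSum F (1, 0) (0, 1) (1, 1) (1, 0) ∧
    quadSum F v0 v1 v0 v2 = quadSum F (1, 0) (0, 1) (1, 0) (1, 1) ∧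
    quadSum F v0 v1 v2 v1 = quadSum F (1, 0) (0, 1) (1, 1) (0, 1) ∧
    quadSum F v0 v1 v0 v1 = quadSum F (1, 0) (0, 1) (1, 0) (0, 1) := by
  obtain ⟨w0, w1, s, t, hw, hs, ht, e0, e1, e2, -, -⟩ := exists_frame h01 h02 h12
  have e0' : v0 = s • ((1 : ZMod p) • w0 + (0 : ZMod p) • w1) := by simpa using e0
  have e1' : v1 = t • ((0 : ZMod p) • w0 + (1 : ZMod p) • w1) := by simpa using e1
  have e2' : v2 = (1 : ZMod p) • ((1 : ZMod p) • w0 + (1 : ZMod p) • w1) := by simpa using e2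
  refine ⟨?_, ?_, ?_, ?_⟩
  · exact quadSum_comp hF hw (1, 0) (0, 1) (1, 1) (1, 0)  hs ht one_ne_zero hs e0' e1' e2' e0'
  · exact quadSum_comp hF hw (1, 0) (0, 1) (1, 0) (1, 1)  hs ht hs one_ne_zero e0' e1' e0' e2'
  · exact quadSum_comp hF hw (1, 0) (0, 1) (1, 1) (0, 1)  hs ht one_ne_zero ht e0' e1' e2' e1'
  · exact quadSum_comp hF hw (1, 0) (0, 1) (1, 0) (0, 1)  hs ht hs ht e0' e1' e0' e1'

lemma indep4_std {F : Type*} [Field F] {x : F} (h0 : x ≠ 0) (h1 : x ≠ 1) :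
    Indep4 ((1, 0) : F × F) (0, 1) (1, 1) (1, x) := by
  refine ⟨?_, ?_, ?_, ?_, ?_, ?_⟩ <;> simp [det2, h0, sub_eq_zero, h1]

end QuadraticField

namespace FinBloch

variable {p : ℕ} [Fact p.Prime]

/-- A solution of the five-term relation over a prime field is, up to the factor two, a multiple of
the count of carries. -/
lemma exists_generator {W : Type*} [AddCommGroup W] [Module ZHalf W] {B : ZMod p → W} {C : W}
    (hB : FinBloch p B C) : ∃ ζ : W, (p+1) • ζ = 0 ∧
      ∀ x, x ≠ 0 → x ≠ 1 → B x + B x = carryCount x • ζ := by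
  obtain ⟨θ, hθ⟩ := nonReal_nonempty (p := p)
  choose P hP0 hP using exists_point θ hθ
  have pos : ∀ m, qfPos θ (P m) = m := fun m => by rw [qfPos, hP, qfLog_pow, natCast_zmod_val]
  have ind : ∀ {m m' : ZMod (p+1)}, m ≠ m' → det2 (P m) (P m') ≠ 0 := by
    intro m m' h h'; rw [← qfPos_eq_iff hθ (hP0 _) (hP0 _), pos, pos] at h'; exact h h'
  have ind4 : ∀ {m0 m1 m2 m3}, Distinct4 m0 m1 m2 m3 → Indep4 (P m0) (P m1) (P m2) (P m3) := by
    rintro m0 m1 m2 m3 ⟨h1, h2, h3, h4, h5, h6⟩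
    exact ⟨ind h1, ind h2, ind h3, ind h4, ind h5, ind h6⟩
  have nz := fun m => linForm_ne_zero hθ (hP0 m)
  set c : Quad (p+1) W := fun m0 m1 m2 m3 => B (crossRatio (P m0) (P m1) (P m2) (P m3)) with hc
  have key : ∀ τ ∈ nonReal p, ∀ v0 v1 v2 v3 : V2 p, v0 ≠ 0 → v1 ≠ 0 → v2 ≠ 0 → v3 ≠ 0 →
      c (qfPos τ v0) (qfPos τ v1) (qfPos τ v2) (qfPos τ v3) = B (crossRatio v0 v1 v2 v3) := by
    intro τ hτ v0 v1 v2 v3 h0 h1 h2 h3; simp only [hc]; congr 1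
    apply (algebraMap (ZMod p) (QF p)).injective
    rw [algebraMap_crossRatio hθ, algebraMap_crossRatio hτ]
    refine qfCross_congr one_ne_zero (nz _) (nz _) (nz _)
      (nz _) (linForm_ne_zero hτ h0) (linForm_ne_zero hτ h1) (linForm_ne_zero hτ h2) (linForm_ne_zero hτ h3) ?_ ?_ ?_ ?_ <;>
      rw [one_mul] <;> exact pos _
  have trans : ∀ t m0 m1 m2 m3, c (m0+t) (m1+t) (m2+t) (m3+t) = c m0 m1 m2 m3 := by
    intro t m0 m1 m2 m3; simp only [hc]; congr 1; apply (algebraMap (ZMod p) (QF p)).injective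
    rw [algebraMap_crossRatio hθ, algebraMap_crossRatio hθ]
    have hu : ((qfGen p : QF p))^t.val ≠ 0 := pow_ne_zero _ (qfGen p).ne_zero
    have e : ∀ m, qfLog p (linForm θ (P (m+t))) = qfLog p ((qfGen p : QF p)^t.val*linForm θ (P m)) := by
      intro m; rw [qfLog_mul hu (nz _), qfLog_pow, natCast_zmod_val]
      exact (pos _).trans (by rw [add_comm m t]; congr 1; exact (pos m).symm)
    exact qfCross_congr hu (nz _) (nz _) (nz _) (nz _) (nz _) (nz _) (nz _)
      (nz _) (e _) (e _) (e _) (e _)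
  set ce := quadExt c (-C) with hce
  have cocycle : ∀ m0 m1 m2 m3 m4, cobdry ce m0 m1 m2 m3 m4 = 0 := by
    refine cobdry_quadExt (by rw [← neg_eq_zero, ← hB.three]; abel) ?_ ?_ ?_ ?_
    · intro m0 m1 m2 m3 h; simp only [hc]; rw [crossRatio_swap01, hB.inv]
    · intro m0 m1 m2 m3 h; have h' := ind4 h; simp only [hc]
      rw [crossRatio_swap12 h', hB.inv, hB.one_sub, hB.inv]
      · abel
      · exact inv_ne_zero (crossRatio_ne_zero h')
      · exact fun e => crossRatio_ne_one h' (inv_eq_one.1 e)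
    · intro m0 m1 m2 m3 h; simp only [hc]; rw [crossRatio_swap23, hB.inv]
    · rintro m0 m1 m2 m3 m4 ⟨h1, h2, h3, h4, h5, h6⟩ g0 g1 g2 g3
      have i3 := ind4 (m0 := m0) (m1 := m1) (m2 := m2) (m3 := m3) ⟨h1, h2, h3, h4, h5, h6⟩
      have i4 := ind4 (m0 := m0) (m1 := m1) (m2 := m2) (m3 := m4) ⟨h1, h2, g0, h4, g1, g2⟩
      have i5 := ind4 (m0 := m0) (m1 := m1) (m2 := m3) (m3 := m4) ⟨h1, h3, g0, h5, g1, g3⟩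
      have := hB.five _ _ (crossRatio_ne_zero i3) (crossRatio_ne_one i3) (crossRatio_ne_zero i4)
        (crossRatio_ne_one i4) (fun e => by
          have d := crossRatio_div i3 (ind g0) (ind g1)
          rw [← e, div_self (crossRatio_ne_zero i3)] at d
          exact crossRatio_ne_one i5 d.symm)
      rw [crossRatio_div i3 (ind g0) (ind g1), crossRatio_one_sub_div i3 i4,
        crossRatio_one_sub_inv_div i3 i4] at this
      unfold cobdry; simp only [hc]; rw [← this]; abel
  have transe : Homog ce := by
    intro t m0 m1 m2 m3
    exact quadExt_comp (f := fun m => m + t) (add_left_injective t) (trans t) m0 m1 m2 m3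
  obtain ⟨ζ, b, hζ, hb, hdec⟩ := exists_cyclic_decomposition cocycle transe
    (fun x y z => by simp [hce, quadExt])
  refine ⟨ζ, hζ, fun x hx0 hx1 => ?_⟩; have hi := indep4_std hx0 hx1; set v0 : V2 p := (1, 0)
  set v1 : V2 p := (0, 1); set v2 : V2 p := (1, 1); set v3 : V2 p := (1, x) with hv3
  have hcr : crossRatio v0 v1 v2 v3 = x := crossRatio_std x; obtain ⟨i1, i2, i3, i4, i5, i6⟩ := hi
  have hconst : ∀ {u0 u1 u2 : V2 p}, det2 u0 u1 ≠ 0 → det2 u0 u2 ≠ 0 → det2 u1 u2 ≠ 0 →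
      ∑ τ ∈ nonReal p, b (qfPos τ u0) (qfPos τ u1) (qfPos τ u2)
        = quadSum (fun x0 x1 x2 _ => b x0 x1 x2) (1, 0) (0, 1) (1, 1) (1, 0) := by
    intro u0 u1 u2 h01 h02 h12
    exact (quadSum_triple (F := fun x0 x1 x2 _ => b x0 x1 x2) (fun t x0 x1 x2 _ => hb t x0 x1 x2)
      h01 h02 h12).1
  have hsum : ∑ τ ∈ nonReal p, ce (qfPos τ v0) (qfPos τ v1) (qfPos τ v2) (qfPos τ v3)
      = (p^2 - p) • B x := by
    rw [← card_nonReal, ← Finset.sum_const]; refine sum_congr rfl fun τ hτ => ?_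
    rw [hce, quadExt_of_distinct ⟨qfPos_zero_ne hτ i1, qfPos_zero_ne hτ i2, qfPos_zero_ne hτ i3,
      qfPos_zero_ne hτ i4, qfPos_zero_ne hτ i5, qfPos_zero_ne hτ i6⟩,
      key τ hτ _ _ _ _ (by simp [v0]) (by simp [v1]) (by simp [v2]) (by simp [v3]), hcr]
  simp only [hdec, sum_sub_distrib, sum_add_distrib] at hsum
  rw [hconst i4 i5 i6, hconst i2 i3 i6, hconst i1 i3 i5, hconst i1 i2 i4, ← Finset.sum_smul] at hsum
  have hn := hB.card_smul x; have hp2 := (Fact.out : p.Prime).two_le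
  have e : p^2 - p = (p-2)*(p+1) + 2 := by
    obtain ⟨k, rfl⟩ : ∃ k, p = k + 2 := ⟨p - 2, by omega⟩; rw [Nat.add_sub_cancel]
    apply Nat.sub_eq_of_eq_add; ring
  rw [e, add_smul, mul_smul, hn, smul_zero, zero_add, two_smul] at hsum; rw [← hsum]
  unfold carryCount quadSum; abel

end FinBloch

section OddPart

lemma oddPart_dvd (m : ℕ) : oddPart m ∣ m :=
  ⟨2^m.factorization 2, (Nat.div_mul_cancel (Nat.ordProj_dvd m 2)).symm⟩

lemma coprime_two_oddPart {m : ℕ} (hm : m ≠ 0) : Nat.Coprime 2 (oddPart m) :=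
  Nat.coprime_ordCompl Nat.prime_two hm

lemma zmod_isUnit_two {m : ℕ} (h : Nat.Coprime 2 m) : IsUnit (2 : ZMod m) := by
  have := (ZMod.unitOfCoprime 2 h).isUnit; simpa using this

lemma zmod_add_self {m : ℕ} (h : Nat.Coprime 2 m) {w : ZMod m} (hw : w + w = 0) : w = 0 := by
  simp_all

/-- `ℤ[1/2]` acts on finite cyclic groups of odd order. -/
def zhalfToZMod {m : ℕ} (h : Nat.Coprime 2 m) : ZHalf →+* ZMod m :=
  (IsLocalization.Away.lift (2 : ℤ) (g := Int.castRingHom (ZMod m))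
    (by simpa using zmod_isUnit_two h)).comp zhalfEquiv.toRingHom

instance zmodOddPartModule (m : ℕ) : Module ZHalf (ZMod (oddPart (m+1))) :=
  Module.compHom _ (zhalfToZMod (coprime_two_oddPart m.succ_ne_zero))

end OddPart

namespace FinBloch

variable {p : ℕ} [Fact p.Prime]

lemma homog_carryCocycle {n : ℕ} [NeZero n] : Homog (carryCocycle (n := n)) := by
  intro t x0 x1 x2 x3; simp [carryCocycle]

lemma carry_zero_left {n : ℕ} [NeZero n] (k : ZMod n) : carry 0 k = 0 := by
  rw [carry, ZMod.val_zero, zero_add, Nat.div_eq_of_lt k.val_lt]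

lemma carry_zero_right {n : ℕ} [NeZero n] (k : ZMod n) : carry k 0 = 0 := by
  rw [carry, ZMod.val_zero, add_zero, Nat.div_eq_of_lt k.val_lt]

def planeCocycle (v0 v1 v2 v3 : V2 p) : ZMod (oddPart (p+1)) :=
  ZMod.castHom (oddPart_dvd (p+1)) _ (quadSum carryCocycle v0 v1 v2 v3)

lemma cobdry_planeCocycle (v0 v1 v2 v3 v4 : V2 p) : cobdry planeCocycle v0 v1 v2 v3 v4 = 0 := by
  unfold cobdry planeCocycle; simp only [← map_add, ← map_sub]; unfold quadSum
  simp only [← sum_add_distrib, ← sum_sub_distrib]; rw [sum_eq_zero, map_zero]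
  exact fun τ _ => cobdry_carryCocycle _ _ _ _ _

lemma planeCocycle_left (v w u : V2 p) : planeCocycle v v w u = 0 := by
  simp [planeCocycle, quadSum, carryCocycle, carry_zero_left]

lemma planeCocycle_mid (v w u : V2 p) : planeCocycle v w w u = 0 := by
  simp [planeCocycle, quadSum, carryCocycle, carry_zero_right]

lemma planeCocycle_right (v w u : V2 p) : planeCocycle v w u u = 0 := by
  simp [planeCocycle, quadSum, carryCocycle]

def planeConst (p : ℕ) [Fact p.Prime] : ZMod (oddPart (p+1)) :=
  planeCocycle ((1, 0) : V2 p) (0, 1) (1, 1) (1, 0)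

variable {v0 v1 v2 v3 : V2 p}

lemma planeCocycle_cyc (h01 : det2 v0 v1 ≠ 0) (h02 : det2 v0 v2 ≠ 0) (h12 : det2 v1 v2 ≠ 0) :
    planeCocycle v0 v1 v2 v0 = planeConst p := by
  rw [planeCocycle, (quadSum_triple homog_carryCocycle h01 h02 h12).1]; rfl

lemma planeCocycle_alt_zero (h01 : det2 v0 v1 ≠ 0) : planeCocycle v0 v1 v0 v1 = 0 := by
  apply zmod_add_self (coprime_two_oddPart p.succ_ne_zero)
  have e : ∀ {v0 v1 : V2 p}, det2 v0 v1 ≠ 0 → planeCocycle v0 v1 v0 v1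
      = planeCocycle (1, 0) (0, 1) (1, 0) (0, 1) := by
    intro v0 v1 h
    have := (quadSum_triple (homog_carryCocycle (n := p + 1)) h (v2 := v0 + v1)
      (by have : det2 v0 (v0+v1) = det2 v0 v1 := by simp [det2]; ring
          rwa [this])
      (by have : det2 v1 (v0+v1) = -det2 v0 v1 := by simp [det2]; ring
          grind)).2.2.2
    rw [planeCocycle, this]; rfl
  have h := cobdry_planeCocycle v0 v1 v0 v1 v0; unfold cobdry at h
  rw [planeCocycle_left, planeCocycle_mid, planeCocycle_right, e h01,
    e (det2_ne_swap h01)] at h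
  rw [e h01, ← h]; ring

lemma planeCocycle_bd (h01 : det2 v0 v1 ≠ 0) (h02 : det2 v0 v2 ≠ 0) (h12 : det2 v1 v2 ≠ 0) :
    planeCocycle v0 v1 v0 v2 + planeCocycle v1 v0 v2 v0 = -planeConst p := by
  have h := cobdry_planeCocycle v0 v1 v0 v2 v0; unfold cobdry at h
  rw [planeCocycle_left, planeCocycle_right, planeCocycle_cyc h01 h02 h12] at h
  linear_combination h

lemma planeCocycle_b (h01 : det2 v0 v1 ≠ 0) (h02 : det2 v0 v2 ≠ 0) (h12 : det2 v1 v2 ≠ 0) :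
    planeCocycle v0 v1 v0 v2 = planeCocycle ((1, 0) : V2 p) (0, 1) (1, 0) (1, 1) := by
  rw [planeCocycle, (quadSum_triple homog_carryCocycle h01 h02 h12).2.1]; rfl

lemma planeCocycle_d (h01 : det2 v0 v1 ≠ 0) (h02 : det2 v0 v2 ≠ 0) (h12 : det2 v1 v2 ≠ 0) :
    planeCocycle v0 v1 v2 v1 = planeCocycle ((1, 0) : V2 p) (0, 1) (1, 1) (0, 1) := by
  rw [planeCocycle, (quadSum_triple homog_carryCocycle h01 h02 h12).2.2.1]; rfl

lemma planeConst_eq : planeCocycle ((1, 0) : V2 p) (0, 1) (1, 0) (1, 1)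
    + planeCocycle ((1, 0) : V2 p) (0, 1) (1, 1) (0, 1) = -planeConst p := by
  rw [← planeCocycle_bd (p := p) (v0 := (1, 0)) (v1 := (0, 1)) (v2 := (1, 1)) (by simp [det2])
    (by simp [det2]) (by simp [det2]), planeCocycle_d (v0 := (0, 1)) (v1 := (1, 0)) (v2 := (1, 1))
    (by simp [det2]) (by simp [det2]) (by simp [det2])]

lemma planeConst_three : planeConst p + planeConst p + planeConst p = 0 := by
  have i1 : det2 ((1, 0) : V2 p) (0, 1) ≠ 0 := by simp [det2]
  have i2 : det2 ((1, 0) : V2 p) (1, 1) ≠ 0 := by simp [det2]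
  have i3 : det2 ((0, 1) : V2 p) (1, 1) ≠ 0 := by simp [det2]
  have h := cobdry_planeCocycle ((1, 0) : V2 p) (0, 1) (1, 1) (1, 0) (0, 1); unfold cobdry at h
  rw [planeCocycle_cyc i1 i2 i3, planeCocycle_cyc i3 (det2_ne_swap i1) (det2_ne_swap i2), planeCocycle_alt_zero i1,
    planeCocycle_b i2 i1 (det2_ne_swap i3)] at h
  linear_combination h + planeConst_eq (p := p)

lemma planeCocycle_swap01 (h : Indep4 v0 v1 v2 v3) :
    planeCocycle v1 v0 v2 v3 = -planeCocycle v0 v1 v2 v3 := by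
  obtain ⟨h1, h2, h3, h4, h5, h6⟩ := h; have h := cobdry_planeCocycle v0 v1 v0 v2 v3
  unfold cobdry at h; rw [planeCocycle_left, planeCocycle_b h1 h3 h5, planeCocycle_b h1 h2 h4] at h
  linear_combination h

lemma planeCocycle_swap12 (h : Indep4 v0 v1 v2 v3) :
    planeCocycle v0 v2 v1 v3 = -planeConst p - planeCocycle v0 v1 v2 v3 := by
  obtain ⟨h1, h2, h3, h4, h5, h6⟩ := h; have h := cobdry_planeCocycle v0 v1 v2 v1 v3
  unfold cobdry at h; rw [planeCocycle_mid, planeCocycle_b h4 h5 h6, planeCocycle_d h1 h2 h4] at h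
  linear_combination -h + planeConst_eq (p := p)

lemma planeCocycle_eq (h : Indep4 v0 v1 v2 v3) : planeCocycle v0 v1 v2 v3
    = planeCocycle (1, 0) (0, 1) (1, 1) (1, crossRatio v0 v1 v2 v3) := by
  rw [planeCocycle, quadSum_of_indep homog_carryCocycle h]; rfl

/-- The finite dilogarithm of a prime field. -/
def finDilog (x : ZMod p) : ZMod (oddPart (p+1)) :=
  if x = 0 then 0 else planeCocycle (1, 0) (0, 1) (1, 1) (1, x)

lemma finDilog_crossRatio (h : Indep4 v0 v1 v2 v3) :
    finDilog (crossRatio v0 v1 v2 v3) = planeCocycle v0 v1 v2 v3 := by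
  rw [finDilog, if_neg (crossRatio_ne_zero h), planeCocycle_eq h]

lemma finBloch_finDilog : FinBloch p (finDilog (p := p)) (planeConst p) := by
  have inv : ∀ x : ZMod p, finDilog x⁻¹ = -finDilog x := by
    intro x; by_cases h0 : x = 0
    · simp [h0, finDilog]
    by_cases h1 : x = 1
    · simp [h1, finDilog, planeCocycle_right]
    have hi := indep4_std h0 h1; have := finDilog_crossRatio (indep4_symm01 hi)
    rw [crossRatio_swap01, crossRatio_std, planeCocycle_swap01 hi, ← finDilog_crossRatio hi,
      crossRatio_std] at this
    exact this
  refine ⟨by simp [finDilog], by simp [finDilog, planeCocycle_right], ?_, inv, ?_, planeConst_three⟩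
  · intro x y hx hx1 hy hy1 hxy; have i3 := indep4_std hx hx1; have i4 := indep4_std hy hy1
    have d34 : det2 ((1, x) : V2 p) (1, y) ≠ 0 := by
      simp only [det2, one_mul]; exact sub_ne_zero.2 hxy.symm
    have h := cobdry_planeCocycle ((1, 0) : V2 p) (0, 1) (1, 1) (1, x) (1, y); unfold cobdry at h
    rw [← finDilog_crossRatio i3, ← finDilog_crossRatio i4] at h; have c3 := crossRatio_std x
    have c4 := crossRatio_std y; have e1 := crossRatio_div i3 i4.2.2.1 i4.2.2.2.2.1
    have e2 := crossRatio_one_sub_div i3 i4; have e3 := crossRatio_one_sub_inv_div i3 i4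
    obtain ⟨a1, a2, a3, a4, a5, a6⟩ := i3; obtain ⟨b1, b2, b3, b4, b5, b6⟩ := i4
    rw [← finDilog_crossRatio ⟨a4, a5, b5, a6, b6, d34⟩,
      ← finDilog_crossRatio ⟨a2, a3, b3, a6, b6, d34⟩,
      ← finDilog_crossRatio ⟨a1, a3, b3, a5, b5, d34⟩, ← e1, ← e2, ← e3, c3, c4] at h
    rw [← h]; ring
  · have key : ∀ x : ZMod p, x ≠ 0 → x ≠ 1 → finDilog (1 - x⁻¹) = planeConst p + finDilog x := by
      intro x h0 h1; have hi := indep4_std h0 h1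
      have hi' : Indep4 ((1, 0) : V2 p) (1, 1) (0, 1) (1, x) := by
        obtain ⟨a1, a2, a3, a4, a5, a6⟩ := hi
        exact ⟨a2, a1, a3, det2_ne_swap a4, a6, a5⟩
      have := finDilog_crossRatio hi'
      rw [crossRatio_swap12 hi, crossRatio_std, planeCocycle_swap12 hi, ← finDilog_crossRatio hi,
        crossRatio_std, inv] at this
      linear_combination -this
    intro x h0 h1; have := key x⁻¹ (inv_ne_zero h0) (fun h => h1 (inv_eq_one.1 h)); grind

lemma cast_carryCount {x : ZMod p} (hx : x ≠ 0) :
    ((carryCount x : ℕ) : ZMod (oddPart (p+1))) = finDilog x := by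
  rw [finDilog, if_neg hx, planeCocycle, ← map_natCast (ZMod.castHom (oddPart_dvd (p+1)) _)]
  congr 1; unfold carryCount quadSum; push_cast; refine sum_congr rfl fun τ _ => ?_
  rw [carryCocycle, natCast_zmod_val]

end FinBloch

namespace FinBloch

variable {p : ℕ} [Fact p.Prime]

lemma sum_carry_one {n : ℕ} [NeZero n] (hn : 1 < n) : ∑ m : ZMod n, (carry 1 m : ZMod n) = 1 := by
  have hc : ∀ m : ZMod n, (carry 1 m : ZMod n) = if m = -1 then 1 else 0 := by
    intro m; have : Fact (1 < n) := ⟨hn⟩; have v1 : (1 : ZMod n).val = 1 := val_one n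
    have lt := m.val_lt
    have key : m = -1 ↔ m.val = n - 1 := by
      rw [← (ZMod.val_injective n).eq_iff, ZMod.neg_val, if_neg one_ne_zero, v1]
    rw [carry, v1]; split_ifs with h
    · rw [key.1 h, show 1 + (n-1) = n by omega, Nat.div_self (by omega), Nat.cast_one]
    · have : m.val ≠ n - 1 := fun h' => h (key.2 h')
      rw [Nat.div_eq_of_lt (by omega), Nat.cast_zero]
  simp [hc]

lemma sum_carry_neg_one {n : ℕ} [NeZero n] (hn : 1 < n) :
    ∑ m : ZMod n, (carry (-1) (-m) : ZMod n)*(-1) = 1 := by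
  have hc : ∀ m : ZMod n, (carry (-1) (-m) : ZMod n) = 1 - if m = 0 then 1 else 0 := by
    intro m; have : Fact (1 < n) := ⟨hn⟩
    have v1 : (-1 : ZMod n).val = n - 1 := by rw [ZMod.neg_val, if_neg one_ne_zero, val_one n]
    split_ifs with h
    · rw [h, neg_zero, carry_zero_right]; simp
    · have : (-m).val ≠ 0 := fun h' => h (neg_eq_zero.1 ((ZMod.val_eq_zero _).1 h'))
      have lt := (-m).val_lt
      rw [carry, v1, show n - 1 + (-m).val = n + ((-m).val - 1) by omega,
        Nat.add_div_left _ (by omega), Nat.div_eq_of_lt (by omega)]; simp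
  simp only [hc, mul_neg, mul_one]; rw [Finset.sum_neg_distrib, sum_sub_distrib]; simp [ZMod.card]

/-- The position with respect to a nonreal point in the coordinate `y = (τ - θ) / (τ - θᵖ)`. -/
def orbPos (y x : QF p) : ZMod (p+1) := qfLog p (x - y*x^p)

lemma orb_ne_zero {x y : QF p} (hx : x ≠ 0) (hy : y^(p+1) ≠ 1) : x - y*x^p ≠ 0 := by
  intro h; apply hy; have e : y*x^p = x := (sub_eq_zero.1 h).symm
  have hq : x^(p*p) = x := by
    have := pow_card x; rwa [card_QF, sq] at this
  have h1 : (y*x^p)^(p+1) = x^(p+1) := by rw [e]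
  rw [mul_pow, ← pow_mul, mul_add, mul_one, pow_add x, hq] at h1
  have h2 : x*x^p ≠ 0 := mul_ne_zero hx (pow_ne_zero _ hx); rw [pow_succ' x] at h1
  exact mul_right_cancel₀ h2 (by rw [h1, one_mul])

lemma orbPos_shift {x x' y : QF p} (hx : x ≠ 0) (hx' : x' ≠ 0) (hy : y^(p+1) ≠ 1) (j : ℕ)
    (h : qfLog p x' = qfLog p x + j) :
    orbPos y x' = orbPos (y*(qfGen p : QF p)^((p-1)*j)) x + j := by
  have hg : (qfGen p : QF p)^j ≠ 0 := pow_ne_zero _ (qfGen p).ne_zero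
  obtain ⟨t, ht, e⟩ := exists_scalar hx' (mul_ne_zero hx hg) (by rw [h, qfLog_mul hx hg, qfLog_pow])
  have hp := (Fact.out : p.Prime).one_le
  have e2 : x' - y*x'^p = algebraMap _ _ t*((x - y*(qfGen p : QF p)^((p-1)*j)*x^p)
      * (qfGen p : QF p)^j) := by
    have hpow : ((qfGen p : QF p)^j)^p = (qfGen p : QF p)^((p-1)*j)*(qfGen p : QF p)^j := by
      rw [← pow_mul, ← pow_add]; congr 1; obtain ⟨k, rfl⟩ : ∃ k, p = k + 1 := ⟨p - 1, by omega⟩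
      rw [Nat.add_sub_cancel]; ring
    rw [e, mul_pow, mul_pow, qf_charP_pow, hpow]; ring
  have hne := orb_ne_zero hx' hy; rw [e2] at hne; have h1 := right_ne_zero_of_mul hne
  rw [orbPos, e2, qfLog_mul (left_ne_zero_of_mul hne) h1, qfLog_algebraMap ht, zero_add,
    qfLog_mul (left_ne_zero_of_mul h1) hg, qfLog_pow, orbPos]

lemma sum_planePoints (hp : 2 < p) {θ : QF p} (hθ : θ ∈ nonReal p) (P : ZMod (p+1) → V2 p)
    (hP0 : ∀ m, P m ≠ 0) (hP : ∀ m, linForm θ (P m) = (qfGen p : QF p)^m.val) :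
    ∑ m : ZMod (p+1), quadSum carryCocycle (P 0) (P 1) (P (m+1)) (P (m+2)) = 2 := by
  have hθ' := mem_nonReal.1 hθ; set θ' : QF p := θ^p with hθ'def
  have hq : ∀ x : QF p, (x^p)^p = x := by
    intro x; have := pow_card x; rwa [card_QF, sq, pow_mul] at this
  have hθθ : θ'^p = θ := hq θ
  have pos : ∀ m, qfPos θ (P m) = m := fun m => by rw [qfPos, hP, qfLog_pow, natCast_zmod_val]
  have xne : ∀ m, linForm θ (P m) ≠ 0 := fun m => linForm_ne_zero hθ (hP0 m)
  have pos' : ∀ m, qfPos θ' (P m) = -m := fun m => by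
    rw [qfPos, ← linForm_pow, hP, ← pow_mul, qfLog_pow, Nat.cast_mul, natCast_zmod_val]
    have : ((p + 1 : ℕ) : ZMod (p+1)) = 0 := natCast_self _; push_cast at this
    linear_combination m*this
  have hθ'mem : θ' ∈ nonReal p := by rw [mem_nonReal, hθθ]; exact fun h => hθ' h.symm
  have hne : θ ≠ θ' := fun h => hθ' h.symm
  set F : QF p → ZMod (p+1) := fun τ => ∑ m : ZMod (p+1),
    carryCocycle (qfPos τ (P 0)) (qfPos τ (P 1)) (qfPos τ (P (m+1))) (qfPos τ (P (m+2))) with hF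
  have hswap : ∑ m : ZMod (p+1), quadSum carryCocycle (P 0) (P 1) (P (m+1)) (P (m+2))
      = ∑ τ ∈ nonReal p, F τ := by
    unfold quadSum; rw [Finset.sum_comm]
  have F1 : F θ = 1 := by
    rw [hF]; simp only [pos, carryCocycle]
    refine Eq.trans ?_ (sum_carry_one (n := p + 1) (by omega)); refine sum_congr rfl fun m _ => ?_
    rw [show (1 : ZMod (p+1)) - 0 = 1 by ring, show m + 1 - 1 = m by ring,
      show m + 2 - (m+1) = 1 by ring, mul_one]
  have F2 : F θ' = 1 := by
    rw [hF]; simp only [pos', carryCocycle]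
    refine Eq.trans ?_ (sum_carry_neg_one (n := p + 1) (by omega))
    refine sum_congr rfl fun m _ => ?_
    rw [show (-1 : ZMod (p+1)) - -0 = -1 by ring, show -(m+1) - -1 = -m by ring,
      show -(m+2) - -(m+1) = -1 by ring]
  set T := ((nonReal p).erase θ).erase θ' with hT
  have hmT : ∀ τ, τ ∈ T ↔ τ ≠ θ' ∧ τ ≠ θ ∧ τ^p ≠ τ := by intro τ; simp [hT, mem_nonReal]
  have hsplit : ∑ τ ∈ nonReal p, F τ = 2 + ∑ τ ∈ T, F τ := by
    rw [← Finset.add_sum_erase _ _ hθ, ← Finset.add_sum_erase _ _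
      (Finset.mem_erase.2 ⟨hne.symm, hθ'mem⟩), F1, F2, ← hT]; ring
  rw [hswap, hsplit]; set X : ZMod (p+1) → QF p := fun m => linForm θ (P m) with hX
  set H : QF p → ZMod (p+1) := fun y => ∑ m : ZMod (p+1),
    carryCocycle (orbPos y (X 0)) (orbPos y (X 1)) (orbPos y (X (m+1))) (orbPos y (X (m+2))) with hH
  set Y : Finset (QF p) := univ.filter fun y => y ≠ 0 ∧ y^(p+1) ≠ 1 with hY
  have hmY : ∀ y, y ∈ Y ↔ y ≠ 0 ∧ y^(p+1) ≠ 1 := by intro y; simp [hY]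
  have hd : θ - θ' ≠ 0 := sub_ne_zero.2 hne
  have sub_p : ∀ a c : QF p, (a-c)^p = a^p - c^p := fun a c => sub_pow_char _ _
  have yT : ∀ τ ∈ T, (τ-θ)/(τ - θ') ∈ Y := by
    intro τ hτ; obtain ⟨h1, h2, h3⟩ := (hmT τ).1 hτ; have h1' := sub_ne_zero.2 h1
    have h2' := sub_ne_zero.2 h2
    have h3' : τ^p - θ ≠ 0 := sub_ne_zero.2 fun h => h1 (by rw [← hq τ, h])
    refine (hmY _).2 ⟨div_ne_zero h2' h1', fun h => ?_⟩
    rw [pow_succ, div_pow, sub_p, sub_p, hθθ, ← hθ'def, div_mul_div_comm,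
      div_eq_one_iff_eq (mul_ne_zero h3' h1')] at h
    grind
  have hbij : ∑ τ ∈ T, F τ = ∑ y ∈ Y, H y := by
    refine Finset.sum_nbij' (fun τ => (τ-θ)/(τ - θ')) (fun y => (θ - y*θ')/(1-y))
      ?_ ?_ ?_ ?_ ?_
    · exact yT
    · intro y hy; obtain ⟨h0, h1⟩ := (hmY y).1 hy
      have hy1 : 1 - y ≠ 0 := sub_ne_zero.2 fun h => h1 (by rw [← h, one_pow])
      have hyp : 1 - y^p ≠ 0 := by
        have := pow_ne_zero p hy1; rwa [sub_p, one_pow] at this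
      refine (hmT _).2 ⟨fun h => ?_, fun h => ?_, fun h => ?_⟩
      · grind
      · grind
      · rw [div_pow, sub_p, sub_p, one_pow, mul_pow, hθθ, ← hθ'def, div_eq_div_iff hyp hy1] at h
        rw [pow_succ] at h1; grind
    · intro τ hτ; obtain ⟨h1, h2, h3⟩ := (hmT τ).1 hτ; have h1' := sub_ne_zero.2 h1
      have e : 1 - (τ-θ)/(τ - θ') = (θ - θ')/(τ - θ') := by field_simp; ring
      rw [e, div_eq_iff (div_ne_zero hd h1')]; field_simp; ring
    · intro y hy; obtain ⟨h0, h1⟩ := (hmY y).1 hy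
      have hy1 : 1 - y ≠ 0 := sub_ne_zero.2 fun h => h1 (by rw [← h, one_pow])
      have e : (θ - y*θ')/(1-y) - θ' = (θ - θ')/(1-y) := by field_simp; ring
      have e' : (θ - y*θ')/(1-y) - θ = y*(θ - θ')/(1-y) := by field_simp; ring
      rw [e, e']; field_simp
    · intro τ hτ; obtain ⟨h1, h2, h3⟩ := (hmT τ).1 hτ; have h1' := sub_ne_zero.2 h1
      have hκ : (τ - θ')/(θ - θ') ≠ 0 := div_ne_zero h1' hd; have hy := (hmY _).1 (yT τ hτ)
      have e : ∀ m, qfPos τ (P m) = orbPos ((τ-θ)/(τ - θ')) (X m)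
          + qfLog p ((τ - θ')/(θ - θ')) := by
        intro m; rw [orbPos, ← qfLog_mul (orb_ne_zero (xne m) hy.2) hκ, qfPos]; congr 1
        rw [linForm_pow, ← hθ'def]; field_simp; unfold linForm; ring
      simp only [hF, hH, e, homog_carryCocycle _ _ _ _ _]
  rw [hbij]
  have hn : (qfGen p : QF p)^((p-1)*(p+1)) = 1 := by
    rw [← val_pow_eq_pow_val, ← orderOf_qfGen, pow_orderOf_eq_one, Units.val_one]
  have hgp : ∀ a c : ℕ, (a : ZMod (p+1)) = c →
      (qfGen p : QF p)^((p-1)*a) = (qfGen p : QF p)^((p-1)*c) := by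
    intro a c h; rw [ZMod.natCast_eq_natCast_iff] at h
    rw [← val_pow_eq_pow_val, ← val_pow_eq_pow_val, val_inj, pow_eq_pow_iff_modEq, orderOf_qfGen]
    exact h.mul_left' _
  have fin : ∑ y ∈ Y, H y = 0 := by
    refine sum_eq_zero_of_free (Γ := ZMod (p+1)) Y
      (fun j y => y*(qfGen p : QF p)^((p-1)*j.val)) ?_ ?_ ?_ ?_ H ?_
    · intro y; simp
    · intro g h y; rw [mul_assoc, ← pow_add, ← mul_add]; congr 1
      apply hgp; push_cast; simp [add_comm]
    · intro g y hy; obtain ⟨h0, h1⟩ := (hmY y).1 hy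
      refine (hmY _).2 ⟨mul_ne_zero h0 (pow_ne_zero _ (qfGen p).ne_zero), ?_⟩
      rw [mul_pow, ← pow_mul, mul_right_comm, pow_mul, hn, one_pow, mul_one]; exact h1
    · intro g y hy h; obtain ⟨h0, -⟩ := (hmY y).1 hy
      have h1 : (qfGen p : QF p)^((p-1)*g.val) = 1 := mul_left_cancel₀ h0 (by rw [h, mul_one])
      rw [← val_pow_eq_pow_val, Units.val_eq_one, ← orderOf_dvd_iff_pow_eq_one, orderOf_qfGen,
        Nat.mul_dvd_mul_iff_left (by omega)] at h1
      exact (ZMod.val_eq_zero g).1 (Nat.eq_zero_of_dvd_of_lt h1 g.val_lt)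
    · intro y hy; obtain ⟨h0, h1⟩ := (hmY y).1 hy
      have sh : ∀ j i : ZMod (p+1), orbPos y (X (i+j))
          = orbPos (y*(qfGen p : QF p)^((p-1)*j.val)) (X i) + j := by
        intro j i
        have := orbPos_shift (xne i) (xne (i+j)) h1 j.val (by
          rw [natCast_zmod_val]
          exact (pos _).trans (congrArg (· + j) (pos i).symm))
        rwa [natCast_zmod_val] at this
      have hj : ∀ j : ZMod (p+1), H (y*(qfGen p : QF p)^((p-1)*j.val))
          = ∑ l : ZMod (p+1), carryCocycle (orbPos y (X j)) (orbPos y (X (j+1)))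
            (orbPos y (X l)) (orbPos y (X (l+1))) := by
        intro j; rw [hH]; refine sum_equiv (addRight (1+j)) _ _ fun m => ?_
        rw [← homog_carryCocycle j, ← sh, ← sh, ← sh, ← sh]; simp only [Equiv.coe_addRight]
        rw [show (0 : ZMod (p+1)) + j = j by ring, show (1 : ZMod (p+1)) + j = j + 1 by ring,
          show m + 1 + j = m + (j+1) by ring, show m + 2 + j = m + (j+1) + 1 by ring]
      simp only [hj]; exact sum_join_eq_zero cobdry_carryCocycle (fun i => orbPos y (X i))
  rw [fin, add_zero]

lemma closure_finDilog (hp : 2 < p) {S : AddSubgroup (ZMod (oddPart (p+1)))}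
    (hS : ∀ x : ZMod p, finDilog x ∈ S) : S = ⊤ := by
  obtain ⟨θ, hθ⟩ := nonReal_nonempty (p := p)
  choose P hP0 hP using exists_point θ hθ
  have pos : ∀ m, qfPos θ (P m) = m := fun m => by rw [qfPos, hP, qfLog_pow, natCast_zmod_val]
  have ind : ∀ {m m' : ZMod (p+1)}, m ≠ m' → det2 (P m) (P m') ≠ 0 := by
    intro m m' h h'; rw [← qfPos_eq_iff hθ (hP0 _) (hP0 _), pos, pos] at h'; exact h h'
  have hC : planeConst p ∈ S := by
    have : Fact (2 < p) := ⟨hp⟩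
    have h2 : (2 : ZMod p) ≠ 0 := by
      simpa using (natCast_eq_zero_iff 2 p).not.2 (Nat.not_dvd_of_pos_of_lt two_pos hp)
    have := finBloch_finDilog.one_sub (2 : ZMod p) h2 (by grind)
    rw [← sub_add_cancel (planeConst p), ← this]; exact S.add_mem (hS _) (hS _)
  have hsum := sum_planePoints hp hθ P hP0 hP
  have h2 : (2 : ZMod (oddPart (p+1))) ∈ S := by
    have := congrArg (ZMod.castHom (oddPart_dvd (p+1)) (ZMod (oddPart (p+1)))) hsum
    rw [map_sum, map_ofNat] at this; rw [← this]; refine S.sum_mem fun m _ => ?_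
    change planeCocycle _ _ _ _ ∈ S; have : Fact (1 < p + 1) := ⟨by omega⟩
    have h01 : (0 : ZMod (p+1)) ≠ 1 := zero_ne_one
    have h20 : (2 : ZMod (p+1)) ≠ 0 := by
      simpa using (natCast_eq_zero_iff 2 (p+1)).not.2 (Nat.not_dvd_of_pos_of_lt two_pos (by omega))
    by_cases m0 : m = 0
    · rw [m0, zero_add, planeCocycle_mid]; exact S.zero_mem
    by_cases m1 : m = -1
    · rw [m1, neg_add_cancel, show (-1 : ZMod (p+1)) + 2 = 1 by ring,
        planeCocycle_alt_zero (ind h01)]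
      exact S.zero_mem
    by_cases m2 : m = -2
    · rw [m2, neg_add_cancel, show (-2 : ZMod (p+1)) + 1 = -1 by ring,
        planeCocycle_cyc (ind h01) (ind (fun h => h01 (by linear_combination -h))) (ind (fun h => h20 (by linear_combination h)))]
      exact hC
    · rw [← finDilog_crossRatio]
      · exact hS _
      · exact ⟨ind h01, ind (fun h => m1 (by linear_combination -h)),
          ind (fun h => m2 (by linear_combination -h)), ind (fun h => m0 (by linear_combination -h)),
          ind (fun h => m1 (by linear_combination -h)), ind (fun h => h01 (by linear_combination h))⟩
  have hu := zmod_isUnit_two (coprime_two_oddPart p.succ_ne_zero); rw [eq_top_iff]; intro w _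
  obtain ⟨u, hu⟩ := hu
  have e : w = ((u⁻¹ : (ZMod (oddPart (p+1)))ˣ)*w : ZMod (oddPart (p+1))).val •
      (2 : ZMod (oddPart (p+1))) := by
    have : NeZero (oddPart (p+1)) := ⟨fun h => by
      have := coprime_two_oddPart p.succ_ne_zero
      rw [h] at this; norm_num at this⟩
    rw [nsmul_eq_mul, natCast_zmod_val, ← hu, mul_comm, ← mul_assoc, Units.mul_inv, one_mul]
  rw [e]; exact S.nsmul_mem h2 _

end FinBloch

/-- The rational number `z` is `p`-integral with residue `r`. -/
def Red (p : ℕ) (z : ℚ) (r : ZMod p) : Prop := ∃ a c : ℤ, (c : ZMod p) ≠ 0 ∧ z*c = a ∧ r*c = a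

namespace Red

variable {p : ℕ} [hp : Fact p.Prime] {z w : ℚ} {r q : ZMod p}

lemma cast_ne {c : ℤ} (hc : (c : ZMod p) ≠ 0) : (c : ℚ) ≠ 0 := by
  rintro h; rw [Int.cast_eq_zero.1 h] at hc; simp at hc

lemma intCast (a : ℤ) : Red p (a : ℚ) (a : ZMod p) := ⟨a, 1, by simp, by simp, by simp⟩

lemma one : Red p 1 1 := by simpa using intCast (p := p) 1

lemma unique (h : Red p z r) (h' : Red p z q) : r = q := by
  obtain ⟨a, c, hc, e1, e2⟩ := h; obtain ⟨a', c', hc', e1', e2'⟩ := h'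
  have e : (a*c' : ℚ) = a'*c := by rw [← e1, ← e1']; ring
  have e4 : (a*c' : ZMod p) = a'*c := mod_cast congrArg (Int.cast (R := ZMod p)) (mod_cast e)
  apply mul_right_cancel₀ (mul_ne_zero hc hc'); linear_combination c'*e2 + e4 - c*e2'

lemma sub (h : Red p z r) (h' : Red p w q) : Red p (z-w) (r-q) := by
  obtain ⟨a, c, hc, e1, e2⟩ := h; obtain ⟨a', c', hc', e1', e2'⟩ := h'
  refine ⟨a*c' - a'*c, c*c', by push_cast; exact mul_ne_zero hc hc', ?_, ?_⟩
  · push_cast; linear_combination c'*e1 - c*e1'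
  · push_cast; linear_combination c'*e2 - c*e2'

lemma mul (h : Red p z r) (h' : Red p w q) : Red p (z*w) (r*q) := by
  obtain ⟨a, c, hc, e1, e2⟩ := h; obtain ⟨a', c', hc', e1', e2'⟩ := h'
  refine ⟨a*a', c*c', by push_cast; exact mul_ne_zero hc hc', ?_, ?_⟩
  · push_cast; rw [← e1, ← e1']; ring
  · push_cast; rw [← e2, ← e2']; ring

lemma inv (h : Red p z r) (hr : r ≠ 0) : Red p z⁻¹ r⁻¹ := by
  obtain ⟨a, c, hc, e1, e2⟩ := h
  have ha : (a : ZMod p) ≠ 0 := by rw [← e2]; exact mul_ne_zero hr hc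
  have hz : z ≠ 0 := by rintro rfl; exact cast_ne ha (by rw [← e1, zero_mul])
  exact ⟨c, a, ha, by rw [← e1]; field_simp, by rw [← e2]; field_simp⟩

lemma div (h : Red p z r) (h' : Red p w q) (hq : q ≠ 0) : Red p (z/w) (r/q) := by
  rw [div_eq_mul_inv, div_eq_mul_inv]; exact h.mul (h'.inv hq)

lemma congr (h : Red p z r) (e : z = w) (e' : r = q) : Red p w q := e ▸ e' ▸ h

lemma total (z : ℚ) : (∃ r : ZMod p, Red p z r) ∨ Red p z⁻¹ 0 := by
  by_cases hd : ((z.den : ℤ) : ZMod p) = 0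
  · right
    have hn : (z.num : ZMod p) ≠ 0 := by
      intro h; rw [intCast_zmod_eq_zero_iff_dvd] at h hd
      have := Nat.dvd_gcd (Int.natCast_dvd.1 h) (Int.natCast_dvd_natCast.1 hd)
      rw [z.reduced.gcd_eq_one] at this; exact hp.out.one_lt.ne' (Nat.dvd_one.1 this)
    refine ⟨z.den, z.num, hn, ?_, ?_⟩
    · have h1 : (z.num : ℚ) ≠ 0 := cast_ne hn; have h2 := Rat.mul_den_eq_num z
      have hz : z ≠ 0 := by rintro rfl; exact h1 (by simp)
      rw [← h2]; push_cast; field_simp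
    · rw [zero_mul, hd]
  · left
    exact ⟨z.num/(z.den : ℤ), z.num, z.den, hd, mod_cast Rat.mul_den_eq_num z, div_mul_cancel₀ _ hd⟩

end Red

namespace FinBloch

variable {W : Type*} [AddCommGroup W] {p : ℕ} [hp : Fact p.Prime] {B : ZMod p → W} {C : W}

/-- The function on `ℚ` obtained by reduction modulo `p`. -/
def lift (B : ZMod p → W) (C : W) (z : ℚ) : W :=
  if z = 0 then 0
  else if h : ∃ r : ZMod p, Red p z r then (if h.choose = 0 then C else B h.choose) else -C

lemma lift_zero {z : ℚ} (hz : z ≠ 0) (h : Red p z 0) : lift B C z = C := by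
  have h' : ∃ r : ZMod p, Red p z r := ⟨0, h⟩
  rw [lift, if_neg hz, dif_pos h', if_pos (h'.choose_spec.unique h)]

lemma lift_unit {z : ℚ} {r : ZMod p} (h : Red p z r) (hr : r ≠ 0) : lift B C z = B r := by
  have h' : ∃ r : ZMod p, Red p z r := ⟨r, h⟩
  have hz : z ≠ 0 := by rintro rfl; exact hr (h.unique (by simpa using Red.intCast (p := p) 0))
  have e := h'.choose_spec.unique h
  rw [lift, if_neg hz, dif_pos h', if_neg (by rw [e]; exact hr), e]

lemma lift_infty {z : ℚ} (hz : z ≠ 0) (h : Red p z⁻¹ 0) : lift B C z = -C := by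
  have h' : ¬ ∃ r : ZMod p, Red p z r := by
    rintro ⟨r, hr⟩
    have := (hr.mul h).unique (q := 1) ((Red.one).congr (mul_inv_cancel₀ hz).symm rfl); simp at this
  rw [lift, if_neg hz, dif_neg h']

lemma lift_inv (hB : FinBloch p B C) (z : ℚ) : lift B C z⁻¹ = -lift B C z := by
  by_cases hz : z = 0
  · simp [hz, lift]
  rcases Red.total (p := p) z with ⟨r, hr⟩ | h
  · by_cases h0 : r = 0
    · subst h0; rw [lift_zero hz hr, lift_infty (inv_ne_zero hz) (by rwa [inv_inv])]
    · rw [lift_unit hr h0, lift_unit (hr.inv h0) (inv_ne_zero h0), hB.inv]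
  · rw [lift_zero (inv_ne_zero hz) h, lift_infty hz h, neg_neg]

lemma lift_mul_one {s t : ℚ} (hs : s ≠ 0) (ht0 : t ≠ 0) (ht : Red p t 1) :
    lift B C (s*t) = lift B C s := by
  have ti : Red p t⁻¹ 1 := by simpa using ht.inv one_ne_zero
  rcases Red.total (p := p) s with ⟨r, hr⟩ | h
  · have := hr.mul ht; rw [mul_one] at this; by_cases h0 : r = 0
    · subst h0; rw [lift_zero hs hr, lift_zero (mul_ne_zero hs ht0) this]
    · rw [lift_unit hr h0, lift_unit this h0]
  · rw [lift_infty hs h, lift_infty (mul_ne_zero hs ht0)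
      ((h.mul ti).congr (mul_inv _ _).symm (mul_one _))]

/-- Reduction modulo `p` of a solution over the prime field is a solution over `ℚ`, for every
character trivial on `p`-adic units. -/
lemma isBloch_lift (hB : FinBloch p B C) {χ : ℚ →*₀ ℤ}
    (hχ : ∀ (z : ℚ) (r : ZMod p), Red p z r → r ≠ 0 → χ z = 1) : IsBloch χ (lift B C) := by
  refine ⟨by simp [lift], by rw [lift_unit Red.one one_ne_zero, hB.one], ?_⟩
  intro x y hx hx1 hy hy1 hxy; have X1 : 1 - x ≠ 0 := sub_ne_zero.2 hx1.symm
  have Y1 : 1 - y ≠ 0 := sub_ne_zero.2 hy1.symm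
  have Xi : 1 - x⁻¹ ≠ 0 := sub_ne_zero.2 fun h => hx1 (inv_eq_one.1 h.symm)
  have Yi : 1 - y⁻¹ ≠ 0 := sub_ne_zero.2 fun h => hy1 (inv_eq_one.1 h.symm)
  have hs : y/x ≠ 0 := div_ne_zero hy hx; have ht : (1-x)/(1-y) ≠ 0 := div_ne_zero X1 Y1
  have hst : (1 - x⁻¹)/(1 - y⁻¹) ≠ 0 := div_ne_zero Xi Yi
  have est : (1 - x⁻¹)/(1 - y⁻¹) = y/x*((1-x)/(1-y)) := by
    rw [one_sub_inv_div hx hy hy1]; field_simp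
  have fi : ∀ {z : ℚ}, z ≠ 0 → z⁻¹ - 1 = (1-z)/z := fun h => by field_simp
  have c3 : C + C + C = 0 := hB.three
  have sgn : χ (x⁻¹ - 1) = χ x*χ (1-x) := by rw [fi hx, chi_div, mul_comm]
  have l3 : ∀ {r}, Red p x r → Red p y⁻¹ 0 → lift B C (y/x) = -C := fun hr h =>
    lift_infty hs ((hr.mul h).congr (by rw [inv_div]; rfl) (by simp))
  have l5 : ∀ {r}, Red p x r → Red p y⁻¹ 0 → lift B C ((1-x)/(1-y)) = C := fun hr h =>
    lift_zero ht (((Red.one.sub hr).mul (h.div (h.sub Red.one) (by simp))).congr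
      (by rw [fi hy]; field_simp) (by simp))
  rcases Red.total (p := p) x with ⟨r, hr⟩ | xinf
  · have r1 := Red.one.sub hr; by_cases r0 : r = 0
    · subst r0; have e3 : χ (1-x) = 1 := hχ _ _ r1 (by simp)
      rw [lift_zero hx hr, sgn, e3, mul_one, one_smul]
      have s0 : ∀ q : ZMod p, Red p y q → q ≠ 0 → lift B C (y/x) = -C := fun q hq h =>
        lift_infty hs ((hr.div hq h).congr (inv_div _ _).symm (by simp))
      rcases Red.total (p := p) y with ⟨q, hq⟩ | yinf
      · have q1 := Red.one.sub hq; by_cases q0 : q = 0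
        · subst q0
          have t1 : Red p ((1-x)/(1-y)) 1 := (r1.div q1 (by simp)).congr rfl (by simp)
          rw [lift_zero hy hq, lift_unit t1 one_ne_zero, hB.one, est, lift_mul_one hs ht t1]; abel
        · rw [s0 q hq q0, lift_unit hq q0]
          have l4 : lift B C ((1 - x⁻¹)/(1 - y⁻¹)) = -C := by
            have e : ((1 - x⁻¹)/(1 - y⁻¹))⁻¹ = x*(1-y)/(y*(1-x)) := by
              rw [est, mul_inv, inv_div, inv_div]; field_simp
            refine lift_infty hst (((hr.mul q1).div (hq.mul r1) ?_).congr e.symm (by simp))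
            simpa using q0
          by_cases q1' : q = 1
          · subst q1'
            have l5 : lift B C ((1-x)/(1-y)) = -C :=
              lift_infty ht ((q1.div r1 (by simp)).congr (inv_div _ _).symm (by simp))
            rw [l4, l5, hB.one]; simp only [smul_neg]; abel
          · have nq : 1 - q ≠ 0 := sub_ne_zero.2 (Ne.symm q1')
            have l5 : lift B C ((1-x)/(1-y)) = B q - C := by
              rw [lift_unit ((r1.div q1 nq)) (by simpa using nq), sub_zero, one_div, hB.inv,
                hB.one_sub q q0 q1']; abel
            rw [l4, l5]; simp only [smul_neg]; abel
      · have l4 : lift B C ((1 - x⁻¹)/(1 - y⁻¹)) = -C := by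
          have : x - 1 ≠ 0 := sub_ne_zero.2 hx1
          refine lift_infty hst (((Red.one.sub yinf).mul (hr.div (hr.sub Red.one) (by simp))).congr ?_
            (by simp))
          rw [inv_div, div_eq_mul_inv (1 - y⁻¹)]; congr 1; field_simp
        rw [lift_infty hy yinf, l3 hr yinf, l4, l5 hr yinf, ← c3]; simp only [smul_neg]; abel
    · have e1 : χ x = 1 := hχ _ _ hr r0; have ri := hr.inv r0
      rw [lift_unit hr r0, sgn, e1, one_mul, one_smul]; by_cases r1' : r = 1
      · subst r1'; rw [hB.one]; rcases Red.total (p := p) y with ⟨q, hq⟩ | yinf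
        · have q1 := Red.one.sub hq; have s1 := hq.div hr one_ne_zero; rw [div_one] at s1
          by_cases q1' : q = 1
          · subst q1'
            rw [lift_unit hq one_ne_zero, lift_unit s1 one_ne_zero, hB.one, est, mul_comm,
              lift_mul_one ht hs s1]
            abel
          · have nq : 1 - q ≠ 0 := sub_ne_zero.2 (Ne.symm q1')
            have t0 : Red p ((1-x)/(1-y)) 0 := (r1.div q1 nq).congr rfl (by simp)
            have st0 : Red p ((1 - x⁻¹)/(1 - y⁻¹)) 0 := (s1.mul t0).congr est.symm (by simp)
            rw [lift_zero ht t0, lift_zero hst st0]; by_cases q0 : q = 0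
            · subst q0; rw [lift_zero hy hq, lift_zero hs s1]; abel
            · rw [lift_unit hq q0, lift_unit s1 q0]; abel
        · have l4 : lift B C ((1 - x⁻¹)/(1 - y⁻¹)) = C :=
            lift_zero hst (((Red.one.sub ri).div (Red.one.sub yinf) (by simp)).congr rfl (by simp))
          rw [lift_infty hy yinf, l3 hr yinf, l4, l5 hr yinf]; abel
      · have nr : 1 - r ≠ 0 := sub_ne_zero.2 (Ne.symm r1')
        have nri : 1 - r⁻¹ ≠ 0 := sub_ne_zero.2 fun h => r1' (inv_eq_one.1 h.symm)
        have e3 : χ (1-x) = 1 := hχ _ _ r1 nr; rw [e3, one_smul, one_smul]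
        rcases Red.total (p := p) y with ⟨q, hq⟩ | yinf
        · have q1 := Red.one.sub hq; have s1 := hq.div hr r0; by_cases q0 : q = 0
          · subst q0; have t0 := r1.div q1 (by simp); simp only [sub_zero, div_one] at t0
            have st0 : Red p ((1 - x⁻¹)/(1 - y⁻¹)) 0 := (s1.mul t0).congr est.symm (by simp)
            rw [lift_zero hy hq, lift_zero hs (s1.congr rfl (by simp)), lift_unit t0 nr,
              lift_zero hst st0, hB.one_sub r r0 r1']
            abel
          · by_cases q1' : q = 1
            · subst q1'
              have l4 : lift B C ((1 - x⁻¹)/(1 - y⁻¹)) = -C := by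
                refine lift_infty hst (((Red.one.sub (hq.inv one_ne_zero)).div (Red.one.sub ri)
                  nri).congr (inv_div _ _).symm (by simp))
              have l5 : lift B C ((1-x)/(1-y)) = -C :=
                lift_infty ht ((q1.div r1 nr).congr (inv_div _ _).symm (by simp))
              rw [lift_unit hq one_ne_zero, hB.one, lift_unit s1 (by simpa using r0), l4, l5,
                one_div, hB.inv]
              abel
            · have nq : 1 - q ≠ 0 := sub_ne_zero.2 (Ne.symm q1')
              have nqi : 1 - q⁻¹ ≠ 0 := sub_ne_zero.2 fun h => q1' (inv_eq_one.1 h.symm)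
              have l4 := lift_unit (B := B) (C := C) ((Red.one.sub ri).div (Red.one.sub (hq.inv q0)) nqi)
                (div_ne_zero nri nqi)
              have l5 := lift_unit (B := B) (C := C) (r1.div q1 nq) (div_ne_zero nr nq)
              rw [lift_unit hq q0, lift_unit s1 (div_ne_zero q0 r0), l4, l5]; by_cases hrq : r = q
              · subst hrq; rw [div_self r0, div_self nr, div_self nri, hB.one]; abel
              · exact hB.five r q r0 r1' q0 q1' hrq
        · have l4 : lift B C ((1 - x⁻¹)/(1 - y⁻¹)) = B (1 - r⁻¹) :=
            lift_unit (((Red.one.sub ri).div (Red.one.sub yinf) (by simp)).congr rfl (by simp)) nri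
          rw [lift_infty hy yinf, l3 hr yinf, l4, l5 hr yinf, hB.one_sub _ (inv_ne_zero r0)
            (fun h => r1' (inv_eq_one.1 h)), hB.inv]
          abel
  · have xi1 := Red.one.sub xinf; have e2 : χ (x⁻¹ - 1) = 1 := hχ _ _ (xinf.sub Red.one) (by simp)
    have e3 : χ (1-x) = χ x := by
      rw [sgn] at e2; rcases chi_cases χ hx with h | h <;> rw [h] at e2 ⊢ <;> linarith
    rw [lift_infty hx xinf, e2, e3, one_smul]
    have s0 : ∀ q : ZMod p, Red p y q → lift B C (y/x) = C := fun q hq =>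
      lift_zero hs ((hq.mul xinf).congr rfl (by simp))
    have t0 : ∀ q : ZMod p, Red p y q → lift B C ((1-x)/(1-y)) = -C := by
      intro q hq
      have e : ((1-x)/(1-y))⁻¹ = (1-y)*(x⁻¹/(x⁻¹ - 1)) := by
        have : x⁻¹ - 1 = (1-x)/x := by field_simp
        rw [this, inv_div]; field_simp
      exact lift_infty ht (((Red.one.sub hq).mul (xinf.div (xinf.sub Red.one) (by simp))).congr
        e.symm (by simp))
    rcases Red.total (p := p) y with ⟨q, hq⟩ | yinf
    · rw [s0 q hq, t0 q hq]; by_cases q0 : q = 0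
      · subst q0
        have l4 : lift B C ((1 - x⁻¹)/(1 - y⁻¹)) = C := by
          have e : (1 - x⁻¹)/(1 - y⁻¹) = (1 - x⁻¹)*(y/(y-1)) := by
            have : y - 1 ≠ 0 := sub_ne_zero.2 hy1
            rw [div_eq_mul_inv (1 - x⁻¹)]; congr 1; field_simp
          exact lift_zero hst ((xi1.mul (hq.div (hq.sub Red.one) (by simp))).congr e.symm (by simp))
        rw [lift_zero hy hq, l4, ← neg_zero, ← c3]; simp only [smul_neg]; abel
      · have qi := Red.one.sub (hq.inv q0); by_cases q1' : q = 1
        · subst q1'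
          have l4 : lift B C ((1 - x⁻¹)/(1 - y⁻¹)) = -C :=
            lift_infty hst ((qi.div xi1 (by simp)).congr (inv_div _ _).symm (by simp))
          rw [lift_unit hq one_ne_zero, hB.one, l4]; simp only [smul_neg]; abel
        · have nqi : 1 - q⁻¹ ≠ 0 := sub_ne_zero.2 fun h => q1' (inv_eq_one.1 h.symm)
          have l4 := lift_unit (B := B) (C := C) (xi1.div qi nqi) (by simpa using nqi)
          rw [sub_zero, one_div, hB.inv, hB.one_sub _ (inv_ne_zero q0)
            (fun h => q1' (inv_eq_one.1 h)), hB.inv] at l4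
          rw [lift_unit hq q0, l4]; simp only [smul_neg]; abel
    · have st1 : Red p ((1 - x⁻¹)/(1 - y⁻¹)) 1 :=
        (xi1.div (Red.one.sub yinf) (by simp)).congr rfl (by simp)
      have e : (1-x)/(1-y) = (y/x)⁻¹*((1 - x⁻¹)/(1 - y⁻¹)) := by rw [est]; field_simp
      rw [lift_infty hy yinf, lift_unit st1 one_ne_zero, hB.one, e,
        lift_mul_one (inv_ne_zero hs) hst st1, hB.lift_inv, smul_neg]
      abel

end FinBloch

section AlternatingFaces

variable {A M : Type*} [AddCommGroup M]

lemma neg_one_pow_smul_add_succ (a b : ℕ) (h : a + 1 = b ∨ b + 1 = a) (m : M) :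
    ((-1 : ℤ)^a) • m + ((-1 : ℤ)^b) • m = 0 := by
  rcases h with h | h <;> subst h <;> rw [pow_succ] <;> simp

/-- The alternating sum over all twofold faces of a tuple vanishes. -/
lemma sum_sum_succAbove {n : ℕ} (F : (Fin n → A) → M) (p : Fin (n+2) → A) :
    ∑ i : Fin (n+2), ((-1 : ℤ)^(i : ℕ)) • ∑ j : Fin (n+1), ((-1 : ℤ)^(j : ℕ)) •
      F (fun l => p (i.succAbove (j.succAbove l))) = 0 := by
  simp_rw [smul_sum, smul_smul, ← pow_add]; rw [← Finset.sum_product']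
  refine Finset.sum_involution
    (fun x _ => if h : x.2.castSucc < x.1 then (x.2.castSucc, x.1.pred (Fin.ne_zero_of_lt h))
      else (x.2.succ, x.1.castPred (fun e => h (by rw [e]; exact Fin.castSucc_lt_last _)))) ?_ ?_ ?_ ?_
  · rintro ⟨i, j⟩ -; dsimp only; split_ifs with h
    · have h' : (j : ℕ) < i := by simpa [lt_def] using h
      have e : (fun l => p (i.succAbove (j.succAbove l))) = fun l =>
          p (j.castSucc.succAbove ((i.pred (Fin.ne_zero_of_lt h)).succAbove l)) := by
        funext l; congr 1; ext; simp only [Fin.succAbove, lt_def, val_castSucc, Fin.val_pred]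
        split_ifs <;> simp_all <;> omega
      rw [e]; refine neg_one_pow_smul_add_succ _ _ ?_ _
      right; simp only [val_castSucc, Fin.val_pred]; omega
    · have h' : (i : ℕ) ≤ j := by simpa [lt_def] using h
      have e : (fun l => p (i.succAbove (j.succAbove l))) = fun l => p (j.succ.succAbove
          ((i.castPred (fun e => h (by rw [e]; exact Fin.castSucc_lt_last _))).succAbove l)) := by
        funext l; congr 1; ext
        simp only [Fin.succAbove, lt_def, val_castSucc, Fin.val_succ, Fin.coe_castPred]
        split_ifs <;> simp_all <;> omega
      rw [e]; refine neg_one_pow_smul_add_succ _ _ ?_ _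
      left; simp only [Fin.val_succ, Fin.coe_castPred]; omega
  · rintro ⟨i, j⟩ - - he; dsimp only at he; split_ifs at he with h
    · have := congrArg (fun x => (x.1 : ℕ)) he; simp only [val_castSucc] at this
      rw [lt_def, val_castSucc] at h; omega
    · have := congrArg (fun x => (x.1 : ℕ)) he; simp only [Fin.val_succ] at this
      rw [lt_def, val_castSucc] at h; omega
  · intros; simp
  · rintro ⟨i, j⟩ -; dsimp only; by_cases h : j.castSucc < i
    · have h' : (j : ℕ) < i := by simpa [lt_def] using h
      simp only [dif_pos h]
      rw [dif_neg (by simp only [lt_def, val_castSucc, Fin.val_pred]; omega)]; simp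
    · have h' : (i : ℕ) ≤ j := by simpa [lt_def] using h
      simp only [dif_neg h]
      rw [dif_pos (by simp only [lt_def, val_castSucc, Fin.coe_castPred, Fin.val_succ]; omega)]
      simp

end AlternatingFaces

section Bar

variable (G : Type*) [Group G] (k : Type*) [CommRing k]

/-- Inhomogeneous chains of `G` with coefficients in the permutation module on `X`. -/
abbrev Bar (X : Type*) (n : ℕ) : Type _ := ((Fin n → G) × X) →₀ k

variable {G k} {X Y Z : Type*} [MulAction G X] [MulAction G Y] [MulAction G Z]

def nf {n : ℕ} (p : Fin (n+1) → G) (x : X) : (Fin n → G) × X :=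
  (fun i => (p i.castSucc)⁻¹*p i.succ, (p 0)⁻¹ • x)

lemma nf_smul {n : ℕ} (h : G) (p : Fin (n+1) → G) (x : X) :
    nf (fun i => h*p i) (h • x) = nf p x := by
  unfold nf; ext
  · simp [mul_assoc]
  · simp [mul_smul]

lemma nf_partialProd {n : ℕ} (g : (Fin n → G) × X) : nf (partialProd g.1) g.2 = g := by
  unfold nf; ext
  · simp only; rw [Fin.partialProd_right_inv]
  · simp

lemma partialProd_nf {n : ℕ} (p : Fin (n+1) → G) (x : X) (i : Fin (n+1)) :
    p 0*partialProd (nf p x).1 i = p i := by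
  have := congrFun (Fin.partialProd_left_inv p) i; simpa [nf] using this

variable (k) in
def cell {n : ℕ} (p : Fin (n+1) → G) (x : X) : Bar G k X n := single (nf p x) 1

variable (k) in
lemma cell_smul {n : ℕ} (h : G) (p : Fin (n+1) → G) (x : X) :
    cell k (fun i => h*p i) (h • x) = cell k p x := by rw [cell, nf_smul]; rfl

lemma bar_induction {n : ℕ} {P : Bar G k X n → Prop} (c : Bar G k X n) (zero : P 0)
    (add : ∀ a b, P a → P b → P (a+b)) (smul : ∀ (r : k) p x, P (r • cell k p x)) : P c := by
  induction c using Finsupp.induction_linear with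
  | zero => exact zero
  | add a b ha hb => exact add a b ha hb
  | single g r =>
    have := smul r (partialProd g.1) g.2
    rwa [cell, nf_partialProd, Finsupp.smul_single, smul_eq_mul, mul_one] at this

lemma bar_hom_ext {n : ℕ} {M : Type*} [AddCommGroup M] [Module k M] {f g : Bar G k X n →ₗ[k] M}
    (h : ∀ p x, f (cell k p x) = g (cell k p x)) : f = g := by
  refine LinearMap.ext fun c => ?_
  exact bar_induction (P := fun c => f c = g c) c (by simp) (fun a b ha hb => by rw [map_add, map_add, ha, hb])
    (fun r p x => by rw [map_smul, map_smul, h])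

variable (G k X) in
def bd (n : ℕ) : Bar G k X (n+1) →ₗ[k] Bar G k X n :=
  Finsupp.lift _ k _ fun g => ∑ i : Fin (n+2), ((-1 : ℤ)^(i : ℕ)) •
    cell k (fun l => partialProd g.1 (i.succAbove l)) g.2

lemma bd_cell {n : ℕ} (p : Fin (n+2) → G) (x : X) : bd G k X n (cell k p x) =
    ∑ i : Fin (n+2), ((-1 : ℤ)^(i : ℕ)) • cell k (fun l => p (i.succAbove l)) x := by
  have : bd G k X n (cell k p x) = ∑ i : Fin (n+2), ((-1 : ℤ)^(i : ℕ)) •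
      cell k (fun l => partialProd (nf p x).1 (i.succAbove l)) (nf p x).2 := by
    simp [bd, cell]
  rw [this]; refine sum_congr rfl fun i _ => ?_
  rw [← cell_smul k (p 0)]; congr 2
  · funext l; exact partialProd_nf p x _
  · simp [nf]

lemma bd_bd {n : ℕ} (c : Bar G k X (n+2)) : bd G k X n (bd G k X (n+1) c) = 0 := by
  have : bd G k X n ∘ₗ bd G k X (n+1) = 0 := by
    apply bar_hom_ext; intro p x
    simp only [comp_apply, bd_cell, map_sum, map_zsmul, LinearMap.zero_apply]
    exact sum_sum_succAbove (fun q => cell k q x) p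
  exact LinearMap.congr_fun this c

variable (G k) in
def push (f : X → Y) (n : ℕ) : Bar G k X n →ₗ[k] Bar G k Y n :=
  Finsupp.lmapDomain k k (Prod.map id f)

def Equivar (G : Type*) [Group G] {X Y : Type*} [MulAction G X] [MulAction G Y] (f : X → Y) : Prop :=
  ∀ (g : G) x, f (g • x) = g • f x

lemma push_cell {f : X → Y} (hf : Equivar G f) {n : ℕ} (p : Fin (n+1) → G) (x : X) :
    push G k f n (cell k p x) = cell k p (f x) := by
  simp [push, cell, nf, hf (p 0)⁻¹ x]

lemma bd_push {f : X → Y} (hf : Equivar G f) {n : ℕ} (c : Bar G k X (n+1)) :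
    bd G k Y n (push G k f (n+1) c) = push G k f n (bd G k X n c) := by
  have : bd G k Y n ∘ₗ push G k f (n+1) = push G k f n ∘ₗ bd G k X n := by
    apply bar_hom_ext; intro p x; simp [bd_cell, push_cell hf]
  exact LinearMap.congr_fun this c

lemma push_push (f : X → Y) (g : Y → Z) {n : ℕ} (c : Bar G k X n) :
    push G k g n (push G k f n c) = push G k (g ∘ f) n c := by
  simp only [push, Finsupp.lmapDomain_apply, ← Finsupp.mapDomain_comp]; rfl

lemma push_id {n : ℕ} (c : Bar G k X n) : push G k id n c = c := by simp [push]

lemma push_surjective {f : X → Y} (hf : Function.Surjective f) (n : ℕ) :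
    Function.Surjective (push G k f n) :=
  Finsupp.mapDomain_surjective (Function.surjective_id.prodMap hf)

end Bar

section FinsuppKernel

variable {k S R : Type*} [CommRing k]

abbrev fibers (k : Type*) [CommRing k] (f : S → R) : Submodule k (S →₀ k) :=
  span k {x | ∃ a b, f a = f b ∧ x = single b (1 : k) - single a 1}

lemma mem_span_of_mapDomain_eq_zero (f : S → R) {c : S →₀ k} (hc : mapDomain f c = 0) :
    c ∈ fibers k f := by
  rcases isEmpty_or_nonempty S with hS | hS
  · rw [Subsingleton.elim c 0]; exact zero_mem _
  have key : ∀ c : S →₀ k, c - mapDomain (Function.invFun f) (mapDomain f c) ∈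
      fibers k f := by
    intro c
    induction c using Finsupp.induction_linear with
    | zero => simp
    | add a b ha hb =>
      rw [mapDomain_add, mapDomain_add, add_sub_add_comm]; exact Submodule.add_mem _ ha hb
    | single a r =>
      have : single a r - mapDomain (Function.invFun f)
          (mapDomain f (single a r)) = r • (single a (1 : k) -
            single (Function.invFun f (f a)) 1) := by
        simp [smul_sub]
      rw [this]; exact Submodule.smul_mem _ _ (subset_span ⟨_, _, Function.invFun_eq ⟨a, rfl⟩, rfl⟩)
  simpa [hc] using key c

lemma single_zpow_sub_mem (τ : Equiv.Perm S) (n : ℤ) (s : S) :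
    ∃ a : S →₀ k, single ((τ^n) s) (1 : k) - single s 1 = mapDomain τ a - a := by
  induction n using Int.induction_on with
  | zero => exact ⟨0, by simp⟩
  | succ n ih =>
    obtain ⟨a, ha⟩ := ih; refine ⟨a + single ((τ^(n : ℤ)) s) 1, ?_⟩
    rw [mapDomain_add, add_sub_add_comm, ← ha, Finsupp.mapDomain_single, add_comm (n : ℤ) 1,
      zpow_add, zpow_one, Equiv.Perm.mul_apply]
    abel
  | pred n ih =>
    obtain ⟨a, ha⟩ := ih; refine ⟨a - single ((τ^(-(n : ℤ) - 1)) s) 1, ?_⟩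
    have e : τ ((τ^(-(n : ℤ) - 1)) s) = (τ^(-(n : ℤ))) s := by
      rw [← Equiv.Perm.mul_apply, ← zpow_one_add]; congr 2; ring
    have : mapDomain τ (a - single ((τ^(-(n : ℤ) - 1)) s) (1 : k)) =
        mapDomain τ a - single ((τ^(-(n : ℤ))) s) 1 := by
      rw [sub_eq_add_neg, ← Finsupp.single_neg, mapDomain_add, Finsupp.mapDomain_single, e,
        Finsupp.single_neg, sub_eq_add_neg]
    rw [this, sub_sub_sub_comm, ← ha]; abel

lemma exists_of_mapDomain_eq_zero {τ : Equiv.Perm S} {f : S → R}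
    (hf : ∀ a b, f a = f b → ∃ n : ℤ, b = (τ^n) a) {c : S →₀ k}
    (hc : mapDomain f c = 0) : ∃ a : S →₀ k, mapDomain τ a - a = c := by
  have h := mem_span_of_mapDomain_eq_zero f hc
  have hle : fibers k f ≤ LinearMap.range (Finsupp.lmapDomain k k τ - LinearMap.id) := by
    rw [span_le]; rintro _ ⟨a, b, hab, rfl⟩; obtain ⟨n, rfl⟩ := hf a b hab
    obtain ⟨u, hu⟩ := single_zpow_sub_mem (k := k) τ n a; exact ⟨u, by simpa using hu.symm⟩
  obtain ⟨a, ha⟩ := hle h; exact ⟨a, by simpa using ha⟩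

lemma eq_zero_of_mapDomain_eq {τ : Equiv.Perm S} (hτ : ∀ (n : ℤ) s, (τ^n) s = s → n = 0)
    {a : S →₀ k} (ha : mapDomain τ a = a) : a = 0 := by
  by_contra hne; obtain ⟨s, hs⟩ := Finsupp.support_nonempty_iff.2 hne
  have step : ∀ n : ℕ, (τ^(n : ℤ)) s ∈ a.support := by
    intro n
    induction n with
    | zero => simpa using hs
    | succ n ih =>
      rw [Finsupp.mem_support_iff] at ih ⊢
      have : (τ^((n + 1 : ℕ) : ℤ)) s = τ ((τ^(n : ℤ)) s) := by
        rw [← Equiv.Perm.mul_apply, ← zpow_one_add]; congr 2; push_cast; ring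
      rw [this, ← ha, Finsupp.mapDomain_apply τ.injective]; exact ih
  have inj : Function.Injective (fun n : ℕ => (⟨(τ^(n : ℤ)) s, step n⟩ : a.support)) := by
    intro m n hmn; have h : (τ^(m : ℤ)) s = (τ^(n : ℤ)) s := congrArg Subtype.val hmn
    have := hτ ((m : ℤ) - n) s (by
      rw [sub_eq_neg_add, zpow_add, Equiv.Perm.mul_apply, h, ← Equiv.Perm.mul_apply, ← zpow_add]
      simp)
    omega
  exact not_injective_infinite_finite _ inj

lemma exists_index_of_finset {ι : Type*} [Preorder ι] [IsDirectedOrder ι] [Nonempty ι]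
    (r : ι → S → S → Prop) (mono : ∀ i j, i ≤ j → ∀ a b, r i a b → r j a b) (f : S → R)
    (hf : ∀ a b, f a = f b → ∃ i, r i a b) (s : Finset S) :
    ∃ i, ∀ a ∈ s, ∀ b ∈ s, f a = f b → r i a b := by
  have key : ∀ t : Finset (S × S), ∃ i, ∀ x ∈ t, f x.1 = f x.2 → r i x.1 x.2 := by
    intro t
    induction t using Finset.induction_on with
    | empty => exact ⟨Classical.arbitrary ι, by simp⟩
    | insert x t _ ih =>
      obtain ⟨i, hi⟩ := ih; by_cases hx : f x.1 = f x.2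
      · obtain ⟨j, hj⟩ := hf _ _ hx; obtain ⟨l, hil, hjl⟩ := exists_ge_ge i j; exact ⟨l, by grind⟩
      · exact ⟨i, by grind⟩
  obtain ⟨i, hi⟩ := key (s ×ˢ s)
  exact ⟨i, fun a ha b hb e => hi (a, b) (Finset.mem_product.2 ⟨ha, hb⟩) e⟩

lemma mapDomain_apply_eq (f : S → R) (c : S →₀ k) (t : R) :
    mapDomain f c t = ∑ x ∈ c.support, if f x = t then c x else 0 := by
  rw [mapDomain, Finsupp.sum_apply, Finsupp.sum]; simp [single_apply]

lemma mapDomain_eq_zero_of {Q : Type*} (f : S → R) (g : S → Q) {c : S →₀ k}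
    (h : ∀ a ∈ c.support, ∀ b ∈ c.support, f a = f b → g a = g b)
    (hc : mapDomain f c = 0) : mapDomain g c = 0 := by
  ext q; by_cases hq : ∃ a ∈ c.support, g a = q
  · obtain ⟨a, ha, rfl⟩ := hq
    have e1 : mapDomain g c (g a) = ∑ y ∈ (c.support.filter fun x => g x = g a).image f,
        mapDomain f c y := by
      rw [mapDomain_apply_eq]; simp_rw [mapDomain_apply_eq f]; rw [Finset.sum_comm]
      refine sum_congr rfl fun x hx => ?_
      rw [Finset.sum_ite_eq]; congr 1; simp only [mem_image, mem_filter]; grind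
    rw [e1, hc]; simp
  · push Not at hq; rw [mapDomain_apply_eq]; exact sum_eq_zero fun x hx => if_neg (hq x hx)

end FinsuppKernel

section Acyclic

variable {G : Type*} [Group G] {k : Type*} [CommRing k] {X : Type*} [MulAction G X]

lemma snoc_castSucc_succAbove {A : Type*} {n : ℕ} (p : Fin (n+1) → A) (a : A) (i : Fin (n+1)) :
    (fun l => (snoc p a : Fin (n+2) → A) (i.castSucc.succAbove l)) =
      (snoc (fun l => p (i.succAbove l)) a : Fin (n+1) → A) := by
  funext l; refine Fin.lastCases ?_ (fun l => ?_) l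
  · rw [Fin.succAbove_of_le_castSucc _ _ (Fin.castSucc_le_castSucc_iff.2 (Fin.le_last i)),
      Fin.succ_last, Fin.snoc_last, Fin.snoc_last]
  · rw [Fin.castSucc_succAbove_castSucc, Fin.snoc_castSucc, Fin.snoc_castSucc]

def snocHtpy (σ τ : X → G) (h : k) (n : ℕ) : Bar G k X n →ₗ[k] Bar G k X (n+1) :=
  Finsupp.lift _ k _ fun g =>
    h • (cell k (snoc (partialProd g.1) (σ g.2) : Fin (n+2) → G) g.2 +
      cell k (snoc (partialProd g.1) (τ g.2) : Fin (n+2) → G) g.2)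

lemma cell_snoc {n : ℕ} (h : G) (p : Fin (n+1) → G) (a : G) (x : X) :
    cell k (snoc (fun i => h*p i) (h*a) : Fin (n+2) → G) (h • x) =
      cell k (snoc p a : Fin (n+2) → G) x := by
  rw [← cell_smul k h (snoc p a : Fin (n+2) → G) x]; congr 1; funext i
  refine Fin.lastCases ?_ (fun i => ?_) i <;> simp

lemma snocHtpy_cell {σ τ : X → G} (hσ : ∀ (g : G) x, (σ (g • x) = g*σ x ∧ τ (g • x) = g*τ x) ∨
    (σ (g • x) = g*τ x ∧ τ (g • x) = g*σ x)) (h : k) {n : ℕ} (p : Fin (n+1) → G) (x : X) :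
    snocHtpy σ τ h n (cell k p x) = h • (cell k (snoc p (σ x) : Fin (n+2) → G) x +
        cell k (snoc p (τ x) : Fin (n+2) → G) x) := by
  have e : snocHtpy σ τ h n (cell k p x) =
      h • (cell k (snoc (partialProd (nf p x).1) (σ (nf p x).2) : Fin (n+2) → G) (nf p x).2 +
      cell k (snoc (partialProd (nf p x).1) (τ (nf p x).2) : Fin (n+2) → G) (nf p x).2) := by
    rw [snocHtpy, cell, Finsupp.lift_apply, Finsupp.sum_single_index (by rw [zero_smul]), one_smul]
  have hp : (fun i => p 0*partialProd (nf p x).1 i) = p := funext fun i => partialProd_nf p x i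
  have hx : p 0 • (nf p x).2 = x := by simp [nf]
  rw [e, ← cell_snoc (p 0) (partialProd _), ← cell_snoc (p 0) (partialProd _) (τ _), hp, hx]
  have := hσ (p 0) (nf p x).2; rw [hx] at this; rcases this with ⟨h1, h2⟩ | ⟨h1, h2⟩
  · rw [h1, h2]
  · rw [h1, h2]; exact congrArg (h • ·) (add_comm _ _)

lemma bd_snocHtpy {σ τ : X → G} (hσ : ∀ (g : G) x, (σ (g • x) = g*σ x ∧ τ (g • x) = g*τ x) ∨
    (σ (g • x) = g*τ x ∧ τ (g • x) = g*σ x)) {h : k} (hh : 2*h = 1) {n : ℕ}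
    (c : Bar G k X (n+1)) : bd G k X (n+1) (snocHtpy σ τ h (n+1) c) =
      snocHtpy σ τ h n (bd G k X n c) + ((-1 : ℤ)^(n+2)) • c := by
  refine bar_induction (P := fun c => bd G k X (n+1) (snocHtpy σ τ h (n+1) c) =
      snocHtpy σ τ h n (bd G k X n c) + ((-1 : ℤ)^(n+2)) • c) c (by simp) ?_ ?_
  · intro a b ha hb; simp only [map_add, ha, hb, smul_add]; abel
  · intro r p x; simp only [map_smul, snocHtpy_cell hσ, map_add, bd_cell, map_sum, map_zsmul]
    rw [Fin.sum_univ_castSucc, Fin.sum_univ_castSucc (n := n + 2)]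
    simp_rw [snoc_castSucc_succAbove, Fin.succAbove_last, Fin.snoc_castSucc]
    rw [smul_comm _ r (cell k p x), ← smul_add]; congr 1
    have : cell k p x = h • (cell k p x + cell k p x) := by
      rw [← two_smul k, smul_smul, mul_comm, hh, one_smul]
    conv_rhs => rw [this]
    simp only [val_castSucc, Fin.val_last, smul_add, smul_sum, sum_add_distrib, smul_comm h]; abel

/-- Cycles of positive degree bound if all stabilizers lie in a central group of order two. -/
lemma bounds_of_stabilizer {e : G} (he2 : e*e = 1)
    (hX : ∀ (g : G) (x : X), g • x = x → g = 1 ∨ g = e) {h : k} (hh : 2*h = 1) {n : ℕ}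
    {c : Bar G k X (n+1)} (hc : bd G k X n c = 0) : c ∈ LinearMap.range (bd G k X (n+1)) := by
  have ex : ∀ x : X, ∃ g : G, g • (Quotient.out (Quotient.mk (orbitRel G X) x)) = x := by
    intro x; have := Quotient.mk_out (s := orbitRel G X) x; rw [MulAction.orbitRel_apply] at this
    obtain ⟨g, hg⟩ := this; exact ⟨g⁻¹, by rw [← hg, inv_smul_smul]⟩
  choose σ hσ using ex
  have key : ∀ (g : G) x, σ (g • x) = g*σ x ∨ σ (g • x) = g*(σ x*e) := by
    intro g x
    have hq : Quotient.mk (orbitRel G X) (g • x) = Quotient.mk (orbitRel G X) x :=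
      Quotient.sound (MulAction.orbitRel_apply.2 ⟨g, rfl⟩)
    have h1 := hσ (g • x); rw [hq] at h1
    have h2 : ((g*σ x)⁻¹*σ (g • x)) • (Quotient.out (Quotient.mk (orbitRel G X) x)) =
        Quotient.out (Quotient.mk (orbitRel G X) x) := by
      rw [mul_smul, h1, inv_smul_eq_iff, mul_smul, hσ]
    rcases hX _ _ h2 with h3 | h3
    · left; exact (inv_mul_eq_one.1 h3).symm
    · right; rw [inv_mul_eq_iff_eq_mul] at h3; rw [h3, mul_assoc]
  have hst : ∀ (g : G) x, (σ (g • x) = g*σ x ∧ σ (g • x)*e = g*(σ x*e)) ∨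
      (σ (g • x) = g*(σ x*e) ∧ σ (g • x)*e = g*σ x) := by
    intro g x; rcases key g x with h1 | h1
    · left; exact ⟨h1, by rw [h1, mul_assoc]⟩
    · right; refine ⟨h1, ?_⟩; rw [h1, mul_assoc, mul_assoc, he2, mul_one]
  have hb := bd_snocHtpy (σ := σ) (τ := fun x => σ x*e) hst hh c
  rw [hc, map_zero, zero_add] at hb
  have h2 : c = ((-1 : ℤ)^(n+2)) • ((-1 : ℤ)^(n+2)) • c := by
    rw [smul_smul, ← mul_pow]; simp
  rw [h2, ← hb, ← map_zsmul]; exact ⟨_, rfl⟩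

end Acyclic

section Perm

variable {G : Type*} [Group G] {k : Type*} [CommRing k] {X Y : Type*} [MulAction G X] [MulAction G Y]

lemma prodCongr_zpow {S : Type*} (τ : Equiv.Perm X) (n : ℤ) (x : S × X) :
    ((prodCongr (Equiv.refl S) τ : Equiv.Perm (S × X))^n) x = (x.1, (τ^n) x.2) := by
  induction n using Int.induction_on generalizing x with
  | zero => simp
  | succ n ih => rw [zpow_add_one, zpow_add_one, Equiv.Perm.mul_apply, Equiv.Perm.mul_apply, ih]; rfl
  | pred n ih => rw [zpow_sub_one, zpow_sub_one, Equiv.Perm.mul_apply, Equiv.Perm.mul_apply, ih]; rfl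

lemma exists_of_push_eq_zero {τ : Equiv.Perm X} {f : X → Y}
    (hf : ∀ a b, f a = f b → ∃ n : ℤ, b = (τ^n) a) {n : ℕ} {c : Bar G k X n}
    (hc : push G k f n c = 0) : ∃ a, push G k τ n a - a = c := by
  refine exists_of_mapDomain_eq_zero (τ := prodCongr (Equiv.refl _) τ) (f := Prod.map id f) ?_ hc
  rintro ⟨g, a⟩ ⟨g', b⟩ h; rw [Prod.map_apply, Prod.map_apply, Prod.mk.injEq] at h
  obtain ⟨m, hm⟩ := hf a b h.2
  exact ⟨m, by rw [prodCongr_zpow, Prod.mk.injEq]; exact ⟨h.1.symm, hm⟩⟩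

lemma eq_zero_of_push_eq {τ : Equiv.Perm X} (hτ : ∀ (n : ℤ) s, (τ^n) s = s → n = 0)
    {n : ℕ} {a : Bar G k X n} (ha : push G k τ n a = a) : a = 0 := by
  refine eq_zero_of_mapDomain_eq (τ := prodCongr (Equiv.refl _) τ) ?_ ha; intro m s h
  rw [prodCongr_zpow] at h; exact hτ m s.2 (congrArg Prod.snd h)

/-- Translating the point changes a `0`-chain by a boundary. -/
lemma bd_edge (p : Fin 1 → G) (g : G) (x : X) :
    bd G k X 0 (cell k ![p 0, g⁻¹*p 0] x) = cell k p (g • x) - cell k p x := by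
  rw [bd_cell, Fin.sum_univ_two]
  have h1 : cell k (fun l => (![p 0, g⁻¹*p 0] : Fin 2 → G) ((0 : Fin 2).succAbove l)) x =
      cell k p (g • x) := by
    rw [← cell_smul k g]; congr 1; funext l; fin_cases l; simp
  have h2 : cell k (fun l => (![p 0, g⁻¹*p 0] : Fin 2 → G) ((1 : Fin 2).succAbove l)) x =
      cell k p x := by
    congr 1; funext l; fin_cases l; simp
  rw [h1, h2]; simp [sub_eq_add_neg]

lemma push_sub_mem_of_push_eq_zero (f : X → Y) {n : ℕ} {c : Bar G k X n}
    (hc : push G k f n c = 0) : c ∈ span k {z : Bar G k X n | ∃ g x y, f x = f y ∧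
      z = single (g, y) 1 - single (g, x) 1} := by
  have := mem_span_of_mapDomain_eq_zero _ hc; refine span_mono ?_ this
  rintro _ ⟨⟨g, a⟩, ⟨g', b⟩, h, rfl⟩; rw [Prod.map_apply, Prod.map_apply, Prod.mk.injEq] at h
  obtain rfl : g = g' := h.1; exact ⟨g, a, b, h.2, rfl⟩

end Perm

section Coset

variable {G : Type*} [Group G] {k : Type*} [CommRing k]

/-- `w` carries cosets of `H` to cosets of `H'` by right multiplication. -/
def Nrm (H H' : Subgroup G) (w : G) : Prop := ∀ h ∈ H, w⁻¹*h*w ∈ H'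

def rm (H H' : Subgroup G) (w : G) (x : G ⧸ H) : G ⧸ H' := QuotientGroup.mk (x.out*w)

variable {H H' H'' : Subgroup G} {w w' : G}

lemma rm_mk (hw : Nrm H H' w) (g : G) : rm H H' w (g : G ⧸ H) = ((g*w : G) : G ⧸ H') := by
  obtain ⟨h, hh⟩ := mk_out_eq_mul H g; rw [rm, hh, QuotientGroup.eq]; have := hw _ (H.inv_mem h.2)
  convert this using 1
  group

lemma rm_equivar (hw : Nrm H H' w) : Equivar G (rm H H' w) := by
  intro g x
  induction' x using induction_on with x
  rw [rm_mk hw]; change rm H H' w ((g*x : G) : G ⧸ H) = ((g*(x*w) : G) : G ⧸ H')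
  rw [rm_mk hw, mul_assoc]

lemma rm_rm (hw : Nrm H H' w) (hw' : Nrm H' H'' w') (hww : Nrm H H'' (w*w')) (x : G ⧸ H) :
    rm H' H'' w' (rm H H' w x) = rm H H'' (w*w') x := by
  induction' x using induction_on with x
  rw [rm_mk hw, rm_mk hw', rm_mk hww, mul_assoc]

lemma Nrm.mul (hw : Nrm H H' w) (hw' : Nrm H' H'' w') : Nrm H H'' (w*w') := by
  intro h hh; have := hw' _ (hw h hh); convert this using 1; group

lemma Nrm.of_mem (hw : w ∈ H) : Nrm H H w := fun _ hh => H.mul_mem (H.mul_mem (H.inv_mem hw) hh) hw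

lemma Nrm.of_le (h : H ≤ H') : Nrm H H' 1 := fun x hx => by simpa using h hx

lemma rm_of_mem (hw : w ∈ H) (x : G ⧸ H) : rm H H w x = x := by
  induction' x using induction_on with x
  rw [rm_mk (Nrm.of_mem hw), QuotientGroup.eq]; simpa using hw

variable (k) in
def rmap (H H' : Subgroup G) (w : G) (n : ℕ) : Bar G k (G ⧸ H) n →ₗ[k] Bar G k (G ⧸ H') n :=
  push G k (rm H H' w) n

lemma rmap_rmap (hw : Nrm H H' w) (hw' : Nrm H' H'' w') {n : ℕ} (c : Bar G k (G ⧸ H) n) :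
    rmap k H' H'' w' n (rmap k H H' w n c) = rmap k H H'' (w*w') n c := by
  rw [rmap, rmap, push_push, rmap]; congr 1
  exact congrArg (push G k · n) (funext fun x => rm_rm hw hw' (hw.mul hw') x)

lemma rmap_of_mem (hw : w ∈ H) {n : ℕ} (c : Bar G k (G ⧸ H) n) : rmap k H H w n c = c := by
  have : rm H H w = id := funext fun x => rm_of_mem hw x
  rw [rmap, this, push_id]

lemma bd_rmap (hw : Nrm H H' w) {n : ℕ} (c : Bar G k (G ⧸ H) (n+1)) :
    bd G k _ n (rmap k H H' w (n+1) c) = rmap k H H' w n (bd G k _ n c) :=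
  bd_push (rm_equivar hw) c

lemma rmap_surjective (h : H ≤ H') (n : ℕ) : Function.Surjective (rmap k H H' 1 n) := by
  refine push_surjective (fun x => ?_) n
  induction' x using induction_on with x
  exact ⟨x, by rw [rm_mk (Nrm.of_le h), mul_one]⟩

def rmPerm (H : Subgroup G) (t : G) (ht : Nrm H H t) (ht' : Nrm H H t⁻¹) : Equiv.Perm (G ⧸ H) where
  toFun := rm H H t
  invFun := rm H H t⁻¹
  left_inv x := by rw [rm_rm ht ht' (ht.mul ht'), rm_of_mem (by simp)]
  right_inv x := by rw [rm_rm ht' ht (ht'.mul ht), rm_of_mem (by simp)]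

lemma rmPerm_zpow (t : G) (ht : Nrm H H t) (ht' : Nrm H H t⁻¹) (n : ℤ) (g : G) :
    (rmPerm H t ht ht'^n) (g : G ⧸ H) = ((g*t^n : G) : G ⧸ H) := by
  induction n using Int.induction_on generalizing g with
  | zero => simp
  | succ n ih =>
    rw [zpow_add_one, Equiv.Perm.mul_apply]; change (rmPerm H t ht ht'^(n : ℤ)) (rm H H t g) = _
    rw [rm_mk ht, ih, mul_assoc, add_comm (n : ℤ) 1, zpow_one_add]
  | pred n ih =>
    rw [zpow_sub_one, Equiv.Perm.mul_apply]
    change (rmPerm H t ht ht'^(-(n : ℤ))) (rm H H t⁻¹ g) = _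
    rw [rm_mk ht', ih, mul_assoc, sub_eq_add_neg, add_comm (-(n : ℤ)) (-1), zpow_add, zpow_neg_one]

/-- `H'` is generated over `H` by the element `t`, which has infinite order modulo `H`. -/
structure CyclicOver (H H' : Subgroup G) (t : G) : Prop where
  le : H ≤ H'
  nrm : Nrm H H t
  nrm_inv : Nrm H H t⁻¹
  mem : t ∈ H'
  exists_zpow : ∀ g ∈ H', ∃ n : ℤ, ∃ h ∈ H, g = t^n*h
  free : ∀ n : ℤ, t^n ∈ H → n = 0

variable {t : G}

lemma CyclicOver.exists_of_rmap (hc : CyclicOver H H' t) {n : ℕ} {c : Bar G k (G ⧸ H) n}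
    (h : rmap k H H' 1 n c = 0) : ∃ a, rmap k H H t n a - a = c := by
  refine exists_of_push_eq_zero (τ := rmPerm H t hc.nrm hc.nrm_inv) (f := rm H H' 1) ?_ h
  intro a b hab
  induction' a using induction_on with a
  induction' b using induction_on with b
  rw [rm_mk (Nrm.of_le hc.le), rm_mk (Nrm.of_le hc.le), mul_one, mul_one, QuotientGroup.eq] at hab
  obtain ⟨m, h, hh, e⟩ := hc.exists_zpow _ hab; refine ⟨m, ?_⟩; rw [rmPerm_zpow, QuotientGroup.eq]
  have : b⁻¹*(a*t^m) = h⁻¹ := by rw [eq_inv_iff_mul_eq_one, mul_assoc, mul_assoc, ← e]; group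
  rw [this]; exact H.inv_mem hh

lemma CyclicOver.eq_zero_of_rmap (hc : CyclicOver H H' t) {n : ℕ} {a : Bar G k (G ⧸ H) n}
    (h : rmap k H H t n a = a) : a = 0 := by
  refine eq_zero_of_push_eq (τ := rmPerm H t hc.nrm hc.nrm_inv) ?_ h; intro m s hs
  induction' s using induction_on with g
  rw [rmPerm_zpow, eq_comm, QuotientGroup.eq] at hs; exact hc.free m (by simpa using hs)

lemma CyclicOver.rmap_rmap_sub (hc : CyclicOver H H' t) {n : ℕ} (a : Bar G k (G ⧸ H) n) :
    rmap k H H' 1 n (rmap k H H t n a - a) = 0 := by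
  have : Nrm H' H' t := Nrm.of_mem hc.mem
  rw [map_sub, rmap_rmap hc.nrm (Nrm.of_le hc.le), sub_eq_zero, mul_one,
    ← rmap_of_mem (H := H') hc.mem (rmap k H H' 1 n a), rmap_rmap (Nrm.of_le hc.le) this, one_mul]

def IsCyc {X : Type*} [MulAction G X] : ∀ {n : ℕ}, Bar G k X n → Prop
  | 0, _ => True
  | n + 1, c => bd G k X n c = 0

variable {X Y : Type*} [MulAction G X] [MulAction G Y]

lemma IsCyc.bd {n : ℕ} (c : Bar G k X (n+1)) : IsCyc (bd G k X n c) := by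
  cases n with
  | zero => trivial
  | succ n => exact bd_bd c

lemma IsCyc.push {f : X → Y} (hf : Equivar G f) {n : ℕ} {c : Bar G k X n} (h : IsCyc c) :
    IsCyc (push G k f n c) := by
  cases n with
  | zero => trivial
  | succ n => change _root_.bd G k Y n _ = 0; rw [bd_push hf, show _root_.bd G k X n c = 0 from h, map_zero]

lemma IsCyc.add {n : ℕ} {c c' : Bar G k X n} (h : IsCyc c) (h' : IsCyc c') : IsCyc (c + c') := by
  cases n with
  | zero => trivial
  | succ n =>
    change _root_.bd G k X n _ = 0
    rw [map_add, show _root_.bd G k X n c = 0 from h, show _root_.bd G k X n c' = 0 from h', add_zero]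

lemma IsCyc.smul {n : ℕ} {c : Bar G k X n} (h : IsCyc c) (r : k) : IsCyc (r • c) := by
  cases n with
  | zero => trivial
  | succ n =>
    change _root_.bd G k X n _ = 0; rw [map_smul, show _root_.bd G k X n c = 0 from h, smul_zero]

lemma CyclicOver.isCyc (hc : CyclicOver H H' t) {n : ℕ} {a : Bar G k (G ⧸ H) n}
    (h : IsCyc (rmap k H H t n a - a)) : IsCyc a := by
  cases n with
  | zero => trivial
  | succ n =>
    change _root_.bd G k _ n _ = 0 at h; rw [map_sub, bd_rmap hc.nrm, sub_eq_zero] at h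
    exact hc.eq_zero_of_rmap h

abbrev Bd (G k X : Type*) [Group G] [CommRing k] [MulAction G X] (n : ℕ) :
    Submodule k (Bar G k X n) := LinearMap.range (bd G k X n)

lemma push_mem_Bd {f : X → Y} (hf : Equivar G f) {n : ℕ} {c : Bar G k X n} (h : c ∈ Bd G k X n) :
    push G k f n c ∈ Bd G k Y n := by
  obtain ⟨y, rfl⟩ := h; exact ⟨push G k f (n+1) y, bd_push hf y⟩

lemma rmap_mem_Bd (hw : Nrm H H' w) {n : ℕ} {c : Bar G k (G ⧸ H) n} (h : c ∈ Bd G k (G ⧸ H) n) :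
    rmap k H H' w n c ∈ Bd G k (G ⧸ H') n := push_mem_Bd (rm_equivar hw) h

end Coset

section Torus

variable {G : Type*} [Group G] {k : Type*} [CommRing k]

/-- `w` inverts the commutative group `A`, and both normalize `H`. -/
structure Inverts (H : Subgroup G) (w : G) (A : Subgroup G) : Prop where
  nrm : Nrm H H w
  nrm_of_mem : ∀ a ∈ A, Nrm H H a
  sq_mem : w*w ∈ H
  conj : ∀ a ∈ A, a*w = w*a⁻¹
  comm : ∀ a ∈ A, ∀ b ∈ A, a*b = b*a

/-- On homology `w` acts by the parity of the degree, `A` acts trivially, and there is no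
torsion. -/
structure Rigid (k : Type*) [CommRing k] (H : Subgroup G) (w : G) (A : Subgroup G) : Prop where
  sign : ∀ (n : ℕ) (z : Bar G k (G ⧸ H) n), IsCyc z →
    rmap k H H w n z - ((-1 : ℤ)^n) • z ∈ Bd G k (G ⧸ H) n
  trivial_of_mem : ∀ a ∈ A, ∀ (n : ℕ) (z : Bar G k (G ⧸ H) n), IsCyc z →
    rmap k H H a n z - z ∈ Bd G k (G ⧸ H) n
  torsion_free : ∀ (m : ℕ), m ≠ 0 → ∀ (n : ℕ) (z : Bar G k (G ⧸ H) n), IsCyc z →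
    m • z ∈ Bd G k (G ⧸ H) n → z ∈ Bd G k (G ⧸ H) n

lemma mem_of_add_self_mem {M : Type*} [AddCommGroup M] [Module k M] {h : k} (hh : 2*h = 1)
    {B : Submodule k M} {x : M} (hx : x + x ∈ B) : x ∈ B := by
  have := B.smul_mem h hx; rwa [← two_smul k, smul_smul, mul_comm, hh, one_smul] at this

variable {H H' : Subgroup G} {w t : G} {A : Subgroup G}

lemma IsCyc.sub {X : Type*} [MulAction G X] {n : ℕ} {c c' : Bar G k X n} (h : IsCyc c)
    (h' : IsCyc c') : IsCyc (c - c') := by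
  have := h.add (h'.smul (-1)); rwa [neg_one_smul, ← sub_eq_add_neg] at this

lemma IsCyc.zsmul {X : Type*} [MulAction G X] {n : ℕ} {c : Bar G k X n} (h : IsCyc c) (m : ℤ) :
    IsCyc (m • c) := by
  have := h.smul (m : k); rwa [Int.cast_smul_eq_zsmul] at this

lemma IsCyc.rmap {n : ℕ} {c : Bar G k (G ⧸ H) n} (h : IsCyc c) (hw : Nrm H H' w) :
    IsCyc (rmap k H H' w n c) := h.push (rm_equivar hw)

lemma CyclicOver.exists_defect (hc : CyclicOver H H' t) {s : G} (hs : Nrm H H s) (hs' : Nrm H' H' s)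
    {ε : ℤ} {n : ℕ}
    (ih : ∀ a' : Bar G k (G ⧸ H) n, IsCyc a' → ∃ b, rmap k H H s n (rmap k H H t n a' - a') =
      rmap k H H t n b - b ∧ b - ε • a' ∈ Bd G k (G ⧸ H) n)
    (ih' : ∀ c : Bar G k (G ⧸ H) (n+1), IsCyc c →
      rmap k H H s (n+1) c - ε • c ∈ Bd G k (G ⧸ H) (n+1))
    (z : Bar G k (G ⧸ H') (n+1)) (hz : IsCyc z) :
    rmap k H' H' s (n+1) (rmap k H' H' s (n+1) z - ε • z) -
      ε • (rmap k H' H' s (n+1) z - ε • z) ∈ Bd G k (G ⧸ H') (n+1) := by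
  obtain ⟨a, rfl⟩ := rmap_surjective (k := k) hc.le (n+1) z
  have h1 : Nrm H H' 1 := Nrm.of_le hc.le
  have h0 : rmap k H H' 1 n (bd G k _ n a) = 0 := by rw [← bd_rmap h1]; exact hz
  obtain ⟨a', ha'⟩ := hc.exists_of_rmap h0
  have ca' : IsCyc a' := hc.isCyc (by rw [ha']; exact IsCyc.bd a)
  obtain ⟨b, hb, e, he⟩ := ih a' ca'
  set c := rmap k H H s (n+1) a - ε • a - (rmap k H H t (n+1) e - e) with hcdef
  have cyc : IsCyc c := by
    change bd G k _ n c = 0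
    rw [hcdef, map_sub, map_sub, map_sub, bd_rmap hs, bd_rmap hc.nrm, map_zsmul, ← ha', hb, he,
      map_sub, map_zsmul, smul_sub]
    abel
  have comm : ∀ x, rmap k H' H' s (n+1) (rmap k H H' 1 (n+1) x) =
      rmap k H H' 1 (n+1) (rmap k H H s (n+1) x) := fun x => by
    rw [rmap_rmap h1 hs', rmap_rmap hs h1, one_mul, mul_one]
  have pc : rmap k H H' 1 (n+1) c =
      rmap k H' H' s (n+1) (rmap k H H' 1 (n+1) a) - ε • rmap k H H' 1 (n+1) a := by
    rw [hcdef, map_sub, hc.rmap_rmap_sub, sub_zero, map_sub, comm, map_zsmul]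
  have := rmap_mem_Bd h1 (ih' c cyc); rwa [map_sub, map_zsmul, ← comm, pc] at this

lemma Rigid.step (hR : Rigid k H w A) {h : k} (hh : 2*h = 1) (hI : Inverts H w A)
    (hI' : Inverts H' w A) (hc : CyclicOver H H' t) (ht : t ∈ A) : Rigid k H' w A := by
  have h1 : Nrm H H' 1 := Nrm.of_le hc.le
  have comm : ∀ {s : G}, Nrm H H s → Nrm H' H' s → ∀ (n : ℕ) x, rmap k H' H' s n (rmap k H H' 1 n x) =
      rmap k H H' 1 n (rmap k H H s n x) := fun hs hs' n x => by
    rw [rmap_rmap h1 hs', rmap_rmap hs h1, one_mul, mul_one]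
  have sq : ∀ (n : ℕ) z, rmap k H' H' w n (rmap k H' H' w n z) = z := fun n z => by
    rw [rmap_rmap hI'.nrm hI'.nrm, rmap_of_mem hI'.sq_mem]
  have ee : ∀ n : ℕ, ((-1 : ℤ)^n)*(-1)^n = 1 := fun n => by rw [← mul_pow]; simp
  have hsign : ∀ (n : ℕ) (z : Bar G k (G ⧸ H') n), IsCyc z →
      rmap k H' H' w n z - ((-1 : ℤ)^n) • z ∈ Bd G k (G ⧸ H') n := by
    intro n z hz
    cases n with
    | zero =>
      obtain ⟨a, rfl⟩ := rmap_surjective (k := k) hc.le 0 z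
      have := rmap_mem_Bd h1 (hR.sign 0 a trivial)
      rwa [map_sub, map_zsmul, ← comm hI.nrm hI'.nrm] at this
    | succ n =>
      have key := hc.exists_defect hI.nrm hI'.nrm (ε := (-1)^(n+1)) (fun a' ca' => by
        refine ⟨-rmap k H H (w*t⁻¹) n a', ?_, ?_⟩
        · have hn := hI.nrm.mul hc.nrm_inv
          rw [map_neg, map_sub, rmap_rmap hc.nrm hI.nrm, rmap_rmap hn hc.nrm,
            inv_mul_cancel_right, hI.conj t ht]
          abel
        · have e1 := rmap_mem_Bd hc.nrm_inv (hR.sign n a' ca')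
          have e2 := hR.trivial_of_mem t⁻¹ (A.inv_mem ht) n a' ca'
          rw [map_sub, map_zsmul, rmap_rmap hI.nrm hc.nrm_inv] at e1
          have e3 := Submodule.neg_mem _ (Submodule.add_mem _ e1
            (smul_of_tower_mem _ ((-1 : ℤ)^n) e2))
          convert e3 using 1
          rw [pow_succ, smul_sub]; simp only [mul_neg, mul_one, neg_smul]; abel)
        (fun c => hR.sign (n+1) c) z hz
      rw [map_sub, map_zsmul, sq, smul_sub, smul_smul, ee] at key
      have k2 := mem_of_add_self_mem hh (B := Bd G k (G ⧸ H') (n+1))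
        (x := z - ((-1 : ℤ)^(n+1)) • rmap k H' H' w (n+1) z) (by
          convert key using 1; rw [one_smul]; abel)
      have k3 := smul_of_tower_mem _ (-((-1 : ℤ)^(n+1))) k2; convert k3 using 1
      rw [smul_sub, smul_smul, neg_mul, ee]; simp only [neg_smul, one_smul]; abel
  refine ⟨hsign, ?_, ?_⟩
  · intro s hs n z hz; have ns := hI.nrm_of_mem s hs; have ns' := hI'.nrm_of_mem s hs
    have nsi' := hI'.nrm_of_mem s⁻¹ (A.inv_mem hs)
    cases n with
    | zero =>
      obtain ⟨a, rfl⟩ := rmap_surjective (k := k) hc.le 0 z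
      have := rmap_mem_Bd h1 (hR.trivial_of_mem s hs 0 a trivial)
      rwa [map_sub, ← comm ns ns'] at this
    | succ n =>
      have key := hc.exists_defect ns ns' (ε := 1) (fun a' ca' => by
        refine ⟨rmap k H H s n a', ?_, ?_⟩
        · rw [map_sub, rmap_rmap hc.nrm ns, rmap_rmap ns hc.nrm, hI.comm t ht s hs]
        · rw [one_smul]; exact hR.trivial_of_mem s hs n a' ca')
        (fun c hcc => by rw [one_smul]; exact hR.trivial_of_mem s hs (n+1) c hcc) z hz
      rw [one_smul, one_smul, map_sub, rmap_rmap ns' ns'] at key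
      -- `s` and its inverse agree on homology, because `w` interchanges them
      have a1 := hsign (n+1) _ (hz.rmap ns'); have a2 := rmap_mem_Bd nsi' (hsign (n+1) z hz)
      rw [map_sub, map_zsmul, rmap_rmap hI'.nrm nsi', ← hI'.conj s hs] at a2
      rw [rmap_rmap ns' hI'.nrm] at a1
      have a3 := smul_of_tower_mem _ ((-1 : ℤ)^(n+1)) (Submodule.sub_mem _ a2 a1)
      have a4 : rmap k H' H' s (n+1) z - rmap k H' H' s⁻¹ (n+1) z ∈ Bd G k (G ⧸ H') (n+1) := by
        convert a3 using 1
        rw [sub_sub_sub_cancel_left, smul_sub, smul_smul, smul_smul, ee, one_smul, one_smul]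
      have a5 := rmap_mem_Bd ns' a4
      rw [map_sub, rmap_rmap ns' ns', rmap_rmap nsi' ns', inv_mul_cancel,
        rmap_of_mem (Subgroup.one_mem _)] at a5
      refine mem_of_add_self_mem hh ?_; have a6 := Submodule.sub_mem _ a5 key
      convert a6 using 1; abel
  · intro m hm n z hz hmz
    obtain ⟨a, ha, rfl⟩ : ∃ a : Bar G k (G ⧸ H) n, IsCyc a ∧ rmap k H H' 1 n a = z := by
      cases n with
      | zero =>
        obtain ⟨a, rfl⟩ := rmap_surjective (k := k) hc.le 0 z; exact ⟨a, trivial, rfl⟩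
      | succ n =>
        obtain ⟨a, rfl⟩ := rmap_surjective (k := k) hc.le (n+1) z
        have h0 : rmap k H H' 1 n (bd G k _ n a) = 0 := by rw [← bd_rmap h1]; exact hz
        obtain ⟨a', ha'⟩ := hc.exists_of_rmap h0
        have ca' : IsCyc a' := hc.isCyc (by rw [ha']; exact IsCyc.bd a); obtain ⟨b', hb'⟩ := hmz
        obtain ⟨b, rfl⟩ := rmap_surjective (k := k) hc.le (n+2) b'
        have h2 : rmap k H H' 1 (n+1) (m • a - bd G k _ (n+1) b) = 0 := by
          rw [map_sub, map_nsmul, ← bd_rmap h1, hb', sub_self]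
        obtain ⟨f, hf⟩ := hc.exists_of_rmap h2
        have h3 : m • a' = bd G k _ n f := by
          rw [← sub_eq_zero]; apply hc.eq_zero_of_rmap; rw [← sub_eq_zero]
          have e1 := congrArg (bd G k (G ⧸ H) n) hf
          rw [map_sub, bd_rmap hc.nrm, map_sub, bd_bd, sub_zero, map_nsmul, ← ha', smul_sub] at e1
          rw [map_sub, map_nsmul]; rw [← sub_eq_zero] at e1; rw [← neg_eq_zero, ← e1]; abel
        obtain ⟨f', hf'⟩ := hR.torsion_free m hm n a' ca' ⟨f, h3.symm⟩
        refine ⟨a - (rmap k H H t (n+1) f' - f'), ?_, ?_⟩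
        · change bd G k _ n _ = 0; rw [map_sub, map_sub, bd_rmap hc.nrm, hf', ha', sub_self]
        · rw [map_sub, hc.rmap_rmap_sub, sub_zero]
    obtain ⟨b', hb'⟩ := hmz; obtain ⟨b, rfl⟩ := rmap_surjective (k := k) hc.le (n+1) b'
    have h2 : rmap k H H' 1 n (m • a - bd G k _ n b) = 0 := by
      rw [map_sub, map_nsmul, ← bd_rmap h1, hb', sub_self]
    obtain ⟨f, hf⟩ := hc.exists_of_rmap h2
    have cf : IsCyc f := hc.isCyc (by
      rw [hf, ← natCast_zsmul]; exact (ha.zsmul _).sub (IsCyc.bd b))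
    have h3 := Submodule.add_mem _ (hR.trivial_of_mem t ht n f cf) ⟨b, rfl⟩
    rw [hf, sub_add_cancel] at h3; exact rmap_mem_Bd h1 (hR.torsion_free m hm n a ha h3)

end Torus

section Relative

variable {G : Type*} [Group G] {k : Type*} [CommRing k] {H H' V V' : Subgroup G} {t : G}

/-- The kernel of the chain map induced by `G ⧸ H → G ⧸ V` is acyclic. -/
def RelAcyclic (k : Type*) [CommRing k] (H V : Subgroup G) : Prop :=
  ∀ (n : ℕ) (z : Bar G k (G ⧸ H) n), IsCyc z → rmap k H V 1 n z = 0 →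
    ∃ y : Bar G k (G ⧸ H) (n+1), rmap k H V 1 (n+1) y = 0 ∧ bd G k _ n y = z

structure CyclicSquare (H H' V V' : Subgroup G) (t : G) : Prop where
  left : CyclicOver H H' t
  right : CyclicOver V V' t
  le : H ≤ V
  le' : H' ≤ V'

namespace CyclicSquare

lemma comm (hs : CyclicSquare H H' V V' t) {n : ℕ} (c : Bar G k (G ⧸ H) n) :
    rmap k H V 1 n (rmap k H H t n c) = rmap k V V t n (rmap k H V 1 n c) := by
  rw [rmap_rmap hs.left.nrm (Nrm.of_le hs.le), rmap_rmap (Nrm.of_le hs.le) hs.right.nrm,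
    mul_one, one_mul]

lemma comm_proj (hs : CyclicSquare H H' V V' t) {n : ℕ} (c : Bar G k (G ⧸ H) n) :
    rmap k H' V' 1 n (rmap k H H' 1 n c) = rmap k V V' 1 n (rmap k H V 1 n c) := by
  rw [rmap_rmap (Nrm.of_le hs.left.le) (Nrm.of_le hs.le'),
    rmap_rmap (Nrm.of_le hs.le) (Nrm.of_le hs.right.le)]

lemma rel_sub (hs : CyclicSquare H H' V V' t) {n : ℕ} {c : Bar G k (G ⧸ H) n}
    (hc : rmap k H V 1 n c = 0) : rmap k H V 1 n (rmap k H H t n c - c) = 0 := by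
  rw [map_sub, hs.comm, hc, map_zero, sub_zero]

lemma rel_proj (hs : CyclicSquare H H' V V' t) {n : ℕ} {c : Bar G k (G ⧸ H) n}
    (hc : rmap k H V 1 n c = 0) : rmap k H' V' 1 n (rmap k H H' 1 n c) = 0 := by
  rw [hs.comm_proj, hc, map_zero]

lemma exists_lift (hs : CyclicSquare H H' V V' t) {n : ℕ} {z : Bar G k (G ⧸ H') n}
    (hz : rmap k H' V' 1 n z = 0) :
    ∃ a : Bar G k (G ⧸ H) n, rmap k H V 1 n a = 0 ∧ rmap k H H' 1 n a = z := by
  obtain ⟨a, rfl⟩ := rmap_surjective (k := k) hs.left.le n z; rw [hs.comm_proj] at hz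
  obtain ⟨u, hu⟩ := hs.right.exists_of_rmap hz
  obtain ⟨u, rfl⟩ := rmap_surjective (k := k) hs.le n u; refine ⟨a - (rmap k H H t n u - u), ?_, ?_⟩
  · rw [map_sub, map_sub, hs.comm, hu, sub_self]
  · rw [map_sub, hs.left.rmap_rmap_sub, sub_zero]

lemma exists_of_rmap (hs : CyclicSquare H H' V V' t) {n : ℕ} {a : Bar G k (G ⧸ H) n}
    (h0 : rmap k H V 1 n a = 0) (h : rmap k H H' 1 n a = 0) :
    ∃ a', rmap k H V 1 n a' = 0 ∧ rmap k H H t n a' - a' = a := by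
  obtain ⟨a', rfl⟩ := hs.left.exists_of_rmap h; refine ⟨a', hs.right.eq_zero_of_rmap ?_, rfl⟩
  rwa [map_sub, hs.comm, sub_eq_zero] at h0

/-- Acyclicity passes to the cyclic quotient, given that the operator `t - 1` is surjective on
relative homology and injective there. -/
lemma relAcyclic_of (hs : CyclicSquare H H' V V' t)
    (surj : ∀ (n : ℕ) (z : Bar G k (G ⧸ H) n), IsCyc z → rmap k H V 1 n z = 0 →
      ∃ u y, rmap k H V 1 (n+1) y = 0 ∧ bd G k _ n y = z - (rmap k H H t n u - u))
    (inj : ∀ (n : ℕ) (z : Bar G k (G ⧸ H) n), IsCyc z → rmap k H V 1 n z = 0 →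
      (∃ y, rmap k H V 1 (n+1) y = 0 ∧ bd G k _ n y = rmap k H H t n z - z) →
      ∃ y, rmap k H V 1 (n+1) y = 0 ∧ bd G k _ n y = z) : RelAcyclic k H' V' := by
  have hHH := Nrm.of_le hs.left.le; intro n z hz hz0
  obtain ⟨a, ha0, ha, rfl⟩ : ∃ a, rmap k H V 1 n a = 0 ∧ IsCyc a ∧ rmap k H H' 1 n a = z := by
    obtain ⟨a, h1, h2⟩ := hs.exists_lift hz0
    cases n with
    | zero => exact ⟨a, h1, trivial, h2⟩
    | succ n =>
      obtain ⟨a', h5, h6⟩ := hs.exists_of_rmap (a := bd G k _ n a)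
        (by rw [← bd_rmap (Nrm.of_le hs.le), h1, map_zero]) (by rw [← bd_rmap hHH, h2]; exact hz)
      have ca' : IsCyc a' := hs.left.isCyc (by rw [h6]; exact IsCyc.bd a)
      obtain ⟨e, he, hb⟩ := inj n a' ca' h5 ⟨a, h1, h6.symm⟩
      refine ⟨a - (rmap k H H t (n+1) e - e), ?_, ?_, ?_⟩
      · rw [map_sub, h1, hs.rel_sub he, sub_zero]
      · change bd G k _ n _ = 0; rw [map_sub, map_sub, bd_rmap hs.left.nrm, hb, h6, sub_self]
      · rw [map_sub, hs.left.rmap_rmap_sub, sub_zero, h2]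
  obtain ⟨u, y, hy, hb⟩ := surj n a ha ha0; refine ⟨rmap k H H' 1 (n+1) y, hs.rel_proj hy, ?_⟩
  rw [bd_rmap hHH, hb, map_sub, hs.left.rmap_rmap_sub, sub_zero]

lemma relAcyclic_step (hs : CyclicSquare H H' V V' t) (h : RelAcyclic k H V) : RelAcyclic k H' V' :=
  hs.relAcyclic_of (fun n z hz h0 => by
    obtain ⟨y, h1, h2⟩ := h n z hz h0
    exact ⟨0, y, h1, by rw [h2]; simp⟩) (fun n z hz h0 _ => h n z hz h0)

lemma relAcyclic_base (hs : CyclicSquare H H' V V' t)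
    (pos : ∀ (n : ℕ) (z : Bar G k (G ⧸ H) (n+1)), IsCyc z → rmap k H V 1 (n+1) z = 0 →
      ∃ y, rmap k H V 1 (n+2) y = 0 ∧ bd G k _ (n+1) y = z) {c c' : k} (hc : c'*c = 1)
    (zero : ∀ z : Bar G k (G ⧸ H) 0, rmap k H V 1 0 z = 0 →
      ∃ y, rmap k H V 1 1 y = 0 ∧ bd G k _ 0 y = rmap k H H t 0 z - z - c • z) :
    RelAcyclic k H' V' := by
  refine hs.relAcyclic_of ?_ ?_
  · intro n z hz h0
    cases n with
    | succ n =>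
      obtain ⟨y, h1, h2⟩ := pos n z hz h0; exact ⟨0, y, h1, by rw [h2]; simp⟩
    | zero =>
      obtain ⟨y, h1, h2⟩ := zero (c' • z) (by rw [map_smul, h0, smul_zero])
      refine ⟨c' • z, -y, by rw [map_neg, h1, neg_zero], ?_⟩
      rw [map_neg, h2, smul_smul, mul_comm, hc, one_smul]; abel
  · rintro n z hz h0 ⟨y, h1, h2⟩
    cases n with
    | succ n => exact pos n z hz h0
    | zero =>
      obtain ⟨y', h1', h2'⟩ := zero z h0
      refine ⟨c' • (y - y'), by rw [map_smul, map_sub, h1, h1', sub_zero, smul_zero], ?_⟩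
      rw [map_smul, map_sub, h2, h2', sub_sub_cancel, smul_smul, hc, one_smul]

end CyclicSquare

variable {X : Type*} [MulAction G X]

variable (G k) in
def pt (x : X) : Bar G k X 0 := cell k (fun _ => (1 : G)) x

lemma single_eq_pt (g : Fin 0 → G) (x : X) : (single (g, x) 1 : Bar G k X 0) = pt G k x := by
  rw [pt, cell]; congr 1; ext
  · rename_i i; exact i.elim0
  · simp [nf]

lemma push_pt {Y : Type*} [MulAction G Y] {f : X → Y} (hf : Equivar G f) (x : X) :
    push G k f 0 (pt G k x) = pt G k (f x) := push_cell hf _ x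

lemma pt_smul_sub_mem (g : G) (x : X) : pt G k (g • x) - pt G k x ∈ Bd G k X 0 :=
  ⟨_, bd_edge (fun _ => 1) g x⟩

lemma zero_chain_induction {P : Bar G k X 0 → Prop} (c : Bar G k X 0) (zero : P 0)
    (add : ∀ a b, P a → P b → P (a+b)) (smul : ∀ (r : k) x, P (r • pt G k x)) : P c := by
  induction c using Finsupp.induction_linear with
  | zero => exact zero
  | add a b ha hb => exact add a b ha hb
  | single g r =>
    have := smul r g.2; rwa [← single_eq_pt g.1, Finsupp.smul_single, smul_eq_mul, mul_one] at this

lemma zero_chain_ext {M : Type*} [AddCommGroup M] [Module k M] {f g : Bar G k X 0 →ₗ[k] M}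
    (h : ∀ x, f (pt G k x) = g (pt G k x)) : f = g := by
  refine LinearMap.ext fun c => zero_chain_induction (P := fun c => f c = g c) c (by simp)
    (fun a b ha hb => by rw [map_add, map_add, ha, hb]) (fun r x => by rw [map_smul, map_smul, h])

lemma translate_mem {Y : Type*} [MulAction G Y] {f : X → Y} (hf : Equivar G f) (h : G) {x y : X}
    (hxy : f x = f y) : pt G k (h • y) - pt G k (h • x) - (pt G k y - pt G k x) ∈
      Submodule.map (bd G k X 0) (ker (push G k f 1)) := by
  refine ⟨cell k ![1, h⁻¹*1] y - cell k ![1, h⁻¹*1] x, ?_, ?_⟩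
  · rw [mem_coe, mem_ker, map_sub, push_cell hf, push_cell hf, hxy, sub_self]
  · rw [map_sub]
    erw [bd_edge (k := k) (fun _ => (1 : G)) h y, bd_edge (k := k) (fun _ => (1 : G)) h x]
    simp only [pt]; abel

variable (G k X) in
abbrev coeffSum : Bar G k X 0 →ₗ[k] k := Finsupp.lsum k fun _ => LinearMap.id

lemma zero_chain_transitive (x0 : X) (htr : ∀ x : X, ∃ g : G, g • x0 = x) (c : Bar G k X 0) :
    c - coeffSum G k X c • pt G k x0 ∈ Bd G k X 0 := by
  refine zero_chain_induction (P := fun c => c - coeffSum G k X c • pt G k x0 ∈ Bd G k X 0) c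
    (by simp) ?_ ?_
  · intro a b ha hb; convert Submodule.add_mem _ ha hb using 1; rw [map_add, add_smul]; abel
  · intro r x; obtain ⟨g, rfl⟩ := htr x
    have : coeffSum G k X (r • pt G k (g • x0)) = r := by rw [map_smul, pt, cell]; simp
    rw [this, ← smul_sub]; exact Submodule.smul_mem _ _ (pt_smul_sub_mem g x0)

lemma sum_coeff_bd (c : Bar G k X 1) : coeffSum G k X (bd G k X 0 c) = 0 := by
  have : coeffSum G k X ∘ₗ bd G k X 0 = 0 := by
    apply bar_hom_ext; intro p x
    rw [comp_apply, bd_cell, Fin.sum_univ_two, map_add, map_zsmul, map_zsmul]; simp [cell]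
  exact LinearMap.congr_fun this c

lemma Rigid.of_acyclic [NoZeroDivisors k] [CharZero k] {w : G} {A : Subgroup G} (hI : Inverts H w A)
    (pos : ∀ (n : ℕ) (z : Bar G k (G ⧸ H) (n+1)), IsCyc z → z ∈ Bd G k (G ⧸ H) (n+1)) :
    Rigid k H w A := by
  have tr : ∀ x : G ⧸ H, ∃ g : G, g • ((1 : G) : G ⧸ H) = x := fun x => by
    induction' x using induction_on with x
    exact ⟨x, by change ((x*1 : G) : G ⧸ H) = _; rw [mul_one]⟩
  have zero : ∀ s : G, Nrm H H s → ∀ z : Bar G k (G ⧸ H) 0, rmap k H H s 0 z - z ∈ Bd G k (G ⧸ H) 0 := by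
    intro s hs z
    refine zero_chain_induction (P := fun z => rmap k H H s 0 z - z ∈ Bd G k (G ⧸ H) 0) z (by simp) ?_ ?_
    · intro a b ha hb; convert Submodule.add_mem _ ha hb using 1; rw [map_add]; abel
    · intro r x; rw [map_smul, ← smul_sub]; apply Submodule.smul_mem
      rw [rmap, push_pt (rm_equivar hs)]
      induction' x using induction_on with x
      rw [rm_mk hs]; have := pt_smul_sub_mem (k := k) (x*s*x⁻¹) (x : G ⧸ H)
      rwa [smul_coe, smul_eq_mul, inv_mul_cancel_right] at this
  refine ⟨fun n z hz => ?_, fun a ha n z hz => ?_, fun m hm n z hz h => ?_⟩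
  · cases n with
    | zero => rw [pow_zero, one_smul]; exact zero w hI.nrm z
    | succ n => exact pos n _ ((hz.rmap hI.nrm).sub (hz.zsmul _))
  · cases n with
    | zero => exact zero a (hI.nrm_of_mem a ha) z
    | succ n => exact pos n _ ((hz.rmap (hI.nrm_of_mem a ha)).sub hz)
  · cases n with
    | succ n => exact pos n _ hz
    | zero =>
      obtain ⟨b, hb⟩ := h; have h1 := sum_coeff_bd b
      rw [hb, map_nsmul, nsmul_eq_mul, mul_eq_zero, Nat.cast_eq_zero, or_iff_right hm] at h1
      have h2 := zero_chain_transitive _ tr z; rwa [h1, zero_smul, sub_zero] at h2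

end Relative

section Unipotent

variable {G : Type*} [Group G] {k : Type*} [CommRing k] {H V : Subgroup G}

/-- `V` is the extension of `H` by a divisible group `un`, on which `t` acts with multiplier `9`. -/
structure UnipotentOver (H V : Subgroup G) (un : ℚ → G) (t : G) : Prop where
  le : H ≤ V
  add : ∀ a b, un (a+b) = un a*un b
  nrm : ∀ b, Nrm H H (un b)
  mem : ∀ b, un b ∈ V
  exists_mul : ∀ g ∈ V, ∃ b, ∃ h ∈ H, g = un b*h
  free : ∀ b, un b ∈ H → b = 0
  conj : ∀ b, un b*t = t*un (9*b)

namespace UnipotentOver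

variable {un : ℚ → G} {t : G}

lemma un_zero (hu : UnipotentOver H V un t) : un 0 = 1 := by simpa using hu.add 0 0

lemma un_neg (hu : UnipotentOver H V un t) (b : ℚ) : un (-b) = (un b)⁻¹ := by
  rw [eq_inv_iff_mul_eq_one, ← hu.add, neg_add_cancel, hu.un_zero]

lemma un_zsmul (hu : UnipotentOver H V un t) (b : ℚ) (n : ℤ) : un b^n = un (n*b) := by
  induction n using Int.induction_on with
  | zero => simp [hu.un_zero]
  | succ n ih => rw [zpow_add_one, ih, ← hu.add]; congr 1; push_cast; ring
  | pred n ih => rw [zpow_sub_one, ih, ← hu.un_neg, ← hu.add]; congr 1; push_cast; ring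

lemma nrm_inv (hu : UnipotentOver H V un t) (b : ℚ) : Nrm H H (un b)⁻¹ := by
  rw [← hu.un_neg]; exact hu.nrm _

lemma range_le (hu : UnipotentOver H V un t) (b : ℚ) (m n : ℕ) (c : Bar G k (G ⧸ H) n) :
    ∃ a, rmap k H H (un (m*b)) n c - c = rmap k H H (un b) n a - a := by
  induction m with
  | zero => exact ⟨0, by rw [Nat.cast_zero, zero_mul, hu.un_zero, rmap_of_mem H.one_mem]; simp⟩
  | succ m ih =>
    obtain ⟨a, ha⟩ := ih; refine ⟨a + rmap k H H (un (m*b)) n c, ?_⟩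
    rw [map_add, rmap_rmap (hu.nrm _) (hu.nrm _), ← hu.add, add_sub_add_comm, ← ha]; push_cast
    rw [add_mul, one_mul]; abel

lemma exists_of_rmap (hu : UnipotentOver H V un t) {n : ℕ} {c : Bar G k (G ⧸ H) n}
    (hc : rmap k H V 1 n c = 0) : ∃ N : ℕ, N ≠ 0 ∧ ∃ a, rmap k H H (un (1/N)) n a - a = c := by
  have h1 := Nrm.of_le hu.le; have := push_sub_mem_of_push_eq_zero _ hc; clear hc
  induction this using Submodule.span_induction with
  | mem x hx =>
    obtain ⟨g, x, y, hxy, rfl⟩ := hx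
    induction' x using induction_on with x
    induction' y using induction_on with y
    rw [rm_mk h1, rm_mk h1, mul_one, mul_one, QuotientGroup.eq] at hxy
    obtain ⟨b, h, hh, e⟩ := hu.exists_mul _ hxy; refine ⟨b.den, b.den_ne_zero, ?_⟩
    set τ := rmPerm H (un (1/b.den)) (hu.nrm _) (hu.nrm_inv _)
    obtain ⟨a, ha⟩ := single_zpow_sub_mem (k := k) (prodCongr (Equiv.refl (Fin n → G)) τ)
      b.num (g, (x : G ⧸ H))
    refine ⟨a, Eq.trans ha.symm ?_⟩; rw [prodCongr_zpow]; congr 3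
    change (τ^b.num) (x : G ⧸ H) = _
    rw [rmPerm_zpow, hu.un_zsmul, mul_one_div, Rat.num_div_den, QuotientGroup.eq, mul_inv_rev,
      mul_assoc, e, inv_mul_cancel_left]
    exact hh
  | zero => exact ⟨1, one_ne_zero, 0, by simp⟩
  | add x y _ _ hx hy =>
    obtain ⟨N, hN, a, rfl⟩ := hx; obtain ⟨M, hM, b, rfl⟩ := hy
    refine ⟨N*M, mul_ne_zero hN hM, ?_⟩; obtain ⟨a', ha'⟩ := hu.range_le (1/(N*M : ℕ)) M n a
    obtain ⟨b', hb'⟩ := hu.range_le (1/(N*M : ℕ)) N n b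
    rw [show (M : ℚ)*(1/(N*M : ℕ)) = 1/N by push_cast; field_simp] at ha'
    rw [show (N : ℚ)*(1/(N*M : ℕ)) = 1/M by push_cast; field_simp] at hb'
    exact ⟨a' + b', by rw [ha', hb', map_add]; abel⟩
  | smul r x _ hx =>
    obtain ⟨N, hN, a, rfl⟩ := hx; exact ⟨N, hN, r • a, by rw [map_smul, smul_sub]⟩

lemma rel_pos (hu : UnipotentOver H V un t)
    (pos : ∀ (n : ℕ) (z : Bar G k (G ⧸ H) (n+1)), IsCyc z → z ∈ Bd G k (G ⧸ H) (n+1))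
    (n : ℕ) (z : Bar G k (G ⧸ H) (n+1)) (hz : IsCyc z) (h0 : rmap k H V 1 (n+1) z = 0) :
    ∃ y, rmap k H V 1 (n+2) y = 0 ∧ bd G k _ (n+1) y = z := by
  obtain ⟨N, hN, a, rfl⟩ := hu.exists_of_rmap h0; set u := un (1/N)
  have free : ∀ (m : ℤ) (s : G ⧸ H), (rmPerm H u (hu.nrm _) (hu.nrm_inv _)^m) s = s → m = 0 := by
    intro m s hs
    induction' s using induction_on with g
    rw [rmPerm_zpow, eq_comm, QuotientGroup.eq, inv_mul_cancel_left, hu.un_zsmul] at hs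
    have := hu.free _ hs; simpa [hN] using this
  have ca : IsCyc a := by
    change bd G k _ n a = 0
    refine eq_zero_of_push_eq (τ := rmPerm H u (hu.nrm _) (hu.nrm_inv _)) free ?_
    have : bd G k _ n (rmap k H H u (n+1) a - a) = 0 := hz
    rwa [map_sub, bd_rmap (hu.nrm _), sub_eq_zero] at this
  obtain ⟨x, rfl⟩ := pos n a ca; refine ⟨rmap k H H u (n+2) x - x, ?_, ?_⟩
  · have hV : Nrm V V u := Nrm.of_mem (hu.mem _)
    rw [map_sub, rmap_rmap (hu.nrm _) (Nrm.of_le hu.le), mul_one, sub_eq_zero,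
      ← rmap_of_mem (H := V) (hu.mem _) (rmap k H V 1 (n+2) x),
      rmap_rmap (Nrm.of_le hu.le) hV, one_mul]
  · rw [map_sub, bd_rmap (hu.nrm _)]

lemma rel_zero (hu : UnipotentOver H V un t) (ht : Nrm H H t) (z : Bar G k (G ⧸ H) 0)
    (h0 : rmap k H V 1 0 z = 0) :
    ∃ y, rmap k H V 1 1 y = 0 ∧ bd G k _ 0 y = rmap k H H t 0 z - z - (8 : k) • z := by
  have h1 := Nrm.of_le hu.le
  set L := Submodule.map (bd G k (G ⧸ H) 0) (ker (rmap k H V 1 1)) with hL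
  suffices h : z ∈ L.comap (rmap k H H t 0 - LinearMap.id - (8 : k) • LinearMap.id) by
    obtain ⟨y, hy, e⟩ := h; exact ⟨y, hy, by simpa using e⟩
  refine span_le.2 ?_ (push_sub_mem_of_push_eq_zero _ h0); rintro _ ⟨g, x, y, hxy, rfl⟩
  induction' x using induction_on with x
  induction' y using induction_on with y
  rw [rm_mk h1, rm_mk h1, mul_one, mul_one, QuotientGroup.eq] at hxy
  obtain ⟨b, h, hh, e⟩ := hu.exists_mul _ hxy
  have ey : (y : G ⧸ H) = ((x*un b : G) : G ⧸ H) := by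
    rw [eq_comm, QuotientGroup.eq, mul_inv_rev, mul_assoc, e, inv_mul_cancel_left]; exact hh
  set ζ := pt G k ((x*un b : G) : G ⧸ H) - pt G k (x : G ⧸ H) with hζ
  have hrel : rm H V 1 (x : G ⧸ H) = rm H V 1 ((x*un b : G) : G ⧸ H) := by
    rw [rm_mk h1, rm_mk h1, mul_one, mul_one, QuotientGroup.eq, inv_mul_cancel_left]; exact hu.mem _
  have step : ∀ (a : G) (m : ℕ), pt G k ((a*un (m*b) : G) : G ⧸ H) -
      pt G k (a : G ⧸ H) - (m : k) • ζ ∈ L := by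
    intro a m
    induction m with
    | zero => simp [hu.un_zero]
    | succ m ih =>
      have e1 := translate_mem (k := k) (rm_equivar h1) (a*un (m*b)*x⁻¹) hrel
      have e2 : (a*un (m*b)*x⁻¹) • ((x*un b : G) : G ⧸ H) =
          ((a*un ((m + 1 : ℕ)*b) : G) : G ⧸ H) := by
        rw [smul_coe, smul_eq_mul, mul_assoc, inv_mul_cancel_left, mul_assoc, ← hu.add]
        congr 3; push_cast; ring
      have e3 : (a*un (m*b)*x⁻¹) • (x : G ⧸ H) = ((a*un (m*b) : G) : G ⧸ H) := by
        rw [smul_coe, smul_eq_mul, inv_mul_cancel_right]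
      rw [e2, e3] at e1; convert L.add_mem ih e1 using 1; rw [← hζ]; push_cast; module
  have s9 := step (x*t) 9; rw [mem_coe, mem_comap, single_eq_pt, single_eq_pt, ey, ← hζ]
  convert s9 using 1
  have ec : x*un b*t = x*t*un ((9 : ℕ)*b) := by
    rw [mul_assoc, hu.conj, mul_assoc]; norm_num
  simp only [LinearMap.sub_apply, LinearMap.smul_apply, id_apply]
  conv_lhs => rw [hζ, map_sub, rmap, push_pt (rm_equivar ht), push_pt (rm_equivar ht), rm_mk ht,
    rm_mk ht, ec, ← hζ]
  push_cast; module

end UnipotentOver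
end Unipotent

section SL2

open Matrix

lemma sl_ext {g h : SL2Q} (h00 : g 0 0 = h 0 0) (h01 : g 0 1 = h 0 1) (h10 : g 1 0 = h 1 0)
    (h11 : g 1 1 = h 1 1) : g = h := by
  ext i j; fin_cases i <;> fin_cases j <;> assumption

lemma sl_mul (g h : SL2Q) (i j : Fin 2) : (g*h) i j = g i 0*h 0 j + g i 1*h 1 j := by
  change (g.1*h.1) i j = _; rw [Matrix.mul_apply, Fin.sum_univ_two]

lemma sl_det (g : SL2Q) : g 0 0*g 1 1 - g 0 1*g 1 0 = 1 := by
  have := g.2; rwa [det_fin_two] at this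

lemma sl_det' {g : SL2Q} (h : g 1 0 = 0) : g 0 0*g 1 1 = 1 := by simpa [h] using sl_det g

lemma sl_inv (g : SL2Q) : g⁻¹ 0 0 = g 1 1 ∧ g⁻¹ 0 1 = -g 0 1 ∧ g⁻¹ 1 0 = -g 1 0 ∧
    g⁻¹ 1 1 = g 0 0 := by
  rw [SpecialLinearGroup.SL2_inv_expl]; exact ⟨rfl, rfl, rfl, rfl⟩

def dgMat (a : ℚˣ) : SL2Q := ⟨!![(a : ℚ), 0; 0, ((a⁻¹ : ℚˣ) : ℚ)], by simp [det_fin_two]⟩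

def dg : ℚˣ →* SL2Q where
  toFun := dgMat
  map_one' := by ext i j; fin_cases i <;> fin_cases j <;> simp [dgMat]
  map_mul' a b := by apply sl_ext <;> rw [sl_mul] <;> simp [dgMat, mul_comm]

def un (b : ℚ) : SL2Q := ⟨!![1, b; 0, 1], by simp [det_fin_two]⟩

def ww : SL2Q := ⟨!![0, -1; 1, 0], by simp [det_fin_two]⟩

@[simp] lemma dg_00 (a : ℚˣ) : dg a 0 0 = a := rfl
@[simp] lemma dg_01 (a : ℚˣ) : dg a 0 1 = 0 := rfl
@[simp] lemma dg_10 (a : ℚˣ) : dg a 1 0 = 0 := rfl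
@[simp] lemma dg_11 (a : ℚˣ) : dg a 1 1 = (a : ℚ)⁻¹ := by rw [← Units.val_inv_eq_inv_val]; rfl
@[simp] lemma un_00 (b : ℚ) : un b 0 0 = 1 := rfl
@[simp] lemma un_01 (b : ℚ) : un b 0 1 = b := rfl
@[simp] lemma un_10 (b : ℚ) : un b 1 0 = 0 := rfl
@[simp] lemma un_11 (b : ℚ) : un b 1 1 = 1 := rfl
@[simp] lemma ww_00 : ww 0 0 = 0 := rfl
@[simp] lemma ww_01 : ww 0 1 = -1 := rfl
@[simp] lemma ww_10 : ww 1 0 = 1 := rfl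
@[simp] lemma ww_11 : ww 1 1 = 0 := rfl

lemma un_add (a b : ℚ) : un (a+b) = un a*un b := by apply sl_ext <;> simp [sl_mul, add_comm]

lemma un_mul_dg (b : ℚ) (a : ℚˣ) : un b*dg a = dg a*un ((a : ℚ)⁻¹^2*b) := by
  apply sl_ext <;> simp [sl_mul]; field_simp

/-- Upper triangular (for `D` diagonal) matrices whose diagonal entries are units outside `S`. -/
def tri (D : Prop) (S : Finset ℕ) : Subgroup SL2Q where
  carrier := {g | g 1 0 = 0 ∧ (D → g 0 1 = 0) ∧ ∀ q : ℕ, q.Prime → q ∉ S → padicValRat q (g 0 0) = 0}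
  one_mem' := by simp
  mul_mem' := by
    rintro g h ⟨g1, g2, g3⟩ ⟨h1, h2, h3⟩
    refine ⟨by rw [sl_mul, g1, h1]; ring, fun d => by rw [sl_mul, g2 d, h2 d]; ring,
      fun q hq hS => ?_⟩
    have := Fact.mk hq
    rw [sl_mul, h1, mul_zero, add_zero, padicValRat.mul (left_ne_zero_of_mul_eq_one (sl_det' g1))
      (left_ne_zero_of_mul_eq_one (sl_det' h1)), g3 q hq hS, h3 q hq hS, add_zero]
  inv_mem' := by
    rintro g ⟨g1, g2, g3⟩; obtain ⟨i1, i2, i3, i4⟩ := sl_inv g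
    refine ⟨by rw [i3, g1, neg_zero], fun d => by rw [i2, g2 d, neg_zero], fun q hq hS => ?_⟩
    have := Fact.mk hq
    rw [i1, eq_inv_of_mul_eq_one_right (sl_det' g1), padicValRat.inv, g3 q hq hS, neg_zero]

variable {D : Prop} {S : Finset ℕ}

lemma mem_tri {g : SL2Q} : g ∈ tri D S ↔ g 1 0 = 0 ∧ (D → g 0 1 = 0) ∧
    ∀ q : ℕ, q.Prime → q ∉ S → padicValRat q (g 0 0) = 0 := Iff.rfl

lemma tri_ne_zero {g : SL2Q} (hg : g ∈ tri D S) : g 0 0 ≠ 0 :=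
  left_ne_zero_of_mul_eq_one (sl_det' hg.1)

lemma tri_mono {D D' : Prop} {S S' : Finset ℕ} (hD : D' → D) (hS : S ⊆ S') : tri D S ≤ tri D' S' :=
  fun _ hg => ⟨hg.1, fun d => hg.2.1 (hD d), fun q hq h => hg.2.2 q hq fun h' => h (hS h')⟩

lemma nrm_dg (a : ℚˣ) : Nrm (tri D S) (tri D S) (dg a) := by
  intro h hh; refine ⟨?_, fun d => ?_, fun q hq hS => ?_⟩
  · simp [sl_mul, sl_inv, hh.1]
  · simp [sl_mul, sl_inv, hh.2.1 d]
  · rw [← hh.2.2 q hq hS]; congr 1; simp [sl_mul, sl_inv]; field_simp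

lemma nrm_ww : Nrm (tri True S) (tri True S) ww := by
  intro h hh; refine ⟨?_, fun d => ?_, fun q hq hS => ?_⟩
  · simp [sl_mul, sl_inv, hh.2.1 trivial]
  · simp [sl_mul, sl_inv, hh.1]
  · have := Fact.mk hq
    have e : (ww⁻¹*h*ww) 0 0 = (h 0 0)⁻¹ := by
      rw [← eq_inv_of_mul_eq_one_right (sl_det' hh.1)]; simp [sl_mul, sl_inv]
    rw [e, padicValRat.inv, hh.2.2 q hq hS, neg_zero]

lemma dg_mem_tri {a : ℚˣ} :
    dg a ∈ tri D S ↔ ∀ q : ℕ, q.Prime → q ∉ S → padicValRat q (a : ℚ) = 0 := by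
  rw [mem_tri]; simp

lemma inverts_ww : Inverts (tri True S) ww dg.range where
  nrm := nrm_ww
  nrm_of_mem := by rintro _ ⟨a, rfl⟩; exact nrm_dg a
  sq_mem := by
    refine ⟨by simp [sl_mul], fun _ => by simp [sl_mul], fun q hq _ => ?_⟩
    have : (ww*ww) 0 0 = -1 := by simp [sl_mul]
    rw [this, padicValRat.neg, padicValRat.one]
  conj := by
    rintro _ ⟨a, rfl⟩; apply sl_ext <;> rw [sl_mul, sl_mul] <;> simp [sl_inv]
  comm := by
    rintro _ ⟨a, rfl⟩ _ ⟨b, rfl⟩; rw [← map_mul, mul_comm, map_mul]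

def invUnit (q : ℕ) (hq : q.Prime) : ℚˣ := (mk0 (q : ℚ) (Nat.cast_ne_zero.2 hq.ne_zero))⁻¹

lemma padicValRat_invUnit_zpow {q : ℕ} (hq : q.Prime) {r : ℕ} (hr : r.Prime) (n : ℤ) :
    padicValRat r ((invUnit q hq^n : ℚˣ) : ℚ) = if r = q then -n else 0 := by
  have := Fact.mk hq; have := Fact.mk hr; have h0 : (q : ℚ) ≠ 0 := Nat.cast_ne_zero.2 hq.ne_zero
  have : ((invUnit q hq^n : ℚˣ) : ℚ) = ((q : ℚ)^n)⁻¹ := by simp [invUnit]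
  rw [this, padicValRat.inv, padicValRat.zpow]; split_ifs with h
  · subst h; rw [padicValRat.self hr.one_lt]; ring
  · rw [padicValRat.of_nat, padicValNat_primes h]; simp

lemma cyclicOver_tri {q : ℕ} (hq : q.Prime) (hS : q ∉ S) :
    CyclicOver (tri D S) (tri D (insert q S)) (dg (invUnit q hq)) where
  le := tri_mono id (Finset.subset_insert q S)
  nrm := nrm_dg _
  nrm_inv := by rw [← map_inv]; exact nrm_dg _
  mem := by
    rw [dg_mem_tri]; intro r hr hrS
    rw [← zpow_one (invUnit q hq), padicValRat_invUnit_zpow hq hr, if_neg]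
    rintro rfl; exact hrS (mem_insert_self _ _)
  exists_zpow := by
    intro g hg; have := Fact.mk hq
    refine ⟨-padicValRat q (g 0 0), (dg (invUnit q hq)^(-padicValRat q (g 0 0)))⁻¹*g, ?_,
      by group⟩
    rw [← _root_.zpow_neg, neg_neg, ← map_zpow]
    refine ⟨by rw [sl_mul, dg_10, dg_11, hg.1]; ring, fun d => by
      rw [sl_mul, dg_00, dg_01, hg.2.1 d]; ring, fun r hr hrS => ?_⟩
    have := Fact.mk hr
    rw [sl_mul, dg_00, dg_01, zero_mul, add_zero, padicValRat.mul (Units.ne_zero _) (tri_ne_zero hg),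
      padicValRat_invUnit_zpow hq hr]
    split_ifs with h
    · subst h; ring
    · rw [zero_add]; exact hg.2.2 r hr (by rw [mem_insert]; tauto)
  free := by
    intro n hn; rw [← map_zpow, dg_mem_tri] at hn; have := hn q hq hS
    rw [padicValRat_invUnit_zpow hq hq, if_pos rfl] at this; omega

lemma eq_one_or_neg_one_of_padicValRat {x : ℚ} (hx : x ≠ 0)
    (h : ∀ q : ℕ, q.Prime → padicValRat q x = 0) : x = 1 ∨ x = -1 := by
  have hn : x.num.natAbs = 1 := by
    by_contra hne; obtain ⟨q, hq, hd⟩ := Nat.exists_prime_and_dvd hne; have := Fact.mk hq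
    have h1 : ¬ q ∣ x.den := fun hd' => hq.one_lt.ne'
      (Nat.dvd_one.1 (x.reduced.gcd_eq_one ▸ Nat.dvd_gcd hd hd'))
    have h2 := h q hq; rw [padicValRat, padicValNat.eq_zero_of_not_dvd h1, padicValInt] at h2
    have h3 := one_le_padicValNat_of_dvd (by simpa using hx) hd
    simp only [Nat.cast_zero, sub_zero, Nat.cast_eq_zero] at h2; omega
  have hd : x.den = 1 := by
    by_contra hne; obtain ⟨q, hq, hd⟩ := Nat.exists_prime_and_dvd hne; have := Fact.mk hq
    have h1 : padicValNat q x.num.natAbs = 0 := by rw [hn]; simp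
    have h2 := h q hq; rw [padicValRat, padicValInt, h1] at h2
    have h3 := one_le_padicValNat_of_dvd x.den_ne_zero hd; omega
  rw [← Rat.num_div_den x, hd]; rcases Int.natAbs_eq x.num with h1 | h1 <;> rw [h1, hn] <;> simp

lemma mem_tri_empty {g : SL2Q} (hg : g ∈ tri True ∅) : g = 1 ∨ g = -1 := by
  have dh := sl_det' hg.1; have h01 := hg.2.1 trivial
  rcases eq_one_or_neg_one_of_padicValRat (tri_ne_zero hg) (fun q hq => hg.2.2 q hq (by simp)) with h | h
  · left; rw [h, one_mul] at dh; apply sl_ext <;> simp [h, h01, hg.1, dh]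
  · right; rw [h] at dh; have : g 1 1 = -1 := by linarith
    apply sl_ext <;> simp [h, h01, hg.1, this]

lemma pos_tri_empty (n : ℕ) (z : Bar SL2Q ZHalf (SL2Q ⧸ tri True ∅) (n+1)) (hz : IsCyc z) :
    z ∈ Bd SL2Q ZHalf (SL2Q ⧸ tri True ∅) (n+1) := by
  refine bounds_of_stabilizer (e := -1) (by simp) ?_ two_mul_half hz; intro g x hx
  induction' x using induction_on with x
  have : ((g*x : SL2Q) : SL2Q ⧸ tri True ∅) = (x : SL2Q ⧸ tri True ∅) := hx
  rw [eq_comm, QuotientGroup.eq] at this; rcases mem_tri_empty this with h | h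
  · left; rw [inv_mul_eq_one] at h; exact mul_eq_right.1 h.symm
  · right; rw [inv_mul_eq_iff_eq_mul, mul_neg_one, ← neg_one_mul] at h; exact mul_right_cancel h

lemma unipotentOver_tri (a : ℚˣ) (ha : ((a : ℚ)⁻¹)^2 = 9) :
    UnipotentOver (tri True ∅) (tri False ∅) un (dg a) where
  le := tri_mono False.elim subset_rfl
  add := un_add
  nrm := by
    intro b h hh; rcases mem_tri_empty hh with rfl | rfl
    · simpa using Subgroup.one_mem _
    · have : (un b)⁻¹ * -1*un b = -1 := by simp
      rw [this]; exact hh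
  mem := fun b => ⟨rfl, fun h => h.elim, fun q _ _ => by simp⟩
  exists_mul := by
    intro g hg; have dh := sl_det' hg.1
    rcases eq_one_or_neg_one_of_padicValRat (tri_ne_zero hg)
      (fun q hq => hg.2.2 q hq (by simp)) with h | h
    · refine ⟨g 0 1, 1, Subgroup.one_mem _, ?_⟩; rw [h, one_mul] at dh
      apply sl_ext <;> simp [h, hg.1, dh]
    · refine ⟨-g 0 1, -1, ⟨by simp, fun _ => by simp, fun q hq _ => ?_⟩, ?_⟩
      · have : (-1 : SL2Q) 0 0 = -1 := rfl; rw [this, padicValRat.neg, padicValRat.one]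
      · rw [h] at dh; have : g 1 1 = -1 := by linarith
        apply sl_ext <;> simp [sl_mul, h, hg.1, this]
  free := fun b hb => hb.2.1 trivial
  conj := by intro b; rw [un_mul_dg, ha]

lemma rigid_tri (S : Finset ℕ) (hS : ∀ q ∈ S, q.Prime) : Rigid ZHalf (tri True S) ww dg.range := by
  induction S using Finset.induction_on with
  | empty => exact Rigid.of_acyclic inverts_ww pos_tri_empty
  | insert q S hqS ih =>
    have hq := hS q (mem_insert_self _ _)
    exact (ih fun r hr => hS r (mem_insert_of_mem hr)).step two_mul_half inverts_ww inverts_ww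
      (cyclicOver_tri hq hqS) ⟨_, rfl⟩

lemma cyclicSquare_tri {q : ℕ} (hq : q.Prime) (hS : q ∉ S) :
    CyclicSquare (tri True S) (tri True (insert q S)) (tri False S) (tri False (insert q S))
      (dg (invUnit q hq)) :=
  ⟨cyclicOver_tri hq hS, cyclicOver_tri hq hS, tri_mono False.elim subset_rfl,
    tri_mono False.elim subset_rfl⟩

lemma relAcyclic_tri (S : Finset ℕ) (h3 : 3 ∈ S) (hS : ∀ q ∈ S, q.Prime) :
    RelAcyclic ZHalf (tri True S) (tri False S) := by
  have key : ∀ R : Finset ℕ, (∀ q ∈ R, q.Prime) →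
      RelAcyclic ZHalf (tri True (insert 3 R)) (tri False (insert 3 R)) := by
    intro R hR
    induction R using Finset.induction_on with
    | empty =>
      have hsq : (((invUnit 3 Nat.prime_three : ℚˣ) : ℚ)⁻¹)^2 = 9 := by simp [invUnit]; norm_num
      have hu := unipotentOver_tri _ hsq
      have h8 : (half^3)*(8 : ZHalf) = 1 := by
        rw [show (8 : ZHalf) = 2^3 by norm_num, ← mul_pow, mul_comm, two_mul_half, one_pow]
      exact (cyclicSquare_tri Nat.prime_three (by simp)).relAcyclic_base (hu.rel_pos pos_tri_empty) h8
        (hu.rel_zero (nrm_dg _))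
    | insert q R hqR ih =>
      have ih' := ih fun r hr => hR r (mem_insert_of_mem hr)
      by_cases h : q ∈ insert 3 R
      · rw [Finset.insert_comm, Finset.insert_eq_of_mem h]; exact ih'
      · rw [Finset.insert_comm]
        exact (cyclicSquare_tri (hR q (mem_insert_self _ _)) h).relAcyclic_step ih'
  have := key S hS; rwa [Finset.insert_eq_of_mem h3] at this

end SL2

/-- A `G`-set with an invariant relation of general position. -/
class GenPos (G : Type*) (P : Type*) [Group G] [MulAction G P] where
  rel : P → P → Prop
  rel_symm : ∀ {x y}, rel x y → rel y x
  rel_smul : ∀ (g : G) {x y}, rel x y → rel (g • x) (g • y)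
  exists_rel : ∀ s : Finset P, ∃ x, ∀ y ∈ s, rel x y

section Conf

variable (G : Type*) [Group G] (k : Type*) [CommRing k] (P : Type*) [MulAction G P] [GenPos G P]

/-- Tuples of `n` points in pairwise general position. -/
def Conf (n : ℕ) : Type _ := {f : Fin n → P // ∀ i j, i ≠ j → GenPos.rel G (f i) (f j)}

variable {G k P}

instance (n : ℕ) : MulAction G (Conf G P n) where
  smul g f := ⟨fun i => g • f.1 i, fun i j h => GenPos.rel_smul g (f.2 i j h)⟩
  one_smul f := Subtype.ext (funext fun i => one_smul G (f.1 i))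
  mul_smul g h f := Subtype.ext (funext fun i => mul_smul g h (f.1 i))

lemma Conf.smul_val {n : ℕ} (g : G) (f : Conf G P n) (i : Fin n) : (g • f).1 i = g • f.1 i := rfl

def face {n : ℕ} (i : Fin (n+1)) (f : Conf G P (n+1)) : Conf G P n :=
  ⟨fun l => f.1 (i.succAbove l), fun a b h => f.2 _ _ fun e => h (Fin.succAbove_right_injective e)⟩

lemma face_equivar {n : ℕ} (i : Fin (n+1)) : Equivar G (face (G := G) (P := P) i) :=
  fun _ _ => rfl

variable (G k P) in
/-- The differential in the direction of the configurations. -/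
def cd (p q : ℕ) : Bar G k (Conf G P (p+1)) q →ₗ[k] Bar G k (Conf G P p) q :=
  ∑ i : Fin (p+1), ((-1 : ℤ)^(i : ℕ)) • push G k (face i) q

lemma cd_apply {p q : ℕ} (c : Bar G k (Conf G P (p+1)) q) :
    cd G k P p q c = ∑ i : Fin (p+1), ((-1 : ℤ)^(i : ℕ)) • push G k (face i) q c := by
  simp [cd]

lemma cd_single {p q : ℕ} (g : Fin q → G) (f : Conf G P (p+1)) : cd G k P p q (single (g, f) 1) =
      ∑ i : Fin (p+1), ((-1 : ℤ)^(i : ℕ)) • single (g, face i f) (1 : k) := by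
  simp [cd_apply, push]

lemma bd_cd {p q : ℕ} (c : Bar G k (Conf G P (p+1)) (q+1)) :
    bd G k _ q (cd G k P p (q+1) c) = cd G k P p q (bd G k _ q c) := by
  simp only [cd_apply, map_sum, map_zsmul, bd_push (face_equivar _)]

/-- The basis chain of a tuple, zero if the tuple is not in general position. -/
def tupleCell {p q : ℕ} (g : Fin q → G) (f : Fin p → P) : Bar G k (Conf G P p) q :=
  if h : ∀ i j, i ≠ j → GenPos.rel G (f i) (f j) then single (g, ⟨f, h⟩) 1 else 0

lemma tupleCell_val {p q : ℕ} (g : Fin q → G) (f : Conf G P p) :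
    tupleCell (k := k) g f.1 = single (g, f) 1 := dif_pos f.2

lemma cd_cd {p q : ℕ} (c : Bar G k (Conf G P (p+2)) q) :
    cd G k P p q (cd G k P (p+1) q c) = 0 := by
  have : cd G k P p q ∘ₗ cd G k P (p+1) q = 0 := by
    refine Finsupp.lhom_ext' fun a => ext_ring ?_
    obtain ⟨g, f⟩ := a
    simp only [comp_apply, lsingle_apply, cd_single, map_sum, map_zsmul, LinearMap.zero_apply]
    have := sum_sum_succAbove (tupleCell (k := k) g) f.1; refine Eq.trans ?_ this
    refine sum_congr rfl fun i _ => ?_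
    congr 1; refine sum_congr rfl fun j _ => ?_
    exact congrArg (((-1 : ℤ)^(j : ℕ)) • ·) (tupleCell_val g (face j (face i f))).symm
  exact LinearMap.congr_fun this c

/-- Adjoining a point in general position. -/
def Conf.cons {n : ℕ} (x : P) (f : Conf G P n) (h : ∀ i, GenPos.rel G x (f.1 i)) :
    Conf G P (n+1) := ⟨Fin.cons x f.1, by
    intro i j; refine Fin.cases ?_ (fun i => ?_) i <;> refine Fin.cases ?_ (fun j => ?_) j
    · intro h; exact absurd rfl h
    · intro _; simpa using h j
    · intro _; simpa using GenPos.rel_symm (h i)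
    · intro hij
      simpa using f.2 i j fun e => hij (by rw [e])⟩

variable (k) in
def cone (x : P) (p q : ℕ) : Bar G k (Conf G P p) q →ₗ[k] Bar G k (Conf G P (p+1)) q :=
  Finsupp.lift _ k _ fun a => if h : ∀ i, GenPos.rel G x (a.2.1 i) then
    single (a.1, Conf.cons x a.2 h) 1 else 0

lemma cone_single {x : P} {p q : ℕ} (g : Fin q → G) (f : Conf G P p)
    (h : ∀ i, GenPos.rel G x (f.1 i)) :
    cone k x p q (single (g, f) 1) = single (g, Conf.cons x f h) 1 := by
  rw [cone, Finsupp.lift_apply, Finsupp.sum_single_index (by rw [zero_smul]), one_smul, dif_pos h]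

lemma exists_generic {p q : ℕ} (c : Bar G k (Conf G P p) q) :
    ∃ x : P, ∀ a ∈ c.support, ∀ i, GenPos.rel G x (a.2.1 i) := by
  obtain ⟨x, hx⟩ := GenPos.exists_rel (G := G) (c.support.biUnion fun a => univ.image a.2.1)
  exact ⟨x, fun a ha i => hx _ (Finset.mem_biUnion.2 ⟨a, ha, Finset.mem_image_of_mem _ (mem_univ _)⟩)⟩

lemma mem_span_support {S : Type*} (c : S →₀ k) (T : Set S) (h : ∀ a ∈ c.support, a ∈ T) :
    c ∈ span k ((fun a => single a (1 : k)) '' T) := by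
  rw [← Finsupp.supported_eq_span_single, Finsupp.mem_supported]; exact h

lemma face_zero_cons {n : ℕ} (x : P) (f : Conf G P n) (h : ∀ i, GenPos.rel G x (f.1 i)) :
    face 0 (Conf.cons x f h) = f := by
  apply Subtype.ext; funext l; simp [face, Conf.cons]

lemma face_succ_cons {n : ℕ} (x : P) (f : Conf G P (n+1)) (h : ∀ i, GenPos.rel G x (f.1 i))
    (i : Fin (n+1)) : face i.succ (Conf.cons x f h) = Conf.cons x (face i f) (fun l => h _) := by
  apply Subtype.ext; funext l; refine Fin.cases ?_ (fun l => ?_) l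
  · simp [face, Conf.cons]
  · simp [face, Conf.cons, Fin.succ_succAbove_succ]

lemma exists_cd_eq_of_zero {q : ℕ} (c : Bar G k (Conf G P 0) q) : ∃ e, cd G k P 0 q e = c := by
  obtain ⟨x, hx⟩ := exists_generic c; refine ⟨cone k x 0 q c, ?_⟩
  have key : c ∈ eqLocus (cd G k P 0 q ∘ₗ cone k x 0 q) LinearMap.id := by
    refine span_le.2 ?_ (mem_span_support c {a | ∀ i, GenPos.rel G x (a.2.1 i)} hx)
    rintro _ ⟨⟨g, f⟩, h, rfl⟩; rw [mem_coe, mem_eqLocus]; simp only [comp_apply, id_apply]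
    rw [cone_single g f h, cd_single]; simp [face_zero_cons]
  exact key

lemma exists_cd_eq {p q : ℕ} {c : Bar G k (Conf G P (p+1)) q} (hc : cd G k P p q c = 0) :
    ∃ e, cd G k P (p+1) q e = c := by
  obtain ⟨x, hx⟩ := exists_generic c; refine ⟨cone k x (p+1) q c, ?_⟩
  have key : c ∈ eqLocus (cd G k P (p+1) q ∘ₗ cone k x (p+1) q)
      (LinearMap.id - cone k x p q ∘ₗ cd G k P p q) := by
    refine span_le.2 ?_ (mem_span_support c {a | ∀ i, GenPos.rel G x (a.2.1 i)} hx)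
    rintro _ ⟨⟨g, f⟩, h, rfl⟩; rw [mem_coe, mem_eqLocus]
    simp only [comp_apply, LinearMap.sub_apply, id_apply]
    rw [cone_single g f h, cd_single, cd_single, Fin.sum_univ_succ, face_zero_cons, map_sum]
    simp_rw [face_succ_cons, map_zsmul]
    have : ∀ i : Fin (p+1), cone k x p q (single (g, face i f) 1) =
        single (g, Conf.cons x (face i f) fun l => h _) 1 := fun i => cone_single _ _ _
    simp_rw [this]; simp [pow_succ, sub_eq_add_neg]
  rw [mem_eqLocus] at key; simpa [hc] using key

/-- The total relation between a chain of `G` and a chain of quadruples. -/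
def Zigzag (z : Bar G k (Conf G P 0) 3) (c : Bar G k (Conf G P 4) 0) : Prop :=
  ∃ c₀ c₁ c₂, cd G k P 0 3 c₀ = z ∧ bd G k _ 2 c₀ = cd G k P 1 2 c₁ ∧
    bd G k _ 1 c₁ = cd G k P 2 1 c₂ ∧ bd G k _ 0 c₂ = cd G k P 3 0 c

variable (G k P) in
/-- Coinvariance and five-term relations. -/
def relN : Submodule k (Bar G k (Conf G P 4) 0) :=
  LinearMap.range (bd G k (Conf G P 4) 0) ⊔ LinearMap.range (cd G k P 4 0)

lemma Zigzag.add {z z' : Bar G k (Conf G P 0) 3} {c c'} (h : Zigzag z c) (h' : Zigzag z' c') :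
    Zigzag (z + z') (c + c') := by
  obtain ⟨a0, a1, a2, e0, e1, e2, e3⟩ := h; obtain ⟨b0, b1, b2, f0, f1, f2, f3⟩ := h'
  exact ⟨a0 + b0, a1 + b1, a2 + b2, by rw [map_add, e0, f0], by rw [map_add, map_add, e1, f1],
    by rw [map_add, map_add, e2, f2], by rw [map_add, map_add, e3, f3]⟩

lemma Zigzag.smul {z : Bar G k (Conf G P 0) 3} {c} (h : Zigzag z c) (r : k) :
    Zigzag (r • z) (r • c) := by
  obtain ⟨a0, a1, a2, e0, e1, e2, e3⟩ := h
  exact ⟨r • a0, r • a1, r • a2, by rw [map_smul, e0], by rw [map_smul, map_smul, e1],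
    by rw [map_smul, map_smul, e2], by rw [map_smul, map_smul, e3]⟩

lemma exists_zigzag {z : Bar G k (Conf G P 0) 3} (hz : bd G k _ 2 z = 0) : ∃ c, Zigzag z c := by
  obtain ⟨c0, h0⟩ := exists_cd_eq_of_zero z
  obtain ⟨c1, h1⟩ := exists_cd_eq (c := bd G k _ 2 c0) (by rw [← bd_cd, h0, hz])
  obtain ⟨c2, h2⟩ := exists_cd_eq (c := bd G k _ 1 c1) (by rw [← bd_cd, h1, bd_bd])
  obtain ⟨c3, h3⟩ := exists_cd_eq (c := bd G k _ 0 c2) (by rw [← bd_cd, h2, bd_bd])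
  exact ⟨c3, c0, c1, c2, h0, h1.symm, h2.symm, h3.symm⟩

lemma Zigzag.mem_relN {z : Bar G k (Conf G P 0) 3} {c} (h : Zigzag z c)
    (hz : z ∈ Bd G k (Conf G P 0) 3) : c ∈ relN G k P := by
  obtain ⟨c0, c1, c2, h0, h1, h2, h3⟩ := h; obtain ⟨y, rfl⟩ := hz
  obtain ⟨e0, he0⟩ := exists_cd_eq_of_zero y
  obtain ⟨e1, he1⟩ := exists_cd_eq (c := c0 - bd G k _ 3 e0) (by rw [map_sub, ← bd_cd, he0, h0, sub_self])
  obtain ⟨e2, he2⟩ := exists_cd_eq (c := c1 - bd G k _ 2 e1) (by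
    rw [map_sub, ← bd_cd, he1, map_sub, bd_bd, h1, sub_zero, sub_self])
  obtain ⟨e3, he3⟩ := exists_cd_eq (c := c2 - bd G k _ 1 e2) (by
    rw [map_sub, ← bd_cd, he2, map_sub, bd_bd, h2, sub_zero, sub_self])
  obtain ⟨e4, he4⟩ := exists_cd_eq (c := c - bd G k _ 0 e3) (by
    rw [map_sub, ← bd_cd, he3, map_sub, bd_bd, h3, sub_zero, sub_self])
  rw [relN, mem_sup]; exact ⟨_, ⟨e3, rfl⟩, _, ⟨e4, rfl⟩, by rw [he4]; abel⟩

variable (G k P) in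
/-- What is needed about the homology of tuples of up to three points. -/
structure LowDegree : Prop where
  triple : ∀ z : Bar G k (Conf G P 3) 1, bd G k _ 0 z = 0 → z ∈ Bd G k (Conf G P 3) 1
  pair : ∀ z : Bar G k (Conf G P 2) 2, bd G k _ 1 z = 0 → ∃ y, cd G k P 1 2 z = bd G k _ 2 (cd G k P 1 3 y)
  point : ∀ z : Bar G k (Conf G P 1) 3, bd G k _ 2 z = 0 → cd G k P 0 3 z ∈ Bd G k (Conf G P 0) 3
  pair_torsion_free : ∀ m : ℕ, m ≠ 0 → ∀ z : Bar G k (Conf G P 2) 1, bd G k _ 0 z = 0 →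
    m • z ∈ Bd G k (Conf G P 2) 1 → z ∈ Bd G k (Conf G P 2) 1
  point_torsion_free : ∀ m : ℕ, m ≠ 0 → ∀ z : Bar G k (Conf G P 1) 2, bd G k _ 1 z = 0 →
    m • z ∈ Bd G k (Conf G P 1) 2 → z ∈ Bd G k (Conf G P 1) 2

lemma LowDegree.mem_Bd (hL : LowDegree G k P) {z : Bar G k (Conf G P 0) 3} {c} (h : Zigzag z c)
    (hc : c ∈ relN G k P) : z ∈ Bd G k (Conf G P 0) 3 := by
  obtain ⟨c0, c1, c2, rfl, h1, h2, h3⟩ := h; rw [relN, mem_sup] at hc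
  obtain ⟨_, ⟨e3, rfl⟩, _, ⟨e4, rfl⟩, rfl⟩ := hc
  obtain ⟨e2, he2⟩ := hL.triple (c2 - cd G k P 3 1 e3) (by
    rw [map_sub, h3, bd_cd, map_add, cd_cd, add_zero, sub_self])
  obtain ⟨y, hy⟩ := hL.pair (c1 - cd G k P 2 2 e2) (by
    rw [map_sub, h2, bd_cd, he2, map_sub, cd_cd, sub_zero, sub_self])
  rw [map_sub, cd_cd, sub_zero, ← h1] at hy
  have := hL.point (c0 - cd G k P 1 3 y) (by rw [map_sub, hy, sub_self])
  rwa [map_sub, cd_cd, sub_zero] at this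

lemma LowDegree.exists_zigzag (hL : LowDegree G k P) {c : Bar G k (Conf G P 4) 0}
    (hc : cd G k P 3 0 c ∈ Bd G k (Conf G P 3) 0) {m : ℕ} (hm : m ≠ 0) (hmc : m • c ∈ relN G k P) :
    ∃ z, bd G k _ 2 z = 0 ∧ Zigzag z c := by
  obtain ⟨c2, h2⟩ := hc; rw [relN, mem_sup] at hmc; obtain ⟨_, ⟨e3, rfl⟩, _, ⟨e4, rfl⟩, he⟩ := hmc
  obtain ⟨e2, he2⟩ := hL.triple (m • c2 - cd G k P 3 1 e3) (by
    rw [map_sub, map_nsmul, h2, bd_cd, ← map_nsmul, ← he, map_add, cd_cd, add_zero, sub_self])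
  obtain ⟨c1, h1⟩ := hL.pair_torsion_free m hm (cd G k P 2 1 c2) (by rw [bd_cd, h2, cd_cd])
    ⟨cd G k P 2 2 e2, by rw [bd_cd, he2, map_sub, cd_cd, sub_zero, map_nsmul]⟩
  obtain ⟨y, hy⟩ := hL.pair (m • c1 - cd G k P 2 2 e2) (by
    rw [map_sub, map_nsmul, h1, bd_cd, he2, map_sub, cd_cd, sub_zero, map_nsmul, sub_self])
  rw [map_sub, cd_cd, sub_zero, map_nsmul] at hy
  obtain ⟨c0, h0⟩ := hL.point_torsion_free m hm (cd G k P 1 2 c1) (by rw [bd_cd, h1, cd_cd])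
    ⟨_, hy.symm⟩
  exact ⟨cd G k P 0 3 c0, by rw [bd_cd, h0, cd_cd], c0, c1, c2, rfl, h0, h1, h2⟩

section Map

variable {Q : Type*} [MulAction G Q] [GenPos G Q] {φ : P → Q}
  (hr : ∀ x y, GenPos.rel G x y → GenPos.rel G (φ x) (φ y))

def Conf.map (hr : ∀ x y, GenPos.rel G x y → GenPos.rel G (φ x) (φ y)) (n : ℕ) (f : Conf G P n) :
    Conf G Q n := ⟨fun i => φ (f.1 i), fun i j h => hr _ _ (f.2 i j h)⟩

lemma Conf.map_equivar (hφ : Equivar G φ) (n : ℕ) : Equivar G (Conf.map (G := G) hr n) :=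
  fun g f => Subtype.ext (funext fun i => hφ g (f.1 i))

lemma cd_push_map {p q : ℕ} (c : Bar G k (Conf G P (p+1)) q) :
    cd G k Q p q (push G k (Conf.map hr (p+1)) q c) = push G k (Conf.map hr p) q (cd G k P p q c) := by
  simp only [cd_apply, map_sum, map_zsmul, push_push]; rfl

lemma Zigzag.map (hφ : Equivar G φ) {z : Bar G k (Conf G P 0) 3} {c} (h : Zigzag z c) :
    Zigzag (push G k (Conf.map hr 0) 3 z) (push G k (Conf.map hr 4) 0 c) := by
  obtain ⟨c0, c1, c2, h0, h1, h2, h3⟩ := h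
  refine ⟨push G k (Conf.map hr 1) 3 c0, push G k (Conf.map hr 2) 2 c1,
    push G k (Conf.map hr 3) 1 c2, ?_, ?_, ?_, ?_⟩
  · rw [cd_push_map, h0]
  · rw [cd_push_map, bd_push (Conf.map_equivar hr hφ _), h1]
  · rw [cd_push_map, bd_push (Conf.map_equivar hr hφ _), h2]
  · rw [cd_push_map, bd_push (Conf.map_equivar hr hφ _), h3]

end Map
end Conf

section Orbit

variable {G : Type*} [Group G] {k : Type*} [CommRing k] {X : Type*} [MulAction G X]

def orb (H : Subgroup G) (x₀ : X) (x : G ⧸ H) : X := x.out • x₀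

variable {H : Subgroup G} {x₀ : X}

lemma orb_mk (h : ∀ g ∈ H, g • x₀ = x₀) (g : G) : orb H x₀ (g : G ⧸ H) = g • x₀ := by
  obtain ⟨a, ha⟩ := mk_out_eq_mul H g; rw [orb, ha, mul_smul, h _ a.2]

lemma orb_equivar (h : ∀ g ∈ H, g • x₀ = x₀) : Equivar G (orb H x₀) := by
  intro g x
  induction' x using induction_on with x
  rw [orb_mk h]; change orb H x₀ ((g*x : G) : G ⧸ H) = _; rw [orb_mk h, mul_smul]

/-- A directed family of subgroups with union the stabilizer of a point. -/
structure Exhausts {ι : Type*} [Preorder ι] (H : ι → Subgroup G) (x₀ : X) : Prop where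
  mono : ∀ i j, i ≤ j → H i ≤ H j
  fix : ∀ i, ∀ g ∈ H i, g • x₀ = x₀
  stab : ∀ g : G, g • x₀ = x₀ → ∃ i, g ∈ H i

variable {ι : Type*} [Preorder ι] [IsDirectedOrder ι] [Nonempty ι] {F : ι → Subgroup G}

lemma Exhausts.push_orb (hF : Exhausts F x₀) {i j : ι} (hij : i ≤ j) {n : ℕ}
    (a : Bar G k (G ⧸ F i) n) :
    push G k (orb (F j) x₀) n (rmap k (F i) (F j) 1 n a) = push G k (orb (F i) x₀) n a := by
  rw [rmap, push_push]; congr 2; funext x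
  induction' x using induction_on with x
  rw [Function.comp_apply, rm_mk (Nrm.of_le (hF.mono i j hij)), orb_mk (hF.fix j), orb_mk (hF.fix i), mul_one]

lemma Exhausts.exists_rmap_eq_zero (hF : Exhausts F x₀) {i : ι} {n : ℕ} {a : Bar G k (G ⧸ F i) n}
    (h : push G k (orb (F i) x₀) n a = 0) : ∃ j, i ≤ j ∧ rmap k (F i) (F j) 1 n a = 0 := by
  obtain ⟨j, hj⟩ := exists_index_of_finset
    (r := fun (j : ι) (a b : (Fin n → G) × (G ⧸ F i)) => ∀ l, i ≤ l → j ≤ l → a.1 = b.1 ∧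
      rm (F i) (F l) 1 a.2 = rm (F i) (F l) 1 b.2)
    (fun j l hjl a b hab m him hlm => hab m him (hjl.trans hlm)) (Prod.map id (orb (F i) x₀)) (by
      rintro ⟨g, a⟩ ⟨g', b⟩ hab; rw [Prod.map_apply, Prod.map_apply, Prod.mk.injEq] at hab
      induction' a using induction_on with a
      induction' b using induction_on with b
      rw [orb_mk (hF.fix i), orb_mk (hF.fix i)] at hab
      obtain ⟨j, hj⟩ := hF.stab (a⁻¹*b) (by rw [mul_smul, ← hab.2, inv_smul_smul])
      refine ⟨j, fun l hil hjl => ⟨hab.1, ?_⟩⟩; dsimp only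
      rw [rm_mk (Nrm.of_le (hF.mono i l hil)), rm_mk (Nrm.of_le (hF.mono i l hil)), mul_one, mul_one,
        QuotientGroup.eq]
      exact hF.mono j l hjl hj) a.support
  obtain ⟨l, hil, hjl⟩ := exists_ge_ge i j
  exact ⟨l, hil, mapDomain_eq_zero_of _ _ (fun x hx y hy e =>
    Prod.ext_iff.2 (hj x hx y hy e l hil hjl)) h⟩

lemma Exhausts.surjective (hF : Exhausts F x₀) (tr : ∀ x : X, ∃ g : G, g • x₀ = x) (i : ι) :
    Function.Surjective (orb (F i) x₀) := fun x => by
  obtain ⟨g, rfl⟩ := tr x; exact ⟨g, orb_mk (hF.fix i) g⟩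

lemma Exhausts.exists_cycle (hF : Exhausts F x₀) (tr : ∀ x : X, ∃ g : G, g • x₀ = x) {n : ℕ}
    {z : Bar G k X n} (hz : IsCyc z) (i₀ : ι) : ∃ i, i₀ ≤ i ∧ ∃ a : Bar G k (G ⧸ F i) n, IsCyc a ∧
      push G k (orb (F i) x₀) n a = z := by
  obtain ⟨a, rfl⟩ := push_surjective (G := G) (k := k) (hF.surjective tr i₀) n z
  cases n with
  | zero => exact ⟨i₀, le_refl _, a, trivial, rfl⟩
  | succ n =>
    have h0 : push G k (orb (F i₀) x₀) n (bd G k _ n a) = 0 := by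
      rw [← bd_push (orb_equivar (hF.fix i₀))]; exact hz
    obtain ⟨j, hj, e⟩ := hF.exists_rmap_eq_zero h0
    refine ⟨j, hj, rmap k (F i₀) (F j) 1 (n+1) a, ?_, hF.push_orb hj a⟩; change bd G k _ n _ = 0
    rw [bd_rmap (Nrm.of_le (hF.mono _ _ hj)), e]

end Orbit

section ProjectiveLine

def mkSL (a b c d : ℚ) (h : a*d - b*c = 1) : SL2Q :=
  ⟨!![a, b; c, d], by rw [Matrix.det_fin_two]; exact h⟩

section
variable {a b c d : ℚ} {h : a*d - b*c = 1}
@[simp] lemma mkSL_00 : mkSL a b c d h 0 0 = a := rfl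
@[simp] lemma mkSL_01 : mkSL a b c d h 0 1 = b := rfl
@[simp] lemma mkSL_10 : mkSL a b c d h 1 0 = c := rfl
@[simp] lemma mkSL_11 : mkSL a b c d h 1 1 = d := rfl
end

def slv (g : SL2Q) (v : ℚ × ℚ) : ℚ × ℚ := (g 0 0*v.1 + g 0 1*v.2, g 1 0*v.1 + g 1 1*v.2)

lemma slv_one (v : ℚ × ℚ) : slv 1 v = v := by simp [slv]

lemma slv_mul (g h : SL2Q) (v : ℚ × ℚ) : slv (g*h) v = slv g (slv h v) := by
  simp only [slv, sl_mul]; ext <;> simp <;> ring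

lemma det2_slv (g : SL2Q) (v w : ℚ × ℚ) : det2 (slv g v) (slv g w) = det2 v w := by
  have := sl_det g; simp only [det2, slv]; linear_combination (v.1*w.2 - w.1*v.2)*this

lemma slv_ne_zero (g : SL2Q) {v : ℚ × ℚ} (hv : v ≠ 0) : slv g v ≠ 0 := by
  intro h; apply hv; rw [← slv_one v, ← inv_mul_cancel g, slv_mul, h]; simp [slv]

@[ext]
structure NV where
  val : ℚ × ℚ
  ne_zero : val ≠ 0

instance : MulAction SL2Q NV where
  smul g v := ⟨slv g v.1, slv_ne_zero g v.2⟩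
  one_smul v := NV.ext (slv_one v.1)
  mul_smul g h v := NV.ext (slv_mul g h v.1)

lemma NV.smul_val (g : SL2Q) (v : NV) : (g • v).1 = slv g v.1 := rfl

lemma det2_trans {u v w : ℚ × ℚ} (hv : v ≠ 0) (h1 : det2 u v = 0) (h2 : det2 v w = 0) :
    det2 u w = 0 := by
  have e1 : v.1*det2 u w = 0 := by simp only [det2] at *; linear_combination w.1*h1 + u.1*h2
  have e2 : v.2*det2 u w = 0 := by simp only [det2] at *; linear_combination w.2*h1 + u.2*h2
  by_contra hne
  exact hv (Prod.ext ((mul_eq_zero.1 e1).resolve_right hne) ((mul_eq_zero.1 e2).resolve_right hne))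

lemma exists_det2_ne_zero (s : Finset NV) : ∃ x : NV, ∀ y ∈ s, det2 x.1 y.1 ≠ 0 := by
  obtain ⟨n, hn⟩ := Infinite.exists_notMem_finset (s.image fun y => y.1.2/y.1.1)
  refine ⟨⟨(1, n), by simp⟩, fun y hy h => ?_⟩; simp only [det2] at h; by_cases h1 : y.1.1 = 0
  · rw [h1] at h; exact y.2 (Prod.ext h1 (by simpa using h))
  · apply hn; exact mem_image.2 ⟨y, hy, by rw [div_eq_iff h1]; linarith⟩

instance : GenPos SL2Q NV where
  rel v w := det2 v.1 w.1 ≠ 0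
  rel_symm := det2_ne_swap
  rel_smul g x y h := by rw [NV.smul_val, NV.smul_val, det2_slv]; exact h
  exists_rel := exists_det2_ne_zero

instance nvSetoid : Setoid NV where
  r v w := det2 v.1 w.1 = 0
  iseqv := ⟨fun v => det2_self v.1, fun h => by rw [det2_swap, h, neg_zero],
    fun {_ v _} h1 h2 => det2_trans v.2 h1 h2⟩

def P1 : Type := Quotient nvSetoid

def toP1 (v : NV) : P1 := Quotient.mk nvSetoid v

lemma toP1_eq {v w : NV} : toP1 v = toP1 w ↔ det2 v.1 w.1 = 0 := Quotient.eq (r := nvSetoid)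

lemma toP1_surjective : Function.Surjective toP1 := Quotient.exists_rep

instance : MulAction SL2Q P1 where
  smul g := Quotient.map (g • ·) fun v w (h : det2 v.1 w.1 = 0) => by
    change det2 (slv g v.1) (slv g w.1) = 0; rw [det2_slv, h]
  one_smul x := by
    obtain ⟨v, rfl⟩ := toP1_surjective x; change toP1 ((1 : SL2Q) • v) = toP1 v; rw [one_smul]
  mul_smul g h x := by
    obtain ⟨v, rfl⟩ := toP1_surjective x; change toP1 ((g*h) • v) = toP1 (g • h • v)
    rw [mul_smul]

lemma smul_toP1 (g : SL2Q) (v : NV) : g • toP1 v = toP1 (g • v) := rfl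

instance : GenPos SL2Q P1 where
  rel := fun x y => x ≠ y
  rel_symm h := h.symm
  rel_smul g _ _ h := fun e => h (MulAction.injective g e)
  exists_rel s := by
    obtain ⟨x, hx⟩ := exists_det2_ne_zero (s.image (surjInv toP1_surjective))
    refine ⟨toP1 x, fun y hy e => ?_⟩; apply hx _ (Finset.mem_image_of_mem _ hy)
    rw [← toP1_eq, e]; exact (Function.surjInv_eq toP1_surjective y).symm

abbrev PC (n : ℕ) : Type := Conf SL2Q P1 n

def rep (x : P1) : ℚ × ℚ := (surjInv toP1_surjective x).1

lemma rep_ne_zero (x : P1) : rep x ≠ 0 := (surjInv toP1_surjective x).2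

lemma toP1_rep (x : P1) : toP1 ⟨rep x, rep_ne_zero x⟩ = x := Function.surjInv_eq toP1_surjective x

lemma det2_rep {x y : P1} : det2 (rep x) (rep y) = 0 ↔ x = y := by
  have := @toP1_eq ⟨rep x, rep_ne_zero x⟩ ⟨rep y, rep_ne_zero y⟩; rw [toP1_rep, toP1_rep] at this
  exact this.symm

lemma rep_smul_det (g : SL2Q) (x : P1) : det2 (rep (g • x)) (slv g (rep x)) = 0 := by
  have := @toP1_eq ⟨rep (g • x), rep_ne_zero _⟩ (g • (⟨rep x, rep_ne_zero x⟩ : NV))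
  rw [toP1_rep, ← smul_toP1, toP1_rep] at this; exact this.1 rfl

lemma rep_toP1_det (v : NV) : det2 (rep (toP1 v)) v.1 = 0 := by
  have := @toP1_eq ⟨rep (toP1 v), rep_ne_zero _⟩ v; rw [toP1_rep] at this; exact this.1 rfl

def pInf : P1 := toP1 ⟨(1, 0), by simp⟩

def pZero : P1 := toP1 ⟨(0, 1), by simp⟩

def mkPair {x y : P1} (h : x ≠ y) : PC 2 := ⟨![x, y], fun i j hij => by
  fin_cases i <;> fin_cases j
  exacts [absurd rfl hij, h, h.symm, absurd rfl hij]⟩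

def pair₀ : PC 2 := mkPair (x := pInf) (y := pZero) fun e => by simpa [det2] using toP1_eq.1 e

lemma smul_pInf {g : SL2Q} : g • pInf = pInf ↔ g 1 0 = 0 := by
  rw [pInf, smul_toP1, toP1_eq]; simp [NV.smul_val, slv, det2]

lemma smul_pZero {g : SL2Q} : g • pZero = pZero ↔ g 0 1 = 0 := by
  rw [pZero, smul_toP1, toP1_eq]; simp [NV.smul_val, slv, det2]

lemma conf_ext {n : ℕ} {f f' : PC n} (h : ∀ i, f.1 i = f'.1 i) : f = f' := Subtype.ext (funext h)

lemma smul_pair₀ {g : SL2Q} : g • pair₀ = pair₀ ↔ g 1 0 = 0 ∧ g 0 1 = 0 := by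
  rw [← smul_pInf, ← smul_pZero]
  refine ⟨fun h => ⟨congrFun (congrArg Subtype.val h) 0, congrFun (congrArg Subtype.val h) 1⟩,
    fun ⟨h1, h2⟩ => conf_ext fun i => ?_⟩
  fin_cases i
  exacts [h1, h2]

lemma pair_transitive (f : PC 2) : ∃ g : SL2Q, g • pair₀ = f := by
  set v := rep (f.1 0); set w := rep (f.1 1)
  have hd : det2 v w ≠ 0 := fun h => f.2 0 1 (by decide) (det2_rep.1 h)
  have hdet : v.1*w.2 - w.1*v.2 ≠ 0 := hd
  refine ⟨mkSL v.1 (w.1/det2 v w) v.2 (w.2/det2 v w) ?_, ?_⟩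
  · simp only [det2]; field_simp
  · apply conf_ext; intro i; fin_cases i
    · change _ • pInf = f.1 0; rw [pInf, smul_toP1, ← toP1_rep (f.1 0), toP1_eq]
      simp [NV.smul_val, slv, det2, v]
    · change _ • pZero = f.1 1; rw [pZero, smul_toP1, ← toP1_rep (f.1 1), toP1_eq]
      simp [NV.smul_val, slv, det2, w]; ring

/-- Finite sets of primes containing `3`. -/
abbrev PrimeSet : Type := {S : Finset ℕ // 3 ∈ S ∧ ∀ q ∈ S, q.Prime}

instance : IsDirectedOrder PrimeSet where
  directed S T := ⟨⟨S.1 ∪ T.1, Finset.mem_union_left _ S.2.1, fun q hq =>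
    (Finset.mem_union.1 hq).elim (S.2.2 q) (T.2.2 q)⟩, Finset.subset_union_left,
    Finset.subset_union_right⟩

instance : Nonempty PrimeSet := ⟨⟨{3}, by simp, by simpa using Nat.prime_three⟩⟩

lemma exists_pSet {x : ℚ} (hx : x ≠ 0) : ∃ S : PrimeSet, ∀ q : ℕ, q.Prime → q ∉ S.1 → padicValRat q x = 0 := by
  refine ⟨⟨insert 3 (x.num.natAbs.primeFactors ∪ x.den.primeFactors), mem_insert_self _ _, ?_⟩, ?_⟩
  · intro q hq; rcases mem_insert.1 hq with rfl | hq
    · exact Nat.prime_three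
    · rcases Finset.mem_union.1 hq with hq | hq <;> exact Nat.prime_of_mem_primeFactors hq
  · intro q hq hS
    have h1 : ¬ q ∣ x.num.natAbs := fun h => hS (mem_insert_of_mem (Finset.mem_union_left _
      (Nat.mem_primeFactors.2 ⟨hq, h, by simpa using hx⟩)))
    have h2 : ¬ q ∣ x.den := fun h => hS (mem_insert_of_mem (Finset.mem_union_right _
      (Nat.mem_primeFactors.2 ⟨hq, h, x.den_ne_zero⟩)))
    rw [padicValRat, padicValInt, padicValNat.eq_zero_of_not_dvd h1, padicValNat.eq_zero_of_not_dvd h2]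
    simp

lemma exists_mem_tri {D : Prop} {g : SL2Q} (h10 : g 1 0 = 0) (h01 : D → g 0 1 = 0) :
    ∃ S : PrimeSet, g ∈ tri D S.1 := by
  obtain ⟨S, hS⟩ := exists_pSet (left_ne_zero_of_mul_eq_one (sl_det' h10)); exact ⟨S, h10, h01, hS⟩

lemma exhausts_pair : Exhausts (fun S : PrimeSet => tri True S.1) pair₀ where
  mono _ _ h := tri_mono id h
  fix _ _ hg := smul_pair₀.2 ⟨hg.1, hg.2.1 trivial⟩
  stab _ hg := exists_mem_tri (smul_pair₀.1 hg).1 fun _ => (smul_pair₀.1 hg).2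

def point₀ : PC 1 := face 1 pair₀

lemma smul_point₀ {g : SL2Q} : g • point₀ = point₀ ↔ g 1 0 = 0 := by
  rw [← smul_pInf]
  exact ⟨fun h => congrFun (congrArg Subtype.val h) 0, fun h => conf_ext fun i => by
    fin_cases i; exact h⟩

lemma exhausts_point : Exhausts (fun S : PrimeSet => tri False S.1) point₀ where
  mono _ _ h := tri_mono id h
  fix _ _ hg := smul_point₀.2 hg.1
  stab _ hg := exists_mem_tri (smul_point₀.1 hg) fun h => h.elim

end ProjectiveLine

notation:max "relQ" => relN SL2Q ZHalf P1
notation:max "cdQ" => cd SL2Q ZHalf P1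
notation:max "BdQ" => Bd SL2Q ZHalf
notation:max "ptQ" => pt SL2Q ZHalf
notation:max "pushQ" => push SL2Q ZHalf
notation:max "bdQ" => bd SL2Q ZHalf

section LowDegree

def swapPair (f : PC 2) : PC 2 := ⟨fun i => f.1 (Equiv.swap 0 1 i), fun i j h =>
  f.2 _ _ fun e => h ((Equiv.swap 0 1).injective e)⟩

lemma swapPair_equivar : Equivar SL2Q swapPair := fun _ _ => rfl

lemma ww_pair₀ : ww • pair₀ = swapPair pair₀ := by
  refine conf_ext fun i => ?_
  fin_cases i <;> change ww • toP1 _ = toP1 _ <;> rw [smul_toP1, toP1_eq] <;>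
    simp [NV.smul_val, slv, det2]

abbrev PB (p q : ℕ) : Type := Bar SL2Q ZHalf (PC p) q

lemma cd_pair {q : ℕ} (c : PB 2 q) : cdQ 1 q c = pushQ (face 0) q c - pushQ (face 1) q c := by
  rw [cd_apply, Fin.sum_univ_two]; simp [sub_eq_add_neg]

lemma cd_swapPair {q : ℕ} (c : PB 2 q) : cdQ 1 q (pushQ swapPair q c) = -cdQ 1 q c := by
  rw [cd_pair, cd_pair, push_push, push_push]
  have h0 : (face 0 ∘ swapPair : PC 2 → PC 1) = face 1 := funext fun f =>
    conf_ext fun i => by fin_cases i; simp [face, swapPair]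
  have h1 : (face 1 ∘ swapPair : PC 2 → PC 1) = face 0 := funext fun f =>
    conf_ext fun i => by fin_cases i; simp [face, swapPair]
  rw [h0, h1]; abel

lemma push_orb_ww {S : PrimeSet} {n : ℕ} (a : Bar SL2Q ZHalf (SL2Q ⧸ tri True S.1) n) :
    pushQ (orb (tri True S.1) pair₀) n (rmap ZHalf (tri True S.1) (tri True S.1) ww n a) =
      pushQ swapPair n (pushQ (orb (tri True S.1) pair₀) n a) := by
  rw [rmap, push_push, push_push]; congr 2; funext x
  induction' x using induction_on with x
  rw [Function.comp_apply, Function.comp_apply, rm_mk nrm_ww, orb_mk (exhausts_pair.fix S),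
    orb_mk (exhausts_pair.fix S), mul_smul, ww_pair₀, swapPair_equivar]

lemma push_orb_face {S : PrimeSet} {n : ℕ} (a : Bar SL2Q ZHalf (SL2Q ⧸ tri True S.1) n) :
    pushQ (orb _ point₀) n (rmap ZHalf (tri True S.1) (tri False S.1) 1 n a) =
      pushQ (face 1) n (pushQ (orb (tri True S.1) pair₀) n a) := by
  rw [rmap, push_push, push_push]; congr 2; funext x
  induction' x using induction_on with x
  rw [Function.comp_apply, Function.comp_apply, rm_mk (Nrm.of_le (tri_mono False.elim subset_rfl)),
    orb_mk (exhausts_pair.fix S), orb_mk (exhausts_point.fix S), mul_one]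
  rfl

lemma pair_sign {n : ℕ} {z : PB 2 n} (hz : IsCyc z) :
    pushQ swapPair n z - ((-1 : ℤ)^n) • z ∈ BdQ (PC 2) n := by
  obtain ⟨S, -, a, ha, rfl⟩ := exhausts_pair.exists_cycle pair_transitive hz (Classical.arbitrary _)
  have := push_mem_Bd (orb_equivar (exhausts_pair.fix S)) ((rigid_tri S.1 S.2.2).sign n a ha)
  rwa [map_sub, map_zsmul, push_orb_ww] at this

lemma pair_torsion {m : ℕ} (hm : m ≠ 0) {n : ℕ} {z : PB 2 n} (hz : IsCyc z)
    (h : m • z ∈ BdQ (PC 2) n) : z ∈ BdQ (PC 2) n := by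
  obtain ⟨S, -, a, ha, rfl⟩ := exhausts_pair.exists_cycle pair_transitive hz (Classical.arbitrary _)
  obtain ⟨b', hb'⟩ := h
  obtain ⟨b, rfl⟩ := push_surjective (G := SL2Q) (k := ZHalf)
    (exhausts_pair.surjective pair_transitive S) (n+1) b'
  have h0 : pushQ (orb (tri True S.1) pair₀) n (m • a - bdQ _ n b) = 0 := by
    rw [map_sub, map_nsmul, ← bd_push (orb_equivar (exhausts_pair.fix S)), hb', sub_self]
  obtain ⟨S', hS, e⟩ := exhausts_pair.exists_rmap_eq_zero h0
  have hn := Nrm.of_le (exhausts_pair.mono _ _ hS)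
  rw [map_sub, sub_eq_zero, map_nsmul, ← bd_rmap hn] at e
  have := push_mem_Bd (orb_equivar (exhausts_pair.fix S'))
    ((rigid_tri S'.1 S'.2.2).torsion_free m hm n _ (ha.rmap hn) ⟨_, e.symm⟩)
  rwa [exhausts_pair.push_orb hS] at this

lemma pair_rel {n : ℕ} {z : PB 2 n} (hz : IsCyc z) (h : pushQ (face 1) n z = 0) :
    ∃ y : PB 2 (n+1), pushQ (face 1) (n+1) y = 0 ∧ bdQ _ n y = z := by
  obtain ⟨S, -, a, ha, rfl⟩ := exhausts_pair.exists_cycle pair_transitive hz (Classical.arbitrary _)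
  rw [← push_orb_face] at h; obtain ⟨S', hS, e⟩ := exhausts_point.exists_rmap_eq_zero h
  have hn := Nrm.of_le (exhausts_pair.mono _ _ hS)
  have hle : ∀ T : PrimeSet, tri True T.1 ≤ tri False T.1 := fun T => tri_mono False.elim subset_rfl
  have e' : rmap ZHalf (tri True S'.1) (tri False S'.1) 1 n (rmap ZHalf (tri True S.1) _ 1 n a) = 0 := by
    rw [rmap_rmap hn (Nrm.of_le (hle S')), ← e, rmap_rmap (Nrm.of_le (hle S))
      (Nrm.of_le (exhausts_point.mono _ _ hS))]
  obtain ⟨y, h1, h2⟩ := relAcyclic_tri S'.1 S'.2.1 S'.2.2 n _ (ha.rmap hn) e'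
  refine ⟨pushQ (orb _ pair₀) (n+1) y, ?_, ?_⟩
  · rw [← push_orb_face, h1, map_zero]
  · rw [bd_push (orb_equivar (exhausts_pair.fix S')), h2, exhausts_pair.push_orb hS]

lemma face_one_surjective : Function.Surjective (face 1 : PC 2 → PC 1) := by
  intro f; obtain ⟨x, hx⟩ := GenPos.exists_rel (G := SL2Q) ({f.1 0} : Finset P1)
  have h : x ≠ f.1 0 := hx _ (Finset.mem_singleton_self _)
  exact ⟨mkPair h.symm, conf_ext fun i => by fin_cases i; rfl⟩

lemma exists_pair_cycle {n : ℕ} {z : PB 1 (n+1)} (hz : bdQ _ n z = 0) :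
    ∃ a : PB 2 (n+1), bdQ _ n a = 0 ∧ pushQ (face 1) (n+1) a = z := by
  obtain ⟨a, rfl⟩ := push_surjective (G := SL2Q) (k := ZHalf) face_one_surjective (n+1) z
  rw [bd_push (face_equivar _)] at hz; obtain ⟨y, h1, h2⟩ := pair_rel (IsCyc.bd a) hz
  exact ⟨a - y, by rw [map_sub, h2, sub_self], by rw [map_sub, h1, sub_zero]⟩

lemma stabilizer_triple (g : SL2Q) (f : PC 3) (h : g • f = f) : g = 1 ∨ g = -1 := by
  have key : ∀ i, det2 (slv g (rep (f.1 i))) (rep (f.1 i)) = 0 := by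
    intro i; have h1 := rep_smul_det g (f.1 i)
    have h2 : g • f.1 i = f.1 i := congrFun (congrArg Subtype.val h) i; rw [h2] at h1
    rw [det2_swap, h1, neg_zero]
  have nd : ∀ i j, i ≠ j → det2 (rep (f.1 i)) (rep (f.1 j)) ≠ 0 := fun i j hij e =>
    f.2 i j hij (det2_rep.1 e)
  have k0 := key 0; have k1 := key 1; have k2 := key 2
  have hD : det2 (rep (f.1 0)) (rep (f.1 1))*det2 (rep (f.1 0)) (rep (f.1 2)) *
      det2 (rep (f.1 1)) (rep (f.1 2)) ≠ 0 :=
    mul_ne_zero (mul_ne_zero (nd 0 1 (by decide)) (nd 0 2 (by decide))) (nd 1 2 (by decide))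
  generalize rep (f.1 0) = u at *; generalize rep (f.1 1) = v at *; generalize rep (f.1 2) = w at *
  have hb : g 0 1 = 0 := by
    apply (mul_eq_zero.1 (?_ : _*g 0 1 = 0)).resolve_left hD; simp only [det2, slv] at *
    linear_combination (v.1*w.1*(v.1*w.2 - w.1*v.2))*k0 -
      (u.1*w.1*(u.1*w.2 - w.1*u.2))*k1 + (u.1*v.1*(u.1*v.2 - v.1*u.2))*k2
  have hc : g 1 0 = 0 := by
    apply (mul_eq_zero.1 (?_ : _*g 1 0 = 0)).resolve_left hD; simp only [det2, slv] at *
    linear_combination -(v.2*w.2*(v.1*w.2 - w.1*v.2))*k0 +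
      (u.2*w.2*(u.1*w.2 - w.1*u.2))*k1 - (u.2*v.2*(u.1*v.2 - v.1*u.2))*k2
  have ha : g 0 0 = g 1 1 := by
    rw [← sub_eq_zero]; apply (mul_eq_zero.1 (?_ : _*(g 0 0 - g 1 1) = 0)).resolve_left hD
    simp only [det2, slv] at *
    linear_combination -((v.1*w.2 + v.2*w.1)*(v.1*w.2 - w.1*v.2))*k0 +
      ((u.1*w.2 + u.2*w.1)*(u.1*w.2 - w.1*u.2))*k1 -
      ((u.1*v.2 + u.2*v.1)*(u.1*v.2 - v.1*u.2))*k2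
  have hd := sl_det g; rw [hb, zero_mul, sub_zero, ← ha, mul_self_eq_one_iff] at hd
  refine hd.imp (fun hd => ?_) fun hd => ?_ <;> apply sl_ext <;> simp [hb, hc, ← ha, hd]

instance : Subsingleton (PC 0) := ⟨fun _ _ => conf_ext fun i => i.elim0⟩

lemma lowDegree : LowDegree SL2Q ZHalf P1 where
  triple z hz := bounds_of_stabilizer (e := -1) (by simp) stabilizer_triple two_mul_half hz
  pair z hz := by
    obtain ⟨y, hy⟩ := pair_sign (n := 2) (z := z) hz; have h := congrArg (cdQ 1 2) hy
    rw [← bd_cd, map_sub, cd_swapPair, map_zsmul] at h; refine ⟨-(half • y), ?_⟩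
    rw [map_neg, map_smul, map_neg, map_smul, h]
    have : -cdQ 1 2 z - (-1 : ℤ)^2 • cdQ 1 2 z = -((2 : ZHalf) • cdQ 1 2 z) := by
      rw [two_smul]; simp; abel
    rw [this, smul_neg, neg_neg, smul_smul, mul_comm, two_mul_half, one_smul]
  point z hz := by
    obtain ⟨a, ha, rfl⟩ := exists_pair_cycle hz; have h := pair_sign (n := 3) (z := a) ha
    have hpush : ∀ c : PB 1 3, cdQ 0 3 c = pushQ (face 0) 3 c := fun c => by
      rw [cd_apply, Fin.sum_univ_one]; simp
    have h2 := push_mem_Bd (f := (face 0 ∘ face 1 : PC 2 → PC 0)) (fun _ _ => rfl) h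
    rw [map_sub, map_zsmul, push_push] at h2
    have e : ((face 0 ∘ face 1) ∘ swapPair : PC 2 → PC 0) = face 0 ∘ face 1 :=
      funext fun _ => Subsingleton.elim _ _
    rw [e, ← push_push, ← hpush] at h2; refine mem_of_add_self_mem two_mul_half ?_
    convert h2 using 1; simp [pow_succ]
  pair_torsion_free m hm z hz h := pair_torsion hm (n := 1) hz h
  point_torsion_free m hm z hz h := by
    obtain ⟨a, ha, rfl⟩ := exists_pair_cycle hz; obtain ⟨b', hb'⟩ := h
    obtain ⟨b, rfl⟩ := push_surjective (G := SL2Q) (k := ZHalf) face_one_surjective 3 b'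
    obtain ⟨y, h1, h2⟩ := pair_rel (n := 2) (z := m • a - bdQ _ 2 b)
      (by change bdQ _ 1 _ = 0; rw [map_sub, map_nsmul, ha, bd_bd]; simp)
      (by rw [map_sub, map_nsmul, ← bd_push (face_equivar _), hb', sub_self])
    have := pair_torsion hm (n := 2) (z := a) ha ⟨y + b, by rw [map_add, h2, sub_add_cancel]⟩
    exact push_mem_Bd (face_equivar _) this

end LowDegree

section Compare

instance : Unique (PC 0) := Unique.mk' (h₁ := ⟨⟨Fin.elim0, fun i => i.elim0⟩⟩) (PC 0)

/-- Chains on the empty configuration are the chains of the group. -/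
def chainsEquiv (n : ℕ) : PB 0 n ≃ₗ[ZHalf] Chains n :=
  Finsupp.domLCongr (Equiv.prodUnique (Fin n → SL2Q) (PC 0))

lemma chainsEquiv_cell {n : ℕ} (p : Fin (n+1) → SL2Q) (x : PC 0) :
    chainsEquiv n (cell ZHalf p x) = single (nf p x).1 1 := by
  rw [cell, chainsEquiv, Finsupp.domLCongr_single]; rfl

lemma neg_one_pow_zsmul {M : Type*} [AddCommGroup M] [Module ZHalf M] (n : ℕ) (v : M) :
    ((-1 : ℤ)^n) • v = ((-1 : ZHalf)^n) • v := by
  rw [← Int.cast_smul_eq_zsmul ZHalf]; push_cast; rfl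

lemma bdry_chainsEquiv {n : ℕ} (c : PB 0 (n+1)) :
    bdry n (chainsEquiv (n+1) c) = chainsEquiv n (bdQ (PC 0) n c) := by
  have : bdry n ∘ₗ (chainsEquiv (n+1)).toLinearMap =
      (chainsEquiv n).toLinearMap ∘ₗ bdQ (PC 0) n := by
    refine Finsupp.lhom_ext' fun a => ext_ring ?_
    obtain ⟨g, x⟩ := a
    have e : (single (g, x) 1 : PB 0 (n+1)) = cell ZHalf (partialProd g) x := by
      rw [cell, nf_partialProd (g, x)]
    simp only [comp_apply, lsingle_apply, LinearEquiv.coe_coe]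
    rw [e, bd_cell, chainsEquiv_cell, nf_partialProd (g, x), map_sum, bdry, Finsupp.lsum_single,
      Fin.sum_univ_succ, Fin.sum_univ_castSucc]
    have h0 : (nf (fun l => partialProd g ((0 : Fin (n+2)).succAbove l)) x).1 = Fin.tail g := by
      funext l; have := Fin.partialProd_right_inv g l.succ; simpa [nf, Fin.tail] using this
    have h1 : ∀ j : Fin (n+1), (nf (fun l => partialProd g (j.succ.succAbove l)) x).1 =
        j.contractNth (· * ·) g := by
      intro j; funext l; rw [← Fin.inv_partialProd_mul_eq_contractNth]
      simp [nf, Fin.succ_succAbove_succ]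
    have h2 : (Fin.last n).contractNth (· * ·) g = Fin.init g := by
      funext l; rw [Fin.contractNth_apply_of_lt _ _ _ _ (by simp)]; rfl
    simp only [map_zsmul]
    simp only [chainsEquiv_cell, h0, h1, h2, neg_one_pow_zsmul, LinearMap.add_apply,
      LinearMap.sum_apply, LinearMap.smul_apply, lsingle_apply]
    simp [add_assoc]
  exact LinearMap.congr_fun this c

end Compare

section Lin

variable {G : Type*} [Group G] {k : Type*} [CommRing k] {X : Type*} [MulAction G X]
  {W : Type*} [AddCommGroup W] [Module k W]

variable (G k) in
/-- The linear extension of a function to chains of degree zero. -/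
def lin (c : X → W) : Bar G k X 0 →ₗ[k] W := Finsupp.lift W k _ fun a => c a.2

lemma pt_eq (x : X) : pt G k x = single (finZeroElim, x) 1 := (single_eq_pt _ x).symm

lemma lin_pt (c : X → W) (x : X) : lin G k c (pt G k x) = c x := by rw [pt_eq, lin]; simp

lemma push_zero_pt {Y : Type*} (f : X → Y) [MulAction G Y] (x : X) :
    push G k f 0 (pt G k x) = pt G k (f x) := by
  rw [pt_eq, pt_eq]; simp [push]

lemma map_Bd_eq_zero {L : Bar G k X 0 →ₗ[k] W} (h : ∀ (g : G) x, L (pt G k (g • x)) = L (pt G k x))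
    {c : Bar G k X 0} (hc : c ∈ Bd G k X 0) : L c = 0 := by
  obtain ⟨e, rfl⟩ := hc
  have : L ∘ₗ bd G k X 0 = 0 := by
    apply bar_hom_ext; intro p x
    have e : ∀ q : Fin 1 → G, L (cell k q x) = L (pt G k x) := by
      intro q; rw [← cell_smul k (q 0)⁻¹, ← h (q 0)⁻¹ x, pt]; congr 2; funext i; fin_cases i; simp
    simp [bd_cell, Fin.sum_univ_two, e]
  exact LinearMap.congr_fun this e

lemma cd_pt {P : Type*} [MulAction G P] [GenPos G P] {p : ℕ} (f : Conf G P (p+1)) :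
    cd G k P p 0 (pt G k f) = ∑ i : Fin (p+1), ((-1 : ℤ)^(i : ℕ)) • pt G k (face i f) := by
  rw [cd_apply]; simp only [push_zero_pt]

end Lin

section Similar

def dt {n : ℕ} (q : PC n) (i j : Fin n) : ℚ := det2 (rep (q.1 i)) (rep (q.1 j))

lemma dt_ne_zero {n : ℕ} (q : PC n) {i j : Fin n} (h : i ≠ j) : dt q i j ≠ 0 :=
  fun e => q.2 i j h (det2_rep.1 e)

/-- Configurations whose determinants agree up to rescaling and a common factor. -/
def Sim {n : ℕ} (a : ℚ) (q q' : PC n) : Prop :=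
  ∃ t : Fin n → ℚ, (∀ i, t i ≠ 0) ∧ ∀ i j, dt q' i j = t i*t j*a*dt q i j

lemma exists_scale {v w : ℚ × ℚ} (hv : v ≠ 0) (hw : w ≠ 0) (h : det2 v w = 0) :
    ∃ t : ℚ, t ≠ 0 ∧ v = t • w := by
  have key : ∃ t : ℚ, v = t • w := by
    simp only [det2] at h; by_cases h1 : w.1 = 0
    · have h2 : w.2 ≠ 0 := fun h2 => hw (Prod.ext h1 h2)
      refine ⟨v.2/w.2, Prod.ext ?_ ?_⟩
      · rw [h1, zero_mul, sub_zero] at h; simpa [h1, h2] using h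
      · simp [h2]
    · refine ⟨v.1/w.1, Prod.ext ?_ ?_⟩
      · simp [h1]
      · simp; field_simp; linarith
  obtain ⟨t, rfl⟩ := key; exact ⟨t, fun e => hv (by rw [e, zero_smul]), rfl⟩

lemma exists_dt {n : ℕ} (q : PC n) (v : Fin n → NV) (h : ∀ i, q.1 i = toP1 (v i)) :
    ∃ t : Fin n → ℚ, (∀ i, t i ≠ 0) ∧ ∀ i j, dt q i j = t i*t j*det2 (v i).1 (v j).1 := by
  have : ∀ i, ∃ t : ℚ, t ≠ 0 ∧ rep (q.1 i) = t • (v i).1 := fun i =>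
    exists_scale (rep_ne_zero _) (v i).2 (by rw [h]; exact rep_toP1_det _)
  choose t h0 ht using this
  refine ⟨t, h0, fun i j => ?_⟩
  simp only [dt, ht, det2, Prod.smul_fst, Prod.smul_snd, smul_eq_mul]; ring

namespace Sim

variable {n : ℕ} {a b : ℚ} {q q' q'' : PC n}

lemma trans (h : Sim a q q') (h' : Sim b q' q'') : Sim (a*b) q q'' := by
  obtain ⟨t, h0, ht⟩ := h; obtain ⟨s, h1, hs⟩ := h'
  exact ⟨fun i => t i*s i, fun i => mul_ne_zero (h0 i) (h1 i), fun i j => by rw [hs, ht]; ring⟩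

lemma symm (ha : a ≠ 0) (h : Sim a q q') : Sim a⁻¹ q' q := by
  obtain ⟨t, h0, ht⟩ := h; refine ⟨fun i => (t i)⁻¹, fun i => inv_ne_zero (h0 i), fun i j => ?_⟩
  rw [ht]; have := h0 i; have := h0 j; field_simp

lemma sq (h : Sim a q q') {s : ℚ} (hs : s ≠ 0) (e : a = b*(s*s)) : Sim b q q' := by
  obtain ⟨t, h0, ht⟩ := h
  exact ⟨fun i => t i*s, fun i => mul_ne_zero (h0 i) hs, fun i j => by rw [ht, e]; ring⟩

lemma face {q q' : PC (n+1)} (h : Sim a q q') (i : Fin (n+1)) : Sim a (face i q) (face i q') := by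
  obtain ⟨t, h0, ht⟩ := h; exact ⟨fun l => t (i.succAbove l), fun l => h0 _, fun l m => ht _ _⟩

lemma of_rep (φ : P1 → NV) (hφ : ∀ x y, det2 (φ x).1 (φ y).1 = a*det2 (rep x) (rep y))
    (h : ∀ i, q'.1 i = toP1 (φ (q.1 i))) : Sim a q q' := by
  obtain ⟨t, h0, ht⟩ := exists_dt q' (fun i => φ (q.1 i)) h
  exact ⟨t, h0, fun i j => by rw [ht, hφ, dt]; ring⟩

lemma smul (g : SL2Q) (q : PC n) : Sim 1 q (g • q) :=
  of_rep (fun x => g • ⟨rep x, rep_ne_zero x⟩) (fun x y => by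
    rw [NV.smul_val, NV.smul_val, det2_slv, one_mul]) (fun i => by
    rw [Conf.smul_val, ← smul_toP1, toP1_rep])

lemma exists_smul {q q' : PC (n+2)} (h : Sim 1 q q') : ∃ g : SL2Q, q' = g • q := by
  obtain ⟨t, h0, ht⟩ := h; set v := fun i => rep (q.1 i) with hv
  set w := fun i => rep (q'.1 i) with hw
  have hd : det2 (v 0) (v 1) ≠ 0 := dt_ne_zero q (by simp)
  have e : ∀ i j, det2 (w i) (w j) = t i*t j*det2 (v i) (v j) := fun i j => by
    have := ht i j; simpa [dt] using this
  have h00 := h0 0; have h01 := h0 1; set d := det2 (v 0) (v 1) with hdd; have e01 := e 0 1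
  let A := ((w 0).1*(v 1).2/t 0 - (w 1).1*(v 0).2/t 1)/d
  let B := ((w 1).1*(v 0).1/t 1 - (w 0).1*(v 1).1/t 0)/d
  let C := ((w 0).2*(v 1).2/t 0 - (w 1).2*(v 0).2/t 1)/d
  let E := ((w 1).2*(v 0).1/t 1 - (w 0).2*(v 1).1/t 0)/d
  have hg : A*E - B*C = 1 := by
    have : A*E - B*C = det2 (w 0) (w 1)*det2 (v 0) (v 1)/(t 0*t 1*d*d) := by
      simp only [A, B, C, E, det2]; field_simp; ring
    rw [this, e01, ← hdd, mul_assoc, div_self (by positivity)]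
  refine ⟨mkSL A B C E hg, conf_ext fun i => ?_⟩
  rw [Conf.smul_val, ← toP1_rep (q'.1 i), ← toP1_rep (q.1 i), smul_toP1, toP1_eq, NV.smul_val]
  have key : det2 (w i) (slv (mkSL A B C E hg) (v i)) =
      (det2 (v i) (v 1)*det2 (w i) (w 0)/t 0 + det2 (v 0) (v i)*det2 (w i) (w 1)/t 1)/d := by
    simp only [slv, mkSL_00, mkSL_01, mkSL_10, mkSL_11, A, B, C, E, det2]; field_simp; ring
  change det2 (w i) (slv _ (v i)) = 0; rw [key, e, e, det2_swap (v 1), det2_swap (v 0) (v i)]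
  field_simp; ring

end Sim

/-- The action of the diagonal matrices of arbitrary determinant. -/
def actV (a : ℚˣ) (x : P1) : NV := ⟨(a*(rep x).1, (rep x).2), fun e => rep_ne_zero x
  (Prod.ext (by simpa using congrArg Prod.fst e) (by simpa using congrArg Prod.snd e))⟩

def actP (a : ℚˣ) (x : P1) : P1 := toP1 (actV a x)

lemma actP_ne (a : ℚˣ) (x y : P1) (h : x ≠ y) : actP a x ≠ actP a y := by
  intro e; rw [actP, actP, toP1_eq] at e; apply h; rw [← det2_rep]
  have : (a : ℚ)*det2 (rep x) (rep y) = 0 := by rw [← e]; simp only [det2, actV]; ring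
  exact (mul_eq_zero.1 this).resolve_left a.ne_zero

def act (a : ℚˣ) (n : ℕ) : PC n → PC n := Conf.map (G := SL2Q) (actP_ne a) n

lemma Sim.act (a : ℚˣ) {n : ℕ} (q : PC n) : Sim a q (act a n q) :=
  Sim.of_rep (actV a) (fun x y => by simp only [det2, actV]; ring) (fun i => rfl)

lemma Sim.exists_smul_act {n : ℕ} {a : ℚˣ} {q q' : PC (n+2)} (h : Sim a q q') :
    ∃ g : SL2Q, q' = g • _root_.act a _ q := by
  have := ((Sim.act a q).symm a.ne_zero).trans h; rw [inv_mul_cancel₀ a.ne_zero] at this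
  exact this.exists_smul

def dil (a : ℚˣ) (n : ℕ) : PB n 0 →ₗ[ZHalf] PB n 0 := pushQ (act a n) 0

lemma dil_pt (a : ℚˣ) {n : ℕ} (q : PC n) : dil a n (ptQ q) = ptQ (act a n q) := push_zero_pt _ q

lemma cd_dil (a : ℚˣ) {n : ℕ} (c : PB (n+1) 0) :
    cdQ n 0 (dil a (n+1) c) = dil a n (cdQ n 0 c) := cd_push_map _ c

lemma pt_sub_mem_of_sim {n : ℕ} {q q' : PC (n+2)} (h : Sim 1 q q') :
    ptQ q' - ptQ q ∈ BdQ (PC (n+2)) 0 := by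
  obtain ⟨g, rfl⟩ := h.exists_smul; exact pt_smul_sub_mem g q

lemma dil_mem_Bd (a : ℚˣ) {n : ℕ} {c : PB (n+2) 0} (hc : c ∈ BdQ (PC (n+2)) 0) :
    dil a _ c ∈ BdQ (PC (n+2)) 0 := by
  rw [← mk_eq_zero]
  refine map_Bd_eq_zero (L := (BdQ (PC (n+2)) 0).mkQ ∘ₗ dil a _) (fun g x => ?_) hc
  rw [comp_apply, comp_apply, dil_pt, dil_pt, ← sub_eq_zero, ← map_sub, mkQ_apply, mk_eq_zero]
  apply pt_sub_mem_of_sim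
  have := (((Sim.act a x).symm a.ne_zero).trans (Sim.smul g x)).trans (Sim.act a (g • x))
  rwa [mul_one, inv_mul_cancel₀ a.ne_zero] at this

lemma dil_mem_relN (a : ℚˣ) {c : PB 4 0} (hc : c ∈ relQ) : dil a _ c ∈ relQ := by
  rw [relN, mem_sup] at hc ⊢; obtain ⟨u, hu, _, ⟨v, rfl⟩, rfl⟩ := hc
  exact ⟨_, dil_mem_Bd a hu, _, ⟨dil a _ v, rfl⟩, by rw [map_add, cd_dil]⟩

lemma dil_dil (a b : ℚˣ) (c : PB 4 0) : dil a _ (dil b _ c) - dil (a*b) _ c ∈ relQ := by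
  refine zero_chain_induction (P := fun c => dil a _ (dil b _ c) - dil (a*b) _ c ∈
    relQ) c (by simp) (fun x y hx hy => ?_) (fun r q => ?_)
  · simpa [add_sub_add_comm] using add_mem hx hy
  · simp only [map_smul, ← smul_sub, dil_pt]
    refine Submodule.smul_mem _ _ (mem_sup_left (pt_sub_mem_of_sim ?_))
    have := ((Sim.act (a*b) q).symm (Units.ne_zero _)).trans ((Sim.act b q).trans (Sim.act a _))
    convert this using 1; push_cast; field_simp

lemma dil_sq (a : ℚˣ) (c : PB 4 0) : dil a _ (dil a _ c) - c ∈ relQ := by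
  refine zero_chain_induction (P := fun c => dil a _ (dil a _ c) - c ∈ relQ) c (by simp) (fun x y hx hy => ?_) (fun r q => ?_)
  · simpa [add_sub_add_comm] using add_mem hx hy
  · simp only [map_smul, ← smul_sub, dil_pt]
    refine Submodule.smul_mem _ _ (mem_sup_left (pt_sub_mem_of_sim ?_))
    exact ((Sim.act a q).trans (Sim.act a _)).sq a.ne_zero (by ring)

end Similar

section Quadruples

variable (χ : ℚ →*₀ ℤ)

/-- The class of the first three points up to squares. -/
def kap {n : ℕ} (q : PC (n+3)) : ℚ := -(dt q 0 1*dt q 0 2*dt q 1 2)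

lemma kap_ne_zero {n : ℕ} (q : PC (n+3)) : kap q ≠ 0 := by
  have h1 : dt q 0 1 ≠ 0 := dt_ne_zero q (by simp [Fin.ext_iff])
  have e : 2 % (n+3) = 2 := Nat.mod_eq_of_lt (by omega)
  have h2 : dt q 0 2 ≠ 0 := dt_ne_zero q (by simp [Fin.ext_iff, Fin.val_ofNat, e])
  have h3 : dt q 1 2 ≠ 0 := dt_ne_zero q (by simp [Fin.ext_iff, Fin.val_ofNat, e])
  exact neg_ne_zero.2 (mul_ne_zero (mul_ne_zero h1 h2) h3)

def cr (q : PC 4) : ℚ := crossRatio (rep (q.1 0)) (rep (q.1 1)) (rep (q.1 2)) (rep (q.1 3))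

lemma cr_eq (q : PC 4) : cr q = dt q 1 2*dt q 0 3/(dt q 1 3*dt q 0 2) := rfl

lemma indep_pc {n : ℕ} (q : PC n) {i j l m : Fin n} (h1 : i ≠ j) (h2 : i ≠ l) (h3 : i ≠ m)
    (h4 : j ≠ l) (h5 : j ≠ m) (h6 : l ≠ m) :
    Indep4 (rep (q.1 i)) (rep (q.1 j)) (rep (q.1 l)) (rep (q.1 m)) :=
  ⟨dt_ne_zero q h1, dt_ne_zero q h2, dt_ne_zero q h3, dt_ne_zero q h4, dt_ne_zero q h5,
    dt_ne_zero q h6⟩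

lemma indep_four (q : PC 4) : Indep4 (rep (q.1 0)) (rep (q.1 1)) (rep (q.1 2)) (rep (q.1 3)) :=
  indep_pc q (by decide) (by decide) (by decide) (by decide) (by decide) (by decide)

lemma cr_ne_zero (q : PC 4) : cr q ≠ 0 := crossRatio_ne_zero (indep_four q)

lemma cr_div (q : PC 5) : cr (face 3 q)/cr (face 4 q) = cr (face 2 q) :=
  crossRatio_div (indep_four (face 4 q)) (indep_four (face 3 q)).2.2.1
    (indep_four (face 3 q)).2.2.2.2.1

lemma cr_ne_one (q : PC 4) : cr q ≠ 1 := crossRatio_ne_one (indep_four q)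

lemma chi_mul_sq {s : ℚ} (hs : s ≠ 0) (x : ℚ) : χ (x*(s*s)) = χ x := by
  rw [map_mul, map_mul, chi_sq χ hs, mul_one]

lemma Sim.chi_kap {n : ℕ} {a : ℚ} (ha : a ≠ 0) {q q' : PC (n+3)} (h : Sim a q q') :
    χ (kap q') = χ a*χ (kap q) := by
  obtain ⟨t, h0, ht⟩ := h
  rw [← map_mul, ← chi_mul_sq χ (mul_ne_zero (mul_ne_zero (mul_ne_zero (h0 0) (h0 1)) (h0 2)) ha) (a*kap q)]
  congr 1; simp only [kap, ht]; ring

lemma Sim.cr_eq {a : ℚ} (ha : a ≠ 0) {q q' : PC 4} (h : Sim a q q') : cr q' = cr q := by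
  obtain ⟨t, h0, ht⟩ := h; have := h0 0; have := h0 1; have := h0 2; have := h0 3
  rw [_root_.cr_eq, _root_.cr_eq]; simp only [ht]; field_simp

/-- The points `∞, 0, 1, …` and others of given slopes. -/
def vecs {n : ℕ} (s : Fin n → ℚ) : Fin (n+2) → NV :=
  Fin.cons ⟨(1, 0), by simp⟩ (Fin.cons ⟨(0, 1), by simp⟩ fun i => ⟨(1, s i), by simp⟩)

section
variable (s : Fin 2 → ℚ) (r : Fin 3 → ℚ)
@[simp] lemma vecs_zero {n : ℕ} (s : Fin n → ℚ) : (vecs s 0).1 = (1, 0) := rfl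
@[simp] lemma vecs_one {n : ℕ} (s : Fin n → ℚ) : (vecs s 1).1 = (0, 1) := rfl
@[simp] lemma vecs_two : (vecs s 2).1 = (1, s 0) := rfl
@[simp] lemma vecs_three : (vecs s 3).1 = (1, s 1) := rfl
@[simp] lemma vecs_two' : (vecs r 2).1 = (1, r 0) := rfl
@[simp] lemma vecs_three' : (vecs r 3).1 = (1, r 1) := rfl
@[simp] lemma vecs_four' : (vecs r 4).1 = (1, r 2) := rfl
end

lemma exists_vecs {n : ℕ} {s : Fin n → ℚ} (h0 : ∀ i, s i ≠ 0) (hs : Function.Injective s) :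
    ∃ q : PC (n+2), ∀ i, q.1 i = toP1 (vecs s i) := by
  refine ⟨⟨fun i => toP1 (vecs s i), fun i j hij e => ?_⟩, fun i => rfl⟩; rw [toP1_eq] at e
  revert e hij
  refine Fin.cases ?_ (Fin.cases ?_ fun i => ?_) i <;>
    refine Fin.cases ?_ (Fin.cases ?_ fun j => ?_) j <;> simp [vecs, det2, h0, Fin.ext_iff]
  intro h e; exact h (by rw [hs (sub_eq_zero.1 e)])

lemma exists_std {x : ℚ} (h0 : x ≠ 0) (h1 : x ≠ 1) :
    ∃ q : PC 4, ∀ i, q.1 i = toP1 (vecs ![1, x] i) :=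
  exists_vecs (by intro i; fin_cases i <;> simp [h0]) (by
    intro i j; fin_cases i <;> fin_cases j <;> simp [h1, h1.symm])

def std {x : ℚ} (h0 : x ≠ 0) (h1 : x ≠ 1) : PC 4 := (exists_std h0 h1).choose

lemma exists_dt_std {x : ℚ} (h0 : x ≠ 0) (h1 : x ≠ 1) : ∃ t : Fin 4 → ℚ, (∀ i, t i ≠ 0) ∧
    ∀ i j, dt (std h0 h1) i j = t i*t j*det2 (vecs ![1, x] i).1 (vecs ![1, x] j).1 :=
  exists_dt _ _ (exists_std h0 h1).choose_spec

lemma Sim.of_lt {n : ℕ} {a : ℚ} {q q' : PC n} {t : Fin n → ℚ} (h0 : ∀ i, t i ≠ 0)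
    (h : ∀ i j, i < j → dt q' i j = t i*t j*a*dt q i j) : Sim a q q' := by
  refine ⟨t, h0, fun i j => ?_⟩; rcases lt_trichotomy i j with e | e | e
  · exact h i j e
  · subst e; simp [dt, det2_self]
  · have := h j i e; rw [dt, det2_swap, ← dt, this, dt, dt, det2_swap (rep (q.1 j))]; ring

lemma sim_std (q : PC 4) {x : ℚ} (h0 : x ≠ 0) (h1 : x ≠ 1) (hx : cr q = x) :
    Sim (kap q) (std h0 h1) q := by
  obtain ⟨s, s0, hs⟩ := exists_dt_std h0 h1; have i1 : dt q 0 1 ≠ 0 := dt_ne_zero q (by decide)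
  have i2 : dt q 0 2 ≠ 0 := dt_ne_zero q (by decide)
  have i4 : dt q 1 2 ≠ 0 := dt_ne_zero q (by decide)
  have i5 : dt q 1 3 ≠ 0 := dt_ne_zero q (by decide)
  have e1 : x = dt q 1 2*dt q 0 3/(dt q 1 3*dt q 0 2) := hx ▸ cr_eq q
  have e2 : x - 1 = -(dt q 0 1*dt q 2 3/(dt q 1 3*dt q 0 2)) := by
    have := one_sub_crossRatio (indep_four q); rw [← neg_sub, ← hx]; exact congrArg Neg.neg this
  have := s0 0; have := s0 1; have := s0 2; have := s0 3
  have n : -(dt q 0 1*dt q 0 2*dt q 1 2) ≠ 0 := kap_ne_zero q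
  refine Sim.of_lt (t := ![1/dt q 1 2/s 0, -1/dt q 0 2/s 1, -1/dt q 0 1/s 2,
    - dt q 1 3/(dt q 0 1*dt q 1 2)/s 3]) ?_ ?_
  · intro i; fin_cases i <;> simp [*]
  · intro i j hij; rw [hs, kap]
    fin_cases i <;> fin_cases j <;> first
      | exact absurd hij (by decide)
      | (simp [det2]; first | (field_simp; done) | (rw [e1]; field_simp; done) |
          (rw [e2]; field_simp; done))

lemma chi_kap_std {x : ℚ} (h0 : x ≠ 0) (h1 : x ≠ 1) : χ (kap (std h0 h1)) = 1 := by
  obtain ⟨s, s0, hs⟩ := exists_dt_std h0 h1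
  rw [← map_one χ, ← chi_mul_sq χ (mul_ne_zero (mul_ne_zero (s0 0) (s0 1)) (s0 2)) 1]; congr 1
  simp only [kap, hs]; simp [det2]; ring

lemma cr_std {x : ℚ} (h0 : x ≠ 0) (h1 : x ≠ 1) : cr (std h0 h1) = x := by
  obtain ⟨s, s0, hs⟩ := exists_dt_std h0 h1; have := s0 0; have := s0 1; have := s0 2; have := s0 3
  rw [cr_eq]; simp only [hs]; simp [det2]; field_simp

lemma five_sum {W : Type*} [AddCommGroup W] (b : ℚ → W) (q : PC 5) :
    ∑ i : Fin 5, ((-1 : ℤ)^(i : ℕ)) • (χ (kap (face i q)) • b (cr (face i q))) =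
      χ (kap (face 4 q)) • (b (cr (face 4 q)) - b (cr (face 3 q))
        + χ (cr (face 4 q)) • b (cr (face 3 q)/cr (face 4 q))
        - χ ((cr (face 4 q))⁻¹ - 1) • b ((1 - (cr (face 4 q))⁻¹)/(1 - (cr (face 3 q))⁻¹))
        + χ (1 - cr (face 4 q)) • b ((1 - cr (face 4 q))/(1 - cr (face 3 q)))) := by
  have I4 : Indep4 (rep (q.1 0)) (rep (q.1 1)) (rep (q.1 2)) (rep (q.1 3)) := indep_four (face 4 q)
  have I3 : Indep4 (rep (q.1 0)) (rep (q.1 1)) (rep (q.1 2)) (rep (q.1 4)) := indep_four (face 3 q)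
  have c1 : (1 - (cr (face 4 q))⁻¹)/(1 - (cr (face 3 q))⁻¹) = cr (face 1 q) :=
    crossRatio_one_sub_inv_div I4 I3
  have c0 : (1 - cr (face 4 q))/(1 - cr (face 3 q)) = cr (face 0 q) := crossRatio_one_sub_div I4 I3
  have hx : cr (face 4 q) = dt q 1 2*dt q 0 3/(dt q 1 3*dt q 0 2) := rfl
  have h1x : 1 - cr (face 4 q) = dt q 0 1*dt q 2 3/(dt q 1 3*dt q 0 2) := one_sub_crossRatio I4
  have n01 : dt q 0 1 ≠ 0 := dt_ne_zero q (by decide)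
  have n02 : dt q 0 2 ≠ 0 := dt_ne_zero q (by decide)
  have n03 : dt q 0 3 ≠ 0 := dt_ne_zero q (by decide)
  have n12 : dt q 1 2 ≠ 0 := dt_ne_zero q (by decide)
  have n13 : dt q 1 3 ≠ 0 := dt_ne_zero q (by decide)
  have k4 : kap (face 4 q) = -(dt q 0 1*dt q 0 2*dt q 1 2) := rfl
  have k3 : kap (face 3 q) = kap (face 4 q) := rfl
  have k2 : χ (kap (face 2 q)) = χ (kap (face 4 q))*χ (cr (face 4 q)) := by
    rw [← map_mul, ← chi_mul_sq χ (div_ne_zero n13 n12) (_*_), k4, hx]; congr 1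
    change -(dt q 0 1*dt q 0 3*dt q 1 3) = _; field_simp
  have k1 : χ (kap (face 1 q)) = χ (kap (face 4 q))*χ ((cr (face 4 q))⁻¹ - 1) := by
    rw [← map_mul, ← chi_mul_sq χ (div_ne_zero n03 n01) (_*_), k4]; congr 1
    rw [show (cr (face 4 q))⁻¹ - 1 = (1 - cr (face 4 q))/cr (face 4 q) by
      rw [sub_div, div_self (cr_ne_zero _), one_div], h1x, hx]
    change -(dt q 0 2*dt q 0 3*dt q 2 3) = _; field_simp
  have k0 : χ (kap (face 0 q)) = χ (kap (face 4 q))*χ (1 - cr (face 4 q)) := by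
    rw [← map_mul, ← chi_mul_sq χ (div_ne_zero n13 n01) (_*_), k4, h1x]; congr 1
    change -(dt q 1 2*dt q 1 3*dt q 2 3) = _; field_simp
  rw [cr_div, c1, c0, Fin.sum_univ_five, k0, k1, k2, k3]; simp only [smul_add, smul_sub, smul_smul]
  simp [pow_succ]; abel

/-- The relations satisfied by `χ`-equivariant maps. -/
def RelX : Submodule ZHalf (PB 4 0) := relQ ⊔ span ZHalf
  (Set.range fun u : ℚˣ × PC 4 => ptQ (act u.1 4 u.2) - χ u.1 • ptQ u.2)

lemma relN_le_relX : relQ ≤ RelX χ := le_sup_left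

variable {χ} {W : Type*} [AddCommGroup W] [Module ZHalf W]

lemma map_cd_eq_zero {p : ℕ} {L : PB p 0 →ₗ[ZHalf] W}
    (h : ∀ q, L (cdQ p 0 (ptQ q)) = 0) (c : PB (p+1) 0) : L (cdQ p 0 c) = 0 := by
  have : L ∘ₗ cdQ p 0 = 0 := zero_chain_ext fun q => h q
  exact LinearMap.congr_fun this c

lemma relX_le_ker {L : PB 4 0 →ₗ[ZHalf] W} (h1 : ∀ (g : SL2Q) q, L (ptQ (g • q)) = L (ptQ q))
    (h2 : ∀ q : PC 5, L (cdQ 4 0 (ptQ q)) = 0)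
    (h3 : ∀ (a : ℚˣ) q, L (ptQ (act a 4 q)) = χ a • L (ptQ q)) : RelX χ ≤ ker L := by
  refine sup_le (sup_le (fun c hc => map_Bd_eq_zero h1 hc) ?_) (span_le.2 ?_)
  · rintro _ ⟨c, rfl⟩; exact map_cd_eq_zero h2 c
  · rintro _ ⟨⟨a, q⟩, rfl⟩; simp [h3]

variable (χ) in
/-- The map on quadruples given by a function of the cross ratio. -/
def Ev (b : ℚ → W) : PB 4 0 →ₗ[ZHalf] W := lin SL2Q ZHalf fun q => χ (kap q) • b (cr q)

lemma Ev_act {b : ℚ → W} (a : ℚˣ) (q : PC 4) : Ev χ b (ptQ (act a 4 q)) = χ a • Ev χ b (ptQ q) := by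
  rw [Ev, lin_pt, lin_pt, (Sim.act a q).chi_kap χ a.ne_zero, (Sim.act a q).cr_eq a.ne_zero, mul_smul]

lemma relX_le_ker_Ev {b : ℚ → W} (hb : IsBloch χ b) : RelX χ ≤ ker (Ev χ b) := by
  refine relX_le_ker (fun g q => ?_) (fun q => ?_) (fun a q => ?_)
  · rw [Ev, lin_pt, lin_pt, (Sim.smul g q).chi_kap χ one_ne_zero, (Sim.smul g q).cr_eq one_ne_zero,
      map_one, one_mul]
  · rw [cd_pt, map_sum]; simp only [map_zsmul, Ev, lin_pt]; rw [five_sum, hb.five, smul_zero]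
    all_goals first | exact cr_ne_zero _ | exact cr_ne_one _ | intro e; have := cr_div q
    rw [← e, div_self (cr_ne_zero _)] at this; exact cr_ne_one _ this.symm
  · exact Ev_act a q

lemma Ev_std {b : ℚ → W} {x : ℚ} (h0 : x ≠ 0) (h1 : x ≠ 1) : Ev χ b (ptQ (std h0 h1)) = b x := by
  rw [Ev, lin_pt, chi_kap_std, cr_std, one_smul]

variable (χ) in
abbrev QW : Type := PB 4 0 ⧸ RelX χ

variable (χ) in
def bb (x : ℚ) : QW χ :=
  if h : x ≠ 0 ∧ x ≠ 1 then (RelX χ).mkQ (ptQ (std h.1 h.2)) else 0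

lemma mkQ_pt (q : PC 4) : (RelX χ).mkQ (ptQ q) = χ (kap q) • bb χ (cr q) := by
  have h0 : cr q ≠ 0 := cr_ne_zero _; have h1 : cr q ≠ 1 := cr_ne_one _; rw [bb, dif_pos ⟨h0, h1⟩]
  set u := mk0 _ (kap_ne_zero q)
  obtain ⟨g, hg⟩ := Sim.exists_smul_act (a := u) (sim_std q h0 h1 rfl)
  have e1 : ptQ q - ptQ (act u 4 (std h0 h1)) ∈ RelX χ := by
    have := pt_smul_sub_mem (k := ZHalf) g (act u 4 (std h0 h1)); rw [← hg] at this
    exact relN_le_relX χ (mem_sup_left this)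
  have e2 : ptQ (act u 4 (std h0 h1)) - χ (kap q) • ptQ (std h0 h1) ∈ RelX χ :=
    mem_sup_right (subset_span ⟨(_, _), rfl⟩)
  rw [← map_zsmul, ← sub_eq_zero, ← map_sub, mkQ_apply, mk_eq_zero,
    ← sub_add_sub_cancel _ (ptQ (act u 4 (std h0 h1)))]
  exact add_mem e1 e2

lemma isBloch_bb : IsBloch χ (bb χ) where
  zero := dif_neg (by simp)
  one := dif_neg (by simp)
  five x y hx hx1 hy hy1 hxy := by
    obtain ⟨q, hq⟩ := exists_vecs (s := ![1, x, y]) (by intro i; fin_cases i <;> simp [hx, hy]) (by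
      intro i j; fin_cases i <;> fin_cases j <;> simp [*, hx1.symm, hy1.symm, hxy.symm])
    obtain ⟨t, t0, ht⟩ := exists_dt q _ hq
    have := t0 0; have := t0 1; have := t0 2; have := t0 3; have := t0 4
    have e : dt q 1 2*dt q 0 3/(dt q 1 3*dt q 0 2) = x ∧
        dt q 1 2*dt q 0 4/(dt q 1 4*dt q 0 2) = y := by
      constructor <;> simp only [ht] <;> simp [det2] <;> field_simp
    have e4 : cr (face 4 q) = x := e.1; have e3 : cr (face 3 q) = y := e.2
    have h : (RelX χ).mkQ (cdQ 4 0 (ptQ q)) = 0 := by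
      rw [mkQ_apply, mk_eq_zero]; exact relN_le_relX χ (mem_sup_right ⟨_, rfl⟩)
    rw [cd_pt, map_sum] at h; simp only [map_zsmul, mkQ_pt] at h; rw [five_sum, e4, e3] at h
    rcases chi_cases χ (kap_ne_zero (face 4 q)) with hc | hc <;> rw [hc] at h
    · rwa [one_smul] at h
    · rwa [neg_one_smul, neg_eq_zero] at h

lemma mem_span_bb (w : QW χ) : w ∈ span ZHalf (Set.range (bb χ)) := by
  obtain ⟨c, rfl⟩ := (RelX χ).mkQ_surjective w
  refine zero_chain_induction (P := fun c => (RelX χ).mkQ c ∈ span ZHalf (Set.range (bb χ))) c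
    (by simp) (fun a b ha hb => by rw [map_add]; exact add_mem ha hb) (fun r q => ?_)
  rw [map_smul, mkQ_pt]
  exact Submodule.smul_mem _ _ (zsmul_mem (subset_span (Set.mem_range_self _)) _)

def evQ {b : ℚ → W} (hb : IsBloch χ b) : QW χ →ₗ[ZHalf] W := (RelX χ).liftQ (Ev χ b) (relX_le_ker_Ev hb)

lemma evQ_mk {b : ℚ → W} (hb : IsBloch χ b) (c : PB 4 0) : evQ hb ((RelX χ).mkQ c) = Ev χ b c := rfl

lemma evQ_bb {b : ℚ → W} (hb : IsBloch χ b) (x : ℚ) : evQ hb (bb χ x) = b x := by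
  by_cases h : x ≠ 0 ∧ x ≠ 1
  · rw [bb, dif_pos h, evQ_mk, Ev_std]
  · rw [bb, dif_neg h, map_zero]; rcases not_and_or.1 h with h | h <;> rw [not_not.1 h]
    · exact hb.zero.symm
    · exact hb.one.symm

end Quadruples

section Triples

/-- The class of the first three points up to squares is `a`. -/
def Kap {n : ℕ} (a : ℚ) (q : PC (n+3)) : Prop := ∃ s : ℚ, s ≠ 0 ∧ kap q = a*(s*s)

lemma Kap.chi {n : ℕ} {a : ℚ} {q : PC (n+3)} (h : Kap a q) (χ : ℚ →*₀ ℤ) : χ (kap q) = χ a := by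
  obtain ⟨s, hs, e⟩ := h; rw [e, chi_mul_sq χ hs]

lemma Kap.act {n : ℕ} {a : ℚ} {q : PC (n+3)} (h : Kap a q) (x : ℚˣ) :
    Kap (x*a) (act x _ q) := by
  obtain ⟨s, hs, e⟩ := h; obtain ⟨t, t0, ht⟩ := Sim.act x q
  refine ⟨t 0*t 1*t 2*x*s, mul_ne_zero (mul_ne_zero (mul_ne_zero (mul_ne_zero (t0 0) (t0 1))
    (t0 2)) x.ne_zero) hs, ?_⟩
  simp only [kap, ht] at e ⊢; linear_combination (t 0*t 1*t 2*x)^2*x*e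

lemma Kap.sub_mem {a b : ℚ} {q q' : PC 3} (h : Kap a q) (h' : Kap b q') {r : ℚ} (hr : r ≠ 0)
    (e : b = a*(r*r)) : ptQ q' - ptQ q ∈ BdQ (PC 3) 0 := by
  obtain ⟨s, s0, hs⟩ := h; obtain ⟨s', s0', hs'⟩ := h'
  have h01 : dt q 0 1 ≠ 0 := dt_ne_zero q (by decide)
  have h02 : dt q 0 2 ≠ 0 := dt_ne_zero q (by decide)
  have h12 : dt q 1 2 ≠ 0 := dt_ne_zero q (by decide)
  have k01 : dt q' 0 1 ≠ 0 := dt_ne_zero q' (by decide)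
  have k02 : dt q' 0 2 ≠ 0 := dt_ne_zero q' (by decide)
  have k12 : dt q' 1 2 ≠ 0 := dt_ne_zero q' (by decide)
  have ha : a ≠ 0 := fun h => kap_ne_zero q (by rw [hs, h, zero_mul])
  have key : Sim (kap q'/kap q) q q' := by
    refine Sim.of_lt (t := ![dt q 1 2/dt q' 1 2, dt q 0 2/dt q' 0 2, dt q 0 1/dt q' 0 1]) ?_ ?_
    · intro i; fin_cases i <;> simp [*]
    · intro i j hij
      fin_cases i <;> fin_cases j <;> first
        | exact absurd hij (by decide)
        | (simp [kap]; field_simp)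
  refine pt_sub_mem_of_sim (key.sq (s := r*s'/s) (by positivity) ?_)
  rw [hs, hs', e]; field_simp

lemma kap_face_std {x : ℚ} (h0 : x ≠ 0) (h1 : x ≠ 1) :
    Kap (1-x) (face 0 (std h0 h1)) ∧ Kap (x*(1-x)) (face 1 (std h0 h1)) ∧
      Kap x (face 2 (std h0 h1)) ∧ Kap 1 (face 3 (std h0 h1)) := by
  obtain ⟨s, s0, hs⟩ := exists_dt_std h0 h1; have := s0 0; have := s0 1; have := s0 2; have := s0 3
  refine ⟨⟨s 1*s 2*s 3, by positivity, ?_⟩, ⟨s 0*s 2*s 3, by positivity, ?_⟩,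
    ⟨s 0*s 1*s 3, by positivity, ?_⟩, ⟨s 0*s 1*s 2, by positivity, ?_⟩⟩
  · change -(dt (std h0 h1) 1 2*dt (std h0 h1) 1 3*dt (std h0 h1) 2 3) = _
    simp only [hs]; simp [det2]; ring
  · change -(dt (std h0 h1) 0 2*dt (std h0 h1) 0 3*dt (std h0 h1) 2 3) = _
    simp only [hs]; simp [det2]; ring
  · change -(dt (std h0 h1) 0 1*dt (std h0 h1) 0 3*dt (std h0 h1) 1 3) = _
    simp only [hs]; simp [det2]; ring
  · change -(dt (std h0 h1) 0 1*dt (std h0 h1) 0 2*dt (std h0 h1) 1 2) = _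
    simp only [hs]; simp [det2]; ring

lemma cd_quad (q : PC 4) : cdQ 3 0 (ptQ q) = ptQ (face 0 q) - ptQ (face 1 q) + ptQ (face 2 q)
      - ptQ (face 3 q) := by
  rw [cd_pt, Fin.sum_univ_four]; simp [pow_succ, sub_eq_add_neg]

lemma face_act (u : ℚˣ) {n : ℕ} (i : Fin (n+1)) (q : PC (n+1)) :
    face i (act u (n+1) q) = act u n (face i q) := rfl

lemma cd_norm_mem {x : ℚ} (h0 : x ≠ 0) (h1 : x ≠ 1) : cdQ 3 0
    (ptQ (std h0 h1) + dil (mk0 x h0) _ (ptQ (std h0 h1))) ∈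
      BdQ (PC 3) 0 := by
  obtain ⟨k0, k1, k2, k3⟩ := kap_face_std h0 h1
  have e1 := (k1.act (mk0 x h0)).sub_mem k0 (inv_ne_zero h0) (by
    rw [Units.val_mk0]; field_simp)
  have e2 := k1.sub_mem (k0.act (mk0 x h0)) one_ne_zero (by simp)
  have e3 := (k3.act (mk0 x h0)).sub_mem k2 one_ne_zero (by simp)
  have e4 := k3.sub_mem (k2.act (mk0 x h0)) h0 (by simp)
  rw [map_add, dil_pt, cd_quad, cd_quad, face_act, face_act, face_act, face_act]
  generalize mk0 x h0 = u at *; generalize std h0 h1 = q at *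
  convert add_mem (add_mem e1 e2) (add_mem e3 e4) using 1; abel

lemma cd_four_mem : cdQ 3 0 (ptQ (std (x := 4) (by norm_num) (by norm_num))) ∈ BdQ (PC 3) 0 := by
  obtain ⟨k0, k1, k2, k3⟩ := kap_face_std (x := 4) (by norm_num) (by norm_num); rw [cd_quad]
  convert add_mem (k1.sub_mem k0 (r := 1/2) (by norm_num) (by norm_num))
    (k3.sub_mem k2 (r := 2) (by norm_num) (by norm_num)) using 1
  abel

variable (χ : ℚ →*₀ ℤ)

def eps : PB 4 0 →ₗ[ZHalf] ZHalf := lin SL2Q ZHalf (fun q : PC 3 => (χ (kap q) : ZHalf)) ∘ₗ cdQ 3 0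

lemma eps_pt (q : PC 4) : eps χ (ptQ q) =
    χ (kap (face 0 q)) - χ (kap (face 1 q)) + χ (kap (face 2 q)) - χ (kap (face 3 q)) := by
  rw [eps, comp_apply, cd_quad]; simp only [map_add, map_sub, lin_pt]

lemma eps_of_sim {a : ℚ} (ha : a ≠ 0) {q q' : PC 4} (h : Sim a q q') :
    eps χ (ptQ q') = χ a • eps χ (ptQ q) := by
  rw [eps_pt, eps_pt, (h.face 0).chi_kap χ ha, (h.face 1).chi_kap χ ha, (h.face 2).chi_kap χ ha,
    (h.face 3).chi_kap χ ha, zsmul_eq_mul]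
  push_cast; ring

lemma relX_le_ker_eps : RelX χ ≤ ker (eps χ) := by
  refine relX_le_ker (fun g q => ?_) (fun q => ?_) (fun a q => eps_of_sim χ a.ne_zero (Sim.act a q))
  · rw [eps_of_sim χ one_ne_zero (Sim.smul g q), map_one, one_smul]
  · rw [eps, comp_apply, cd_cd, map_zero]

lemma eps_eq_zero {c : PB 4 0} (hc : cdQ 3 0 c ∈ BdQ (PC 3) 0) : eps χ c = 0 := by
  refine map_Bd_eq_zero (L := lin SL2Q ZHalf fun q : PC 3 => (χ (kap q) : ZHalf)) (fun g q => ?_) hc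
  rw [lin_pt, lin_pt, (Sim.smul g q).chi_kap χ one_ne_zero, map_one, one_mul]

def epsQ : QW χ →ₗ[ZHalf] ZHalf := (RelX χ).liftQ (eps χ) (relX_le_ker_eps χ)

lemma epsQ_mk (c : PB 4 0) : epsQ χ ((RelX χ).mkQ c) = eps χ c := rfl

lemma epsQ_bb (x : ℚ) : epsQ χ (bb χ x) = -((1 - χ x)*(1 - χ (1-x))) := by
  by_cases h : x ≠ 0 ∧ x ≠ 1
  · obtain ⟨k0, k1, k2, k3⟩ := kap_face_std h.1 h.2
    rw [bb, dif_pos h, epsQ_mk, eps_pt, k0.chi, k1.chi, k2.chi, k3.chi, map_one, map_mul]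
    push_cast; ring
  · rw [bb, dif_neg h, map_zero]; rcases not_and_or.1 h with h | h <;> rw [not_not.1 h] <;> simp

end Triples

section Symbols

variable (p ℓ : ℕ)

/-- The symbol `x ∧ (1 - x)` evaluated at two primes. -/
def bOmega (x : ℚ) : ZHalf := (omegaVal p ℓ x (1-x) : ZHalf)

variable [Fact p.Prime] [Fact ℓ.Prime]

lemma isBloch_bOmega {χ : ℚ →*₀ ℤ} (hχ : ∀ x, x ≠ 0 → χ x = 1) : IsBloch χ (bOmega p ℓ) where
  zero := by simp [bOmega, omegaVal]
  one := by simp [bOmega, omegaVal]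
  five x y hx hx1 hy hy1 hxy := by
    have a1 : 1 - x ≠ 0 := sub_ne_zero.2 hx1.symm; have a2 : 1 - y ≠ 0 := sub_ne_zero.2 hy1.symm
    have a3 : x - y ≠ 0 := sub_ne_zero.2 hxy; have e1 : 1 - y/x = (x-y)/x := by field_simp
    have e3 : 1 - (1-x)*y/(x*(1-y)) = (x-y)/(x*(1-y)) := by field_simp; ring
    have e4 : 1 - (1-x)/(1-y) = (x-y)/(1-y) := by field_simp; ring
    rw [hχ x hx, show x⁻¹ - 1 = (1-x)/x by field_simp, hχ _ (div_ne_zero a1 hx), hχ _ a1]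
    simp only [one_smul, bOmega]; rw [one_sub_inv_div hx hy hy1, e1, e3, e4]
    simp only [omegaVal, padicValRat.div, padicValRat.mul, mul_ne_zero, ne_eq, not_false_eq_true, *]
    push_cast; ring

/-- A primitive of the symbol on triples of vectors. -/
def betaVec (u v w : ℚ × ℚ) : ZHalf := ((omegaVal p ℓ (det2 u v) (det2 u w) -
  omegaVal p ℓ (det2 u v) (det2 v w) + omegaVal p ℓ (det2 u w) (det2 v w) : ℤ) : ZHalf)

def betaVal (f : Conf SL2Q NV 3) : ZHalf := betaVec p ℓ (f.1 0).1 (f.1 1).1 (f.1 2).1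

lemma toP1_rel (x y : NV) (h : GenPos.rel SL2Q x y) : GenPos.rel SL2Q (toP1 x) (toP1 y) :=
  fun e => h (toP1_eq.1 e)

abbrev toPC (n : ℕ) : Conf SL2Q NV n → PC n := Conf.map toP1_rel n

lemma toP1_equivar : Equivar SL2Q toP1 := fun _ _ => rfl

lemma bOmega_toPC (f : Conf SL2Q NV 4) : bOmega p ℓ (cr (toPC 4 f)) =
    -(betaVal p ℓ (face 0 f) - betaVal p ℓ (face 1 f) + betaVal p ℓ (face 2 f) - betaVal p ℓ (face 3 f)) := by
  obtain ⟨t, t0, ht⟩ := exists_dt (toPC 4 f) f.1 (fun i => rfl)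
  have := t0 0; have := t0 1; have := t0 2; have := t0 3; have d01 := f.2 0 1 (by decide)
  have d02 := f.2 0 2 (by decide); have d03 := f.2 0 3 (by decide); have d12 := f.2 1 2 (by decide)
  have d13 := f.2 1 3 (by decide); have d23 := f.2 2 3 (by decide)
  simp only [GenPos.rel] at d01 d02 d03 d12 d13 d23
  have ex : cr (toPC 4 f) = crossRatio (f.1 0).1 (f.1 1).1 (f.1 2).1 (f.1 3).1 := by
    rw [cr_eq, crossRatio]; simp only [ht]; field_simp
  change _ = -(betaVec p ℓ (f.1 1).1 (f.1 2).1 (f.1 3).1 - betaVec p ℓ (f.1 0).1 (f.1 2).1 (f.1 3).1 +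
    betaVec p ℓ (f.1 0).1 (f.1 1).1 (f.1 3).1 - betaVec p ℓ (f.1 0).1 (f.1 1).1 (f.1 2).1)
  rw [bOmega, ex, one_sub_crossRatio ⟨d01, d02, d03, d12, d13, d23⟩, crossRatio]
  simp only [betaVec, omegaVal, padicValRat.div, padicValRat.mul, mul_ne_zero, ne_eq,
    not_false_eq_true, *]
  push_cast; ring

instance : Subsingleton (Conf SL2Q NV 0) := ⟨fun a b => Subtype.ext (funext fun i => i.elim0)⟩

/-- The symbol vanishes on quadruples coming from homology classes. -/
lemma Ev_bOmega_zigzag {χ : ℚ →*₀ ℤ} (hχ : ∀ x, x ≠ 0 → χ x = 1) {z : PB 0 3} {c : PB 4 0}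
    (hz : bdQ _ 2 z = 0) (h : Zigzag z c) : Ev χ (bOmega p ℓ) c = 0 := by
  have inj : ∀ n, Function.Injective (pushQ (toPC 0) n) := fun n =>
    Finsupp.mapDomain_injective (Function.Injective.prodMap Function.injective_id
      (Function.injective_of_subsingleton _))
  obtain ⟨z', rfl⟩ := push_surjective (G := SL2Q) (k := ZHalf) (f := toPC 0)
    (fun _ => ⟨⟨Fin.elim0, fun i => i.elim0⟩, Subsingleton.elim _ _⟩) 3 z
  have heq := fun n => Conf.map_equivar toP1_rel toP1_equivar n
  obtain ⟨c', hc'⟩ := exists_zigzag (z := z') (inj 2 (by rw [← bd_push (heq 0), hz, map_zero]))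
  have hm := (h.add ((hc'.map toP1_rel toP1_equivar).smul (-1))).mem_relN (by
    rw [neg_one_smul, add_neg_cancel]; exact zero_mem _)
  have e1 := relX_le_ker_Ev (isBloch_bOmega p ℓ hχ) (relN_le_relX χ hm)
  rw [mem_ker, map_add, map_smul, neg_one_smul, add_neg_eq_zero] at e1; rw [e1]
  obtain ⟨-, -, c2, -, -, -, h3⟩ := hc'
  have e2 : Ev χ (bOmega p ℓ) ∘ₗ pushQ (toPC 4) 0 =
      -(lin SL2Q ZHalf (betaVal p ℓ) ∘ₗ cd SL2Q ZHalf NV 3 0) := by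
    refine zero_chain_ext fun f => ?_
    rw [comp_apply, push_zero_pt, Ev, lin_pt, hχ _ (kap_ne_zero _), one_smul, bOmega_toPC,
      LinearMap.neg_apply, comp_apply, cd_pt, Fin.sum_univ_four]
    simp [lin_pt, pow_succ, sub_eq_add_neg]
  have := LinearMap.congr_fun e2 c'; rw [comp_apply] at this
  rw [this, LinearMap.neg_apply, comp_apply, ← h3, neg_eq_zero]
  refine map_Bd_eq_zero (fun g f => ?_) ⟨c2, rfl⟩; rw [lin_pt, lin_pt]
  simp only [betaVal, betaVec, Conf.smul_val, NV.smul_val, det2_slv]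

end Symbols

section Separation

/-- An element of all the equivariant relation modules is a relation. -/
lemma mem_relN_of_forall {r : PB 4 0} (h : ∀ χ, r ∈ RelX χ) : r ∈ relQ := by
  by_contra hr
  obtain ⟨N, -, hN⟩ := zorn_le_nonempty₀ {N : Submodule ZHalf (PB 4 0) | relQ ≤ N ∧
      (∀ (a : ℚˣ) c, c ∈ N → dil a 4 c ∈ N) ∧ r ∉ N} (by
    intro C hC hch N₀ hN₀
    have mem : ∀ {x}, x ∈ sSup C ↔ ∃ N ∈ C, x ∈ N :=
      fun {x} => Submodule.mem_sSup_of_directed ⟨N₀, hN₀⟩ hch.directedOn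
    refine ⟨sSup C, ⟨(hC hN₀).1.trans (le_sSup hN₀), fun a c hc => ?_, fun hc => ?_⟩,
      fun N hN => le_sSup hN⟩
    · obtain ⟨N, hN, hcN⟩ := mem.1 hc; exact mem.2 ⟨N, hN, (hC hN).2.1 a c hcN⟩
    · obtain ⟨N, hN, hcN⟩ := mem.1 hc
      exact (hC hN).2.2 hcN) (relQ) ⟨le_rfl, fun a c => dil_mem_relN a, hr⟩
  obtain ⟨⟨hle, hst, hrN⟩, hmax⟩ := hN
  have comm : ∀ (a b : ℚˣ) c, dil b 4 (dil a 4 c) - dil a 4 (dil b 4 c) ∈ N := fun a b c => by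
    have h1 := hle (dil_dil b a c); have h2 := hle (dil_dil a b c); rw [mul_comm] at h1
    simpa using sub_mem h1 h2
  have step : ∀ (a : ℚˣ) (e : ℤ), r ∉ N ⊔ LinearMap.range (dil a 4 - e • LinearMap.id) →
      ∀ c, dil a 4 c - e • c ∈ N := by
    intro a e hre c
    refine hmax (y := N ⊔ LinearMap.range (dil a 4 - e • LinearMap.id)) ⟨hle.trans le_sup_left, ?_, hre⟩
      le_sup_left (mem_sup_right ⟨c, by simp⟩)
    intro b x hx; obtain ⟨n, hn, _, ⟨u, rfl⟩, rfl⟩ := mem_sup.1 hx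
    refine mem_sup.2 ⟨dil b 4 n + (dil b 4 (dil a 4 u) - dil a 4 (dil b 4 u)),
      add_mem (hst b n hn) (comm a b u), _, ⟨dil b 4 u, rfl⟩, ?_⟩
    simp only [map_add, map_sub, LinearMap.sub_apply, LinearMap.smul_apply, id_apply, map_zsmul]
    abel
  have two : ∀ x : PB 4 0, x + x ∈ N → x ∈ N := fun x hx => by
    rw [← mk_eq_zero] at hx ⊢; exact add_self_cancel hx
  have dich : ∀ a : ℚˣ, ∃ e : ℤ, (e = 1 ∨ e = -1) ∧ ∀ c, dil a 4 c - e • c ∈ N := by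
    intro a; by_contra! hcon
    have f : ∀ e : ℤ, e = 1 ∨ e = -1 → dil a 4 r + e • r ∈ N := by
      intro e he; obtain ⟨c, hc⟩ := hcon e he
      obtain ⟨n, hn, _, ⟨u, rfl⟩, h1⟩ := mem_sup.1 (not_not.1 fun hn => hc (step a e hn c))
      rw [← h1]
      convert add_mem (add_mem (hst a n hn) (N.smul_of_tower_mem e hn)) (hle (dil_sq a u)) using 1
      simp only [map_add, map_sub, LinearMap.sub_apply, LinearMap.smul_apply, id_apply, map_zsmul]
      rcases he with rfl | rfl <;> module
    refine hrN (two r ?_); convert sub_mem (f 1 (.inl rfl)) (f (-1) (.inr rfl)) using 1; module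
  choose φ hφ' hφ using dich
  have uniq : ∀ a (e : ℤ), (e = 1 ∨ e = -1) → (∀ c, dil a 4 c - e • c ∈ N) → φ a = e := by
    intro a e he h; by_contra hne; have h1 := sub_mem (h r) (hφ a r); refine hrN (two r ?_)
    rcases he with rfl | rfl <;> rcases hφ' a with h2 | h2 <;> rw [h2] at h1 hne <;> first
      | exact absurd rfl hne
      | (convert h1 using 1; module)
      | (convert neg_mem h1 using 1; module)
  have φmul : ∀ a b, φ (a*b) = φ a*φ b := by
    intro a b; refine uniq _ _ ?_ fun c => ?_
    · rcases hφ' a with h1 | h1 <;> rcases hφ' b with h2 | h2 <;> simp [h1, h2]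
    · have h1 := hφ a (dil b 4 c); have h2 := N.smul_of_tower_mem (φ a) (hφ b c)
      convert sub_mem (add_mem h1 h2) (hle (dil_dil a b c)) using 1; module
  have φone : φ 1 = 1 := by
    rcases hφ' 1 with h | h
    · exact h
    · have := φmul 1 1; rw [mul_one, h] at this; norm_num at this
  let χ : ℚ →*₀ ℤ :=
    { toFun := fun x => if h : x = 0 then 0 else φ (mk0 x h)
      map_zero' := by simp
      map_one' := by simp [φone]
      map_mul' := by
        intro x y; by_cases hx : x = 0
        · simp [hx]
        by_cases hy : y = 0
        · simp [hy]
        rw [dif_neg (mul_ne_zero hx hy), dif_neg hx, dif_neg hy, ← φmul, Units.mk0_mul] }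
  have hχ : ∀ a : ℚˣ, χ a = φ a := fun a => by
    change (if h : (a : ℚ) = 0 then 0 else φ (mk0 a h)) = _; rw [dif_neg a.ne_zero, Units.mk0_val]
  refine hrN ((sup_le hle (span_le.2 ?_) : RelX χ ≤ N) (h χ)); rintro _ ⟨⟨a, q⟩, rfl⟩
  have := hφ a (ptQ q); rwa [dil_pt, ← hχ] at this

end Separation

section Characters

def chi1 : ℚ →*₀ ℤ where
  toFun x := if x = 0 then 0 else 1
  map_zero' := by simp
  map_one' := by simp
  map_mul' x y := by by_cases hx : x = 0 <;> by_cases hy : y = 0 <;> simp [hx, hy]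

lemma chi1_apply {x : ℚ} (hx : x ≠ 0) : chi1 x = 1 := if_neg hx

variable (p : ℕ) [hp : Fact p.Prime]

/-- The parity of the valuation at a prime. -/
def chiP : ℚ →*₀ ℤ where
  toFun x := if x = 0 then 0 else ((padicValRat p x).negOnePow : ℤ)
  map_zero' := by simp
  map_one' := by simp
  map_mul' x y := by
    by_cases hx : x = 0
    · simp [hx]
    by_cases hy : y = 0
    · simp [hy]
    rw [if_neg (mul_ne_zero hx hy), if_neg hx, if_neg hy, padicValRat.mul hx hy, Int.negOnePow_add,
      Units.val_mul]

lemma chiP_eq_one {x : ℚ} (hx : x ≠ 0) (h : padicValRat p x = 0) : chiP p x = 1 := by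
  change (if x = 0 then 0 else ((padicValRat p x).negOnePow : ℤ)) = 1; rw [if_neg hx, h]; simp

lemma chiP_self : chiP p p = -1 := by
  change (if (p : ℚ) = 0 then 0 else ((padicValRat p (p : ℚ)).negOnePow : ℤ)) = -1
  rw [if_neg (mod_cast hp.1.ne_zero), padicValRat.self hp.1.one_lt]; simp

lemma chiP_neg_one : chiP p (-1) = 1 := chiP_eq_one p (by norm_num) (by simp)

lemma chiP_prime {q : ℕ} (hq : q.Prime) (h : q ≠ p) : chiP p q = 1 := by
  refine chiP_eq_one p (mod_cast hq.ne_zero) ?_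
  rw [padicValRat.of_nat, padicValNat.eq_zero_of_not_dvd fun hd =>
    h ((Nat.prime_dvd_prime_iff_eq hp.1 hq).1 hd).symm]
  rfl

lemma chiP_red {z : ℚ} {r : ZMod p} (h : Red p z r) (hr : r ≠ 0) : chiP p z = 1 := by
  obtain ⟨a, c, hc, e, e'⟩ := h; have ha : (a : ZMod p) ≠ 0 := by rw [← e']; exact mul_ne_zero hr hc
  have v : ∀ {a : ℤ}, (a : ZMod p) ≠ 0 → (a : ℚ) ≠ 0 ∧ padicValRat p (a : ℚ) = 0 := by
    intro a ha; rw [ne_eq, intCast_zmod_eq_zero_iff_dvd] at ha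
    refine ⟨fun h => ha (by rw [Int.cast_eq_zero.1 h]; exact dvd_zero _), ?_⟩
    rw [padicValRat.of_int, padicValInt.eq_zero_of_not_dvd ha]; rfl
  have h1 := chiP_eq_one p (v ha).1 (v ha).2
  rwa [← e, map_mul, chiP_eq_one p (v hc).1 (v hc).2, mul_one] at h1

variable {p}

lemma chi_ext {χ χ' : ℚ →*₀ ℤ} (he : χ (-1) = 1) (he' : χ' (-1) = 1)
    (h : ∀ q : ℕ, q.Prime → χ q = χ' q) : χ = χ' := by
  refine MonoidWithZeroHom.ext fun x => ?_
  by_cases hx : x = 0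
  · simp [hx]
  have : χ x*χ' x = 1 := chi_eq_one_of_primes (χ := χ*χ')
    (by change χ (-1)*χ' (-1) = 1; simp [he, he'])
    (fun q hq => by change χ q*χ' q = 1; rw [h q hq, chi_sq χ' (mod_cast hq.ne_zero)]) hx
  rcases chi_cases χ hx with h1 | h1 <;> rcases chi_cases χ' hx with h2 | h2 <;> simp_all

lemma eq_chiP {χ : ℚ →*₀ ℤ} (he : χ (-1) = 1) (hP : χ p = -1)
    (h : ∀ q : ℕ, q.Prime → q ≠ p → χ q = 1) : χ = chiP p := by
  refine chi_ext he (chiP_neg_one p) fun q hq => ?_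
  by_cases hqp : q = p
  · rw [hqp, hP, chiP_self]
  · rw [h q hq hqp, chiP_prime p hq hqp]

end Characters

section Invariants

variable (p : ℕ) [hp : Fact p.Prime]

/-- The finite dilogarithm, normalized at the prime two. -/
def resB : ZMod p → ZMod (oddPart (p+1)) := if p = 2 then 0 else FinBloch.finDilog

def resC : ZMod (oddPart (p+1)) := if p = 2 then 1 else FinBloch.planeConst p

lemma oddPart_three : oddPart (2+1) = 3 := by
  simp [oddPart, Nat.factorization_eq_zero_of_not_dvd (show ¬ 2 ∣ 3 by decide)]

lemma zmod_two (x : ZMod 2) : x = 0 ∨ x = 1 := by revert x; decide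

lemma finBloch_res : FinBloch p (resB p) (resC p) := by
  by_cases h : p = 2
  · subst h; simp only [resB, resC, if_pos]
    refine ⟨rfl, rfl, fun x y h0 h1 => absurd (zmod_two x) (by simp [h0, h1]), fun x => by simp,
      fun x h0 h1 => absurd (zmod_two x) (by simp [h0, h1]), ?_⟩
    rw [oddPart_three]; decide
  · simp only [resB, resC, if_neg h]; exact FinBloch.finBloch_finDilog

/-- The Bloch function of a prime. -/
def bP : ℚ → ZMod (oddPart (p+1)) := FinBloch.lift (resB p) (resC p)

lemma isBloch_bP : IsBloch (chiP p) (bP p) :=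
  FinBloch.isBloch_lift (finBloch_res p) fun _ _ => chiP_red p

lemma isBloch_bP_one : IsBloch chi1 (bP p) :=
  FinBloch.isBloch_lift (finBloch_res p) fun z r h hr => chi1_apply fun e =>
    hr (h.unique (e ▸ (by simpa using Red.intCast (p := p) 0)))

lemma bP_inv (x : ℚ) : bP p x⁻¹ = -bP p x := FinBloch.lift_inv (finBloch_res p) x

lemma bP_even {n : ℤ} (hn : n ≠ 0) (h : (2 : ℤ) ∣ n) : bP 2 n = 1 := by
  have : Red 2 (n : ℚ) 0 := by
    have := Red.intCast (p := 2) n; rwa [(intCast_zmod_eq_zero_iff_dvd n 2).2 h] at this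
  rw [bP, FinBloch.lift_zero (mod_cast hn) this, resC, if_pos rfl]

lemma bP_int (h2 : p ≠ 2) {n : ℤ} (hn : (n : ZMod p) ≠ 0) : bP p n = FinBloch.finDilog (n : ZMod p) := by
  rw [bP, FinBloch.lift_unit (Red.intCast n) hn, resB, if_neg h2]

variable {W : Type*} [AddCommGroup W] [Module ZHalf W]

lemma two_pow_smul_cancel {n : ℕ} {w : W} (h : (2 : ZHalf)^n • w = 0) : w = 0 :=
  (zhalf_isUnit_two.pow n).smul_eq_zero.1 h

lemma smul_eq_zero_of_oddPart {m : ℕ} {n : ZHalf} {ζ : W} (h : n • (1 : ZMod (oddPart (m+1))) = 0)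
    (hζ : (m+1) • ζ = 0) : n • ζ = 0 := by
  obtain ⟨k, a, hk⟩ := zhalf_exists_pow_mul n
  have h1 : a • (1 : ZMod (oddPart (m+1))) = 0 := by
    rw [← Int.cast_smul_eq_zsmul ZHalf, ← hk, mul_smul, h, smul_zero]
  rw [zsmul_one, intCast_zmod_eq_zero_iff_dvd] at h1; obtain ⟨b, rfl⟩ := h1
  have h2 : oddPart (m+1) • ζ = 0 := by
    apply two_pow_smul_cancel (n := (m+1).factorization 2)
    rw [← Nat.cast_smul_eq_nsmul ZHalf, smul_smul, ← hζ, ← Nat.cast_smul_eq_nsmul ZHalf (m+1)]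
    congr 1; exact_mod_cast Nat.ordProj_mul_ordCompl_eq_self (m+1) 2
  apply two_pow_smul_cancel (n := k)
  rw [smul_smul, hk, Int.cast_smul_eq_zsmul, mul_comm, mul_smul, natCast_zsmul, h2, smul_zero]

end Invariants

section Injectivity

variable {χ : ℚ →*₀ ℤ}

lemma IsBloch.map {W W' : Type*} [AddCommGroup W] [AddCommGroup W'] {b : ℚ → W}
    (hb : IsBloch χ b) (L : W →+ W') : IsBloch χ fun x => L (b x) where
  zero := by rw [hb.zero, map_zero]
  one := by rw [hb.one, map_zero]
  five x y hx hx1 hy hy1 hxy := by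
    simp only [← map_zsmul, ← map_add, ← map_sub, hb.five x y hx hx1 hy hy1 hxy, map_zero]

lemma mem_of_bb {S : Submodule ZHalf (QW χ)} (h : ∀ x, bb χ x ∈ S) (f : QW χ) : f ∈ S :=
  span_le.2 (Set.range_subset_iff.2 h) (mem_span_bb f)

lemma eq_zero_of_chi_odd (he : χ (-1) = -1) {f : QW χ} (hf : epsQ χ f = 0) : f = 0 := by
  obtain ⟨h1, h2, h3⟩ := (isBloch_bb (χ := χ)).of_neg_one he
  have vanish : ∀ x, ¬ (χ x = -1 ∧ χ (1-x) = -1) → bb χ x = 0 := by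
    intro x hx; by_cases h : x ≠ 0 ∧ x ≠ 1
    · rcases chi_cases χ h.1 with e | e
      · exact h1 x e
      · exact h2 x ((chi_cases χ (sub_ne_zero.2 h.2.symm)).resolve_right fun e' => hx ⟨e, e'⟩)
    · rw [bb, dif_neg h]
  by_cases hex : ∃ x, χ x = -1 ∧ χ (1-x) = -1
  · obtain ⟨x, hx, hx'⟩ := hex
    obtain ⟨n, rfl⟩ := mem_span_singleton.1 (mem_of_bb (S := span ZHalf {bb χ x}) (fun y => by
        by_cases hy : χ y = -1 ∧ χ (1-y) = -1
        · rw [h3 y x hy.1 hy.2 hx hx']; exact Submodule.mem_span_singleton_self _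
        · rw [vanish y hy]; exact zero_mem _) f)
    rw [map_smul, epsQ_bb, hx, hx', smul_eq_mul] at hf
    rw [(mul_eq_zero.1 hf).resolve_right (by norm_num), zero_smul]
  · exact (mem_bot _).1 (mem_of_bb (fun y => vanish y (not_exists.1 hex y)) f)

lemma exists_alt (he : χ (-1) = 1) {t : ℚ} (ht : χ t = -1) : ∃ b : ℚ → QW χ, IsBlochAlt χ b (b 2) ∧
    (∀ f, epsQ χ f = 0 → f ∈ span ZHalf (Set.range b)) ∧
      ∀ x, ∃ n : ZHalf, b x = bb χ x + n • (bb χ t + bb χ t⁻¹) := by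
  set D := bb χ t + bb χ t⁻¹ with hD
  have hεD : epsQ χ D = -4 := by
    rw [hD, map_add, epsQ_bb, epsQ_bb, chi_inv, chi_one_sub_inv (ne_of_chi_eq_neg_one ht).1, he, ht]
    push_cast; ring
  let π : QW χ →ₗ[ZHalf] QW χ := LinearMap.id + (half*half) • (epsQ χ).smulRight D
  have hπ : ∀ w, π w = w + (half*half*epsQ χ w) • D := fun w => by simp [π, mul_smul]
  have hπD : π D = 0 := by
    have h2 := two_mul_half
    rw [hπ, hεD, show half*half * -4 = (-1 : ZHalf) by linear_combination (-2*half - 1)*h2,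
      neg_one_smul, add_neg_cancel]
  refine ⟨fun x => π (bb χ x), (isBloch_bb.map π.toAddMonoidHom).alt he (Or.inr ⟨t, ht, ?_⟩), ?_,
    fun x => ⟨_, hπ _⟩⟩
  · change π _ + π _ = 0; rw [← map_add, hπD]
  · intro f hf; have e : f = π f := by rw [hπ, hf, mul_zero, zero_smul, add_zero]
    have := Submodule.mem_map_of_mem (f := π) (mem_span_bb f)
    rwa [← e, Submodule.map_span, ← Set.range_comp] at this

lemma eq_zero_of_bP {p : ℕ} [hp : Fact p.Prime] (h5 : 5 ≤ p) {f : QW (chiP p)}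
    (hf : epsQ (chiP p) f = 0) (hs : evQ (isBloch_bP p) f = 0) : f = 0 := by
  obtain ⟨b, hb, hspan, hbb⟩ := exists_alt (chiP_neg_one p) (chiP_self p)
  have hL : ∀ x, evQ (isBloch_bP p) (b x) = bP p x := by
    intro x; obtain ⟨n, hn⟩ := hbb x
    rw [hn, map_add, map_smul, map_add, evQ_bb, evQ_bb, evQ_bb, bP_inv, add_neg_cancel, smul_zero,
      add_zero]
  have hFB := hb.finBloch (P := p) (chiP_self p) fun q hq h => chiP_prime p hq h
  obtain ⟨ζ, hζ, hB⟩ := hFB.exists_generator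
  let S : Submodule ZHalf (QW (chiP p)) :=
    { carrier := {w | ∃ n : ZHalf, w + w = n • ζ ∧ evQ (isBloch_bP p) w = n • 1}
      zero_mem' := ⟨0, by simp⟩
      add_mem' := by
        rintro u v ⟨n, h1, h2⟩ ⟨m, h3, h4⟩
        exact ⟨n + m, by rw [add_add_add_comm, h1, h3, add_smul], by rw [map_add, h2, h4, add_smul]⟩
      smul_mem' := by
        rintro r u ⟨n, h1, h2⟩
        exact ⟨r*n, by rw [← smul_add, h1, mul_smul], by rw [map_smul, h2, mul_smul]⟩ }
  have hS : ∀ z : ZMod p, b ((z.val : ℕ) : ℚ) ∈ S := by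
    intro z; by_cases h0 : z = 0
    · rw [h0, ZMod.val_zero, Nat.cast_zero, hb.zero]; exact zero_mem S
    by_cases h1 : z = 1
    · rw [h1, val_one, Nat.cast_one, hb.one]; exact zero_mem S
    refine ⟨(FinBloch.carryCount z : ℕ), ?_, ?_⟩
    · rw [Nat.cast_smul_eq_nsmul]; exact hB z h0 h1
    · have hz : (((z.val : ℕ) : ℤ) : ZMod p) = z := by simp
      have := bP_int p (by omega) (n := (z.val : ℕ)) (by rwa [hz]); rw [hz, cast_natCast] at this
      rw [hL, this, ← FinBloch.cast_carryCount h0, Nat.cast_smul_eq_nsmul, nsmul_one]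
  have n0 : (2 : ZMod p) ≠ 0 := fun h => by
    have := Nat.le_of_dvd (by norm_num) ((natCast_eq_zero_iff 2 p).1 (mod_cast h)); omega
  have n1 : (2 : ZMod p) ≠ 1 := by grind
  have hC : b 2 ∈ S := by
    have := add_mem (hS (1-2)) (hS 2); rwa [hFB.one_sub 2 n0 n1, sub_add_cancel] at this
  have hall := hb.mem_span_finBloch (P := p) (chiP_self p) (fun q hq h => chiP_prime p hq h) hC hS
  obtain ⟨n, h1, h2⟩ : f ∈ S := span_le.2 (Set.range_subset_iff.2 hall) (hspan f hf); rw [hs] at h2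
  rw [smul_eq_zero_of_oddPart h2.symm hζ] at h1; exact add_self_cancel h1

lemma smul_const_eq_zero {W : Type*} [AddCommGroup W] [Module ZHalf W] {L : W →ₗ[ZHalf] ZMod (oddPart (2+1))}
    {C : W} (h3 : C + C + C = 0) (hL : L C = 1) {m : ZHalf} (h : L (m • C) = 0) : m • C = 0 := by
  rw [map_smul, hL] at h; exact smul_eq_zero_of_oddPart h (by rw [← h3]; abel)

lemma eq_zero_of_chi_even (he : χ (-1) = 1) {t : ℚ} (ht : χ t = -1) {f : QW χ} (hf : epsQ χ f = 0)
    (hs : ∀ (p : ℕ) [Fact p.Prime], (h : χ = chiP p) → evQ (h ▸ isBloch_bP p : IsBloch χ (bP p)) f = 0) :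
    f = 0 := by
  have t0 := (ne_of_chi_eq_neg_one ht).1; obtain ⟨b, hb, hspan, hbb⟩ := exists_alt he ht
  have vanish (h : ∀ x, b x = 0) : f = 0 :=
    (mem_bot _).1 (span_le.2 (Set.range_subset_iff.2 h) (hspan f hf))
  have ne : ∀ {q : ℕ}, q.Prime → χ q ≠ 1 → χ q = -1 := fun hq h =>
    (chi_cases χ (mod_cast hq.ne_zero)).resolve_left h
  rcases chi_cases χ (show (2 : ℚ) ≠ 0 by norm_num) with h2 | h2
  · rcases chi_cases χ (show (3 : ℚ) ≠ 0 by norm_num) with h3 | h3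
    · have hex : ∃ P : ℕ, P.Prime ∧ χ P = -1 := by
        by_contra hcon; push Not at hcon
        simp [chi_eq_one_of_primes he (fun q hq => by
          by_contra h; exact hcon q hq (ne hq h)) t0] at ht
      obtain ⟨hP, hχP⟩ := Nat.find_spec hex
      have hmin : ∀ q : ℕ, q.Prime → q < Nat.find hex → χ q = 1 := fun q hq hlt => by
        by_contra h; exact Nat.find_min hex hlt ⟨hq, ne hq h⟩
      generalize Nat.find hex = P at *; haveI : Fact P.Prime := ⟨hP⟩
      have h5 : 5 ≤ P := by
        by_contra hlt; have := hP.two_le; interval_cases P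
        · norm_num [h2] at hχP
        · norm_num [h3] at hχP
        · norm_num at hP
      by_cases hex' : ∃ Q : ℕ, Q.Prime ∧ Q ≠ P ∧ χ Q = -1
      · obtain ⟨hQ, hQP, hχQ⟩ := Nat.find_spec hex'
        have hmin' : ∀ q : ℕ, q.Prime → q ≠ P → q < Nat.find hex' → χ q = 1 := fun q hq hqP hlt => by
          by_contra h; exact Nat.find_min hex' hlt ⟨hq, hqP, ne hq h⟩
        generalize Nat.find hex' = Q at *
        have hlt : P < Q := hQP.lt_or_gt.resolve_left fun h => by simp [hmin Q hQ h] at hχQ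
        exact vanish (hb.eq_zero_of_two_primes h5 hχP hQ hχQ hlt hmin')
      · have hχ := eq_chiP he hχP fun q hq hqP => by by_contra h; exact hex' ⟨q, hq, hqP, ne hq h⟩
        have := hs P hχ; subst hχ; exact eq_zero_of_bP h5 hf this
    · exact vanish (hb.eq_zero_of_three h2 h3)
  · have hle : span ZHalf (Set.range b) ≤ span ZHalf {b 2} :=
      span_le.2 (Set.range_subset_iff.2 (hb.mem_span_of_two h2))
    obtain ⟨m, rfl⟩ := mem_span_singleton.1 (hle (hspan f hf)); by_cases hC : b 2 = 0
    · rw [hC, smul_zero]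
    have h3 : χ 3 = 1 := (chi_cases χ (by norm_num)).resolve_right fun h =>
      hC (hb.const_eq_zero_of_three h)
    by_cases hex : ∃ Q : ℕ, Q.Prime ∧ Q ≠ 2 ∧ χ Q = -1
    · obtain ⟨hQ, hQ2, hχQ⟩ := Nat.find_spec hex
      have hmin : ∀ q : ℕ, q.Prime → q ≠ 2 → q < Nat.find hex → χ q = 1 := fun q hq hq2 hlt => by
        by_contra h; exact Nat.find_min hex hlt ⟨hq, hq2, ne hq h⟩
      generalize Nat.find hex = Q at *
      have h5 : 5 ≤ Q := by
        by_contra hlt; have := hQ.two_le; interval_cases Q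
        · exact hQ2 rfl
        · norm_num [h3] at hχQ
        · norm_num at hQ
      exact absurd (hb.const_eq_zero_of_two h2 hQ h5 hχQ hmin) hC
    · have hχ := eq_chiP (p := 2) he (mod_cast h2) fun q hq hq2 => by
        by_contra h; exact hex ⟨q, hq, hq2, ne hq h⟩
      have h0 := hs 2 hχ; subst hχ; refine smul_const_eq_zero hb.three ?_ h0
      obtain ⟨n, hn⟩ := hbb 2
      rw [hn, map_add, map_smul, map_add, evQ_bb, evQ_bb, evQ_bb, bP_inv, add_neg_cancel, smul_zero,
        add_zero]
      exact_mod_cast bP_even (n := 2) (by norm_num) (dvd_refl _)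

/-- Quadruples in the kernel of the boundary and of the symbols. -/
def RB : Submodule ZHalf (PB 4 0) := (BdQ (PC 3) 0).comap (cdQ 3 0) ⊓
    ⨅ u : Nat.Primes × Nat.Primes, ker (Ev chi1 (bOmega u.1 u.2))

lemma mem_RB {c : PB 4 0} : c ∈ RB ↔ cdQ 3 0 c ∈ BdQ (PC 3) 0 ∧
    ∀ p ℓ : ℕ, p.Prime → ℓ.Prime → Ev chi1 (bOmega p ℓ) c = 0 := by
  simp only [RB, mem_inf, mem_comap, mem_iInf, mem_ker]
  exact and_congr_right fun _ => ⟨fun h p ℓ hp hℓ => h (⟨p, hp⟩, ⟨ℓ, hℓ⟩), fun h u => h _ _ u.1.2 u.2.2⟩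

lemma mem_relX_chi1 {r : PB 4 0} (hr : r ∈ RB) (he : Ev chi1 (bP 2) r = 0) : r ∈ RelX chi1 := by
  have hb := (isBloch_bb (χ := chi1)).alt (chi1_apply (by norm_num)) (Or.inl fun x => chi1_apply)
  have hIs : ∀ {p ℓ : ℕ}, p.Prime → ℓ.Prime → IsBloch chi1 (bOmega p ℓ) := fun {p ℓ} hp hℓ =>
    haveI := Fact.mk hp; haveI := Fact.mk hℓ; isBloch_bOmega p ℓ fun x => chi1_apply
  have := mem_span_of_symbols hb (fun x => chi1_apply)
    (fun p ℓ => if h : p.Prime ∧ ℓ.Prime then evQ (hIs h.1 h.2) else 0)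
    (fun p ℓ hp hℓ x _ _ => by rw [dif_pos ⟨hp, hℓ⟩, evQ_bb]; rfl)
    (mem_span_bb ((RelX chi1).mkQ r)) (fun p ℓ hp hℓ => by
      rw [dif_pos ⟨hp, hℓ⟩, evQ_mk]; exact (mem_RB.1 hr).2 p ℓ hp hℓ)
  obtain ⟨m, hm⟩ := mem_span_singleton.1 this; rw [← mk_eq_zero, ← mkQ_apply, ← hm]
  refine smul_const_eq_zero (L := evQ (isBloch_bP_one 2)) hb.three ?_ ?_
  · rw [evQ_bb]; exact_mod_cast bP_even (n := 2) (by norm_num) (dvd_refl _)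
  · rw [hm, evQ_mk, he]

/-- The invariants separate relations. -/
lemma mem_relN_of_invariants {r : PB 4 0} (hr : r ∈ RB) (he : Ev chi1 (bP 2) r = 0)
    (hs : ∀ (p : ℕ) [Fact p.Prime], Ev (chiP p) (bP p) r = 0) : r ∈ relQ := by
  refine mem_relN_of_forall fun χ => ?_
  have hε : epsQ χ ((RelX χ).mkQ r) = 0 := eps_eq_zero χ (mem_RB.1 hr).1
  by_cases h1 : ∀ x, x ≠ 0 → χ x = 1
  · have : χ = chi1 := MonoidWithZeroHom.ext fun x => by
      by_cases hx : x = 0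
      · simp [hx]
      · rw [h1 x hx, chi1_apply hx]
    rw [this]; exact mem_relX_chi1 hr he
  rw [← mk_eq_zero, ← mkQ_apply]; rcases chi_cases χ (show (-1 : ℚ) ≠ 0 by norm_num) with h | h
  · push Not at h1; obtain ⟨t, t0, ht⟩ := h1
    refine eq_zero_of_chi_even h ((chi_cases χ t0).resolve_left ht) hε fun p _ e => ?_
    subst e; exact hs p
  · exact eq_zero_of_chi_odd h hε

end Injectivity

section Invariants

instance (p : Nat.Primes) : Fact (p : ℕ).Prime := ⟨p.2⟩

def invE : PB 4 0 →ₗ[ZHalf] ZMod (oddPart (2+1)) := Ev chi1 (bP 2)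

def invS (p : Nat.Primes) : PB 4 0 →ₗ[ZHalf] ZMod (oddPart ((p : ℕ) + 1)) := Ev (chiP p) (bP p)

lemma invE_relN {c : PB 4 0} (hc : c ∈ relQ) : invE c = 0 :=
  relX_le_ker_Ev (isBloch_bP_one 2) (relN_le_relX _ hc)

lemma invS_relN (p : Nat.Primes) {c : PB 4 0} (hc : c ∈ relQ) : invS p c = 0 :=
  relX_le_ker_Ev (isBloch_bP p) (relN_le_relX _ hc)

lemma mem_relN_of_inv {r : PB 4 0} (hr : r ∈ RB) (he : invE r = 0) (hs : ∀ p, invS p r = 0) :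
    r ∈ relQ := mem_relN_of_invariants hr he fun p hp => hs ⟨p, hp.1⟩

lemma Ev_dil {W : Type*} [AddCommGroup W] [Module ZHalf W] {χ : ℚ →*₀ ℤ} {b : ℚ → W} (a : ℚˣ)
    (c : PB 4 0) : Ev χ b (dil a 4 c) = χ a • Ev χ b c := by
  have : Ev χ b ∘ₗ dil a 4 = χ a • Ev χ b := by
    refine zero_chain_ext fun q => ?_
    rw [comp_apply, dil_pt, LinearMap.smul_apply, Ev_act]
  exact LinearMap.congr_fun this c

lemma chi1_dil {W : Type*} [AddCommGroup W] [Module ZHalf W] {b : ℚ → W} (a : ℚˣ)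
    (c : PB 4 0) : Ev chi1 b (dil a 4 c) = Ev chi1 b c := by
  rw [Ev_dil, chi1_apply a.ne_zero, one_smul]

def primeUnit (p : Nat.Primes) : ℚˣ := mk0 (p : ℕ) (mod_cast p.2.ne_zero)

lemma sub_dil_mem {c : PB 4 0} (hc : cdQ 3 0 c ∈ BdQ (PC 3) 0) (a : ℚˣ) :
    c - dil a 4 c ∈ RB ∧ invE (c - dil a 4 c) = 0 := by
  refine ⟨mem_RB.2 ⟨?_, fun p ℓ _ _ => ?_⟩, ?_⟩
  · rw [map_sub, cd_dil]; exact sub_mem hc (dil_mem_Bd a hc)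
  · rw [map_sub, chi1_dil, sub_self]
  · rw [invE, map_sub, chi1_dil, sub_self]

/-- The elements detected only at a given prime. -/
def onlyAt (p : Nat.Primes) : Submodule ZHalf (PB 4 0) :=
  (RB ⊓ ker invE) ⊓ ⨅ q : {q : Nat.Primes // q ≠ p}, ker (invS q)

lemma mem_onlyAt {p : Nat.Primes} {c : PB 4 0} :
    c ∈ onlyAt p ↔ (c ∈ RB ∧ invE c = 0) ∧ ∀ q, q ≠ p → invS q c = 0 := by
  simp [onlyAt, mem_inf, mem_iInf]

lemma invS_mem_map {p : Nat.Primes} {c : PB 4 0}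
    (hc : cdQ 3 0 c ∈ BdQ (PC 3) 0) : invS p c ∈ (onlyAt p).map (invS p) := by
  have key : ∀ q, invS q (c - dil (primeUnit p) 4 c) = (1 - chiP q p) • invS q c := fun q => by
    rw [invS, map_sub, Ev_dil, sub_smul, one_smul]; rfl
  have h1 : c - dil (primeUnit p) 4 c ∈ onlyAt p := mem_onlyAt.2 ⟨sub_dil_mem hc _, fun q hq => by
    rw [key, chiP_prime _ p.2 (fun e => hq (Subtype.ext e.symm)), sub_self, zero_smul]⟩
  have h2 := Submodule.smul_mem _ half (Submodule.mem_map_of_mem (f := invS p) h1)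
  rw [key, chiP_self] at h2; convert h2 using 1
  rw [show (1 - -1 : ℤ) = 2 by norm_num, ← Int.cast_smul_eq_zsmul ZHalf, smul_smul]; push_cast
  rw [mul_comm, two_mul_half, one_smul]

lemma invS_std {p : Nat.Primes} {x : ℚ} (h0 : x ≠ 0) (h1 : x ≠ 1) :
    invS p (ptQ (std h0 h1)) = bP p x := Ev_std h0 h1

lemma map_onlyAt (p : Nat.Primes) : (onlyAt p).map (invS p) = ⊤ := by
  by_cases h2 : (p : ℕ) = 2
  · obtain ⟨p, hp⟩ := p; obtain rfl : p = 2 := h2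
    have h1 : (1 : ZMod (oddPart (2+1))) ∈ (onlyAt ⟨2, hp⟩).map (invS ⟨2, hp⟩) := by
      have := invS_mem_map (p := ⟨2, hp⟩) cd_four_mem; convert this using 1
      refine Eq.symm (Eq.trans (invS_std (p := ⟨2, hp⟩) _ _) ?_)
      exact_mod_cast bP_even (n := 4) (by norm_num) (by norm_num)
    rw [eq_top_iff]; intro y _
    haveI : NeZero (oddPart (2+1)) := ⟨by rw [oddPart_three]; norm_num⟩
    have := nsmul_mem h1 (ZMod.val (n := oddPart (2+1)) y); rw [nsmul_one] at this
    convert this using 1; exact (natCast_zmod_val (n := oddPart (2+1)) y).symm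
  · have hp2 : 2 < (p : ℕ) := lt_of_le_of_ne p.2.two_le (Ne.symm h2)
    have key : ((onlyAt p).map (invS p)).toAddSubgroup = ⊤ := by
      refine FinBloch.closure_finDilog hp2 fun r => ?_
      by_cases hr : r = 0
      · rw [hr, (FinBloch.finBloch_finDilog (p := p)).zero]; exact zero_mem _
      obtain ⟨n, hn1, hnr⟩ : ∃ n : ℤ, n ≠ 1 ∧ (n : ZMod p) = r := by
        by_cases h1 : r = 1
        · exact ⟨(p : ℕ) + 1, by have := p.2.pos; omega, by simp [h1]⟩
        · refine ⟨(r.val : ℕ), fun h => h1 ?_, by simp⟩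
          have : ((r.val : ℕ) : ZMod p) = 1 := by
            have := congrArg (Int.cast : ℤ → ZMod p) h; simpa using this
          simpa using this
      have hn0 : (n : ZMod p) ≠ 0 := by rwa [hnr]
      have hn : (n : ℚ) ≠ 0 := by intro h; rw [Int.cast_eq_zero.1 h] at hn0; simp at hn0
      have hm := invS_mem_map (p := p) (cd_norm_mem (x := n) hn (mod_cast hn1))
      have e : invS p (ptQ (std hn (mod_cast hn1)) + dil (mk0 (n : ℚ) hn) 4
          (ptQ (std hn (mod_cast hn1)))) = FinBloch.finDilog r + FinBloch.finDilog r := by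
        have hd : invS p (dil (mk0 (n : ℚ) hn) 4 (ptQ (std hn (mod_cast hn1)))) =
            bP p n := by
          rw [invS, Ev_dil, Units.val_mk0, chiP_red p (Red.intCast n) hn0, one_smul]; exact Ev_std _ _
        rw [map_add, hd, invS_std, bP_int _ h2 hn0, hnr]
      rw [e] at hm; have := Submodule.smul_mem _ half hm
      rw [← two_smul ZHalf, smul_smul, mul_comm, two_mul_half, one_smul] at this; exact this
    exact Submodule.toAddSubgroup_injective key

lemma exists_prescribed (T : Finset Nat.Primes) (y : ∀ p : Nat.Primes, ZMod (oddPart ((p : ℕ) + 1))) :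
    ∃ h ∈ RB, invE h = 0 ∧ ∀ p, invS p h = if p ∈ T then y p else 0 := by
  have : ∀ p, ∃ h ∈ onlyAt p, invS p h = y p := fun p => by
    have : y p ∈ (onlyAt p).map (invS p) := by rw [map_onlyAt]; trivial
    exact this
  choose h hm hy using this
  refine ⟨∑ p ∈ T, h p, sum_mem fun p _ => (mem_onlyAt.1 (hm p)).1.1, ?_, fun p => ?_⟩
  · rw [map_sum]; exact sum_eq_zero fun p _ => (mem_onlyAt.1 (hm p)).1.2
  · rw [map_sum]
    have : ∀ q ∈ T, invS p (h q) = if p = q then y p else 0 := fun q _ => by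
      split_ifs with e
      · subst e; exact hy p
      · exact (mem_onlyAt.1 (hm q)).2 p e
    rw [sum_congr rfl this, Finset.sum_ite_eq]

lemma finite_support {r : PB 4 0} (hr : r ∈ RB) (he : invE r = 0) : {p | invS p r ≠ 0}.Finite := by
  let S : Submodule ZHalf (PB 4 0) :=
    { carrier := {c | {p | invS p c ≠ 0}.Finite}
      zero_mem' := by simp
      add_mem' := fun {a b} ha hb => (ha.union hb).subset fun p hp => by
        by_contra h; simp only [Set.mem_union, Set.mem_setOf_eq, not_or, not_not] at h hp
        exact hp (by rw [map_add, h.1, h.2, add_zero])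
      smul_mem' := fun c a ha => ha.subset fun p hp h => hp (by rw [map_smul, h, smul_zero]) }
  suffices RelX chi1 ≤ S from this (mem_relX_chi1 hr he)
  refine sup_le (fun c hc => ?_) (span_le.2 ?_)
  · have : {p | invS p c ≠ 0} = ∅ := Set.eq_empty_of_forall_notMem fun p hp => hp (invS_relN p hc)
    change {p | invS p c ≠ 0}.Finite; rw [this]; exact Set.finite_empty
  · rintro _ ⟨⟨a, q⟩, rfl⟩; obtain ⟨T, hT⟩ := exists_pSet a.ne_zero
    refine (T.1.finite_toSet.preimage (f := fun p : Nat.Primes => (p : ℕ))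
      Subtype.val_injective.injOn).subset fun p hp => ?_
    by_contra h; refine hp ?_; simp only
    rw [map_sub, map_zsmul, ← dil_pt, invS, Ev_dil, chiP_eq_one _ a.ne_zero (hT p p.2 h),
      chi1_apply a.ne_zero, sub_self]

lemma three_nsmul_zmod (a : ZMod (oddPart (2+1))) : 3 • a = 0 := by
  have : ((oddPart (2+1) : ℕ) : ZMod (oddPart (2+1))) = 0 := natCast_self _
  rw [nsmul_eq_mul, ← oddPart_three, this, zero_mul]

lemma exists_untwisted : ∃ r ∈ RB, invE r = 1 := by
  have h0 : (2 : ℚ) ≠ 0 := by norm_num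
  have h1 : (2 : ℚ) ≠ 1 := by norm_num
  refine ⟨half • (ptQ (std h0 h1) + dil (mk0 2 h0) 4 (ptQ (std h0 h1))),
    Submodule.smul_mem _ _ (mem_RB.2 ⟨cd_norm_mem h0 h1, fun p ℓ hp hℓ => ?_⟩), ?_⟩
  · rw [map_add, chi1_dil, Ev_std, bOmega, omegaVal]; norm_num
  · have e : bP 2 (2 : ℚ) = 1 := mod_cast bP_even (n := 2) (by norm_num) (dvd_refl _)
    rw [invE, map_smul, map_add, chi1_dil, Ev_std, e, smul_add, ← add_smul, ← two_mul, two_mul_half,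
      one_smul]

lemma exists_three_torsion : ∃ r ∈ RB, invE r = 1 ∧ ∀ p, 3 • invS p r = 0 := by
  obtain ⟨r, hr, he⟩ := exists_untwisted
  have hfin := finite_support (r := 3 • r) (nsmul_mem hr 3) (by rw [map_nsmul, three_nsmul_zmod])
  obtain ⟨h, hh, hhe, hhs⟩ := exists_prescribed hfin.toFinset fun p => invS p r
  refine ⟨r - h, sub_mem hr hh, by rw [map_sub, he, hhe, sub_zero], fun p => ?_⟩; rw [map_sub, hhs]
  split_ifs with hp
  · rw [sub_self, smul_zero]
  · rw [Set.Finite.mem_toFinset] at hp; rw [sub_zero, ← map_nsmul]; exact not_not.1 hp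

end Invariants

section Main

lemma exists_zigzag_of_mem (z : Z3) : ∃ c : PB 4 0, Zigzag ((chainsEquiv 3).symm z) c := by
  refine exists_zigzag ((chainsEquiv 2).injective ?_)
  rw [← bdry_chainsEquiv, apply_symm_apply, map_zero]; exact z.2

def quad (z : Z3) : PB 4 0 := (exists_zigzag_of_mem z).choose

lemma zigzag_quad (z : Z3) : Zigzag ((chainsEquiv 3).symm z) (quad z) :=
  (exists_zigzag_of_mem z).choose_spec

lemma quad_mem_RB (z : Z3) : quad z ∈ RB := by
  refine mem_RB.2 ⟨?_, fun p ℓ hp hℓ => ?_⟩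
  · obtain ⟨-, -, c2, -, -, -, h3⟩ := zigzag_quad z; exact ⟨c2, h3⟩
  · haveI := Fact.mk hp; haveI := Fact.mk hℓ
    refine Ev_bOmega_zigzag p ℓ (fun x => chi1_apply) ((chainsEquiv 2).injective ?_) (zigzag_quad z)
    rw [← bdry_chainsEquiv, apply_symm_apply, map_zero]; exact z.2

lemma Zigzag.sub_mem {z : PB 0 3} {c c' : PB 4 0} (h : Zigzag z c) (h' : Zigzag z c') :
    c - c' ∈ relQ := by
  have := (h.add (h'.smul (-1))).mem_relN (by rw [neg_one_smul, add_neg_cancel]; exact zero_mem _)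
  rwa [neg_one_smul, ← sub_eq_add_neg] at this

/-- Homomorphisms on quadruples that kill relations induce homomorphisms on cycles. -/
def onCycles {W : Type*} [AddCommGroup W] [Module ZHalf W] (L : PB 4 0 →ₗ[ZHalf] W)
    (hL : ∀ c ∈ relQ, L c = 0) : Z3 →+ W := AddMonoidHom.mk' (fun z => L (quad z)) fun z w => by
    have := hL _ ((zigzag_quad (z+w)).sub_mem (by
      have := (zigzag_quad z).add (zigzag_quad w)
      rwa [← map_add] at this))
    rwa [map_sub, map_add, sub_eq_zero] at this

lemma quad_mem_relN (z : Z3) : quad z ∈ relQ ↔ (z : Chains 3) ∈ B3 := by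
  have key : (z : Chains 3) ∈ B3 ↔ (chainsEquiv 3).symm z ∈ BdQ (PC 0) 3 := by
    constructor
    · rintro ⟨y, hy⟩; refine ⟨(chainsEquiv 4).symm y, (chainsEquiv 3).injective ?_⟩
      rw [← bdry_chainsEquiv, apply_symm_apply, hy, apply_symm_apply]
    · rintro ⟨y, hy⟩; exact ⟨chainsEquiv 4 y, by rw [bdry_chainsEquiv, hy, apply_symm_apply]⟩
  rw [key]; exact ⟨lowDegree.mem_Bd (zigzag_quad z), (zigzag_quad z).mem_relN⟩

lemma exists_cycle_of_torsion {c : PB 4 0} (hc : c ∈ RB) {m : ℕ} (hm : m ≠ 0)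
    (h : m • c ∈ relQ) : ∃ z : Z3, quad z - c ∈ relQ := by
  obtain ⟨z, hz, hzc⟩ := lowDegree.exists_zigzag (mem_RB.1 hc).1 hm h
  refine ⟨⟨chainsEquiv 3 z, ?_⟩, (zigzag_quad _).sub_mem ?_⟩
  · rw [Z3, mem_ker, bdry_chainsEquiv, hz, map_zero]
  · rwa [LinearEquiv.symm_apply_apply]

end Main

/-- The third group homology of `SL₂(ℚ)` with trivial coefficients in
`ℤ[1/2]` — i.e. the quotient of the 3-cycles by the 3-boundaries of the standard
(inhomogeneous) complex — is isomorphic, as an abelian group, to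
`ℤ/3 ⊕ (⊕_{p prime} ℤ/(p+1)′)`, the direct sum ranging over all prime numbers `p`.
(The isomorphism `H₃ ≃ T` is expressed by a surjective homomorphism from the group of
3-cycles to `T` whose kernel consists precisely of the 3-boundaries.) -/
theorem statement0 :
    ∃ φ : ↥Z3 →+ (ZMod 3 × DirectSum Nat.Primes fun p => ZMod (oddPart ((p : ℕ) + 1))),
      Function.Surjective φ ∧ ∀ z : ↥Z3, φ z = 0 ↔ (z : Chains 3) ∈ B3 := by
  obtain ⟨r, hr, he, hs⟩ := exists_three_torsion
  let μ : ∀ p : Nat.Primes, ZMod (oddPart (2 + 1)) →+ ZMod (oddPart ((p : ℕ) + 1)) := fun p =>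
    ZMod.lift _ ⟨zmultiplesHom _ (invS p r), by
      rw [zmultiplesHom_apply, oddPart_three]; exact_mod_cast hs p⟩
  haveI : NeZero (oddPart (2 + 1)) := ⟨by rw [oddPart_three]; norm_num⟩
  have hμ : ∀ p a, μ p a = a.val • invS p r := fun p a => by
    have := ZMod.lift_coe (oddPart (2 + 1)) (⟨zmultiplesHom _ (invS p r), by
      rw [zmultiplesHom_apply, oddPart_three]; exact_mod_cast hs p⟩ :
        {f : ℤ →+ ZMod (oddPart ((p : ℕ) + 1)) // f (oddPart (2 + 1) : ℕ) = 0}) (a.val : ℕ)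
    rw [cast_natCast, natCast_zmod_val] at this; rw [this]; simp
  let E := onCycles invE fun c => invE_relN
  let S : ∀ p, Z3 →+ _ := fun p => onCycles (invS p) (fun c => invS_relN p) - (μ p).comp E
  have hE : ∀ z, E z = invE (quad z) := fun _ => rfl
  have hS : ∀ p z, S p z = invS p (quad z) - μ p (invE (quad z)) := fun _ _ => rfl
  have fin : ∀ z, ∃ d : DirectSum Nat.Primes fun p => ZMod (oddPart ((p : ℕ) + 1)), ∀ p, d p = S p z := by
    intro z
    have hf := finite_support (r := quad z - (invE (quad z)).val • r)
      (sub_mem (quad_mem_RB z) (nsmul_mem hr _)) (by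
        rw [map_sub, map_nsmul, he, nsmul_one, natCast_zmod_val, sub_self])
    have e : ∀ p, S p z = invS p (quad z - (invE (quad z)).val • r) := fun p => by
      rw [hS, hμ, map_sub, map_nsmul]
    refine ⟨DFinsupp.mk hf.toFinset fun p => S p z, fun p => ?_⟩
    refine (DFinsupp.mk_apply ..).trans ?_; split_ifs with hp
    · rfl
    · rw [Set.Finite.mem_toFinset] at hp; rw [e]; exact (not_not.1 hp).symm
  choose D hD using fin
  let cong := ZMod.ringEquivCongr oddPart_three
  let Dh : Z3 →+ DirectSum Nat.Primes fun p => ZMod (oddPart ((p : ℕ) + 1)) :=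
    AddMonoidHom.mk' D fun z w => DFinsupp.ext fun p =>
      (hD (z + w) p).trans ((map_add (S p) z w).trans
        ((congrArg₂ (· + ·) (hD z p) (hD w p)).symm.trans (DFinsupp.add_apply _ _ _).symm))
  refine ⟨(cong.toAddMonoidHom.comp E).prod Dh, ?_, fun z => ?_⟩
  · rintro ⟨a, d⟩; obtain ⟨h, hh, hhe, hhs⟩ := exists_prescribed d.support fun p => d p
    have hhs' : ∀ p, invS p h = d p := fun p => by
      rw [hhs]; split_ifs with hp
      · rfl
      · exact (DFinsupp.notMem_support_iff.1 hp).symm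
    set n := (cong.symm a).val
    have hce : invE (n • r + h) = cong.symm a := by
      rw [map_add, map_nsmul, he, hhe, add_zero, nsmul_one, natCast_zmod_val]
    have hcs : ∀ p, invS p (n • r + h) = n • invS p r + d p := fun p => by
      rw [map_add, map_nsmul, hhs']
    have hc : n • r + h ∈ RB := add_mem (nsmul_mem hr _) hh
    obtain ⟨z, hz⟩ := exists_cycle_of_torsion hc (m := 3 * ∏ p ∈ d.support, ((p : ℕ) + 1)) (by
        refine mul_ne_zero (by norm_num) (Finset.prod_ne_zero_iff.2 fun p _ => by omega)) (by
        refine mem_relN_of_inv (nsmul_mem hc _) ?_ fun p => ?_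
        · rw [map_nsmul, mul_comm, mul_smul, three_nsmul_zmod, smul_zero]
        · rw [map_nsmul, hcs, smul_add, smul_comm _ n, mul_comm, mul_smul, hs, smul_zero, smul_zero,
            zero_add]
          by_cases hp : p ∈ d.support
          · obtain ⟨k, hk⟩ := (oddPart_dvd _).trans (Finset.dvd_prod_of_mem
              (fun p : Nat.Primes => (p : ℕ) + 1) hp)
            rw [hk, mul_assoc, nsmul_eq_mul, Nat.cast_mul, natCast_self, zero_mul, zero_mul]
          · rw [DFinsupp.notMem_support_iff.1 hp, smul_zero])
    have ez : invE (quad z) = cong.symm a := by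
      rw [← hce, ← sub_eq_zero, ← map_sub]; exact invE_relN hz
    have sz : ∀ p, invS p (quad z) = n • invS p r + d p := fun p => by
      rw [← hcs, ← sub_eq_zero, ← map_sub]; exact invS_relN p hz
    refine ⟨z, Prod.ext ?_ (DFinsupp.ext fun p => ?_)⟩
    · change cong (E z) = a; rw [hE, ez, RingEquiv.apply_symm_apply]
    · refine (hD z p).trans ?_; rw [hS, hμ, ez, sz, add_sub_cancel_left]
  · rw [← quad_mem_relN]; constructor
    · intro h; have h1 : cong (E z) = 0 := congrArg Prod.fst h
      have h2 : D z = 0 := congrArg Prod.snd h; rw [map_eq_zero_iff _ cong.injective, hE] at h1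
      refine mem_relN_of_inv (quad_mem_RB z) h1 fun p => ?_
      have := hD z p; rw [h2, hS, h1, map_zero, sub_zero] at this; exact this.symm
    · intro h; refine Prod.ext ?_ (DFinsupp.ext fun p => ?_)
      · change cong (E z) = 0; rw [hE, invE_relN h, map_zero]
      · refine (hD z p).trans ?_; rw [hS, invE_relN h, invS_relN p h, map_zero, sub_zero]; rfl

end
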